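/- Let d ∈ {2,3}, let Ω ⊂ ℝ^d be a bounded domain with C⁴-boundary, 0 < T < ∞, Q_T = Ω × (0,T), and 1 < q < ∞. Let u : [0,T] → L²(Ω)^d be weakly continuous and let H ∈ L^q(Q_T)^{d×d} satisfy ∫_{Q_T} u·∂_t η d(x,t) = ∫_{Q_T} H : ∇η d(x,t) for all smooth compactly supported divergence-free test vector fields η on Q_T. Then there exist integrable functions π_h and π₀ on Q_T such that ∫_{Q_T} u·∂_t η d(x,t) = ∫_{Q_T} H : ∇η d(x,t) + ∫_{Q_T} π₀ div η d(x,t) + ∫_{Q_T} π_h ∂_t(div η) d(x,t) for all smooth compactly supported (not necessarily divergence-free) test vector fields η on Q_T. Moreover: (a) t ↦ π_h(t) is weakly continuous from [0,T] into L^{min{2,q}}(Ω), π_h(0) = 0, and Δπ_h(t) = −div( u(t) − u(0) ) in the sense of distributions on Ω; (b) for every 1 < r ≤ 2 there are constants c(r,q), c(q) > 0, independent of u, H, π_h, π₀, such that ess sup_{t∈(0,T)} ‖π_h(t)‖_{L^r(Ω)} ≤ c(r,q) ( ‖H‖_{L^r(Q_T)} + ess sup_{t∈(0,T)} ‖u(t)‖_{L²(Ω)}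 ) and ‖π₀‖_{L^q(Q_T)} ≤ c(q) ‖H‖_{L^q(Q_T)}. -/

import Mathlib

open MeasureTheory

noncomputable section

/-- `ℝ^d` with the Euclidean structure. -/
abbrev Euc (d : ℕ) := EuclideanSpace ℝ (Fin d)

/-- The `j`-th coordinate direction in `ℝ^d`. -/
def coordDir {d : ℕ} (j : Fin d) : Euc d := EuclideanSpace.single j (1 : ℝ)

/-- `Ω` has a `C⁴`-boundary: near every boundary point, `Ω` is the sublevel set of a `C⁴`
function with nonvanishing gradient. -/
def HasC4Boundary {d : ℕ} (Ω : Set (Euc d)) : Prop :=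
  ∀ x ∈ frontier Ω, ∃ (U : Set (Euc d)) (g : Euc d → ℝ),
    x ∈ U ∧ IsOpen U ∧ ContDiff ℝ 4 g ∧ (∀ y ∈ U, fderiv ℝ g y ≠ 0) ∧
    Ω ∩ U = {y ∈ U | g y < 0}

/-- The product measure on the space-time cylinder `Ω × (0,T)`. -/
def measureQ {d : ℕ} (T : ℝ) (Ω : Set (Euc d)) : Measure (ℝ × Euc d) :=
  (volume.restrict (Set.Ioc 0 T)).prod (volume.restrict Ω)

/-- Spatial divergence of a time-dependent vector field on `ℝ × ℝ^d`. -/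
def spDiv {d : ℕ} (η : ℝ × Euc d → Euc d) (p : ℝ × Euc d) : ℝ :=
  ∑ j : Fin d, fderiv ℝ (fun q => η q j) p ((0 : ℝ), coordDir j)

/-- A smooth vector field compactly supported in the space-time cylinder `Ω × (0,T)`. -/
def IsTestVF {d : ℕ} (T : ℝ) (Ω : Set (Euc d)) (η : ℝ × Euc d → Euc d) : Prop :=
  ContDiff ℝ (⊤ : ℕ∞) η ∧ HasCompactSupport η ∧ tsupport η ⊆ Set.Ioo 0 T ×ˢ Ω

section
open MeasureTheory
noncomputable section

/-! ### Part 1: the Bellman function -/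

lemma visc_mid {φ : ℝ → ℝ} (hφ : Continuous φ) {κ : ℝ}
    (h : ∀ t₀, ∃ α : ℝ, ∀ᶠ t in nhds t₀, φ t₀ + α * (t - t₀) + κ * (t - t₀) ^ 2 ≤ φ t) :
    2 * φ (1 / 2) + κ / 2 ≤ φ 0 + φ 1 := by
  by_contra hcon
  push Not at hcon
  set ε := 2 * φ (1 / 2) + κ / 2 - (φ 0 + φ 1) with hε
  have hεpos : 0 < ε := by linarith
  set κ' := κ - ε with hκ'
  set ψ : ℝ → ℝ := fun t => φ t - κ' * (t ^ 2 - t) - (φ 0 * (1 - t) + φ 1 * t) with hψ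
  have hψc : Continuous ψ := by fun_prop
  obtain ⟨t₀, ht₀, hmax⟩ := isCompact_Icc.exists_isMaxOn (Set.nonempty_Icc.2 zero_le_one)
    (hψc.continuousOn (s := Set.Icc (0:ℝ) 1))
  have hhalf : ψ (1 / 2) ≤ ψ t₀ := hmax (by constructor <;> norm_num)
  have hpos : 0 < ψ (1 / 2) := by
    simp only [hψ, hκ']; nlinarith
  have h0 : ψ 0 = 0 := by simp [hψ]
  have h1 : ψ 1 = 0 := by simp [hψ]
  have ht0' : t₀ ≠ 0 := by rintro rfl; linarith
  have ht1' : t₀ ≠ 1 := by rintro rfl; linarith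
  have hlt0 : 0 < t₀ := lt_of_le_of_ne ht₀.1 (Ne.symm ht0')
  have hlt1 : t₀ < 1 := lt_of_le_of_ne ht₀.2 ht1'
  obtain ⟨α, hα⟩ := h t₀
  have hin : ∀ᶠ t in nhds t₀, t ∈ Set.Icc (0:ℝ) 1 := Icc_mem_nhds hlt0 hlt1
  obtain ⟨δ, hδ, hball⟩ := Metric.eventually_nhds_iff.1 (hα.and hin)
  have hp := @hball (t₀ + δ / 2) (by rw [Real.dist_eq]; rw [abs_of_pos] <;> linarith)
  have hm := @hball (t₀ - δ / 2) (by rw [Real.dist_eq, abs_sub_comm]; rw [abs_of_pos] <;> linarith)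
  have hp2 : ψ (t₀ + δ / 2) ≤ ψ t₀ := hmax hp.2
  have hm2 : ψ (t₀ - δ / 2) ≤ ψ t₀ := hmax hm.2
  have hp1 := hp.1
  have hm1 := hm.1
  simp only [hψ] at hp2 hm2
  have : 0 < ε * δ ^ 2 := by positivity
  simp only [hκ'] at hp2 hm2
  nlinarith

lemma second_deriv_support {φ φ' : ℝ → ℝ} {φ2 c t₀ : ℝ}
    (h1 : ∀ᶠ t in nhds t₀, HasDerivAt φ (φ' t) t) (h2 : HasDerivAt φ' φ2 t₀) (hc : 2 * c < φ2) :
    ∀ᶠ t in nhds t₀, φ t₀ + φ' t₀ * (t - t₀) + c * (t - t₀) ^ 2 ≤ φ t := by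
  set g : ℝ → ℝ := fun t => φ t - φ' t₀ * (t - t₀) - c * (t - t₀) ^ 2 with hg
  have hg1 : ∀ᶠ t in nhds t₀, HasDerivAt g (φ' t - φ' t₀ - 2 * c * (t - t₀)) t := by
    filter_upwards [h1] with t ht
    have a1 := ((hasDerivAt_id t).sub_const t₀)
    have := (ht.sub (a1.const_mul (φ' t₀))).sub ((a1.pow 2).const_mul c)
    refine this.congr_deriv ?_
    simp; ring
  have hg2 : HasDerivAt (fun t => φ' t - φ' t₀ - 2 * c * (t - t₀)) (φ2 - 2 * c) t₀ := by
    have a1 := ((hasDerivAt_id t₀).sub_const t₀)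
    refine ((h2.sub_const (φ' t₀)).sub (a1.const_mul (2 * c))).congr_deriv ?_
    simp
  have hd : deriv g =ᶠ[nhds t₀] fun t => φ' t - φ' t₀ - 2 * c * (t - t₀) := by
    filter_upwards [hg1] with t ht using ht.deriv
  have hmin : IsLocalMin g t₀ := by
    apply isLocalMin_of_deriv_deriv_pos
    · rw [hd.deriv_eq, hg2.deriv]; linarith
    · rw [hd.self_of_nhds]; simp
    · exact hg1.self_of_nhds.continuousAt
  filter_upwards [hmin] with t ht
  simp only [hg] at ht
  simp at ht
  linarith

/-- The Bellman function. -/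
def bell (A p q x y : ℝ) : ℝ :=
  (A + (1 - 2 / p)) * |y| ^ q + x ^ 2 * (max |x| (|y| ^ (q - 1))) ^ (p - 2)
    - (1 - 2 / p) * (max |x| (|y| ^ (q - 1))) ^ p

lemma bell_continuous {A p q : ℝ} (hp : 2 ≤ p) (hq : 1 < q) :
    Continuous (fun z : ℝ × ℝ => bell A p q z.1 z.2) := by
  unfold bell
  have h1 : Continuous fun z : ℝ × ℝ => |z.2| ^ q :=
    (Real.continuous_rpow_const (by linarith)).comp (by fun_prop)
  have hm : Continuous fun z : ℝ × ℝ => max |z.1| (|z.2| ^ (q - 1)) :=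
    (by fun_prop : Continuous fun z : ℝ × ℝ => |z.1|).max
      ((Real.continuous_rpow_const (by linarith)).comp (by fun_prop))
  have h2 := (Real.continuous_rpow_const (q := p - 2) (by linarith)).comp hm
  have h3 := (Real.continuous_rpow_const (q := p) (by linarith)).comp hm
  simp only [Function.comp_def] at h2 h3
  fun_prop

lemma bell_young {p x σ : ℝ} (hp : 2 ≤ p) (hσ : 0 ≤ σ) :
    x ^ 2 * σ ^ (p - 2) - (1 - 2 / p) * σ ^ p ≤ x ^ 2 * |x| ^ (p - 2) - (1 - 2 / p) * |x| ^ p := by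
  have hp0 : 0 < p := by linarith
  have hx : x ^ 2 * |x| ^ (p - 2) = |x| ^ p := by
    rcases eq_or_ne x 0 with rfl | hx
    · simp [Real.zero_rpow hp0.ne']
    · have h0 : 0 < |x| := abs_pos.2 hx
      rw [← sq_abs, ← Real.rpow_natCast, ← Real.rpow_add h0]; norm_num
  rw [hx]
  have key := Real.geom_mean_le_arith_mean2_weighted (w₁ := 2 / p) (w₂ := 1 - 2 / p)
    (p₁ := |x| ^ p) (p₂ := σ ^ p) (by positivity) (by rw [sub_nonneg, div_le_one hp0]; exact hp)
    (by positivity) (by positivity) (by ring)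
  rw [← Real.rpow_mul (abs_nonneg x), ← Real.rpow_mul hσ] at key
  have e1 : p * (2 / p) = 2 := by field_simp
  have e2 : p * (1 - 2 / p) = p - 2 := by field_simp
  rw [e1, e2, Real.rpow_two, sq_abs] at key
  linarith

lemma bell_F1 {A p q x y : ℝ} (hp : 2 ≤ p) (hpq : (q - 1) * p = q) :
    A * |y| ^ q + x ^ 2 * |y| ^ (2 - q) ≤ bell A p q x y := by
  have e : (|y| ^ (q - 1)) ^ (p - 2) = |y| ^ (2 - q) := by
    rw [← Real.rpow_mul (abs_nonneg y)]; congr 1; linarith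
  have e' : (|y| ^ (q - 1)) ^ p = |y| ^ q := by
    rw [← Real.rpow_mul (abs_nonneg y), hpq]
  unfold bell
  rcases le_total |x| (|y| ^ (q - 1)) with h | h
  · rw [max_eq_right h, e, e']; linarith
  · rw [max_eq_left h]
    have := bell_young (x := x) hp (Real.rpow_nonneg (abs_nonneg y) (q - 1))
    rw [e, e'] at this; linarith

lemma bell_F2 {A p q x y σ : ℝ} (hp : 2 ≤ p) (hσ : 0 ≤ σ) (h : |y| ^ (q - 1) ≤ |x|) :
    (A + (1 - 2 / p)) * |y| ^ q + x ^ 2 * σ ^ (p - 2) - (1 - 2 / p) * σ ^ p ≤ bell A p q x y := by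
  unfold bell
  rw [max_eq_left h]
  have := bell_young (x := x) hp hσ
  linarith

lemma bell_eq1 {A p q x y : ℝ} (hpq : (q - 1) * p = q) (h : |x| ≤ |y| ^ (q - 1)) :
    bell A p q x y = A * |y| ^ q + x ^ 2 * |y| ^ (2 - q) := by
  have e : (|y| ^ (q - 1)) ^ (p - 2) = |y| ^ (2 - q) := by
    rw [← Real.rpow_mul (abs_nonneg y)]; congr 1; linarith
  have e' : (|y| ^ (q - 1)) ^ p = |y| ^ q := by
    rw [← Real.rpow_mul (abs_nonneg y), hpq]
  unfold bell
  rw [max_eq_right h, e, e']; ring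

lemma bell_nonneg {A p q x y : ℝ} (hA : 0 ≤ A) (hp : 2 ≤ p) (hpq : (q - 1) * p = q) :
    0 ≤ bell A p q x y := le_trans (by positivity) (bell_F1 hp hpq)

lemma bell_le {A p q x y : ℝ} (hA : 0 ≤ A) (hp : 2 ≤ p) (hpq : (q - 1) * p = q) :
    bell A p q x y ≤ (A + 2) * (|x| ^ p + |y| ^ q) := by
  have hp0 : 0 < p := by linarith
  have hw : 0 ≤ 1 - 2 / p := by rw [sub_nonneg, div_le_one hp0]; exact hp
  have hw' : 1 - 2 / p ≤ 1 := by have : 0 ≤ 2 / p := by positivity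
                                 linarith
  set m := max |x| (|y| ^ (q - 1)) with hm
  have hm0 : 0 ≤ m := le_max_of_le_left (abs_nonneg x)
  have hmp : m ^ p ≤ |x| ^ p + |y| ^ q := by
    have e' : (|y| ^ (q - 1)) ^ p = |y| ^ q := by
      rw [← Real.rpow_mul (abs_nonneg y), hpq]
    rcases max_choice |x| (|y| ^ (q - 1)) with h | h
    · rw [hm, h]; have : 0 ≤ |y| ^ q := by positivity
      linarith
    · rw [hm, h, e']; have : 0 ≤ |x| ^ p := by positivity
      linarith
  have hx : x ^ 2 * m ^ (p - 2) ≤ m ^ p := by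
    rcases eq_or_lt_of_le hm0 with h | h
    · have : |x| ≤ 0 := by rw [h]; exact le_max_left _ _
      have : x = 0 := by simpa using this
      rw [this]; simp; positivity
    · have : m ^ p = m ^ 2 * m ^ (p - 2) := by
        rw [← Real.rpow_natCast, ← Real.rpow_add h]; norm_num
      rw [this]
      have : x ^ 2 ≤ m ^ 2 := by rw [← sq_abs]; gcongr; exact le_max_left _ _
      gcongr
  have h0 : 0 ≤ (1 - 2 / p) * m ^ p := by positivity
  have hx0 : 0 ≤ |x| ^ p := by positivity
  have hy0 : 0 ≤ |y| ^ q := by positivity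
  have : bell A p q x y = (A + (1 - 2 / p)) * |y| ^ q + x ^ 2 * m ^ (p - 2)
    - (1 - 2 / p) * m ^ p := rfl
  rw [this]
  nlinarith

lemma bell_neg_y {A p q x y : ℝ} : bell A p q x (-y) = bell A p q x y := by
  unfold bell; simp

lemma bell_alg {U V θ a K X : ℝ} (hU0 : 0 ≤ U) (hV0 : 0 ≤ V) (hUV : 0 < U ^ 2 + V ^ 2)
    (ha0 : 0 ≤ a) (ha1 : a ≤ 1) (hθ1 : |θ| ≤ 1) (hK : 100 ≤ K) (hX : |X| = U * V) :
    2 * (U * V) < K * V ^ 2 + 2 * U ^ 2 + 4 * a * θ * X - a * (1 - a) * θ ^ 2 * V ^ 2 := by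
  have hh : 0 ≤ U * V := by positivity
  have hcross : -(4 * (U * V)) ≤ 4 * a * θ * X := by
    have : |4 * a * θ * X| ≤ 4 * (U * V) := by
      rw [abs_mul, hX, abs_mul, abs_mul]
      have : |(4:ℝ)| * |a| * |θ| ≤ 4 := by
        rw [abs_of_nonneg ha0, abs_of_pos (by norm_num : (0:ℝ) < 4)]
        have := mul_le_mul ha1 hθ1 (abs_nonneg θ) zero_le_one
        linarith
      exact mul_le_mul_of_nonneg_right this hh
    exact (abs_le.1 this).1
  have hlast : a * (1 - a) * θ ^ 2 ≤ 1 := by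
    have h1 : θ ^ 2 ≤ 1 := by rw [← sq_abs]; exact pow_le_one₀ (abs_nonneg θ) hθ1
    have h2 : a * (1 - a) ≤ 1 := by nlinarith
    have h3 : 0 ≤ a * (1 - a) := mul_nonneg ha0 (by linarith)
    exact mul_le_one₀ h2 (sq_nonneg θ) h1
  have h5 := mul_le_mul_of_nonneg_right hlast (sq_nonneg V)
  have h6 := mul_le_mul_of_nonneg_right hK (sq_nonneg V)
  have h7 := sq_nonneg (U - 3 * V)
  rcases eq_or_lt_of_le hU0 with h | h
  · have hV2 : 0 < V ^ 2 := by rw [← h] at hUV; simpa using hUV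
    nlinarith
  · have : 0 < U ^ 2 := by positivity
    nlinarith [sq_nonneg V]

set_option maxHeartbeats 1000000 in
/-- local supporting parabola, positive `y` and small `x` -/
lemma bell_support1 {A p q x y ξ η : ℝ} (hq : 1 < q) (hq2 : q ≤ 2) (hp : 2 ≤ p)
    (hpq : (q - 1) * p = q) (hA : 100 ≤ A * (q * (q - 1))) (hy : 0 < y)
    (hx : |x| ≤ |y| ^ (q - 1)) :
    ∃ α : ℝ, ∀ᶠ t in nhds (0:ℝ),
      bell A p q x y + α * t + |ξ * η| * t ^ 2 ≤ bell A p q (x + t * ξ) (y + t * η) := by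
  by_cases hz : ξ = 0 ∧ η = 0
  · exact ⟨0, Filter.Eventually.of_forall fun t => by simp [hz.1, hz.2]⟩
  set a := 2 - q with ha
  set φ : ℝ → ℝ := fun t => A * (y + t * η) ^ q + (x + t * ξ) ^ 2 * (y + t * η) ^ a with hφ
  set φ' : ℝ → ℝ := fun t => A * (η * q * (y + t * η) ^ (q - 1)) +
    (2 * (x + t * ξ) * ξ * (y + t * η) ^ a + (x + t * ξ) ^ 2 * (η * a * (y + t * η) ^ (a - 1)))
    with hφ'
  have hpos : ∀ᶠ t in nhds (0:ℝ), 0 < y + t * η := by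
    have : Continuous fun t : ℝ => y + t * η := by fun_prop
    exact this.continuousAt.eventually_const_lt (by simpa using hy)
  have hl : ∀ t, HasDerivAt (fun t : ℝ => y + t * η) η t := fun t => by
    simpa using ((hasDerivAt_id t).mul_const η).const_add y
  have hlx : ∀ t, HasDerivAt (fun t : ℝ => x + t * ξ) ξ t := fun t => by
    simpa using ((hasDerivAt_id t).mul_const ξ).const_add x
  have h1 : ∀ᶠ t in nhds (0:ℝ), HasDerivAt φ (φ' t) t := by
    filter_upwards [hpos] with t ht
    have := (((hl t).rpow_const (p := q) (Or.inl ht.ne')).const_mul A).add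
      (((hlx t).pow 2).mul ((hl t).rpow_const (p := a) (Or.inl ht.ne')))
    refine this.congr_deriv ?_
    simp only [hφ']; simp
  set φ2 : ℝ := A * (η * q * (η * (q - 1) * y ^ (q - 2))) +
    ((2 * ξ * ξ * y ^ a + 2 * x * ξ * (η * a * y ^ (a - 1))) +
      (2 * x * ξ * (η * a * y ^ (a - 1)) + x ^ 2 * (η * a * (η * (a - 1) * y ^ (a - 2))))) with hφ2
  have h2 : HasDerivAt φ' φ2 0 := by
    have hy0 : y + 0 * η ≠ 0 := by simpa using hy.ne'
    have e1 := (((hl 0).rpow_const (p := q - 1) (Or.inl hy0)).const_mul (η * q)).const_mul A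
    have e2 := (((hlx 0).const_mul 2).mul_const ξ).mul ((hl 0).rpow_const (p := a) (Or.inl hy0))
    have e3 := ((hlx 0).pow 2).mul
      (((hl 0).rpow_const (p := a - 1) (Or.inl hy0)).const_mul (η * a))
    refine (e1.add (e2.add e3)).congr_deriv ?_
    simp only [hφ2]
    have i1 : q - 1 - 1 = q - 2 := by ring
    have i2 : a - 1 - 1 = a - 2 := by ring
    simp [i1, i2]
  have hineq : 2 * |ξ * η| < φ2 := by
    set Y := y ^ a with hY
    have hYpos : 0 < Y := by positivity
    have r1 : y ^ (q - 2) = Y⁻¹ := by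
      rw [hY, ← Real.rpow_neg hy.le]; congr 1; simp [ha]
    set S := y ^ (q - 1) with hS
    have hSpos : 0 < S := by positivity
    have r2 : y ^ (a - 1) = S⁻¹ := by
      rw [hS, ← Real.rpow_neg hy.le]; congr 1; simp [ha]; ring
    have r3 : y ^ (a - 2) = S⁻¹ ^ 2 * Y⁻¹ := by
      rw [hS, hY, ← Real.rpow_neg hy.le, ← Real.rpow_neg hy.le, ← Real.rpow_natCast,
        ← Real.rpow_mul hy.le, ← Real.rpow_add hy]; congr 1; simp [ha]; ring
    set θ := x * S⁻¹ with hθ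
    have hθ1 : |θ| ≤ 1 := by
      rw [hθ, abs_mul, abs_of_pos (inv_pos.2 hSpos), ← div_eq_mul_inv, div_le_one hSpos]
      rwa [abs_of_pos hy] at hx
    have e : φ2 = A * (q * (q - 1)) * (η ^ 2 * Y⁻¹) + 2 * (ξ ^ 2 * Y) + 4 * a * θ * (ξ * η)
        - a * (1 - a) * θ ^ 2 * (η ^ 2 * Y⁻¹) := by
      rw [hφ2, r1, r2, r3, hθ]; ring
    have ha0 : 0 ≤ a := by simp [ha]; linarith
    have ha1 : a ≤ 1 := by simp [ha]; linarith
    set U := |ξ| * Real.sqrt Y with hU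
    set V := |η| * (Real.sqrt Y)⁻¹ with hV
    have hsq : 0 < Real.sqrt Y := Real.sqrt_pos.2 hYpos
    have eU : ξ ^ 2 * Y = U ^ 2 := by rw [hU, mul_pow, sq_abs, Real.sq_sqrt hYpos.le]
    have eV : η ^ 2 * Y⁻¹ = V ^ 2 := by rw [hV, mul_pow, sq_abs, inv_pow, Real.sq_sqrt hYpos.le]
    have eUV : |ξ * η| = U * V := by rw [hU, hV, abs_mul]; field_simp
    have hU0 : 0 ≤ U := by positivity
    have hV0 : 0 ≤ V := by positivity
    have hUV : 0 < U ^ 2 + V ^ 2 := by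
      by_contra hh
      have hUz : U = 0 := by nlinarith [sq_nonneg U, sq_nonneg V]
      have hVz : V = 0 := by nlinarith [sq_nonneg U, sq_nonneg V]
      apply hz
      constructor
      · rcases mul_eq_zero.1 hUz with h | h
        · simpa using h
        · exact absurd h hsq.ne'
      · rcases mul_eq_zero.1 hVz with h | h
        · simpa using h
        · exact absurd h (inv_pos.2 hsq).ne'
    rw [e, eU, eV, eUV]
    exact bell_alg hU0 hV0 hUV ha0 ha1 hθ1 hA eUV
  refine ⟨φ' 0, ?_⟩
  filter_upwards [second_deriv_support h1 h2 hineq, hpos] with t ht htp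
  have hb0 : bell A p q x y = φ 0 := by
    rw [bell_eq1 hpq hx, abs_of_pos hy]; simp [hφ, ha]
  have := bell_F1 (A := A) (x := x + t * ξ) (y := y + t * η) hp hpq
  rw [abs_of_pos htp] at this
  rw [hb0]
  simp only [sub_zero] at ht
  exact ht.trans this

/-- `|y|^q` lies above parabolas -/
lemma rpow_support {A q y η σ : ℝ} (hq : 1 < q) (hq2 : q ≤ 2)
    (hA : 100 ≤ A * (q * (q - 1))) (hσ : 0 < σ) (hy : σ⁻¹ ≤ |y| ^ (q - 2) ∨ (y = 0 ∧ σ = 1 ∧ q = 2) ∨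
      (y = 0 ∧ q < 2)) (ξ : ℝ) :
    ∃ α : ℝ, ∀ᶠ t in nhds (0:ℝ),
      A * |y| ^ q + α * t + σ⁻¹ * η ^ 2 * t ^ 2 ≤ A * |y + t * η| ^ q := by
  have hqq : 0 < q * (q - 1) := by apply mul_pos <;> linarith
  have hA0 : 0 < A := by
    by_contra h
    push Not at h
    nlinarith
  have hA50 : 1 ≤ A := by nlinarith
  rcases eq_or_ne y 0 with rfl | hy0
  · refine ⟨0, ?_⟩
    rcases eq_or_ne η 0 with rfl | hη
    · simp
    rcases eq_or_lt_of_le hq2 with h2 | h2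
    · subst h2
      have : σ⁻¹ ≤ 1 := by
        rcases hy with h | h | h
        · simpa using h
        · simp [h.2.1]
        · linarith [h.2]
      refine Filter.Eventually.of_forall fun t => ?_
      have hh : 0 ≤ t ^ 2 * η ^ 2 := by positivity
      rw [zero_add, Real.rpow_two, Real.rpow_two, sq_abs, sq_abs, mul_pow]
      have h4 : σ⁻¹ * (t ^ 2 * η ^ 2) ≤ A * (t ^ 2 * η ^ 2) := by
        apply mul_le_mul_of_nonneg_right _ hh; linarith
      linarith
    · have hc : Filter.Tendsto (fun t : ℝ => σ⁻¹ * |t * η| ^ (2 - q)) (nhds 0) (nhds 0) := by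
        have : Continuous fun t : ℝ => σ⁻¹ * |t * η| ^ (2 - q) :=
          continuous_const.mul ((Real.continuous_rpow_const (by linarith)).comp (by fun_prop))
        have h := this.tendsto 0
        simpa [Real.zero_rpow (by linarith : 2 - q ≠ 0)] using h
      filter_upwards [hc.eventually_lt_const (show (0:ℝ) < 1 by norm_num)] with t ht
      rcases eq_or_ne t 0 with rfl | ht0
      · simp
      have hpos : 0 < |t * η| := abs_pos.2 (mul_ne_zero ht0 hη)
      have e : |t * η| ^ (2:ℝ) = |t * η| ^ (2 - q) * |t * η| ^ q := by
        rw [← Real.rpow_add hpos]; congr 1; ring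
      rw [Real.rpow_two, sq_abs, mul_pow] at e
      have hp' : 0 < |t * η| ^ q := by positivity
      rw [abs_zero, Real.zero_rpow (by linarith : q ≠ 0), zero_add, mul_zero, zero_mul, zero_add,
        zero_add]
      calc σ⁻¹ * η ^ 2 * t ^ 2 = (σ⁻¹ * |t * η| ^ (2 - q)) * |t * η| ^ q := by
            rw [mul_assoc, mul_assoc, ← e]; ring
        _ ≤ 1 * |t * η| ^ q := by gcongr
        _ ≤ A * |t * η| ^ q := by gcongr
  · have hσy : σ⁻¹ ≤ |y| ^ (q - 2) := by
      rcases hy with h | h | h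
      · exact h
      · exact absurd h.1 hy0
      · exact absurd h.1 hy0
    rcases eq_or_ne η 0 with rfl | hη
    · exact ⟨0, by simp⟩
    -- reduce to y > 0
    have main : ∀ y η : ℝ, 0 < y → η ≠ 0 → σ⁻¹ ≤ |y| ^ (q - 2) → ∃ α : ℝ, ∀ᶠ t in nhds (0:ℝ),
        A * |y| ^ q + α * t + σ⁻¹ * η ^ 2 * t ^ 2 ≤ A * |y + t * η| ^ q := by
      intro y η hy hη hσy
      have hpos : ∀ᶠ t in nhds (0:ℝ), 0 < y + t * η := by
        have : Continuous fun t : ℝ => y + t * η := by fun_prop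
        exact this.continuousAt.eventually_const_lt (by simpa using hy)
      have hl : ∀ t, HasDerivAt (fun t : ℝ => y + t * η) η t := fun t => by
        simpa using ((hasDerivAt_id t).mul_const η).const_add y
      have h1 : ∀ᶠ t in nhds (0:ℝ), HasDerivAt (fun t : ℝ => A * (y + t * η) ^ q)
          (A * (η * q * (y + t * η) ^ (q - 1))) t := by
        filter_upwards [hpos] with t ht
        exact ((hl t).rpow_const (p := q) (Or.inl ht.ne')).const_mul A
      have h2 : HasDerivAt (fun t : ℝ => A * (η * q * (y + t * η) ^ (q - 1)))
          (A * (η * q * (η * (q - 1) * y ^ (q - 2)))) 0 := by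
        have hy0 : y + 0 * η ≠ 0 := by simpa using hy.ne'
        have e1 := (((hl 0).rpow_const (p := q - 1) (Or.inl hy0)).const_mul (η * q)).const_mul A
        have i1 : q - 1 - 1 = q - 2 := by ring
        simpa [i1] using e1
      have hineq : 2 * (σ⁻¹ * η ^ 2) < A * (η * q * (η * (q - 1) * y ^ (q - 2))) := by
        rw [abs_of_pos hy] at hσy
        have e : A * (η * q * (η * (q - 1) * y ^ (q - 2))) =
          (A * (q * (q - 1))) * (y ^ (q - 2) * η ^ 2) := by ring
        rw [e]
        have : 0 < η ^ 2 := by positivity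
        have h3 : 0 < y ^ (q - 2) * η ^ 2 := by positivity
        have h4 : σ⁻¹ * η ^ 2 ≤ y ^ (q - 2) * η ^ 2 := by gcongr
        nlinarith
      refine ⟨A * (η * q * (y + 0 * η) ^ (q - 1)), ?_⟩
      filter_upwards [second_deriv_support h1 h2 hineq, hpos] with t ht htp
      rw [abs_of_pos htp, abs_of_pos hy]
      simpa using ht
    rcases lt_or_gt_of_ne hy0 with hneg | hpos
    · obtain ⟨α, hα⟩ := main (-y) (-η) (by linarith) (by simpa using hη) (by simpa using hσy)
      refine ⟨α, ?_⟩
      filter_upwards [hα] with t ht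
      have : -y + t * -η = -(y + t * η) := by ring
      rw [this, abs_neg, abs_neg, neg_sq] at ht
      exact ht
    · exact main y η hpos hη hσy

lemma bell_support {A p q x y : ℝ} (ξ η : ℝ) (hq : 1 < q) (hq2 : q ≤ 2) (hp : 2 ≤ p)
    (hpq : (q - 1) * p = q) (hA : 100 ≤ A * (q * (q - 1))) :
    ∃ α : ℝ, ∀ᶠ t in nhds (0:ℝ),
      bell A p q x y + α * t + |ξ * η| * t ^ 2 ≤ bell A p q (x + t * ξ) (y + t * η) := by
  have hqq : 0 < q * (q - 1) := by apply mul_pos <;> linarith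
  have hA0 : 0 < A := by
    by_contra h
    push Not at h
    nlinarith
  have hA50 : 1 ≤ A := by nlinarith
  rcases le_or_gt |x| (|y| ^ (q - 1)) with hx | hx
  · rcases lt_trichotomy y 0 with hy | hy | hy
    · obtain ⟨α, hα⟩ := bell_support1 (x := x) (y := -y) (ξ := ξ) (η := -η) hq hq2 hp hpq hA
        (by linarith) (by simpa using hx)
      refine ⟨α, ?_⟩
      filter_upwards [hα] with t ht
      have e : -y + t * -η = -(y + t * η) := by ring
      rw [e, bell_neg_y, bell_neg_y] at ht
      simpa using ht
    · subst hy
      have hx0 : x = 0 := by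
        rw [abs_zero, Real.zero_rpow (by linarith)] at hx; simpa using hx
      subst hx0
      refine ⟨0, Filter.Eventually.of_forall fun t => ?_⟩
      have hb : bell A p q 0 0 = 0 := by
        rw [bell_eq1 hpq (by simp; positivity)]
        simp [Real.zero_rpow (by linarith : q ≠ 0)]
      rw [hb]
      refine le_trans ?_ (bell_F1 (A := A) hp hpq)
      simp only [zero_add, zero_mul]
      set s := |t * η| with hs
      have hs0 : 0 ≤ s := abs_nonneg _
      set a := s ^ (q / 2) with ha
      set b := |t * ξ| * s ^ ((2 - q) / 2) with hb
      have ea : s ^ q = a ^ 2 := by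
        rw [ha, ← Real.rpow_natCast, ← Real.rpow_mul hs0]; congr 1; push_cast; ring
      have eb : (t * ξ) ^ 2 * s ^ (2 - q) = b ^ 2 := by
        have e0 : (s ^ ((2 - q) / 2)) ^ 2 = s ^ (2 - q) := by
          rw [← Real.rpow_natCast, ← Real.rpow_mul hs0]; congr 1; push_cast; ring
        rw [hb, mul_pow |t * ξ| _ 2, sq_abs, e0]
      have eab : |ξ * η| * t ^ 2 = a * b := by
        have : a * b = |t * ξ| * s := by
          rw [ha, hb]
          rcases eq_or_lt_of_le hs0 with h | h
          · rw [← h, Real.zero_rpow (by linarith : q / 2 ≠ 0)]; simp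
          · rw [mul_left_comm, ← Real.rpow_add h]
            have : q / 2 + (2 - q) / 2 = 1 := by ring
            rw [this, Real.rpow_one]
        rw [this, hs, ← abs_mul, ← abs_of_nonneg (sq_nonneg t), ← abs_mul]
        congr 1; ring
      rw [ea, eb, eab]
      have ha0 : 0 ≤ a := by positivity
      have hb0 : 0 ≤ b := by positivity
      nlinarith [sq_nonneg (a - b), sq_nonneg a]
    · exact bell_support1 hq hq2 hp hpq hA hy hx
  · have hxpos : 0 < |x| := lt_of_le_of_lt (by positivity) hx
    set w := 1 - 2 / p with hw
    have hp0 : 0 < p := by linarith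
    have hw0 : 0 ≤ w := by rw [hw, sub_nonneg, div_le_one hp0]; exact hp
    set σ := |x| ^ (p - 2) with hσ
    have hσpos : 0 < σ := by positivity
    have hcond : σ⁻¹ ≤ |y| ^ (q - 2) ∨ (y = 0 ∧ σ = 1 ∧ q = 2) ∨ (y = 0 ∧ q < 2) := by
      rcases eq_or_ne y 0 with rfl | hy
      · rcases eq_or_lt_of_le hq2 with h | h
        · right; left
          refine ⟨rfl, ?_, h⟩
          have : p = 2 := by subst h; linarith
          rw [hσ, this]; simp
        · exact Or.inr (Or.inr ⟨rfl, h⟩)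
      · left
        have hy' : 0 < |y| := abs_pos.2 hy
        have : |y| ^ (q - 2) = ((|y| ^ (q - 1)) ^ (p - 2))⁻¹ := by
          rw [← Real.rpow_mul hy'.le, ← Real.rpow_neg hy'.le]; congr 1; linarith
        rw [this]
        exact inv_anti₀ (by positivity) (Real.rpow_le_rpow (by positivity) hx.le (by linarith))
    obtain ⟨α, hα⟩ := rpow_support (A := A + w) (η := η) hq hq2 (by nlinarith) hσpos hcond 0
    refine ⟨α + 2 * x * ξ * σ, ?_⟩
    have hev : ∀ᶠ t in nhds (0:ℝ), |y + t * η| ^ (q - 1) < |x + t * ξ| := by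
      have c1 : Continuous fun t : ℝ => |y + t * η| ^ (q - 1) :=
        (Real.continuous_rpow_const (by linarith)).comp (by fun_prop)
      have c2 : Continuous fun t : ℝ => |x + t * ξ| := by fun_prop
      exact c1.continuousAt.eventually_lt c2.continuousAt (by simpa using hx)
    filter_upwards [hα, hev] with t ht htx
    have hF := bell_F2 (A := A) (σ := |x|) hp hxpos.le htx.le
    have hb : bell A p q x y = (A + w) * |y| ^ q + x ^ 2 * σ - w * |x| ^ p := by
      unfold bell; rw [max_eq_left hx.le]
    rw [hb]
    refine le_trans ?_ hF
    have hc : |ξ * η| ≤ ξ ^ 2 * σ + σ⁻¹ * η ^ 2 := by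
      set r := Real.sqrt σ with hr
      have hr0 : 0 < r := Real.sqrt_pos.2 hσpos
      have e : σ = r ^ 2 := (Real.sq_sqrt hσpos.le).symm
      have : |ξ * η| = (|ξ| * r) * (|η| * r⁻¹) := by rw [abs_mul]; field_simp
      rw [this]
      have e1 : ξ ^ 2 * σ = (|ξ| * r) ^ 2 := by rw [mul_pow, sq_abs, e]
      have e2 : σ⁻¹ * η ^ 2 = (|η| * r⁻¹) ^ 2 := by rw [mul_pow, sq_abs, e, inv_pow]; ring
      rw [e1, e2]
      have h1 : 0 ≤ |ξ| * r := by positivity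
      have h2 : 0 ≤ |η| * r⁻¹ := by positivity
      nlinarith [sq_nonneg (|ξ| * r - |η| * r⁻¹)]
    have : |ξ * η| * t ^ 2 ≤ (ξ ^ 2 * σ + σ⁻¹ * η ^ 2) * t ^ 2 := by gcongr
    nlinarith

lemma bell_mid {A p q : ℝ} (x y x' y' : ℝ) (hq : 1 < q) (hq2 : q ≤ 2) (hp : 2 ≤ p)
    (hpq : (q - 1) * p = q) (hA : 100 ≤ A * (q * (q - 1))) :
    bell A p q ((x + x') / 2) ((y + y') / 2) + |(x - x') * (y - y')| / 4
      ≤ (bell A p q x y + bell A p q x' y') / 2 := by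
  set φ : ℝ → ℝ := fun t => bell A p q (x + t * (x' - x)) (y + t * (y' - y)) with hφ
  have hc : Continuous φ :=
    (bell_continuous (A := A) hp hq).comp
      (by fun_prop : Continuous fun t : ℝ => (x + t * (x' - x), y + t * (y' - y)))
  have := visc_mid hc (κ := |(x' - x) * (y' - y)|) (fun t₀ => by
    obtain ⟨α, hα⟩ := bell_support (x := x + t₀ * (x' - x)) (y := y + t₀ * (y' - y))
      (x' - x) (y' - y) hq hq2 hp hpq hA
    refine ⟨α, ?_⟩
    have ht : Filter.Tendsto (fun t : ℝ => t - t₀) (nhds t₀) (nhds 0) := by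
      have : Continuous fun t : ℝ => t - t₀ := by fun_prop
      simpa using this.tendsto t₀
    filter_upwards [ht.eventually hα] with t ht
    have e1 : x + t₀ * (x' - x) + (t - t₀) * (x' - x) = x + t * (x' - x) := by ring
    have e2 : y + t₀ * (y' - y) + (t - t₀) * (y' - y) = y + t * (y' - y) := by ring
    rw [e1, e2] at ht
    exact ht)
  simp only [hφ] at this
  have e1 : x + 1 / 2 * (x' - x) = (x + x') / 2 := by ring
  have e2 : y + 1 / 2 * (y' - y) = (y + y') / 2 := by ring
  have e3 : |(x' - x) * (y' - y)| = |(x - x') * (y - y')| := by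
    congr 1; ring
  rw [e1, e2, e3] at this
  simp only [zero_mul, add_zero, one_mul, add_sub_cancel] at this
  linarith

/-- Existence of the Bellman function, symmetric formulation for arbitrary conjugate exponents. -/
lemma exists_bellman {p q : ℝ} (hpq : p.HolderConjugate q) :
    ∃ (B : ℝ → ℝ → ℝ) (C : ℝ), 0 < C ∧ Continuous (fun z : ℝ × ℝ => B z.1 z.2) ∧
      (∀ x y, 0 ≤ B x y) ∧ (∀ x y, B x y ≤ C * (|x| ^ p + |y| ^ q)) ∧
      ∀ x y x' y', B ((x + x') / 2) ((y + y') / 2) + |(x - x') * (y - y')| / 4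
        ≤ (B x y + B x' y') / 2 := by
  have key : ∀ p q : ℝ, p.HolderConjugate q → 2 ≤ p →
    ∃ (B : ℝ → ℝ → ℝ) (C : ℝ), 0 < C ∧ Continuous (fun z : ℝ × ℝ => B z.1 z.2) ∧
      (∀ x y, 0 ≤ B x y) ∧ (∀ x y, B x y ≤ C * (|x| ^ p + |y| ^ q)) ∧
      ∀ x y x' y', B ((x + x') / 2) ((y + y') / 2) + |(x - x') * (y - y')| / 4
        ≤ (B x y + B x' y') / 2 := by
    intro p q hpq hp
    have hq : 1 < q := hpq.symm.lt
    have e1 : (q - 1) * p = q := by rw [hpq.symm.sub_one_mul_conj]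
    have hq2 : q ≤ 2 := by nlinarith
    have hqq : 0 < q * (q - 1) := by apply mul_pos <;> linarith
    set A := 100 / (q * (q - 1)) with hA
    have hA0 : 0 < A := by positivity
    have hA1 : 100 ≤ A * (q * (q - 1)) := by rw [hA, div_mul_cancel₀ _ hqq.ne']
    exact ⟨bell A p q, A + 2, by linarith, bell_continuous hp hq,
      fun x y => bell_nonneg hA0.le hp e1, fun x y => bell_le hA0.le hp e1,
      fun x y x' y' => bell_mid x y x' y' hq hq2 hp e1 hA1⟩
  rcases le_total 2 p with h | h
  · exact key p q hpq h
  · have h2 : 2 ≤ q := by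
      have := hpq.inv_add_inv_eq_one
      have hp := hpq.pos
      have hq := hpq.symm.pos
      have e : q = p * (q - 1) := by have := hpq.mul_eq_add; linarith
      by_contra hh
      push Not at hh
      nlinarith
    obtain ⟨B, C, hC, hc, h0, hb, hm⟩ := key q p hpq.symm h2
    refine ⟨fun x y => B y x, C, hC, hc.comp continuous_swap, fun x y => h0 y x,
      fun x y => by rw [add_comm]; exact hb y x, fun x y x' y' => ?_⟩
    rw [mul_comm]; exact hm y x y' x'

end
end

section
open MeasureTheory
noncomputable section

/-! ### Part 2: discrete heat flow and the bilinear embedding -/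

lemma conv_of_mid {φ : ℝ → ℝ} (hφ : Continuous φ)
    (h : ∀ a b, 2 * φ ((a + b) / 2) ≤ φ a + φ b) {l : ℝ} (h0 : 0 ≤ l) (h1 : l ≤ 1) :
    φ l ≤ (1 - l) * φ 0 + l * φ 1 := by
  by_contra hcon
  push Not at hcon
  set ε := φ l - ((1 - l) * φ 0 + l * φ 1) with hε
  have hεpos : 0 < ε := by linarith
  set ψ : ℝ → ℝ := fun t => φ t + ε * (t ^ 2 - t) - (φ 0 * (1 - t) + φ 1 * t) with hψ
  have hψc : Continuous ψ := by fun_prop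
  obtain ⟨t₀, ht₀, hmax⟩ := isCompact_Icc.exists_isMaxOn (Set.nonempty_Icc.2 zero_le_one)
    (hψc.continuousOn (s := Set.Icc (0:ℝ) 1))
  have hl : ψ l ≤ ψ t₀ := hmax ⟨h0, h1⟩
  have hpos : 0 < ψ l := by
    simp only [hψ]; nlinarith [sq_nonneg (l - 1/2)]
  have e0 : ψ 0 = 0 := by simp [hψ]
  have e1 : ψ 1 = 0 := by simp [hψ]
  have ht0' : t₀ ≠ 0 := by rintro rfl; linarith
  have ht1' : t₀ ≠ 1 := by rintro rfl; linarith
  have hlt0 : 0 < t₀ := lt_of_le_of_ne ht₀.1 (Ne.symm ht0')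
  have hlt1 : t₀ < 1 := lt_of_le_of_ne ht₀.2 ht1'
  set δ := min t₀ (1 - t₀) with hδ
  have hδpos : 0 < δ := lt_min hlt0 (by linarith)
  have d1 : δ ≤ t₀ := min_le_left _ _
  have d2 : δ ≤ 1 - t₀ := min_le_right _ _
  have hp2 : ψ (t₀ + δ) ≤ ψ t₀ := hmax ⟨by linarith, by linarith⟩
  have hm2 : ψ (t₀ - δ) ≤ ψ t₀ := hmax ⟨by linarith, by linarith⟩
  have hh := h (t₀ + δ) (t₀ - δ)
  have ee : (t₀ + δ + (t₀ - δ)) / 2 = t₀ := by ring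
  rw [ee] at hh
  simp only [hψ] at hp2 hm2
  have : 0 < ε * δ ^ 2 := by positivity
  nlinarith

lemma convexOn_of_mid {B : ℝ → ℝ → ℝ} (hB : Continuous (fun z : ℝ × ℝ => B z.1 z.2))
    (h : ∀ x y x' y', B ((x + x') / 2) ((y + y') / 2) ≤ (B x y + B x' y') / 2) :
    ConvexOn ℝ Set.univ (fun z : ℝ × ℝ => B z.1 z.2) := by
  refine ⟨convex_univ, fun u _ v _ a b ha hb hab => ?_⟩
  have hc : Continuous fun t : ℝ => B (u.1 + t * (v.1 - u.1)) (u.2 + t * (v.2 - u.2)) :=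
    hB.comp (by fun_prop : Continuous fun t : ℝ =>
      (u.1 + t * (v.1 - u.1), u.2 + t * (v.2 - u.2)))
  have := conv_of_mid hc (fun s t => by
    have := h (u.1 + s * (v.1 - u.1)) (u.2 + s * (v.2 - u.2)) (u.1 + t * (v.1 - u.1))
      (u.2 + t * (v.2 - u.2))
    have e1 : (u.1 + s * (v.1 - u.1) + (u.1 + t * (v.1 - u.1))) / 2 =
      u.1 + (s + t) / 2 * (v.1 - u.1) := by ring
    have e2 : (u.2 + s * (v.2 - u.2) + (u.2 + t * (v.2 - u.2))) / 2 =
      u.2 + (s + t) / 2 * (v.2 - u.2) := by ring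
    rw [e1, e2] at this
    linarith) hb (by linarith)
  have ea : a = 1 - b := by linarith
  subst ea
  simp only [zero_mul, add_zero, one_mul, add_sub_cancel] at this
  have e1 : u.1 + b * (v.1 - u.1) = ((1 - b) • u + b • v).1 := by simp; ring
  have e2 : u.2 + b * (v.2 - u.2) = ((1 - b) • u + b • v).2 := by simp; ring
  rw [e1, e2] at this
  simpa using this

section flow

variable {G : Type*} [AddCommGroup G]

/-- central difference -/
def dif (v : G) (f : G → ℝ) : G → ℝ := fun z => f (z + v) - f (z - v)

/-- averaging over `± w i` -/
def avg {ι : Type*} [Fintype ι] (w : ι → G) (f : G → ℝ) : G → ℝ := fun z =>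
  ∑ i, (2 * (Fintype.card ι : ℝ))⁻¹ * (f (z + w i) + f (z - w i))

variable {ι : Type*} [Fintype ι]

lemma dif_avg (w : ι → G) (v : G) (f : G → ℝ) : dif v (avg w f) = avg w (dif v f) := by
  funext z
  simp only [dif, avg]
  rw [← Finset.sum_sub_distrib]
  refine Finset.sum_congr rfl fun i _ => ?_
  rw [add_right_comm z v, add_sub_right_comm z v, sub_add_eq_add_sub z v, sub_right_comm z v]
  ring

lemma dif_iter (w : ι → G) (v : G) (f : G → ℝ) (n : ℕ) :
    dif v ((avg w)^[n] f) = (avg w)^[n] (dif v f) := by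
  induction n generalizing f with
  | zero => rfl
  | succ n ih => rw [Function.iterate_succ_apply, Function.iterate_succ_apply, ih, dif_avg]

lemma avg_sub (w : ι → G) (f g : G → ℝ) : avg w (f - g) = avg w f - avg w g := by
  funext z; simp only [avg, Pi.sub_apply]; rw [← Finset.sum_sub_distrib]
  exact Finset.sum_congr rfl fun i _ => by ring
lemma avg_add (w : ι → G) (f g : G → ℝ) : avg w (f + g) = avg w f + avg w g := by
  funext z; simp only [avg, Pi.add_apply]; rw [← Finset.sum_add_distrib]
  exact Finset.sum_congr rfl fun i _ => by ring
lemma avg_smul (w : ι → G) (c : ℝ) (f : G → ℝ) : avg w (c • f) = c • avg w f := by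
  funext z; simp only [avg, Pi.smul_apply, smul_eq_mul]; rw [Finset.mul_sum]
  exact Finset.sum_congr rfl fun i _ => by ring
lemma iter_sub (w : ι → G) (f g : G → ℝ) (n : ℕ) :
    (avg w)^[n] (f - g) = (avg w)^[n] f - (avg w)^[n] g := by
  induction n generalizing f g with
  | zero => rfl
  | succ n ih => simp only [Function.iterate_succ_apply, avg_sub, ih]
lemma iter_add (w : ι → G) (f g : G → ℝ) (n : ℕ) :
    (avg w)^[n] (f + g) = (avg w)^[n] f + (avg w)^[n] g := by
  induction n generalizing f g with
  | zero => rfl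
  | succ n ih => simp only [Function.iterate_succ_apply, avg_add, ih]
lemma iter_smul (w : ι → G) (c : ℝ) (f : G → ℝ) (n : ℕ) :
    (avg w)^[n] (c • f) = c • (avg w)^[n] f := by
  induction n generalizing f with
  | zero => rfl
  | succ n ih => simp only [Function.iterate_succ_apply, avg_smul, ih]
lemma dif_sub (v : G) (f g : G → ℝ) : dif v (f - g) = dif v f - dif v g := by
  funext z; simp only [dif, Pi.sub_apply]; ring
lemma dif_add (v : G) (f g : G → ℝ) : dif v (f + g) = dif v f + dif v g := by
  funext z; simp only [dif, Pi.add_apply]; ring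
lemma dif_smul (v : G) (c : ℝ) (f : G → ℝ) : dif v (c • f) = c • dif v f := by
  funext z; simp only [dif, Pi.smul_apply, smul_eq_mul]; ring

lemma bellman_avg [Nonempty ι] (w : ι → G) {B : ℝ → ℝ → ℝ}
    (hB : Continuous (fun z : ℝ × ℝ => B z.1 z.2))
    (h : ∀ x y x' y', B ((x + x') / 2) ((y + y') / 2) + |(x - x') * (y - y')| / 4
        ≤ (B x y + B x' y') / 2) (f g : G → ℝ) (z : G) (k : ι) :
    B (avg w f z) (avg w g z) + (4 * (Fintype.card ι : ℝ))⁻¹ * |dif (w k) f z * dif (w k) g z|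
      ≤ avg w (fun z => B (f z) (g z)) z := by
  have hN : (0:ℝ) < Fintype.card ι := by exact_mod_cast Fintype.card_pos
  have hconv := convexOn_of_mid hB (fun x y x' y' => by
    have := h x y x' y'
    have := abs_nonneg ((x - x') * (y - y'))
    linarith)
  have J := hconv.map_sum_le (t := Finset.univ) (w := fun _ : ι => (Fintype.card ι : ℝ)⁻¹)
    (p := fun i => ((f (z + w i) + f (z - w i)) / 2, (g (z + w i) + g (z - w i)) / 2))
    (fun _ _ => by positivity) (by simp [hN.ne']) (fun _ _ => Set.mem_univ _)
  simp only [smul_eq_mul] at J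
  have e1 : (∑ i : ι, (Fintype.card ι : ℝ)⁻¹ • ((f (z + w i) + f (z - w i)) / 2,
      (g (z + w i) + g (z - w i)) / 2)).1 = avg w f z := by
    rw [Prod.fst_sum]; simp only [avg, Prod.smul_fst, smul_eq_mul]
    exact Finset.sum_congr rfl fun i _ => by rw [mul_inv]; ring
  have e2 : (∑ i : ι, (Fintype.card ι : ℝ)⁻¹ • ((f (z + w i) + f (z - w i)) / 2,
      (g (z + w i) + g (z - w i)) / 2)).2 = avg w g z := by
    rw [Prod.snd_sum]; simp only [avg, Prod.smul_snd, smul_eq_mul]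
    exact Finset.sum_congr rfl fun i _ => by rw [mul_inv]; ring
  rw [e1, e2] at J
  have h2 : ∑ i : ι, (Fintype.card ι : ℝ)⁻¹ * B ((f (z + w i) + f (z - w i)) / 2)
      ((g (z + w i) + g (z - w i)) / 2) + ∑ i : ι, (4 * (Fintype.card ι : ℝ))⁻¹ *
        |dif (w i) f z * dif (w i) g z| ≤ avg w (fun z => B (f z) (g z)) z := by
    rw [← Finset.sum_add_distrib]
    simp only [avg]
    refine Finset.sum_le_sum fun i _ => ?_
    have := h (f (z + w i)) (g (z + w i)) (f (z - w i)) (g (z - w i))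
    have := mul_le_mul_of_nonneg_left this (inv_pos.2 hN).le
    simp only [dif]
    rw [mul_inv, mul_inv]
    linarith
  have h3 : (4 * (Fintype.card ι : ℝ))⁻¹ * |dif (w k) f z * dif (w k) g z| ≤
      ∑ i : ι, (4 * (Fintype.card ι : ℝ))⁻¹ * |dif (w i) f z * dif (w i) g z| :=
    Finset.single_le_sum (f := fun i => (4 * (Fintype.card ι : ℝ))⁻¹ *
      |dif (w i) f z * dif (w i) g z|) (fun i _ => by positivity) (Finset.mem_univ k)
  linarith

variable [MeasurableSpace G] [MeasurableAdd G] {μ : Measure G} [μ.IsAddRightInvariant]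

lemma mp_add (v : G) : MeasurePreserving (fun z => z + v) μ μ := measurePreserving_add_right μ v
lemma mp_sub (v : G) : MeasurePreserving (fun z => z - v) μ μ := by
  simpa [sub_eq_add_neg] using measurePreserving_add_right μ (-v)

lemma dif_memLp {f : G → ℝ} {p : ENNReal} (hf : MemLp f p μ) (v : G) : MemLp (dif v f) p μ :=
  (hf.comp_measurePreserving (mp_add v)).sub (hf.comp_measurePreserving (mp_sub v))

lemma avg_memLp {f : G → ℝ} {p : ENNReal} (hf : MemLp f p μ) (w : ι → G) :
    MemLp (avg w f) p μ :=
  memLp_finsetSum _ fun i _ =>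
    ((hf.comp_measurePreserving (mp_add (w i))).add
      (hf.comp_measurePreserving (mp_sub (w i)))).const_mul _

lemma iter_memLp {f : G → ℝ} {p : ENNReal} (hf : MemLp f p μ) (w : ι → G) (n : ℕ) :
    MemLp ((avg w)^[n] f) p μ := by
  induction n generalizing f with
  | zero => exact hf
  | succ n ih => exact ih (avg_memLp hf w)

lemma integrable_mul_conj {p q : ℝ} (hpq : p.HolderConjugate q) {X : Type*} [MeasurableSpace X]
    {μ : Measure X} {f g : X → ℝ}
    (hf : MemLp f (ENNReal.ofReal p) μ) (hg : MemLp g (ENNReal.ofReal q) μ) :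
    Integrable (fun x => f x * g x) μ := by
  haveI : ENNReal.HolderConjugate (ENNReal.ofReal p) (ENNReal.ofReal q) := hpq.ennrealOfReal
  exact hf.integrable_mul hg


end flow
end
end

section
open MeasureTheory
noncomputable section

lemma integral_rpow_le {X : Type*} [MeasurableSpace X] {μ : Measure X} {f : X → ℝ} {p a : ℝ}
    (hp : 0 < p) (ha : 0 ≤ a) (hf : MemLp f (ENNReal.ofReal p) μ)
    (h : eLpNorm f (ENNReal.ofReal p) μ ≤ ENNReal.ofReal a) : ∫ x, |f x| ^ p ∂μ ≤ a ^ p := by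
  rw [hf.eLpNorm_eq_integral_rpow_norm (by simpa using hp) ENNReal.ofReal_ne_top,
    ENNReal.toReal_ofReal hp.le] at h
  have h2 := (ENNReal.ofReal_le_ofReal_iff ha).1 h
  have h0 : 0 ≤ ∫ x, |f x| ^ p ∂μ := integral_nonneg fun x => by positivity
  calc ∫ x, |f x| ^ p ∂μ = ((∫ x, ‖f x‖ ^ p ∂μ) ^ p⁻¹) ^ p := by
        rw [Real.rpow_inv_rpow (by simpa using h0) hp.ne']; rfl
    _ ≤ a ^ p := Real.rpow_le_rpow (by positivity) h2 hp.le

lemma memLp_integrable_rpow {X : Type*} [MeasurableSpace X] {μ : Measure X} {f : X → ℝ} {p : ℝ}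
    (hp : 0 < p) (hf : MemLp f (ENNReal.ofReal p) μ) : Integrable (fun x => |f x| ^ p) μ := by
  have := hf.integrable_norm_rpow (by simpa using hp) ENNReal.ofReal_ne_top
  rwa [ENNReal.toReal_ofReal hp.le] at this

section flow
variable {G : Type*} [AddCommGroup G] {ι : Type*} [Fintype ι]
variable [MeasurableSpace G] [MeasurableAdd G] {μ : Measure G} [μ.IsAddRightInvariant]

lemma int_add_right (f : G → ℝ) (v : G) : ∫ z, f (z + v) ∂μ = ∫ z, f z ∂μ :=
  integral_add_right_eq_self f v
lemma int_sub_right (f : G → ℝ) (v : G) : ∫ z, f (z - v) ∂μ = ∫ z, f z ∂μ := by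
  simpa [sub_eq_add_neg] using integral_add_right_eq_self f (-v)

lemma integrable_add_right' {f : G → ℝ} (hf : Integrable f μ) (v : G) :
    Integrable (fun z => f (z + v)) μ := (mp_add v).integrable_comp_of_integrable hf
lemma integrable_sub_right' {f : G → ℝ} (hf : Integrable f μ) (v : G) :
    Integrable (fun z => f (z - v)) μ := (mp_sub v).integrable_comp_of_integrable hf

lemma integral_avg [Nonempty ι] (w : ι → G) {f : G → ℝ} (hf : Integrable f μ) :
    ∫ z, avg w f z ∂μ = ∫ z, f z ∂μ := by
  have hN : (0:ℝ) < Fintype.card ι := by exact_mod_cast Fintype.card_pos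
  simp only [avg]
  rw [integral_finsetSum _ fun i _ => by
    exact ((integrable_add_right' hf (w i)).add (integrable_sub_right' hf (w i))).const_mul _]
  have : ∀ i : ι, ∫ z, (2 * (Fintype.card ι : ℝ))⁻¹ * (f (z + w i) + f (z - w i)) ∂μ =
      (Fintype.card ι : ℝ)⁻¹ * ∫ z, f z ∂μ := fun i => by
    rw [integral_const_mul, integral_add (integrable_add_right' hf (w i))
      (integrable_sub_right' hf (w i)), int_add_right, int_sub_right, mul_inv]; ring
  simp only [this]
  simp

lemma integral_mul_dif {p q : ℝ} (hpq : p.HolderConjugate q) {f g : G → ℝ}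
    (hf : MemLp f (ENNReal.ofReal p) μ) (hg : MemLp g (ENNReal.ofReal q) μ) (v : G) :
    ∫ z, dif v f z * g z ∂μ = - ∫ z, f z * dif v g z ∂μ := by
  have i1 := integrable_mul_conj hpq (hf.comp_measurePreserving (mp_add v)) hg
  have i2 := integrable_mul_conj hpq (hf.comp_measurePreserving (mp_sub v)) hg
  have i3 := integrable_mul_conj hpq hf (hg.comp_measurePreserving (mp_add v))
  have i4 := integrable_mul_conj hpq hf (hg.comp_measurePreserving (mp_sub v))
  simp only [Function.comp_def] at i1 i2 i3 i4
  simp only [dif, sub_mul, mul_sub]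
  rw [integral_sub i1 i2, integral_sub i3 i4, ← int_sub_right (fun z => f (z + v) * g z) v,
    ← int_add_right (fun z => f (z - v) * g z) v]
  simp

lemma integral_mul_avg {p q : ℝ} (hpq : p.HolderConjugate q) {f g : G → ℝ}
    (hf : MemLp f (ENNReal.ofReal p) μ) (hg : MemLp g (ENNReal.ofReal q) μ) (w : ι → G) :
    ∫ z, avg w f z * g z ∂μ = ∫ z, f z * avg w g z ∂μ := by
  have i1 := fun v => integrable_mul_conj hpq (hf.comp_measurePreserving (mp_add v)) hg
  have i2 := fun v => integrable_mul_conj hpq (hf.comp_measurePreserving (mp_sub v)) hg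
  have i3 := fun v => integrable_mul_conj hpq hf (hg.comp_measurePreserving (mp_add v))
  have i4 := fun v => integrable_mul_conj hpq hf (hg.comp_measurePreserving (mp_sub v))
  simp only [Function.comp_def] at i1 i2 i3 i4
  simp only [avg, Finset.sum_mul, Finset.mul_sum]
  have e1 : ∀ i z, (2 * (Fintype.card ι : ℝ))⁻¹ * (f (z + w i) + f (z - w i)) * g z =
    (2 * (Fintype.card ι : ℝ))⁻¹ * (f (z + w i) * g z + f (z - w i) * g z) := fun i z => by ring
  have e2 : ∀ i z, f z * ((2 * (Fintype.card ι : ℝ))⁻¹ * (g (z + w i) + g (z - w i))) =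
    (2 * (Fintype.card ι : ℝ))⁻¹ * (f z * g (z + w i) + f z * g (z - w i)) := fun i z => by ring
  simp only [e1, e2]
  rw [integral_finsetSum _ fun i _ => by exact ((i1 (w i)).add (i2 (w i))).const_mul _,
    integral_finsetSum _ fun i _ => by exact ((i3 (w i)).add (i4 (w i))).const_mul _]
  refine Finset.sum_congr rfl fun i _ => ?_
  rw [integral_const_mul, integral_const_mul, integral_add (i1 _) (i2 _), integral_add (i3 _) (i4 _),
    ← int_sub_right (fun z => f (z + w i) * g z) (w i),
    ← int_add_right (fun z => f (z - w i) * g z) (w i)]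
  simp only [sub_add_cancel, add_sub_cancel_right]
  ring

lemma flow_bound [Nonempty ι] {p q : ℝ} (hpq : p.HolderConjugate q) :
    ∃ C : ℝ, 0 < C ∧ ∀ (f g : G → ℝ) (w : ι → G) (k : ι) (a b : ℝ), 0 < a → 0 < b →
      MemLp f (ENNReal.ofReal p) μ → MemLp g (ENNReal.ofReal q) μ →
      eLpNorm f (ENNReal.ofReal p) μ ≤ ENNReal.ofReal a →
      eLpNorm g (ENNReal.ofReal q) μ ≤ ENNReal.ofReal b →
      ∀ K : ℕ, ∑ n ∈ Finset.range K,
        ∫ z, |dif (w k) ((avg w)^[n] f) z * dif (w k) ((avg w)^[n] g) z| ∂μ ≤ C * a * b := by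
  have hN : (0:ℝ) < Fintype.card ι := by exact_mod_cast Fintype.card_pos
  have hp := hpq.pos
  have hq := hpq.symm.pos
  obtain ⟨B, C, hC, hBc, hB0, hBle, hBm⟩ := exists_bellman hpq
  -- unscaled version
  have key : ∀ (f g : G → ℝ) (w : ι → G) (k : ι), MemLp f (ENNReal.ofReal p) μ →
      MemLp g (ENNReal.ofReal q) μ → ∀ K : ℕ, ∑ n ∈ Finset.range K,
        ∫ z, |dif (w k) ((avg w)^[n] f) z * dif (w k) ((avg w)^[n] g) z| ∂μ ≤
        4 * Fintype.card ι * (C * (∫ z, |f z| ^ p ∂μ + ∫ z, |g z| ^ q ∂μ)) := by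
    intro f g w k hf hg K
    have hintg : ∀ f g : G → ℝ, MemLp f (ENNReal.ofReal p) μ → MemLp g (ENNReal.ofReal q) μ →
        Integrable (fun z => B (f z) (g z)) μ := fun f g hf hg => by
      refine Integrable.mono' (((memLp_integrable_rpow hp hf).add
        (memLp_integrable_rpow hq hg)).const_mul C) ?_ ?_
      · exact hBc.comp_aestronglyMeasurable (hf.1.prodMk hg.1)
      · refine Filter.Eventually.of_forall fun z => ?_
        rw [Real.norm_of_nonneg (hB0 _ _)]
        exact hBle _ _
    have step : ∀ f g : G → ℝ, MemLp f (ENNReal.ofReal p) μ → MemLp g (ENNReal.ofReal q) μ →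
        ∫ z, B (avg w f z) (avg w g z) ∂μ + (4 * (Fintype.card ι : ℝ))⁻¹ *
          ∫ z, |dif (w k) f z * dif (w k) g z| ∂μ ≤ ∫ z, B (f z) (g z) ∂μ := fun f g hf hg => by
      have i1 := hintg _ _ (avg_memLp hf w) (avg_memLp hg w)
      have i2 := (integrable_mul_conj hpq (dif_memLp hf (w k)) (dif_memLp hg (w k))).abs
      rw [← integral_avg w (hintg f g hf hg), ← integral_const_mul,
        ← integral_add i1 (i2.const_mul _)]
      refine integral_mono (i1.add (i2.const_mul _)) ?_ fun z => bellman_avg w hBc hBm f g z k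
      have := memLp_one_iff_integrable.2 (hintg f g hf hg)
      exact memLp_one_iff_integrable.1 (avg_memLp this w)
    have tel : ∀ K : ℕ, ∫ z, B ((avg w)^[K] f z) ((avg w)^[K] g z) ∂μ +
        (4 * (Fintype.card ι : ℝ))⁻¹ * ∑ n ∈ Finset.range K,
        ∫ z, |dif (w k) ((avg w)^[n] f) z * dif (w k) ((avg w)^[n] g) z| ∂μ ≤
        ∫ z, B (f z) (g z) ∂μ := by
      intro K
      induction K with
      | zero => simp
      | succ K ih =>
        have := step _ _ (iter_memLp hf w K) (iter_memLp hg w K)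
        rw [Finset.sum_range_succ, Function.iterate_succ_apply', Function.iterate_succ_apply']
        linarith
    have h1 := tel K
    have h2 : 0 ≤ ∫ z, B ((avg w)^[K] f z) ((avg w)^[K] g z) ∂μ :=
      integral_nonneg fun z => hB0 _ _
    have h3 : ∫ z, B (f z) (g z) ∂μ ≤ C * (∫ z, |f z| ^ p ∂μ + ∫ z, |g z| ^ q ∂μ) := by
      rw [← integral_add (memLp_integrable_rpow hp hf) (memLp_integrable_rpow hq hg),
        ← integral_const_mul]
      exact integral_mono (hintg f g hf hg) (((memLp_integrable_rpow hp hf).add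
        (memLp_integrable_rpow hq hg)).const_mul C) fun z => hBle _ _
    have h4 : (4 * (Fintype.card ι : ℝ))⁻¹ * ∑ n ∈ Finset.range K,
        ∫ z, |dif (w k) ((avg w)^[n] f) z * dif (w k) ((avg w)^[n] g) z| ∂μ ≤
        C * (∫ z, |f z| ^ p ∂μ + ∫ z, |g z| ^ q ∂μ) := by linarith
    rwa [inv_mul_le_iff₀ (by positivity)] at h4
  refine ⟨4 * Fintype.card ι * (C * 2), by positivity, ?_⟩
  intro f g w k a b ha hb hf hg hfa hgb K
  have h := key (a⁻¹ • f) (b⁻¹ • g) w k (hf.const_smul _) (hg.const_smul _) K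
  have e1 : ∫ z, |(a⁻¹ • f) z| ^ p ∂μ ≤ 1 := by
    have := integral_rpow_le hp ha.le hf hfa
    simp only [Pi.smul_apply, smul_eq_mul, abs_mul, abs_of_pos (inv_pos.2 ha)]
    simp only [Real.mul_rpow (inv_pos.2 ha).le (abs_nonneg _)]
    rw [integral_const_mul, Real.inv_rpow ha.le, inv_mul_le_iff₀ (by positivity)]
    linarith
  have e2 : ∫ z, |(b⁻¹ • g) z| ^ q ∂μ ≤ 1 := by
    have := integral_rpow_le hq hb.le hg hgb
    simp only [Pi.smul_apply, smul_eq_mul, abs_mul, abs_of_pos (inv_pos.2 hb)]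
    simp only [Real.mul_rpow (inv_pos.2 hb).le (abs_nonneg _)]
    rw [integral_const_mul, Real.inv_rpow hb.le, inv_mul_le_iff₀ (by positivity)]
    linarith
  have e3 : ∀ n z, |dif (w k) ((avg w)^[n] (a⁻¹ • f)) z * dif (w k) ((avg w)^[n] (b⁻¹ • g)) z| =
      (a⁻¹ * b⁻¹) * |dif (w k) ((avg w)^[n] f) z * dif (w k) ((avg w)^[n] g) z| := fun n z => by
    rw [iter_smul, iter_smul, dif_smul, dif_smul]
    simp only [Pi.smul_apply, smul_eq_mul]
    have e4 : a⁻¹ * b⁻¹ = |a⁻¹ * b⁻¹| := (abs_of_pos (by positivity)).symm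
    rw [e4, ← abs_mul]
    congr 1; ring
  simp only [e3, integral_const_mul] at h
  rw [← Finset.mul_sum, ← mul_inv, inv_mul_le_iff₀ (by positivity)] at h
  refine h.trans ?_
  have : C * (∫ z, |(a⁻¹ • f) z| ^ p ∂μ + ∫ z, |(b⁻¹ • g) z| ^ q ∂μ) ≤ C * 2 := by
    gcongr; linarith
  calc a * b * (4 * Fintype.card ι * (C * (∫ z, |(a⁻¹ • f) z| ^ p ∂μ + ∫ z, |(b⁻¹ • g) z| ^ q ∂μ)))
      ≤ a * b * (4 * Fintype.card ι * (C * 2)) := by gcongr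
    _ = _ := by ring

/-- the bilinear form -/
def Lam (μ : Measure G) (w : ι → G) (k : ι) (f g : G → ℝ) : ℝ :=
  ∑' n : ℕ, ∫ z, dif (w k) ((avg w)^[n] f) z * dif (w k) ((avg w)^[n] g) z ∂μ

lemma Lam_summable [Nonempty ι] {p q : ℝ} (hpq : p.HolderConjugate q) {f g : G → ℝ} (w : ι → G)
    (k : ι) (hf : MemLp f (ENNReal.ofReal p) μ) (hg : MemLp g (ENNReal.ofReal q) μ) :
    Summable fun n : ℕ => ∫ z, dif (w k) ((avg w)^[n] f) z * dif (w k) ((avg w)^[n] g) z ∂μ := by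
  obtain ⟨C, hC, h⟩ := flow_bound (ι := ι) (μ := μ) hpq
  have h1 : Summable fun n : ℕ =>
      ∫ z, |dif (w k) ((avg w)^[n] f) z * dif (w k) ((avg w)^[n] g) z| ∂μ :=
    summable_of_sum_range_le (fun n => integral_nonneg fun z => abs_nonneg _)
      (h f g w k ((eLpNorm f (ENNReal.ofReal p) μ).toReal + 1)
        ((eLpNorm g (ENNReal.ofReal q) μ).toReal + 1) (by positivity) (by positivity) hf hg
        (by rw [← ENNReal.ofReal_toReal hf.2.ne]; apply ENNReal.ofReal_le_ofReal; simp)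
        (by rw [← ENNReal.ofReal_toReal hg.2.ne]; apply ENNReal.ofReal_le_ofReal; simp))
  refine Summable.of_norm_bounded h1 fun n => ?_
  exact norm_integral_le_integral_norm _

lemma Lam_bound [Nonempty ι] {p q : ℝ} (hpq : p.HolderConjugate q) :
    ∃ C : ℝ, 0 < C ∧ ∀ (f g : G → ℝ) (w : ι → G) (k : ι) (a b : ℝ), 0 < a → 0 < b →
      MemLp f (ENNReal.ofReal p) μ → MemLp g (ENNReal.ofReal q) μ →
      eLpNorm f (ENNReal.ofReal p) μ ≤ ENNReal.ofReal a →
      eLpNorm g (ENNReal.ofReal q) μ ≤ ENNReal.ofReal b → |Lam μ w k f g| ≤ C * a * b := by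
  obtain ⟨C, hC, h⟩ := flow_bound (ι := ι) (μ := μ) hpq
  refine ⟨C, hC, fun f g w k a b ha hb hf hg hfa hgb => ?_⟩
  have h0 := h f g w k a b ha hb hf hg hfa hgb
  have h1 : Summable fun n : ℕ =>
      ∫ z, |dif (w k) ((avg w)^[n] f) z * dif (w k) ((avg w)^[n] g) z| ∂μ :=
    summable_of_sum_range_le (fun n => integral_nonneg fun z => abs_nonneg _) h0
  have h2 := tsum_of_norm_bounded h1.hasSum
    (f := fun n : ℕ => ∫ z, dif (w k) ((avg w)^[n] f) z * dif (w k) ((avg w)^[n] g) z ∂μ)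
    fun n => norm_integral_le_integral_norm _
  exact h2.trans (Real.tsum_le_of_sum_range_le (fun n => integral_nonneg fun z => abs_nonneg _) h0)

lemma Lam_add [Nonempty ι] {p q : ℝ} (hpq : p.HolderConjugate q) {f g g' : G → ℝ} (w : ι → G)
    (k : ι) (hf : MemLp f (ENNReal.ofReal p) μ) (hg : MemLp g (ENNReal.ofReal q) μ)
    (hg' : MemLp g' (ENNReal.ofReal q) μ) :
    Lam μ w k f (g + g') = Lam μ w k f g + Lam μ w k f g' := by
  unfold Lam
  rw [← (Lam_summable hpq w k hf hg).tsum_add (Lam_summable hpq w k hf hg')]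
  congr 1; funext n
  rw [← integral_add (integrable_mul_conj hpq (dif_memLp (iter_memLp hf w n) _)
    (dif_memLp (iter_memLp hg w n) _)) (integrable_mul_conj hpq (dif_memLp (iter_memLp hf w n) _)
    (dif_memLp (iter_memLp hg' w n) _)), iter_add, dif_add]
  congr 1; funext z; simp only [Pi.add_apply]; ring

lemma Lam_smul {f g : G → ℝ} (w : ι → G) (k : ι) (c : ℝ) :
    Lam μ w k f (c • g) = c * Lam μ w k f g := by
  unfold Lam
  rw [← tsum_mul_left]
  congr 1; funext n
  rw [← integral_const_mul, iter_smul, dif_smul]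
  congr 1; funext z; simp only [Pi.smul_apply, smul_eq_mul]; ring

lemma Lam_identity [Nonempty ι] {p q : ℝ} (hpq : p.HolderConjugate q) {f g : G → ℝ} (w : ι → G)
    (k : ι) (hf : MemLp f (ENNReal.ofReal p) μ) (hg : MemLp g (ENNReal.ofReal q) μ) :
    Lam μ w k f (g - avg w (avg w g)) = - ∫ z, f z * dif (w k) (dif (w k) g) z ∂μ := by
  set a : ℕ → ℝ := fun n =>
    ∫ z, dif (w k) ((avg w)^[n] f) z * dif (w k) ((avg w)^[n] g) z ∂μ with ha
  have hs := Lam_summable hpq w k hf hg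
  have h1 : ∀ n, ∫ z, dif (w k) ((avg w)^[n] f) z *
      dif (w k) ((avg w)^[n] (g - avg w (avg w g))) z ∂μ = a n - a (n + 1) := fun n => by
    have hfn := dif_memLp (iter_memLp hf w n) (w k)
    have hgn := dif_memLp (iter_memLp hg w n) (w k)
    have hgn2 := dif_memLp (iter_memLp (avg_memLp (avg_memLp hg w) w) w n) (w k)
    rw [iter_sub, dif_sub]
    simp only [Pi.sub_apply, mul_sub]
    rw [integral_sub (integrable_mul_conj hpq hfn hgn) (integrable_mul_conj hpq hfn hgn2)]
    congr 1
    simp only [ha]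
    have e1 : dif (w k) ((avg w)^[n + 1] f) = avg w (dif (w k) ((avg w)^[n] f)) := by
      rw [Function.iterate_succ_apply', dif_avg]
    have e2 : dif (w k) ((avg w)^[n + 1] g) = dif (w k) ((avg w)^[n] (avg w g)) := by
      rw [Function.iterate_succ_apply]
    have e3 : dif (w k) ((avg w)^[n] (avg w (avg w g))) =
        avg w (dif (w k) ((avg w)^[n] (avg w g))) := by
      rw [← dif_avg]; congr 1
      rw [← Function.iterate_succ_apply, ← Function.iterate_succ_apply' (avg w)]
    rw [e1, e2, e3, integral_mul_avg hpq hfn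
      (dif_memLp (iter_memLp (avg_memLp hg w) w n) (w k))]
  have h2 : Filter.Tendsto a Filter.atTop (nhds 0) := hs.tendsto_atTop_zero
  have h3 : HasSum (fun n => a n - a (n + 1)) (a 0) := by
    have hsum : Summable fun n => a n - a (n + 1) :=
      hs.sub ((summable_nat_add_iff 1).2 hs)
    rw [hsum.hasSum_iff_tendsto_nat]
    have : ∀ K, ∑ n ∈ Finset.range K, (a n - a (n + 1)) = a 0 - a K := fun K => by
      rw [Finset.sum_range_sub']
    simp only [this]
    simpa using h2.const_sub (a 0)
  unfold Lam
  simp only [h1]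
  rw [h3.tsum_eq]
  simp only [ha, Function.iterate_zero, id]
  rw [integral_mul_dif hpq hf (dif_memLp hg (w k))]

end flow
end
end

section
open MeasureTheory
noncomputable section

/-! ### Basic calculus of test functions -/

section basic
variable {F : Type*} [NormedAddCommGroup F] [NormedSpace ℝ F]

/-- directional derivative -/
def dd (v : F) (f : F → ℝ) : F → ℝ := fun x => fderiv ℝ f x v

/-- smooth functions with compact support in `Ω` -/
structure Tst (Ω : Set F) (f : F → ℝ) : Prop where
  cd : ContDiff ℝ (⊤ : ℕ∞) f
  cs : HasCompactSupport f
  ts : tsupport f ⊆ Ω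

lemma dd_contDiff {f : F → ℝ} (hf : ContDiff ℝ (⊤ : ℕ∞) f) (v : F) :
    ContDiff ℝ (⊤ : ℕ∞) (dd v f) := by
  have : ContDiff ℝ (⊤ : ℕ∞) (fderiv ℝ f) := hf.fderiv_right (by norm_cast)
  exact this.clm_apply contDiff_const

lemma cdiff {f : F → ℝ} (hf : ContDiff ℝ (⊤ : ℕ∞) f) : Differentiable ℝ f :=
  hf.differentiable (by simp)

lemma dd_ts {f : F → ℝ} (v : F) : tsupport (dd v f) ⊆ tsupport f :=
  tsupport_fderiv_apply_subset ℝ v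

lemma dd_cs {f : F → ℝ} (hf : HasCompactSupport f) (v : F) : HasCompactSupport (dd v f) :=
  hf.of_isClosed_subset (isClosed_tsupport _) (dd_ts v)

lemma Tst.diff {Ω : Set F} {f : F → ℝ} (hf : Tst Ω f) : Differentiable ℝ f := cdiff hf.cd
lemma Tst.cont {Ω : Set F} {f : F → ℝ} (hf : Tst Ω f) : Continuous f := hf.cd.continuous

lemma Tst.dd {Ω : Set F} {f : F → ℝ} (hf : Tst Ω f) (v : F) : Tst Ω (dd v f) :=
  ⟨dd_contDiff hf.cd v, dd_cs hf.cs v, (dd_ts v).trans hf.ts⟩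

lemma Tst.mono {Ω Ω' : Set F} {f : F → ℝ} (hf : Tst Ω f) (h : Ω ⊆ Ω') : Tst Ω' f :=
  ⟨hf.cd, hf.cs, hf.ts.trans h⟩

lemma Tst.zero {Ω : Set F} : Tst Ω (fun _ : F => (0:ℝ)) :=
  ⟨contDiff_const, HasCompactSupport.zero, by simp [tsupport]⟩

lemma Tst.add {Ω : Set F} {f g : F → ℝ} (hf : Tst Ω f) (hg : Tst Ω g) :
    Tst Ω (fun x => f x + g x) :=
  ⟨hf.cd.add hg.cd, hf.cs.add hg.cs,
    (tsupport_add f g).trans (Set.union_subset hf.ts hg.ts)⟩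

lemma Tst.mul_left {Ω : Set F} {f g : F → ℝ} (hf : ContDiff ℝ (⊤ : ℕ∞) f) (hg : Tst Ω g) :
    Tst Ω (fun x => f x * g x) :=
  ⟨hf.mul hg.cd, hg.cs.mul_left, (tsupport_mul_subset_right).trans hg.ts⟩

lemma Tst.const_mul {Ω : Set F} {g : F → ℝ} (c : ℝ) (hg : Tst Ω g) :
    Tst Ω (fun x => c * g x) := Tst.mul_left (f := fun _ => c) contDiff_const hg

lemma Tst.neg {Ω : Set F} {g : F → ℝ} (hg : Tst Ω g) : Tst Ω (fun x => - g x) := by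
  simpa using hg.const_mul (-1)

lemma Tst.sub {Ω : Set F} {f g : F → ℝ} (hf : Tst Ω f) (hg : Tst Ω g) :
    Tst Ω (fun x => f x - g x) := by simpa [sub_eq_add_neg] using hf.add hg.neg

lemma Tst.sum {Ω : Set F} {α : Type*} (s : Finset α) {f : α → F → ℝ} (hf : ∀ a ∈ s, Tst Ω (f a)) :
    Tst Ω (fun x => ∑ a ∈ s, f a x) := by
  classical
  induction s using Finset.induction_on with
  | empty => simpa using Tst.zero
  | insert a s ha ih =>
    simp only [Finset.sum_insert ha]
    exact (hf a (by simp)).add (ih fun b hb => hf b (by simp [hb]))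

lemma Tst.of_support {Ω K : Set F} {f : F → ℝ} (hf : ContDiff ℝ (⊤ : ℕ∞) f) (hK : IsCompact K)
    (hKΩ : K ⊆ Ω) (h : ∀ x, x ∉ K → f x = 0) : Tst Ω f := by
  have hs : Function.support f ⊆ K := fun x hx => by
    by_contra hn; exact hx (h x hn)
  have ht : tsupport f ⊆ K := closure_minimal hs hK.isClosed
  exact ⟨hf, hK.of_isClosed_subset (isClosed_tsupport _) ht, ht.trans hKΩ⟩

lemma Tst.eq_zero {Ω : Set F} {f : F → ℝ} (hf : Tst Ω f) {x : F} (hx : x ∉ Ω) : f x = 0 := by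
  by_contra h
  exact hx (hf.ts (subset_tsupport f h))

lemma Tst.bounded {Ω : Set F} {f : F → ℝ} (hf : Tst Ω f) : ∃ C, 0 < C ∧ ∀ x, |f x| ≤ C := by
  obtain ⟨C, hC⟩ := hf.cs.exists_bound_of_continuous hf.cont
  exact ⟨max C 1, by positivity, fun x => (hC x).trans (le_max_left _ _)⟩

lemma Tst.unif {Ω : Set F} {f : F → ℝ} (hf : Tst Ω f) : UniformContinuous f :=
  hf.cs.uniformContinuous_of_continuous hf.cont

lemma dd_add {f g : F → ℝ} (hf : Differentiable ℝ f) (hg : Differentiable ℝ g) (v x : F) :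
    dd v (fun x => f x + g x) x = dd v f x + dd v g x := by
  simp only [dd]; rw [fderiv_fun_add hf.differentiableAt hg.differentiableAt]; rfl
lemma dd_sub {f g : F → ℝ} (hf : Differentiable ℝ f) (hg : Differentiable ℝ g) (v x : F) :
    dd v (fun x => f x - g x) x = dd v f x - dd v g x := by
  simp only [dd]; rw [fderiv_fun_sub hf.differentiableAt hg.differentiableAt]; rfl
lemma dd_const_mul {f : F → ℝ} (hf : Differentiable ℝ f) (c : ℝ) (v x : F) :
    dd v (fun x => c * f x) x = c * dd v f x := by
  simp only [dd]; rw [fderiv_const_mul hf.differentiableAt]; rfl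
lemma dd_mul {f g : F → ℝ} (hf : Differentiable ℝ f) (hg : Differentiable ℝ g) (v x : F) :
    dd v (fun x => f x * g x) x = f x * dd v g x + g x * dd v f x := by
  simp only [dd]; rw [fderiv_fun_mul hf.differentiableAt hg.differentiableAt]; simp
lemma dd_sum {α : Type*} (s : Finset α) {f : α → F → ℝ} (hf : ∀ a ∈ s, Differentiable ℝ (f a))
    (v x : F) : dd v (fun x => ∑ a ∈ s, f a x) x = ∑ a ∈ s, dd v (f a) x := by
  simp only [dd]
  rw [fderiv_fun_sum fun a ha => (hf a ha).differentiableAt]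
  simp
lemma dd_add_dir (f : F → ℝ) (v w x : F) : dd (v + w) f x = dd v f x + dd w f x := by simp [dd]
lemma dd_smul_dir (f : F → ℝ) (c : ℝ) (v x : F) : dd (c • v) f x = c * dd v f x := by simp [dd]

lemma dd_comm {f : F → ℝ} (hf : ContDiff ℝ (⊤ : ℕ∞) f) (v w x : F) :
    dd v (dd w f) x = dd w (dd v f) x := by
  have h2 : IsSymmSndFDerivAt ℝ f x :=
    hf.contDiffAt.isSymmSndFDerivAt (by simp; norm_cast)
  have hd : DifferentiableAt ℝ (fderiv ℝ f) x :=
    ((hf.fderiv_right (m := (⊤ : ℕ∞)) (by norm_cast)).differentiable (by simp)).differentiableAt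
  have e : ∀ v w, dd v (dd w f) x = fderiv ℝ (fderiv ℝ f) x v w := fun v w => by
    change fderiv ℝ (fun y => fderiv ℝ f y w) x v = _
    rw [fderiv_clm_apply hd (differentiableAt_const w)]
    simp
  rw [e, e, h2.eq]

lemma hasDerivAt_line {f : F → ℝ} (hf : Differentiable ℝ f) (x v : F) (t : ℝ) :
    HasDerivAt (fun t : ℝ => f (x + t • v)) (dd v f (x + t • v)) t := by
  have h1 : HasDerivAt (fun t : ℝ => x + t • v) v t := by
    simpa using ((hasDerivAt_id t).smul_const v).const_add x
  exact (hf (x + t • v)).hasFDerivAt.comp_hasDerivAt t h1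

lemma second_diff {f : F → ℝ} (hf : Tst Set.univ f) (v : F) {ε : ℝ} (hε : 0 < ε) :
    ∃ δ > 0, ∀ h, 0 < h → h < δ → ∀ x,
      |f (x + h • v) + f (x - h • v) - 2 * f x - h ^ 2 * dd v (dd v f) x| ≤ ε * h ^ 2 := by
  obtain ⟨δ, hδ, hu⟩ := Metric.uniformContinuous_iff.1 ((hf.dd v).dd v).unif (ε / 2) (by positivity)
  refine ⟨δ / (‖v‖ + 1), by positivity, fun h h0 hh x => ?_⟩
  have hbound : ∀ s : ℝ, |s| ≤ h → |dd v (dd v f) (x + s • v) - dd v (dd v f) x| ≤ ε / 2 := by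
    intro s hs
    refine (hu (a := x + s • v) (b := x) ?_).le
    rw [dist_eq_norm, add_sub_cancel_left, norm_smul, Real.norm_eq_abs]
    rw [lt_div_iff₀ (by positivity)] at hh
    have : |s| * ‖v‖ ≤ h * ‖v‖ := by gcongr
    nlinarith
  set c := dd v (dd v f) x with hc
  have hneg : ∀ t : ℝ, ∀ g : F → ℝ, Differentiable ℝ g →
      HasDerivAt (fun t : ℝ => g (x + (-t) • v)) (-(dd v g (x + (-t) • v))) t := fun t g hg => by
    have := (hasDerivAt_line hg x v (-t)).comp t (hasDerivAt_neg t)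
    simpa [Function.comp_def] using this
  set ψ' : ℝ → ℝ := fun t => dd v f (x + t • v) - dd v f (x + (-t) • v) - 2 * t * c with hψ'
  have d2 : ∀ t : ℝ, HasDerivAt ψ'
      (dd v (dd v f) (x + t • v) + dd v (dd v f) (x + (-t) • v) - 2 * c) t := fun t => by
    have := ((hasDerivAt_line (hf.dd v).diff x v t).sub (hneg t _ (hf.dd v).diff)).sub
      (((hasDerivAt_id t).const_mul 2).mul_const c)
    refine this.congr_deriv ?_
    ring
  set ψ : ℝ → ℝ := fun t => f (x + t • v) + f (x + (-t) • v) - t ^ 2 * c with hψ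
  have d1 : ∀ t : ℝ, HasDerivAt ψ (ψ' t) t := fun t => by
    have := ((hasDerivAt_line hf.diff x v t).add (hneg t _ hf.diff)).sub
      (((hasDerivAt_id t).pow 2).mul_const c)
    refine this.congr_deriv ?_
    simp [hψ']; ring
  have b1 : ∀ t ∈ Set.Icc 0 h, |ψ' t| ≤ ε * h := by
    intro t ht
    have := (convex_Icc (0:ℝ) h).norm_image_sub_le_of_norm_hasDerivWithin_le (f := ψ') (C := ε)
      (fun s hs => (d2 s).hasDerivWithinAt) (fun s hs => by
        have h1 := hbound s (by rw [abs_of_nonneg hs.1]; exact hs.2)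
        have h2 := hbound (-s) (by rw [abs_neg, abs_of_nonneg hs.1]; exact hs.2)
        rw [Real.norm_eq_abs]
        rw [abs_le] at *
        constructor <;> linarith [h1.1, h1.2, h2.1, h2.2]) (Set.left_mem_Icc.2 h0.le) ht
    have e0 : ψ' 0 = 0 := by simp [hψ']
    rw [e0, sub_zero, sub_zero, Real.norm_eq_abs, Real.norm_eq_abs, abs_of_nonneg ht.1] at this
    exact this.trans (by have := ht.2; gcongr)
  have := (convex_Icc (0:ℝ) h).norm_image_sub_le_of_norm_hasDerivWithin_le (f := ψ) (C := ε * h)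
      (fun s hs => (d1 s).hasDerivWithinAt) b1 (Set.left_mem_Icc.2 h0.le)
      (Set.right_mem_Icc.2 h0.le)
  simp only [hψ, sub_zero, Real.norm_eq_abs, abs_of_pos h0] at this
  have e : f (x + h • v) + f (x - h • v) - 2 * f x - h ^ 2 * c = f (x + h • v) + f (x + -h • v) -
      h ^ 2 * c - (f (x + (0:ℝ) • v) + f (x + -(0:ℝ) • v) - 0 ^ 2 * c) := by
    simp [sub_eq_add_neg]; ring
  rw [e]
  calc _ ≤ _ := this
    _ = _ := by ring

end basic

section meas
variable {d : ℕ}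

lemma Tst.integrable {Ω : Set (Euc d)} {f : Euc d → ℝ} (hf : Tst Ω f) : Integrable f :=
  hf.cont.integrable_of_hasCompactSupport hf.cs

lemma Tst.memLp {Ω : Set (Euc d)} {f : Euc d → ℝ} (hf : Tst Ω f) (p : ENNReal) (μ : Measure (Euc d))
    [IsFiniteMeasureOnCompacts μ] : MemLp f p μ :=
  hf.cont.memLp_of_hasCompactSupport hf.cs

lemma integral_mul_dd {f g : Euc d → ℝ} (hf : ContDiff ℝ (⊤ : ℕ∞) f) (hg : Tst Set.univ g)
    (v : Euc d) : ∫ x, f x * dd v g x = - ∫ x, dd v f x * g x := by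
  have h1 := (Tst.mul_left hf (hg.dd v)).integrable
  have h2 := (Tst.mul_left (dd_contDiff hf v) hg).integrable
  have h3 := (Tst.mul_left hf hg).integrable
  exact integral_mul_fderiv_eq_neg_fderiv_mul_of_integrable h2 h1 h3
    (fun x _ => (cdiff hf).differentiableAt) (fun x _ => hg.diff.differentiableAt)

lemma integral_dd {g : Euc d → ℝ} (hg : Tst Set.univ g) (v : Euc d) : ∫ x, dd v g x = 0 := by
  have := integral_mul_dd (f := fun _ => 1) contDiff_const hg v
  simpa [dd] using this

end meas
end
end

section
open MeasureTheory
noncomputable section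

/-! ### Second order differences, uniform convergence -/

section lim
variable {d : ℕ}

/-- index set of directions -/
abbrev Idx (d : ℕ) := Fin d × Fin d × Bool

/-- directions `e_i ± e_j` -/
def vec (k : Idx d) : Euc d := coordDir k.1 + (if k.2.2 then (1:ℝ) else -1) • coordDir k.2.1

/-- Laplacian -/
def lap (f : Euc d → ℝ) : Euc d → ℝ := fun x => ∑ j, dd (coordDir j) (dd (coordDir j) f) x

lemma lap_tst {Ω : Set (Euc d)} {f : Euc d → ℝ} (hf : Tst Ω f) : Tst Ω (lap f) :=
  Tst.sum _ fun j _ => (hf.dd _).dd _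

lemma dd_vec {f : Euc d → ℝ} (hf : ContDiff ℝ (⊤ : ℕ∞) f) (k : Idx d) (x : Euc d) :
    dd (vec k) (dd (vec k) f) x = dd (coordDir k.1) (dd (coordDir k.1) f) x +
      dd (coordDir k.2.1) (dd (coordDir k.2.1) f) x +
      2 * (if k.2.2 then (1:ℝ) else -1) * dd (coordDir k.1) (dd (coordDir k.2.1) f) x := by
  set s : ℝ := if k.2.2 then (1:ℝ) else -1 with hs
  have hs2 : s * s = 1 := by rw [hs]; split_ifs <;> norm_num
  have e : dd (vec k) f = fun x => dd (coordDir k.1) f x + s * dd (coordDir k.2.1) f x := by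
    funext y; rw [vec, dd_add_dir, dd_smul_dir]
  rw [e, dd_add (cdiff (dd_contDiff hf _))
    ((cdiff (dd_contDiff hf (coordDir k.2.1))).const_mul s),
    dd_const_mul (cdiff (dd_contDiff hf _)), vec, dd_add_dir, dd_smul_dir, dd_add_dir, dd_smul_dir,
    dd_comm hf (coordDir k.2.1) (coordDir k.1)]
  linear_combination (dd (coordDir k.2.1) (dd (coordDir k.2.1) f) x) * hs2

lemma sum_dd_vec {f : Euc d → ℝ} (hf : ContDiff ℝ (⊤ : ℕ∞) f) (x : Euc d) :
    ∑ k : Idx d, dd (vec k) (dd (vec k) f) x = 4 * d * lap f x := by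
  simp only [dd_vec hf]
  rw [Fintype.sum_prod_type]
  simp only [Fintype.sum_prod_type, Fintype.sum_bool]
  simp only [if_true, Bool.false_eq_true, if_false]
  have : ∀ i j : Fin d, dd (coordDir i) (dd (coordDir i) f) x +
      dd (coordDir j) (dd (coordDir j) f) x + 2 * 1 * dd (coordDir i) (dd (coordDir j) f) x +
      (dd (coordDir i) (dd (coordDir i) f) x + dd (coordDir j) (dd (coordDir j) f) x +
      2 * -1 * dd (coordDir i) (dd (coordDir j) f) x) =
      2 * dd (coordDir i) (dd (coordDir i) f) x + 2 * dd (coordDir j) (dd (coordDir j) f) x :=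
    fun i j => by ring
  simp only [this, Finset.sum_add_distrib, ← Finset.mul_sum, lap]
  simp only [Finset.sum_const, Finset.card_univ, Fintype.card_fin, nsmul_eq_mul, ← Finset.mul_sum]
  ring

/-- scaled directions -/
def wv (h : ℝ) (k : Idx d) : Euc d := h • vec k

lemma card_Idx : (Fintype.card (Idx d) : ℝ) = 2 * d ^ 2 := by
  simp [Idx]; ring

/-- uniform convergence for `ζ - M ζ` -/
lemma unif_avg1 (hd : 0 < d) {f : Euc d → ℝ} (hf : Tst Set.univ f) {ε : ℝ} (hε : 0 < ε) :
    ∃ δ > 0, ∀ h, 0 < h → h < δ → ∀ x,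
      |f x - avg (wv h) f x + (h ^ 2 / d) * lap f x| ≤ ε * h ^ 2 := by
  have hd' : (0:ℝ) < d := by exact_mod_cast hd
  haveI : Nonempty (Idx d) := ⟨(⟨0, hd⟩, ⟨0, hd⟩, true)⟩
  have hN : (0:ℝ) < Fintype.card (Idx d) := by exact_mod_cast Fintype.card_pos
  choose δ hδ h using fun k : Idx d => second_diff hf (vec k) hε
  obtain ⟨δ', hδ', hle⟩ : ∃ δ' > 0, ∀ k, δ' ≤ δ k := by
    refine ⟨Finset.univ.inf' Finset.univ_nonempty δ, ?_, fun k => Finset.inf'_le _ (Finset.mem_univ k)⟩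
    rw [gt_iff_lt, Finset.lt_inf'_iff]; exact fun k _ => hδ k
  refine ⟨δ', hδ', fun t ht0 ht x => ?_⟩
  have e : f x - avg (wv t) f x + (t ^ 2 / d) * lap f x =
      - ∑ k : Idx d, (2 * (Fintype.card (Idx d) : ℝ))⁻¹ * (f (x + t • vec k) + f (x - t • vec k)
        - 2 * f x - t ^ 2 * dd (vec k) (dd (vec k) f) x) := by
    have e1 : ∑ k : Idx d, (2 * (Fintype.card (Idx d) : ℝ))⁻¹ * (f (x + t • vec k) +
        f (x - t • vec k) - 2 * f x - t ^ 2 * dd (vec k) (dd (vec k) f) x) =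
        avg (wv t) f x - ∑ k : Idx d, (2 * (Fintype.card (Idx d) : ℝ))⁻¹ * (2 * f x)
        - (2 * (Fintype.card (Idx d) : ℝ))⁻¹ * (t ^ 2) *
          ∑ k : Idx d, dd (vec k) (dd (vec k) f) x := by
      simp only [avg, wv]
      rw [Finset.mul_sum, ← Finset.sum_sub_distrib, ← Finset.sum_sub_distrib]
      exact Finset.sum_congr rfl fun k _ => by ring
    rw [e1, sum_dd_vec hf.cd, Finset.sum_const, Finset.card_univ, nsmul_eq_mul, card_Idx]
    field_simp
    ring
  rw [e, abs_neg]
  calc _ ≤ ∑ k : Idx d, |(2 * (Fintype.card (Idx d) : ℝ))⁻¹ * (f (x + t • vec k) + f (x - t • vec k)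
        - 2 * f x - t ^ 2 * dd (vec k) (dd (vec k) f) x)| := Finset.abs_sum_le_sum_abs _ _
    _ ≤ ∑ k : Idx d, (2 * (Fintype.card (Idx d) : ℝ))⁻¹ * (ε * t ^ 2) := by
        refine Finset.sum_le_sum fun k _ => ?_
        rw [abs_mul, abs_of_pos (by positivity)]
        gcongr
        exact h k t ht0 (ht.trans_le (hle k)) x
    _ = ε * t ^ 2 / 2 := by
        rw [Finset.sum_const, Finset.card_univ, nsmul_eq_mul]; field_simp
    _ ≤ _ := by have : 0 ≤ ε * t ^ 2 := by positivity
                linarith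

lemma avg_abs_le [Nonempty (Idx d)] (w : Idx d → Euc d) {f : Euc d → ℝ} {C : ℝ}
    (hf : ∀ x, |f x| ≤ C) (x : Euc d) : |avg w f x| ≤ C := by
  have hN : (0:ℝ) < Fintype.card (Idx d) := by exact_mod_cast Fintype.card_pos
  calc |avg w f x| ≤ ∑ k : Idx d, |(2 * (Fintype.card (Idx d) : ℝ))⁻¹ * (f (x + w k) + f (x - w k))| :=
        Finset.abs_sum_le_sum_abs _ _
    _ ≤ ∑ k : Idx d, (2 * (Fintype.card (Idx d) : ℝ))⁻¹ * (2 * C) := by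
        refine Finset.sum_le_sum fun k _ => ?_
        rw [abs_mul, abs_of_pos (by positivity)]
        gcongr
        calc _ ≤ |f (x + w k)| + |f (x - w k)| := abs_add_le _ _
          _ ≤ 2 * C := by linarith [hf (x + w k), hf (x - w k)]
    _ = C := by
        rw [Finset.sum_const, Finset.card_univ, nsmul_eq_mul]; field_simp

lemma avg_sub_self_le [Nonempty (Idx d)] (w : Idx d → Euc d) {f : Euc d → ℝ} {C : ℝ} {x : Euc d}
    (hf : ∀ k, |f (x + w k) - f x| ≤ C) (hf' : ∀ k, |f (x - w k) - f x| ≤ C) :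
    |avg w f x - f x| ≤ C := by
  have hN : (0:ℝ) < Fintype.card (Idx d) := by exact_mod_cast Fintype.card_pos
  have e : avg w f x - f x = ∑ k : Idx d, (2 * (Fintype.card (Idx d) : ℝ))⁻¹ *
      ((f (x + w k) - f x) + (f (x - w k) - f x)) := by
    have : f x = ∑ k : Idx d, (2 * (Fintype.card (Idx d) : ℝ))⁻¹ * (2 * f x) := by
      rw [Finset.sum_const, Finset.card_univ, nsmul_eq_mul]; field_simp
    conv_lhs => rw [this]
    rw [avg, ← Finset.sum_sub_distrib]
    exact Finset.sum_congr rfl fun k _ => by ring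
  rw [e]
  calc _ ≤ ∑ k : Idx d, |(2 * (Fintype.card (Idx d) : ℝ))⁻¹ *
      ((f (x + w k) - f x) + (f (x - w k) - f x))| :=
        Finset.abs_sum_le_sum_abs _ _
    _ ≤ ∑ k : Idx d, (2 * (Fintype.card (Idx d) : ℝ))⁻¹ * (2 * C) := by
        refine Finset.sum_le_sum fun k _ => ?_
        rw [abs_mul, abs_of_pos (by positivity)]
        gcongr
        calc _ ≤ |f (x + w k) - f x| + |f (x - w k) - f x| := abs_add_le _ _
          _ ≤ 2 * C := by linarith [hf k, hf' k]
    _ = C := by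
        rw [Finset.sum_const, Finset.card_univ, nsmul_eq_mul]; field_simp

lemma vec_norm (k : Idx d) : ‖vec k‖ ≤ 2 := by
  unfold vec
  have h1 : ‖(coordDir k.1 : Euc d)‖ = 1 := by simp [coordDir]
  have h2 : ‖(coordDir k.2.1 : Euc d)‖ = 1 := by simp [coordDir]
  calc _ ≤ _ := norm_add_le _ _
    _ ≤ _ := by
      rw [norm_smul, h1, h2]; split_ifs <;> norm_num

lemma unif_avg2 (hd : 0 < d) {f : Euc d → ℝ} (hf : Tst Set.univ f) {ε : ℝ} (hε : 0 < ε) :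
    ∃ δ > 0, ∀ h, 0 < h → h < δ → ∀ x,
      |f x - avg (wv h) (avg (wv h) f) x + (2 * h ^ 2 / d) * lap f x| ≤ ε * h ^ 2 := by
  have hd' : (0:ℝ) < d := by exact_mod_cast hd
  haveI : Nonempty (Idx d) := ⟨(⟨0, hd⟩, ⟨0, hd⟩, true)⟩
  obtain ⟨δ1, hδ1, h1⟩ := unif_avg1 hd hf (ε := ε / 3) (by positivity)
  obtain ⟨δ2, hδ2, h2⟩ := Metric.uniformContinuous_iff.1 (lap_tst hf).unif (d * ε / 3) (by positivity)
  refine ⟨min δ1 (δ2 / 4), by positivity, fun h h0 hh x => ?_⟩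
  have hh1 : h < δ1 := hh.trans_le (min_le_left _ _)
  have hh2 : h < δ2 / 4 := hh.trans_le (min_le_right _ _)
  set w := wv (d := d) h with hw
  set F : Euc d → ℝ := fun x => f x - avg w f x + (h ^ 2 / d) * lap f x with hF
  have hFb : ∀ x, |F x| ≤ ε / 3 * h ^ 2 := fun x => h1 h h0 hh1 x
  have e : f x - avg w (avg w f) x + (2 * h ^ 2 / d) * lap f x =
      F x + avg w F x - (h ^ 2 / d) * (avg w (lap f) x - lap f x) := by
    have : F = (f - avg w f) + (h ^ 2 / d) • lap f := rfl
    rw [this, avg_add, avg_sub, avg_smul]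
    simp only [Pi.add_apply, Pi.sub_apply, Pi.smul_apply, smul_eq_mul]
    ring
  rw [e]
  have hk : ∀ k : Idx d, ‖w k‖ < δ2 := fun k => by
    rw [hw, wv, norm_smul, Real.norm_of_nonneg h0.le]
    have := vec_norm k
    nlinarith
  have b3 : |avg w (lap f) x - lap f x| ≤ d * ε / 3 := avg_sub_self_le w
    (fun k => (h2 (a := x + w k) (b := x) (by simpa [dist_eq_norm] using hk k)).le)
    (fun k => (h2 (a := x - w k) (b := x) (by simpa [dist_eq_norm] using hk k)).le)
  have b2 := avg_abs_le w hFb x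
  have b1 := hFb x
  have b4 : |(h ^ 2 / d) * (avg w (lap f) x - lap f x)| ≤ ε / 3 * h ^ 2 := by
    rw [abs_mul, abs_of_pos (by positivity)]
    calc _ ≤ h ^ 2 / d * (d * ε / 3) := by gcongr
      _ = _ := by field_simp
  rw [abs_le] at *
  constructor <;> linarith [b1.1, b1.2, b2.1, b2.2, b4.1, b4.2]

lemma unif_dif {f : Euc d → ℝ} (hf : Tst Set.univ f) (k : Idx d) {ε : ℝ} (hε : 0 < ε) :
    ∃ δ > 0, ∀ h, 0 < h → h < δ → ∀ x,
      |dif (wv h k) (dif (wv h k) f) x - (4 * h ^ 2) * dd (vec k) (dd (vec k) f) x| ≤ ε * h ^ 2 := by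
  obtain ⟨δ, hδ, h1⟩ := second_diff hf (vec k) (ε := ε / 4) (by positivity)
  refine ⟨δ / 2, by positivity, fun h h0 hh x => ?_⟩
  have := h1 (2 * h) (by positivity) (by linarith) x
  have e : dif (wv h k) (dif (wv h k) f) x = f (x + (2 * h) • vec k) + f (x - (2 * h) • vec k)
      - 2 * f x := by
    simp only [dif, wv]
    have e1 : x + h • vec k + h • vec k = x + (2 * h) • vec k := by rw [two_mul, add_smul, add_assoc]
    have e2 : x - h • vec k - h • vec k = x - (2 * h) • vec k := by rw [two_mul, add_smul, sub_sub]
    rw [e1, e2]; simp; ring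
  rw [e]
  calc _ = |f (x + (2 * h) • vec k) + f (x - (2 * h) • vec k) - 2 * f x -
      (2 * h) ^ 2 * dd (vec k) (dd (vec k) f) x| := by congr 1; ring
    _ ≤ _ := this
    _ = _ := by ring

/-- everything vanishes away from the support -/
lemma avg_supp {f : Euc d → ℝ} {R h : ℝ} (h0 : 0 ≤ h) (hf : ∀ x, R < ‖x‖ → f x = 0) :
    ∀ x, R + 2 * h < ‖x‖ → avg (wv h) f x = 0 := by
  intro x hx
  unfold avg
  refine Finset.sum_eq_zero fun k _ => ?_
  have hk : ‖wv h k‖ ≤ 2 * h := by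
    rw [wv, norm_smul, Real.norm_of_nonneg h0]; have := vec_norm k; nlinarith
  rw [hf, hf] <;> [simp; skip; skip]
  · have := norm_sub_norm_le x (wv h k); linarith
  · have := norm_sub_norm_le x (-(wv h k)); rw [norm_neg, sub_neg_eq_add] at this; linarith

lemma dif_supp {f : Euc d → ℝ} {R h : ℝ} (k : Idx d) (h0 : 0 ≤ h) (hf : ∀ x, R < ‖x‖ → f x = 0) :
    ∀ x, R + 2 * h < ‖x‖ → dif (wv h k) f x = 0 := by
  intro x hx
  unfold dif
  have hk : ‖wv h k‖ ≤ 2 * h := by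
    rw [wv, norm_smul, Real.norm_of_nonneg h0]; have := vec_norm k; nlinarith
  rw [hf, hf] <;> [simp; skip; skip]
  · have := norm_sub_norm_le x (wv h k); linarith
  · have := norm_sub_norm_le x (-(wv h k)); rw [norm_neg, sub_neg_eq_add] at this; linarith

lemma Tst.exists_radius {Ω : Set (Euc d)} {f : Euc d → ℝ} (hf : Tst Ω f) :
    ∃ R : ℝ, 0 < R ∧ ∀ x, R < ‖x‖ → f x = 0 := by
  obtain ⟨R, hR⟩ := hf.cs.isBounded.exists_norm_le
  refine ⟨max R 1, by positivity, fun x hx => ?_⟩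
  by_contra h
  have := hR x (subset_tsupport f h)
  exact absurd (this.trans (le_max_left _ _)) (not_le.2 hx)

end lim
end
end

section
open MeasureTheory
noncomputable section

section czf
variable {d : ℕ}

instance volE_inv : (volume : Measure (ℝ × Euc d)).IsAddRightInvariant := by
  rw [Measure.volume_eq_prod]; infer_instance

/-- all-exponent integrable functions -/
def AllLp {X : Type*} [MeasurableSpace X] (μ : Measure X) (g : X → ℝ) : Prop := ∀ p, MemLp g p μ

lemma AllLp.add {X : Type*} [MeasurableSpace X] {μ : Measure X} {g g' : X → ℝ}
    (h : AllLp μ g) (h' : AllLp μ g') : AllLp μ (g + g') := fun p => (h p).add (h' p)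
lemma AllLp.smul {X : Type*} [MeasurableSpace X] {μ : Measure X} {g : X → ℝ}
    (h : AllLp μ g) (c : ℝ) : AllLp μ (c • g) := fun p => (h p).const_smul c

/-- a bounded measurable function supported on a set of finite measure -/
lemma AllLp.of_bdd {X : Type*} [MeasurableSpace X] {μ : Measure X} {g : X → ℝ} {K : Set X}
    (hK : MeasurableSet K) (hμ : μ K ≠ ⊤) (hg : AEStronglyMeasurable g μ) {C : ℝ}
    (h : ∀ x, |g x| ≤ C * K.indicator (fun _ => 1) x) : AllLp μ g := by
  intro p
  have h1 : MemLp (K.indicator (fun _ => (1:ℝ))) p μ := memLp_indicator_const p hK 1 (Or.inr hμ)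
  refine (h1.const_mul C).of_le hg (Filter.Eventually.of_forall fun x => ?_)
  rw [Real.norm_eq_abs]
  exact (h x).trans (le_abs_self _)

/-- the indicator of `(0,t]` tensor `ζ` -/
def tens (t : ℝ) (ζ : Euc d → ℝ) : ℝ × Euc d → ℝ :=
  fun p => (Set.Ioc 0 t).indicator (fun _ => 1) p.1 * ζ p.2

lemma tens_abs (t : ℝ) {ζ : Euc d → ℝ} {C R : ℝ} (h : ∀ x, |ζ x| ≤ C)
    (hs : ∀ x, R < ‖x‖ → ζ x = 0) (p : ℝ × Euc d) :
    |tens t ζ p| ≤ C * (Set.Ioc 0 t ×ˢ Metric.closedBall (0 : Euc d) R).indicator (fun _ => 1) p := by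
  have hC : 0 ≤ C := (abs_nonneg _).trans (h 0)
  unfold tens
  by_cases h1 : p.1 ∈ Set.Ioc 0 t
  · by_cases h2 : p.2 ∈ Metric.closedBall (0 : Euc d) R
    · rw [Set.indicator_of_mem h1, Set.indicator_of_mem (Set.mk_mem_prod h1 h2)]
      simpa using h p.2
    · have : ζ p.2 = 0 := hs _ (by simpa using h2)
      rw [this, mul_zero, abs_zero]
      exact mul_nonneg hC (Set.indicator_nonneg (by simp) _)
  · rw [Set.indicator_of_notMem h1, zero_mul, abs_zero]
    exact mul_nonneg hC (Set.indicator_nonneg (by simp) _)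

lemma vol_box (t R : ℝ) : (volume : Measure (ℝ × Euc d))
    (Set.Ioc 0 t ×ˢ Metric.closedBall (0 : Euc d) R) ≠ ⊤ := by
  rw [Measure.volume_eq_prod, Measure.prod_prod]
  refine ENNReal.mul_ne_top (by simp) ?_
  exact (isCompact_closedBall _ _).measure_lt_top.ne

lemma meas_box (t R : ℝ) : MeasurableSet (Set.Ioc 0 t ×ˢ Metric.closedBall (0 : Euc d) R) :=
  measurableSet_Ioc.prod Metric.isClosed_closedBall.measurableSet

lemma tens_meas (t : ℝ) {ζ : Euc d → ℝ} (h : Continuous ζ) : Measurable (tens t ζ) :=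
  ((measurable_const.indicator measurableSet_Ioc).comp measurable_fst).mul
    (h.measurable.comp measurable_snd)

lemma tens_allLp (t : ℝ) {ζ : Euc d → ℝ} (hc : Continuous ζ) {C R : ℝ} (h : ∀ x, |ζ x| ≤ C)
    (hs : ∀ x, R < ‖x‖ → ζ x = 0) : AllLp volume (tens t ζ) :=
  AllLp.of_bdd (meas_box t R) (vol_box t R) (tens_meas t hc).aestronglyMeasurable (tens_abs t h hs)

lemma tens_add (t : ℝ) (ζ η : Euc d → ℝ) : tens t (ζ + η) = tens t ζ + tens t η := by
  funext p; simp [tens, mul_add]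
lemma tens_sub (t : ℝ) (ζ η : Euc d → ℝ) : tens t (ζ - η) = tens t ζ - tens t η := by
  funext p; simp [tens, mul_sub]
lemma tens_smul (t c : ℝ) (ζ : Euc d → ℝ) : tens t (c • ζ) = c • tens t ζ := by
  funext p; simp [tens]; ring

/-- spatial translations in space-time -/
def wE (h : ℝ) (k : Idx d) : ℝ × Euc d := (0, wv h k)

lemma dif_tens (h : ℝ) (k : Idx d) (t : ℝ) (ζ : Euc d → ℝ) :
    dif (wE h k) (tens t ζ) = tens t (dif (wv h k) ζ) := by
  funext p; simp [dif, tens, wE, mul_sub]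

lemma avg_tens (h : ℝ) (t : ℝ) (ζ : Euc d → ℝ) :
    avg (wE h) (tens t ζ) = tens t (avg (wv h) ζ) := by
  funext p; simp only [avg, tens, wE]; rw [Finset.mul_sum]
  exact Finset.sum_congr rfl fun i _ => by simp; ring

lemma avg_cont {w : Idx d → Euc d} {f : Euc d → ℝ} (hf : Continuous f) : Continuous (avg w f) := by
  unfold avg; fun_prop
lemma dif_cont {w : Euc d} {f : Euc d → ℝ} (hf : Continuous f) : Continuous (dif w f) := by
  unfold dif; fun_prop

/-- step size -/
def hn (n : ℕ) : ℝ := 1 / ((n:ℝ) + 1)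
lemma hn_pos (n : ℕ) : 0 < hn n := by unfold hn; positivity
lemma hn_le (n : ℕ) : hn n ≤ 1 := by
  unfold hn; rw [div_le_one (by positivity)]; have : (0:ℝ) ≤ n := by positivity
  linarith
lemma hn_lim : Filter.Tendsto hn Filter.atTop (nhds 0) := tendsto_one_div_add_atTop_nhds_zero_nat

/-- approximating functional -/
def LamN (f : ℝ × Euc d → ℝ) (k : Idx d) (g : ℝ × Euc d → ℝ) (n : ℕ) : ℝ :=
  Lam volume (wE (hn n)) k f g

lemma LamN_lim (hd : 0 < d) {q q' : ℝ} (hq : q.HolderConjugate q') {f : ℝ × Euc d → ℝ}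
    (hf : MemLp f (ENNReal.ofReal q)) (k : Idx d) (t : ℝ) {ζ : Euc d → ℝ} (hζ : Tst Set.univ ζ) :
    Filter.Tendsto (LamN f k (tens t (lap ζ))) Filter.atTop
      (nhds (2 * d * ∫ p, f p * tens t (dd (vec k) (dd (vec k) ζ)) p)) := by
  have hd' : (0:ℝ) < d := by exact_mod_cast hd
  have hne : Nonempty (Idx d) := ⟨(⟨0, hd⟩, ⟨0, hd⟩, true)⟩
  obtain ⟨C, hC, hL⟩ := Lam_bound (ι := Idx d) (μ := (volume : Measure (ℝ × Euc d))) hq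
  obtain ⟨R, hR, hsupp⟩ := hζ.exists_radius
  have hsL : ∀ x, R + 4 < ‖x‖ → lap ζ x = 0 := by
    intro x hx
    by_contra hne
    have hx2 : x ∈ tsupport ζ := by
      by_contra hn
      apply hne
      unfold lap
      refine Finset.sum_eq_zero fun j _ => ?_
      by_contra h3
      exact hn (dd_ts _ (dd_ts _ (subset_tsupport _ h3)))
    have : tsupport ζ ⊆ Metric.closedBall 0 R := by
      refine closure_minimal (fun y hy => ?_) Metric.isClosed_closedBall
      by_contra hn
      exact hy (hsupp y (by simpa using hn))
    have := this hx2
    simp at this; linarith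
  have hsD : ∀ x, R + 4 < ‖x‖ → dd (vec k) (dd (vec k) ζ) x = 0 := by
    intro x hx
    by_contra hne
    have hx2 : x ∈ tsupport ζ := dd_ts _ (dd_ts _ (subset_tsupport _ hne))
    have : tsupport ζ ⊆ Metric.closedBall 0 R := by
      refine closure_minimal (fun y hy => ?_) Metric.isClosed_closedBall
      by_contra hn
      exact hy (hsupp y (by simpa using hn))
    have := this hx2
    simp at this; linarith
  set K := Set.Ioc 0 t ×ˢ Metric.closedBall (0 : Euc d) (R + 4) with hK
  have hKm : MeasurableSet K := meas_box t (R + 4)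
  have hKv := vol_box (d := d) t (R + 4)
  set χ : ℝ × Euc d → ℝ := K.indicator (fun _ => 1) with hχ
  have hχL : MemLp χ (ENNReal.ofReal q') := memLp_indicator_const _ hKm 1 (Or.inr hKv)
  set B : ℝ := (eLpNorm χ (ENNReal.ofReal q') volume).toReal + 1 with hB
  have hB0 : 0 < B := by positivity
  have hχB : eLpNorm χ (ENNReal.ofReal q') volume ≤ ENNReal.ofReal B := by
    rw [← ENNReal.ofReal_toReal hχL.eLpNorm_ne_top]; exact ENNReal.ofReal_le_ofReal (by rw [hB]; linarith)
  set A : ℝ := (eLpNorm f (ENNReal.ofReal q) volume).toReal + 1 with hA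
  have hA0 : 0 < A := by positivity
  have hfA : eLpNorm f (ENNReal.ofReal q) volume ≤ ENNReal.ofReal A := by
    rw [← ENNReal.ofReal_toReal hf.eLpNorm_ne_top]; exact ENNReal.ofReal_le_ofReal (by rw [hA]; linarith)
  have hintg : Integrable (fun p => |f p| * χ p) := by
    simpa using integrable_mul_conj hq hf.norm hχL
  set D : ℝ := ∫ p, |f p| * χ p with hD
  have hχ0 : ∀ p, 0 ≤ χ p := fun p => Set.indicator_nonneg (by simp) _
  have hD0 : 0 ≤ D := integral_nonneg fun p => mul_nonneg (abs_nonneg _) (hχ0 p)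
  have hlapC := (lap_tst hζ).cont
  have hddC := ((hζ.dd (vec k)).dd (vec k)).cont
  rw [Metric.tendsto_atTop]
  intro ε hε
  obtain ⟨δ, hδ, hδε⟩ : ∃ δ > 0, d / 2 * (C * A * (δ * B) + δ * D) < ε := by
    refine ⟨ε / (d / 2 * (C * A * B + D + 1)), by positivity, ?_⟩
    have h1 : (0:ℝ) < d / 2 * (C * A * B + D + 1) := by positivity
    rw [show (d:ℝ) / 2 * (C * A * (ε / (d / 2 * (C * A * B + D + 1)) * B) +
      ε / (d / 2 * (C * A * B + D + 1)) * D) = ε * ((d / 2 * (C * A * B + D)) /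
      (d / 2 * (C * A * B + D + 1))) by ring]
    have : (d / 2 * (C * A * B + D)) / (d / 2 * (C * A * B + D + 1)) < 1 := by
      rw [div_lt_one h1]; nlinarith
    nlinarith
  obtain ⟨δ1, hδ1, h1⟩ := unif_avg2 hd hζ hδ
  obtain ⟨δ2, hδ2, h2⟩ := unif_dif hζ k hδ
  obtain ⟨N, hN⟩ := (Metric.tendsto_atTop.1 hn_lim) (min δ1 δ2) (by positivity)
  refine ⟨N, fun n hn' => ?_⟩
  have hh := hn_pos n
  have hh1 := hn_le n
  have hlt : hn n < min δ1 δ2 := by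
    have := hN n hn'; rwa [Real.dist_eq, sub_zero, abs_of_pos hh] at this
  set h := hn n with hhdef
  -- error functions
  set e1 : Euc d → ℝ := (h ^ 2)⁻¹ • (ζ - avg (wv h) (avg (wv h) ζ)) + (2 / (d:ℝ)) • lap ζ with he1
  set e2 : Euc d → ℝ := (h ^ 2)⁻¹ • (dif (wv h k) (dif (wv h k) ζ)) -
    (4:ℝ) • dd (vec k) (dd (vec k) ζ) with he2
  have be1 : ∀ x, |e1 x| ≤ δ := by
    intro x
    have := h1 h hh (hlt.trans_le (min_le_left _ _)) x
    have e : e1 x = (h ^ 2)⁻¹ * (ζ x - avg (wv h) (avg (wv h) ζ) x + (2 * h ^ 2 / d) * lap ζ x) := by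
      simp [he1]; field_simp
    rw [e, abs_mul, abs_of_pos (by positivity), inv_mul_le_iff₀ (by positivity)]; linarith
  have be2 : ∀ x, |e2 x| ≤ δ := by
    intro x
    have := h2 h hh (hlt.trans_le (min_le_right _ _)) x
    have e : e2 x = (h ^ 2)⁻¹ * (dif (wv h k) (dif (wv h k) ζ) x -
        (4 * h ^ 2) * dd (vec k) (dd (vec k) ζ) x) := by
      simp [he2]; field_simp
    rw [e, abs_mul, abs_of_pos (by positivity), inv_mul_le_iff₀ (by positivity)]; linarith
  have se1 : ∀ x, R + 4 < ‖x‖ → e1 x = 0 := by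
    intro x hx
    have a1 := avg_supp hh.le (avg_supp hh.le hsupp) x (by linarith)
    simp [he1, hsL x hx, a1, hsupp x (by linarith)]
  have se2 : ∀ x, R + 4 < ‖x‖ → e2 x = 0 := by
    intro x hx
    have a1 := dif_supp k hh.le (dif_supp k hh.le hsupp) x (by linarith)
    simp [he2, hsD x hx, a1]
  have ce1 : Continuous e1 :=
    ((hζ.cont.sub (avg_cont (avg_cont hζ.cont))).const_smul _).add (hlapC.const_smul _)
  have ce2 : Continuous e2 :=
    ((dif_cont (dif_cont hζ.cont)).const_smul _).sub (hddC.const_smul _)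
  have Le1 := tens_allLp t ce1 be1 se1
  have Le2 := tens_allLp t ce2 be2 se2
  obtain ⟨Cz, hCz, bz⟩ := hζ.bounded
  obtain ⟨Cl, hCl, bl⟩ := (lap_tst hζ).bounded
  obtain ⟨Cv, hCv, bv⟩ := ((hζ.dd (vec k)).dd (vec k)).bounded
  have Lz := tens_allLp t hζ.cont bz hsupp
  have Ll := tens_allLp t hlapC bl hsL
  have Ld := tens_allLp t hddC bv hsD
  have key := Lam_identity (μ := (volume : Measure (ℝ × Euc d))) hq (wE h) k hf (Lz (ENNReal.ofReal q'))
  rw [avg_tens, avg_tens, dif_tens, dif_tens, ← tens_sub] at key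
  have L1 : Lam volume (wE h) k f (tens t e1) = (h ^ 2)⁻¹ *
      Lam volume (wE h) k f (tens t (ζ - avg (wv h) (avg (wv h) ζ))) +
      (2 / d) * Lam volume (wE h) k f (tens t (lap ζ)) := by
    have Lx : AllLp volume (tens t (ζ - avg (wv h) (avg (wv h) ζ))) := by
      rw [tens_sub]
      intro p
      refine (Lz p).sub ?_
      rw [← avg_tens, ← avg_tens]; exact avg_memLp (avg_memLp (Lz p) _) _
    rw [he1, tens_add, tens_smul, tens_smul, Lam_add hq _ k hf ((Lx.smul _) _) ((Ll.smul _) _),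
      Lam_smul, Lam_smul]
  have I2 : ∫ p, f p * tens t e2 p = (h ^ 2)⁻¹ * (∫ p, f p * tens t (dif (wv h k) (dif (wv h k) ζ)) p)
      - 4 * ∫ p, f p * tens t (dd (vec k) (dd (vec k) ζ)) p := by
    have Lx : AllLp volume (tens t (dif (wv h k) (dif (wv h k) ζ))) := by
      intro p
      rw [← dif_tens, ← dif_tens]; exact dif_memLp (dif_memLp (Lz p) _) _
    rw [← integral_const_mul, ← integral_const_mul, ← integral_sub
      ((integrable_mul_conj hq hf (Lx _)).const_mul _) ((integrable_mul_conj hq hf (Ld _)).const_mul _)]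
    congr 1; funext p
    rw [he2, tens_sub, tens_smul, tens_smul]; simp; ring
  have B1 : |Lam volume (wE h) k f (tens t e1)| ≤ C * A * (δ * B) := by
    refine hL f _ _ k A (δ * B) hA0 (by positivity) hf (Le1 _) hfA ?_
    calc eLpNorm (tens t e1) (ENNReal.ofReal q') volume
        ≤ ENNReal.ofReal δ * eLpNorm χ (ENNReal.ofReal q') volume := by
          refine eLpNorm_le_mul_eLpNorm_of_ae_le_mul (Filter.Eventually.of_forall fun p => ?_) _
          rw [Real.norm_eq_abs, Real.norm_eq_abs, abs_of_nonneg (hχ0 p)]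
          exact tens_abs t be1 se1 p
      _ ≤ ENNReal.ofReal δ * ENNReal.ofReal B := by gcongr
      _ = _ := (ENNReal.ofReal_mul hδ.le).symm
  have B2 : |∫ p, f p * tens t e2 p| ≤ δ * D := by
    rw [hD, ← integral_const_mul]
    refine (abs_integral_le_integral_abs).trans (integral_mono_of_nonneg
      (Filter.Eventually.of_forall fun p => abs_nonneg _) (hintg.const_mul _)
      (Filter.Eventually.of_forall fun p => ?_))
    have := tens_abs t be2 se2 p
    simp only [abs_mul]
    calc |f p| * |tens t e2 p| ≤ |f p| * (δ * χ p) := by gcongr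
      _ = _ := by ring
  rw [Real.dist_eq]
  have : LamN f k (tens t (lap ζ)) n - 2 * d * ∫ p, f p * tens t (dd (vec k) (dd (vec k) ζ)) p =
      d / 2 * (Lam volume (wE h) k f (tens t e1) + ∫ p, f p * tens t e2 p) := by
    unfold LamN
    rw [L1, I2, key]; field_simp; ring
  rw [this, abs_mul, abs_of_pos (by positivity)]
  refine lt_of_le_of_lt ?_ hδε
  gcongr
  exact (abs_add_le _ _).trans (add_le_add B1 B2)

/-- the limit functional -/
def Tlim (f : ℝ × Euc d → ℝ) (k : Idx d) (g : ℝ × Euc d → ℝ) : ℝ :=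
  Filter.limUnder (Filter.hyperfilter ℕ : Filter ℕ) (LamN f k g)

lemma Tlim_tendsto (hd : 0 < d) {q q' : ℝ} (hq : q.HolderConjugate q') {f g : ℝ × Euc d → ℝ}
    (hf : MemLp f (ENNReal.ofReal q)) (hg : MemLp g (ENNReal.ofReal q')) (k : Idx d) :
    Filter.Tendsto (LamN f k g) (Filter.hyperfilter ℕ : Filter ℕ) (nhds (Tlim f k g)) := by
  have hne : Nonempty (Idx d) := ⟨(⟨0, hd⟩, ⟨0, hd⟩, true)⟩
  obtain ⟨C, hC, hL⟩ := Lam_bound (ι := Idx d) (μ := (volume : Measure (ℝ × Euc d))) hq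
  have hb : ∀ n, LamN f k g n ∈ Metric.closedBall (0:ℝ)
      (C * ((eLpNorm f (ENNReal.ofReal q) volume).toReal + 1) *
        ((eLpNorm g (ENNReal.ofReal q') volume).toReal + 1)) := fun n => by
    rw [mem_closedBall_zero_iff]
    refine hL f g _ k _ _ (by positivity) (by positivity) hf hg ?_ ?_
    · rw [← ENNReal.ofReal_toReal hf.eLpNorm_ne_top]; exact ENNReal.ofReal_le_ofReal (by simp)
    · rw [← ENNReal.ofReal_toReal hg.eLpNorm_ne_top]; exact ENNReal.ofReal_le_ofReal (by simp)
  obtain ⟨l, _, hl⟩ := (isCompact_closedBall (0:ℝ) _).ultrafilter_le_nhds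
    ((Filter.hyperfilter ℕ).map (LamN f k g)) (by
      rw [Filter.le_principal_iff]
      exact Filter.mem_map.2 (Filter.univ_mem' hb))
  have : Filter.Tendsto (LamN f k g) (Filter.hyperfilter ℕ : Filter ℕ) (nhds l) := hl
  unfold Tlim; rwa [this.limUnder_eq]

lemma cz_functional (hd : 0 < d) : ∃ C : ℝ → ℝ, (∀ r, 0 < C r) ∧
    ∀ (i j : Fin d) (q : ℝ), 1 < q → ∀ f : ℝ × Euc d → ℝ, MemLp f (ENNReal.ofReal q) →
      ∃ T : (ℝ × Euc d → ℝ) → ℝ,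
        (∀ g g', AllLp volume g → AllLp volume g' → T (g + g') = T g + T g') ∧
        (∀ (c : ℝ) g, AllLp volume g → T (c • g) = c * T g) ∧
        (∀ r r' : ℝ, r.HolderConjugate r' → ∀ a b : ℝ, 0 < a → 0 < b → ∀ g,
          MemLp f (ENNReal.ofReal r) → AllLp volume g →
          eLpNorm f (ENNReal.ofReal r) volume ≤ ENNReal.ofReal a →
          eLpNorm g (ENNReal.ofReal r') volume ≤ ENNReal.ofReal b → |T g| ≤ C r * a * b) ∧
        (∀ (t : ℝ) (ζ : Euc d → ℝ), Tst Set.univ ζ →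
          T (tens t (lap ζ)) = ∫ p, f p * tens t (dd (coordDir i) (dd (coordDir j) ζ)) p) := by
  have hd' : (0:ℝ) < d := by exact_mod_cast hd
  have hne : Nonempty (Idx d) := ⟨(⟨0, hd⟩, ⟨0, hd⟩, true)⟩
  have hC : ∀ r : ℝ, ∃ C : ℝ, 0 < C ∧ ∀ r', r.HolderConjugate r' →
      ∀ (f g : ℝ × Euc d → ℝ) (w : Idx d → ℝ × Euc d) (k : Idx d) (a b : ℝ), 0 < a → 0 < b →
      MemLp f (ENNReal.ofReal r) → MemLp g (ENNReal.ofReal r') →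
      eLpNorm f (ENNReal.ofReal r) volume ≤ ENNReal.ofReal a →
      eLpNorm g (ENNReal.ofReal r') volume ≤ ENNReal.ofReal b → |Lam volume w k f g| ≤ C * a * b := by
    intro r
    by_cases h : ∃ r', r.HolderConjugate r'
    · obtain ⟨r', hr⟩ := h
      obtain ⟨C, hC, hL⟩ := Lam_bound (ι := Idx d) (μ := (volume : Measure (ℝ × Euc d))) hr
      refine ⟨C, hC, fun s hs => ?_⟩
      have : s = r' := by rw [hs.conjugate_eq, hr.conjugate_eq]
      subst this; exact hL
    · exact ⟨1, one_pos, fun r' hr => absurd ⟨r', hr⟩ h⟩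
  choose C hC0 hC using hC
  refine ⟨fun r => C r / (4 * d), fun r => div_pos (hC0 r) (by positivity), fun i j q hq f hf => ?_⟩
  have hqq := Real.HolderConjugate.conjExponent hq
  set q' := q.conjExponent
  have tl := fun g (hg : AllLp volume g) k => Tlim_tendsto hd hqq hf (hg (ENNReal.ofReal q')) k
  have Tadd : ∀ k g g', AllLp volume g → AllLp volume g' →
      Tlim f k (g + g') = Tlim f k g + Tlim f k g' := fun k g g' hg hg' => by
    refine tendsto_nhds_unique (tl _ (hg.add hg') k) (((tl _ hg k).add (tl _ hg' k)).congr fun n => ?_)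
    exact (Lam_add hqq _ k hf (hg _) (hg' _)).symm
  have Tsmul : ∀ k (c : ℝ) g, AllLp volume g → Tlim f k (c • g) = c * Tlim f k g := fun k c g hg => by
    refine tendsto_nhds_unique (tl _ (hg.smul c) k) (((tl _ hg k).const_mul c).congr fun n => ?_)
    exact (Lam_smul _ k c).symm
  refine ⟨fun g => (8 * d : ℝ)⁻¹ * (Tlim f (i, j, true) g - Tlim f (i, j, false) g), ?_, ?_, ?_, ?_⟩
  · intro g g' hg hg'; simp only [Tadd _ g g' hg hg']; ring
  · intro c g hg; simp only [Tsmul _ c g hg]; ring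
  · intro r r' hr a b ha hb g hfr hg hfa hgb
    have hT : ∀ k, |Tlim f k g| ≤ C r * a * b := fun k =>
      le_of_tendsto (tl g hg k).abs (Filter.Eventually.of_forall fun n =>
        hC r r' hr f g _ k a b ha hb hfr (hg _) hfa hgb)
    rw [abs_mul, abs_of_pos (by positivity)]
    calc _ ≤ (8 * d : ℝ)⁻¹ * (C r * a * b + C r * a * b) := by
          gcongr; exact (abs_sub _ _).trans (add_le_add (hT _) (hT _))
      _ = _ := by field_simp; ring
  · intro t ζ hζ
    obtain ⟨R, hR, hsupp⟩ := (lap_tst hζ).exists_radius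
    obtain ⟨Cl, hCl, bl⟩ := (lap_tst hζ).bounded
    have Ll := tens_allLp t (lap_tst hζ).cont bl hsupp
    have hk : ∀ k, Tlim f k (tens t (lap ζ)) = 2 * d *
        ∫ p, f p * tens t (dd (vec k) (dd (vec k) ζ)) p := fun k => by
      refine tendsto_nhds_unique (tl _ Ll k) ?_
      exact (LamN_lim hd hqq hf k t hζ).mono_left Nat.hyperfilter_le_atTop
    have Lv : ∀ k : Idx d, AllLp volume (tens t (dd (vec k) (dd (vec k) ζ))) := fun k => by
      obtain ⟨R, hR, hsupp⟩ := ((hζ.dd (vec k)).dd (vec k)).exists_radius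
      obtain ⟨Cl, hCl, bl⟩ := ((hζ.dd (vec k)).dd (vec k)).bounded
      exact tens_allLp t ((hζ.dd (vec k)).dd (vec k)).cont bl hsupp
    simp only [hk]
    rw [← mul_sub, ← integral_sub (integrable_mul_conj hqq hf (Lv _ _))
      (integrable_mul_conj hqq hf (Lv _ _)), ← mul_assoc, ← integral_const_mul]
    congr 1; funext p
    simp only [tens, dd_vec hζ.cd]
    simp; field_simp; ring

end czf
end
end

section
open MeasureTheory
noncomputable section

/-! ### Riesz representation for `L^p` -/
section lpdual
variable {X : Type*} [MeasurableSpace X] {μ : Measure X}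

/-- the submodule of `L^q` functions -/
def LqSub (μ : Measure X) (q : ENNReal) : Submodule ℝ (X → ℝ) where
  carrier := {f | MemLp f q μ}
  add_mem' := fun ha hb => ha.add hb
  zero_mem' := MemLp.zero
  smul_mem' := fun c _ hf => hf.const_smul c

lemma nrm_ind [IsFiniteMeasure μ] {q : ℝ} (hq : 0 < q) {A : Set X} (hA : MeasurableSet A) :
    (eLpNorm (A.indicator (fun _ => (1:ℝ))) (ENNReal.ofReal q) μ).toReal = (μ.real A) ^ (1/q) := by
  rw [eLpNorm_indicator_const hA (by simpa using hq) (by simp)]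
  simp [ENNReal.toReal_ofReal hq.le, Measure.real, ENNReal.toReal_rpow]

lemma ind_mem [IsFiniteMeasure μ] {q : ENNReal} {A : Set X} (hA : MeasurableSet A) :
    A.indicator (fun _ => (1:ℝ)) ∈ LqSub μ q :=
  (memLp_indicator_const q hA (1:ℝ) (Or.inr (measure_ne_top _ _)))

/-- floor approximation -/
lemma floor_approx {v : X → ℝ} {M : ℝ} (hM : ∀ x, |v x| ≤ M) (N : ℕ) (hN : 0 < N) :
    ∀ x, |v x - (∑ k ∈ Finset.Icc (-⌈N * M + 1⌉) ⌈N * M + 1⌉, ((k:ℝ)/N) •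
      (({y | ⌊N * v y⌋ = k} : Set X).indicator (fun _ => (1:ℝ)))) x| ≤ 1 / N := by
  intro x
  have hN' : (0:ℝ) < N := by exact_mod_cast hN
  have h1 : (∑ k ∈ Finset.Icc (-⌈N * M + 1⌉) ⌈N * M + 1⌉, ((k:ℝ)/N) •
      (({y | ⌊N * v y⌋ = k} : Set X).indicator (fun _ => (1:ℝ)))) x = (⌊N * v x⌋:ℝ)/N := by
    rw [Finset.sum_apply, Finset.sum_eq_single ⌊N * v x⌋]
    · simp
    · intro b _ hb
      simp [Set.indicator, Ne.symm hb]
    · intro h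
      exfalso; apply h
      have := abs_le.1 (hM x)
      rw [Finset.mem_Icc]
      constructor
      · rw [Int.le_floor]
        push_cast
        have := Int.le_ceil (N * M + 1)
        nlinarith
      · have h2 := Int.le_ceil (N * M + 1)
        have h3 := Int.floor_le (N * v x)
        have : ((⌊N * v x⌋:ℤ):ℝ) ≤ ⌈N * M + 1⌉ := by nlinarith
        exact_mod_cast this
  rw [h1]
  have h2 := Int.floor_le (N * v x)
  have h3 := Int.lt_floor_add_one (N * v x)
  have : v x - (⌊N * v x⌋:ℝ)/N = (N * v x - ⌊N * v x⌋)/N := by field_simp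
  rw [this, abs_div, abs_of_pos hN', abs_of_nonneg (by linarith)]
  gcongr
  linarith

lemma lp_rep_bdd [IsFiniteMeasure μ] {q : ℝ} (hq : 1 < q)
    (Φ : LqSub μ (ENNReal.ofReal q) →ₗ[ℝ] ℝ) {C : ℝ} (hC : 0 ≤ C)
    (hΦ : ∀ v, |Φ v| ≤ C * (eLpNorm (v : X → ℝ) (ENNReal.ofReal q) μ).toReal) :
    ∃ π : X → ℝ, Measurable π ∧ Integrable π μ ∧ ∀ v (hv : v ∈ LqSub μ (ENNReal.ofReal q)),
      Measurable v → (∃ M, ∀ x, |v x| ≤ M) → Φ ⟨v, hv⟩ = ∫ x, π x * v x ∂μ := by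
  classical
  have hq0 : 0 < q := by linarith
  let m : Set X → ℝ := fun A => if h : MeasurableSet A then Φ ⟨_, ind_mem h⟩ else 0
  have hm : ∀ A (h : MeasurableSet A), m A = Φ ⟨_, ind_mem h⟩ := fun A h => by simp [m, h]
  have hmb : ∀ A, MeasurableSet A → |m A| ≤ C * (μ.real A) ^ (1/q) := by
    intro A h
    rw [hm A h]
    have := hΦ ⟨_, ind_mem h⟩
    rwa [nrm_ind hq0 h] at this
  have hadd : ∀ A B, MeasurableSet A → MeasurableSet B → Disjoint A B → m (A ∪ B) = m A + m B := by
    intro A B hA hB hAB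
    rw [hm _ hA, hm _ hB, hm _ (hA.union hB), ← map_add]
    congr 1
    apply Subtype.ext
    change (A ∪ B).indicator (fun _ => (1:ℝ)) = A.indicator (fun _ => (1:ℝ)) + B.indicator (fun _ => (1:ℝ))
    exact Set.indicator_union_of_disjoint hAB _
  have hm0 : m ∅ = 0 := by
    have := hmb ∅ MeasurableSet.empty
    simp only [measureReal_empty] at this
    rw [Real.zero_rpow (by positivity)] at this
    simpa using this
  have hfin : ∀ (f : ℕ → Set X), (∀ i, MeasurableSet (f i)) → Pairwise (Function.onFun Disjoint f) →
      ∀ s : Finset ℕ, m (⋃ i ∈ s, f i) = ∑ i ∈ s, m (f i) := by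
    intro f hf hd s
    induction s using Finset.induction_on with
    | empty => simpa using hm0
    | insert a s ha ih =>
      rw [Finset.set_biUnion_insert, hadd _ _ (hf a) (Finset.measurableSet_biUnion _ fun i _ => hf i),
        ih, Finset.sum_insert ha]
      rw [Set.disjoint_iUnion₂_right]
      intro i hi
      exact hd (by rintro rfl; exact ha hi)
  let ν : SignedMeasure X :=
    { measureOf' := m
      empty' := hm0
      not_measurable' := fun A hA => by simp [m, hA]
      m_iUnion' := by
        intro f hf hd
        have hU : MeasurableSet (⋃ i, f i) := MeasurableSet.iUnion hf
        have h1 : Filter.Tendsto (fun s : Finset ℕ => μ.real ((⋃ i, f i) \ (⋃ i ∈ s, f i)))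
            Filter.atTop (nhds 0) := by
          have h2 : HasSum (fun i => μ.real (f i)) (μ.real (⋃ i, f i)) := by
            have e := measure_iUnion (μ := μ) hd hf
            have := ENNReal.hasSum_toReal (f := fun i => μ (f i)) (by rw [← e]; exact measure_ne_top _ _)
            rw [Measure.real, e, ENNReal.tsum_toReal_eq (fun i => measure_ne_top _ _)]
            exact this
          have h3 : ∀ s : Finset ℕ, μ.real ((⋃ i, f i) \ (⋃ i ∈ s, f i))
              = μ.real (⋃ i, f i) - ∑ i ∈ s, μ.real (f i) := by
            intro s
            rw [measureReal_sdiff (Set.iUnion₂_subset fun i _ => Set.subset_iUnion f i)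
              (Finset.measurableSet_biUnion _ fun i _ => hf i),
              measureReal_biUnion_finset (fun i _ j _ hij => hd hij) (fun i _ => hf i)]
          simp_rw [h3]
          have := (tendsto_const_nhds (x := μ.real (⋃ i, f i))).sub h2
          simpa using this
        have h4 : Filter.Tendsto (fun s : Finset ℕ => C * (μ.real ((⋃ i, f i) \ (⋃ i ∈ s, f i))) ^ (1/q))
            Filter.atTop (nhds 0) := by
          have := (h1.rpow_const (p := 1/q) (Or.inr (by positivity))).const_mul C
          rwa [Real.zero_rpow (by positivity), mul_zero] at this
        have h5 : Filter.Tendsto (fun s : Finset ℕ => m (⋃ i, f i) - ∑ i ∈ s, m (f i))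
            Filter.atTop (nhds 0) := by
          apply squeeze_zero_norm _ h4
          intro s
          have hs : MeasurableSet (⋃ i ∈ s, f i) := Finset.measurableSet_biUnion _ fun i _ => hf i
          rw [← hfin f hf hd s]
          have h6 := hadd _ _ hs (hU.diff hs) Set.disjoint_sdiff_right
          rw [Set.union_sdiff_cancel (Set.iUnion₂_subset fun i _ => Set.subset_iUnion f i)] at h6
          rw [h6, add_sub_cancel_left]
          exact hmb _ (hU.diff hs)
        have h7 := (tendsto_const_nhds (x := m (⋃ i, f i))).sub h5
        simpa [HasSum] using h7 }
  have hνm : ∀ A, ν A = m A := fun A => rfl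
  have hac : ν ≪ᵥ μ.toENNRealVectorMeasure := by
    apply VectorMeasure.AbsolutelyContinuous.mk
    intro A hA h0
    rw [Measure.toENNRealVectorMeasure_apply_measurable hA] at h0
    have := hmb A hA
    rw [Measure.real, h0] at this
    simp only [ENNReal.toReal_zero] at this
    rw [Real.zero_rpow (by positivity)] at this
    rw [hνm]; simpa using this
  have hrn := (SignedMeasure.absolutelyContinuous_iff_withDensityᵥ_rnDeriv_eq ν μ).1 hac
  have hπi := SignedMeasure.integrable_rnDeriv ν μ
  have hπm := SignedMeasure.measurable_rnDeriv ν μ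
  set π := ν.rnDeriv μ
  have hA : ∀ A, MeasurableSet A → m A = ∫ x in A, π x ∂μ := by
    intro A hA
    rw [← hνm, ← hrn, withDensityᵥ_apply hπi hA]
  refine ⟨π, hπm, hπi, ?_⟩
  intro v hv hvm ⟨M, hM⟩
  -- approximate
  let S : ℕ → X → ℝ := fun N => ∑ k ∈ Finset.Icc (-⌈(N+1:ℕ) * M + 1⌉) ⌈(N+1:ℕ) * M + 1⌉,
      ((k:ℝ)/(N+1:ℕ)) • (({y | ⌊(N+1:ℕ) * v y⌋ = k} : Set X).indicator (fun _ => (1:ℝ)))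
  have hSm : ∀ N (k : ℤ), MeasurableSet {y | ⌊((N+1:ℕ):ℝ) * v y⌋ = k} := by
    intro N k
    exact (Int.measurable_floor.comp (hvm.const_mul _)) (measurableSet_singleton k)
  have hS1 : ∀ N x, |v x - S N x| ≤ 1 / ((N:ℝ)+1) := by
    intro N x
    have := floor_approx hM (N+1) (Nat.succ_pos N) x
    simpa [S] using this
  have hSmem : ∀ N, S N ∈ LqSub μ (ENNReal.ofReal q) := fun N =>
    Submodule.sum_mem _ fun k _ => Submodule.smul_mem _ _ (ind_mem (hSm N k))
  have hSΦ : ∀ N, Φ ⟨S N, hSmem N⟩ = ∫ x, π x * S N x ∂μ := by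
    intro N
    have e1 : (⟨S N, hSmem N⟩ : LqSub μ (ENNReal.ofReal q)) =
        ∑ k ∈ Finset.Icc (-⌈(N+1:ℕ) * M + 1⌉) ⌈(N+1:ℕ) * M + 1⌉,
          ((k:ℝ)/(N+1:ℕ)) • (⟨_, ind_mem (hSm N k)⟩ : LqSub μ (ENNReal.ofReal q)) := by
      apply Subtype.ext
      simp [S]
    rw [e1, map_sum]
    have e2 : ∀ x, π x * S N x = ∑ k ∈ Finset.Icc (-⌈(N+1:ℕ) * M + 1⌉) ⌈(N+1:ℕ) * M + 1⌉,
        ((k:ℝ)/(N+1:ℕ)) * ({y | ⌊((N+1:ℕ):ℝ) * v y⌋ = k}.indicator π x) := by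
      intro x
      simp only [S, Finset.sum_apply, Finset.mul_sum]
      refine Finset.sum_congr rfl fun k _ => ?_
      by_cases hx : x ∈ {y | ⌊((N+1:ℕ):ℝ) * v y⌋ = k}
      · rw [Pi.smul_apply, Set.indicator_of_mem hx, Set.indicator_of_mem hx, smul_eq_mul]; ring
      · rw [Pi.smul_apply, Set.indicator_of_notMem hx, Set.indicator_of_notMem hx, smul_eq_mul]; ring
    simp_rw [e2]
    rw [integral_finsetSum _ fun k _ => by exact (hπi.indicator (hSm N k)).const_mul _]
    refine Finset.sum_congr rfl fun k _ => ?_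
    rw [integral_const_mul, integral_indicator (hSm N k), ← hA _ (hSm N k), map_smul, hm _ (hSm N k)]
    rfl
  have hlim0 : Filter.Tendsto (fun N : ℕ => 1 / ((N:ℝ)+1)) Filter.atTop (nhds 0) :=
    tendsto_one_div_add_atTop_nhds_zero_nat
  have l1 : Filter.Tendsto (fun N => Φ ⟨v, hv⟩ - Φ ⟨S N, hSmem N⟩) Filter.atTop (nhds 0) := by
    have hb : Filter.Tendsto (fun N : ℕ => C * ((1 / ((N:ℝ)+1)) * (μ.real Set.univ) ^ (1/q)))
        Filter.atTop (nhds 0) := by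
      have := (hlim0.mul_const ((μ.real Set.univ) ^ (1/q))).const_mul C
      simpa using this
    apply squeeze_zero_norm _ hb
    intro N
    rw [← map_sub]
    refine (hΦ _).trans ?_
    gcongr
    have : eLpNorm (v - S N) (ENNReal.ofReal q) μ ≤ μ Set.univ ^ (ENNReal.ofReal q).toReal⁻¹ * ENNReal.ofReal (1 / ((N:ℝ)+1)) :=
      eLpNorm_le_of_ae_bound (Filter.Eventually.of_forall fun x => hS1 N x)
    have h2 := ENNReal.toReal_mono (by
      refine ENNReal.mul_ne_top ?_ (by simp)
      exact ENNReal.rpow_ne_top_of_nonneg (by positivity) (measure_ne_top _ _)) this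
    rw [ENNReal.toReal_mul, ← ENNReal.toReal_rpow, ENNReal.toReal_ofReal hq0.le,
      ENNReal.toReal_ofReal (by positivity)] at h2
    rw [mul_comm, one_div q]
    exact h2
  have hvi : Integrable (fun x => π x * v x) μ := by
    refine hπi.mul_bdd (c := M) hvm.aestronglyMeasurable ?_
    exact Filter.Eventually.of_forall hM
  have hSi : ∀ N, Integrable (fun x => π x * S N x) μ := by
    intro N
    have hSmeas : Measurable (S N) := by
      have : S N = fun x => ∑ k ∈ Finset.Icc (-⌈(N+1:ℕ) * M + 1⌉) ⌈(N+1:ℕ) * M + 1⌉,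
        ((k:ℝ)/(N+1:ℕ)) * (({y | ⌊(N+1:ℕ) * v y⌋ = k} : Set X).indicator (fun _ => (1:ℝ))) x := by
        funext x; simp [S]
      rw [this]
      exact Finset.measurable_sum _ fun k _ => (measurable_const.indicator (hSm N k)).const_mul _
    refine hπi.mul_bdd (c := M + 1 / ((N:ℝ)+1)) hSmeas.aestronglyMeasurable ?_
    refine Filter.Eventually.of_forall fun x => ?_
    have h1 := hS1 N x
    have h2 := hM x
    rw [Real.norm_eq_abs]
    rw [abs_le] at *
    constructor <;> linarith
  have l2 : Filter.Tendsto (fun N => (∫ x, π x * v x ∂μ) - ∫ x, π x * S N x ∂μ) Filter.atTop (nhds 0) := by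
    have hb : Filter.Tendsto (fun N : ℕ => (∫ x, |π x| ∂μ) * (1 / ((N:ℝ)+1)))
        Filter.atTop (nhds 0) := by
      have := hlim0.const_mul (∫ x, |π x| ∂μ)
      simpa using this
    apply squeeze_zero_norm _ hb
    intro N
    rw [← integral_sub hvi (hSi N), ← integral_mul_const]
    refine norm_integral_le_of_norm_le (hπi.abs.mul_const _) (Filter.Eventually.of_forall fun x => ?_)
    rw [← mul_sub, Real.norm_eq_abs, abs_mul]
    gcongr
    exact hS1 N x
  have l3 := l1.sub l2
  simp_rw [hSΦ, sub_sub_sub_cancel_right, sub_zero] at l3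
  have := tendsto_nhds_unique l3 tendsto_const_nhds
  linarith

lemma lp_dual [IsFiniteMeasure μ] {p q : ℝ} (hpq : p.HolderConjugate q) (V : Submodule ℝ (X → ℝ))
    (hV : ∀ v ∈ V, MemLp v (ENNReal.ofReal q) μ) (L : V →ₗ[ℝ] ℝ) {C : ℝ} (hC : 0 ≤ C)
    (hL : ∀ v : V, |L v| ≤ C * (eLpNorm (v : X → ℝ) (ENNReal.ofReal q) μ).toReal) :
    ∃ π : X → ℝ, Measurable π ∧ MemLp π (ENNReal.ofReal p) μ ∧
      eLpNorm π (ENNReal.ofReal p) μ ≤ ENNReal.ofReal C ∧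
      ∀ v : V, Measurable (v : X → ℝ) → (∃ M, ∀ x, |(v : X → ℝ) x| ≤ M) →
        L v = ∫ x, π x * (v : X → ℝ) x ∂μ := by
  have hq0 : 0 < q := hpq.symm.pos
  have hp0 : 0 < p := hpq.pos
  -- Hahn-Banach
  let E := LqSub μ (ENNReal.ofReal q)
  have hVE : V ≤ E := fun v hv => hV v hv
  let V' : Submodule ℝ E := V.comap E.subtype
  let toV : V' →ₗ[ℝ] V := LinearMap.codRestrict V (E.subtype.comp V'.subtype) (fun x => x.2)
  let s : E →ₗ.[ℝ] ℝ := ⟨V', L.comp toV⟩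
  obtain ⟨Φ, hΦ1, hΦ2⟩ := exists_extension_of_le_sublinear s
    (fun f => C * (eLpNorm (f : X → ℝ) (ENNReal.ofReal q) μ).toReal)
    (by
      intro c hc x
      have : eLpNorm (((c • x : E)) : X → ℝ) (ENNReal.ofReal q) μ = ‖c‖ₑ * eLpNorm (x : X → ℝ) (ENNReal.ofReal q) μ :=
        eLpNorm_const_smul c _ _ _
      rw [this, ENNReal.toReal_mul]
      simp only [toReal_enorm, Real.norm_eq_abs, abs_of_pos hc]; ring)
    (by
      intro x y
      rw [← mul_add]
      gcongr
      rw [← ENNReal.toReal_add x.2.2.ne y.2.2.ne]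
      refine ENNReal.toReal_mono (by simp [x.2.2.ne, y.2.2.ne]) ?_
      exact eLpNorm_add_le x.2.1 y.2.1 (by simpa using hpq.symm.lt.le))
    (by
      intro x
      exact (le_abs_self _).trans (hL (toV x)))
  have hΦ3 : ∀ v, |Φ v| ≤ C * (eLpNorm (v : X → ℝ) (ENNReal.ofReal q) μ).toReal := by
    intro v
    rw [abs_le]
    refine ⟨?_, hΦ2 v⟩
    have h1 := hΦ2 (-v)
    have : eLpNorm (((-v : E)) : X → ℝ) (ENNReal.ofReal q) μ = eLpNorm (v : X → ℝ) (ENNReal.ofReal q) μ :=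
      eLpNorm_neg _ _ _
    rw [this, map_neg] at h1
    linarith
  obtain ⟨π, hπm, hπi, hπ⟩ := lp_rep_bdd hpq.symm.lt Φ hC hΦ3
  have hb : eLpNorm π (ENNReal.ofReal p) μ ≤ ENNReal.ofReal C := by
    let A : ℕ → Set X := fun n => {x | |π x| ≤ n}
    have hAm : ∀ n, MeasurableSet (A n) := fun n => hπm.abs measurableSet_Iic
    have key : ∀ n, eLpNorm ((A n).indicator π) (ENNReal.ofReal p) μ ≤ ENNReal.ofReal C := by
      intro n
      let w : X → ℝ := (A n).indicator π
      have hwm : Measurable w := hπm.indicator (hAm n)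
      have hwb : ∀ x, |w x| ≤ n := by
        intro x
        by_cases hx : x ∈ A n
        · simp only [w, Set.indicator_of_mem hx]; exact hx
        · simp [w, Set.indicator_of_notMem hx]
      let v : X → ℝ := fun x => |w x| ^ (p - 1) * SignType.sign (w x)
      have hsm : Measurable (fun x => ((SignType.sign (w x) : SignType) : ℝ)) := by
        have : (fun x => ((SignType.sign (w x) : SignType) : ℝ)) =
            fun x => if 0 < w x then 1 else if w x < 0 then -1 else 0 := by
          funext x
          rcases lt_trichotomy (w x) 0 with h | h | h
          · simp [h, h.le.not_gt]
          · simp [h]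
          · simp [h]
        rw [this]
        exact Measurable.ite (measurableSet_lt measurable_const hwm) measurable_const
          (Measurable.ite (measurableSet_lt hwm measurable_const) measurable_const measurable_const)
      have hvm : Measurable v := (hwm.abs.pow_const _).mul hsm
      have hvabs : ∀ x, |v x| = |w x| ^ (p - 1) := by
        intro x
        simp only [v]
        rw [abs_mul, abs_of_nonneg (by positivity)]
        rcases lt_trichotomy (w x) 0 with h | h | h
        · simp [h]
        · simp [h, Real.zero_rpow (sub_ne_zero.2 hpq.lt.ne')]
        · simp [h]
      have hvb : ∀ x, |v x| ≤ (n:ℝ) ^ (p - 1) := by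
        intro x
        rw [hvabs]
        exact Real.rpow_le_rpow (abs_nonneg _) (hwb x) (by linarith [hpq.lt])
      have hvE : v ∈ E := MemLp.of_bound hvm.aestronglyMeasurable _ (Filter.Eventually.of_forall hvb)
      have h1 := hπ v hvE hvm ⟨_, hvb⟩
      have h2 : ∀ x, π x * v x = |w x| ^ p := by
        intro x
        by_cases hx : x ∈ A n
        · have e : w x = π x := Set.indicator_of_mem hx _
          simp only [v]
          rw [← e]
          rcases eq_or_ne (w x) 0 with h0 | h0
          · simp [h0, Real.zero_rpow hp0.ne']
          · have : |w x| ^ p = |w x| ^ (p - 1) * |w x| := by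
              rw [← Real.rpow_add_one (abs_ne_zero.2 h0)]; simp
            rw [this]
            have h3 : w x * SignType.sign (w x) = |w x| := self_mul_sign (w x)
            rw [← h3]; ring_nf
        · have e : w x = 0 := Set.indicator_of_notMem hx _
          simp [v, e, Real.zero_rpow hp0.ne']
      simp_rw [h2] at h1
      have hwL : MemLp w (ENNReal.ofReal p) μ :=
        MemLp.of_bound hwm.aestronglyMeasurable _ (Filter.Eventually.of_forall hwb)
      -- norms
      have n1 := hwL.eLpNorm_eq_integral_rpow_norm (by simpa using hp0) (by simp)
      have n2 := hvE.eLpNorm_eq_integral_rpow_norm (by simpa using hq0) (by simp)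
      rw [ENNReal.toReal_ofReal hp0.le] at n1
      rw [ENNReal.toReal_ofReal hq0.le] at n2
      have h4 : ∀ x, ‖v x‖ ^ q = |w x| ^ p := by
        intro x
        rw [Real.norm_eq_abs, hvabs, ← Real.rpow_mul (abs_nonneg _), hpq.sub_one_mul_conj]
      simp_rw [h4] at n2
      simp_rw [Real.norm_eq_abs] at n1
      set I := ∫ x, |w x| ^ p ∂μ with hI
      have hI0 : 0 ≤ I := integral_nonneg fun x => by positivity
      have h5 := hΦ3 ⟨v, hvE⟩
      rw [h1, n2, ENNReal.toReal_ofReal (by positivity), abs_of_nonneg hI0] at h5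
      change eLpNorm w _ _ ≤ _
      rw [n1]
      apply ENNReal.ofReal_le_ofReal
      rcases hI0.eq_or_lt with h0 | h0
      · rw [← h0, Real.zero_rpow (by positivity)]; exact hC
      · have h6 : I = I ^ p⁻¹ * I ^ q⁻¹ := by
          rw [← Real.rpow_add h0, hpq.inv_add_inv_eq_one, Real.rpow_one]
        have h7 : 0 < I ^ q⁻¹ := Real.rpow_pos_of_pos h0 _
        nlinarith
    have hlim : ∀ x, Filter.Tendsto (fun n => (A n).indicator π x) Filter.atTop (nhds (π x)) := by
      intro x
      obtain ⟨N, hN⟩ := exists_nat_ge (|π x|)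
      apply tendsto_const_nhds.congr'
      filter_upwards [Filter.eventually_ge_atTop N] with n hn
      rw [Set.indicator_of_mem]
      exact hN.trans (by exact_mod_cast hn)
    refine (Lp.eLpNorm_lim_le_liminf_eLpNorm (fun n => (hπm.indicator (hAm n)).aestronglyMeasurable) π
      (Filter.Eventually.of_forall hlim)).trans ?_
    refine Filter.liminf_le_of_frequently_le' ?_
    exact Filter.Frequently.of_forall key
  refine ⟨π, hπm, ⟨hπm.aestronglyMeasurable, hb.trans_lt ENNReal.ofReal_lt_top⟩, hb, ?_⟩
  intro v hvm hvb
  have h1 := hΦ1 ⟨⟨v, hVE v.2⟩, v.2⟩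
  rw [← hπ v (hVE v.2) hvm hvb, h1]
  rfl

end lpdual
end
end

section
open MeasureTheory
noncomputable section

/-! ### Consequences of the Calderon-Zygmund functional -/
variable {d : ℕ}

/-- the submodule of functions in every `L^p` -/
def AllSub {X : Type*} [MeasurableSpace X] (μ : Measure X) : Submodule ℝ (X → ℝ) where
  carrier := {f | AllLp μ f}
  add_mem' := fun ha hb => AllLp.add ha hb
  zero_mem' := fun _ => MemLp.zero
  smul_mem' := fun c _ hf => AllLp.smul hf c

/-- uniqueness for `L^1` functions tested by bounded functions -/
lemma ae_eq_of_test {X : Type*} [MeasurableSpace X] {μ : Measure X} [IsFiniteMeasure μ]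
    {f g : X → ℝ} (hf : Integrable f μ) (hg : Integrable g μ)
    (h : ∀ v : X → ℝ, AllLp μ v → Measurable v → (∃ M, ∀ x, |v x| ≤ M) →
      ∫ x, f x * v x ∂μ = ∫ x, g x * v x ∂μ) : f =ᵐ[μ] g := by
  apply Integrable.ae_eq_of_forall_setIntegral_eq f g hf hg
  intro s hs _
  have h1 := h (s.indicator (fun _ => (1:ℝ)))
    (fun p => memLp_indicator_const p hs (1:ℝ) (Or.inr (measure_ne_top _ _)))
    (measurable_const.indicator hs) ⟨1, fun x => by
      by_cases hx : x ∈ s <;> simp [hx]⟩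
  have e : ∀ (k : X → ℝ) x, k x * s.indicator (fun _ => (1:ℝ)) x = s.indicator k x := by
    intro k x
    by_cases hx : x ∈ s <;> simp [hx]
  simp_rw [e] at h1
  rwa [integral_indicator hs, integral_indicator hs] at h1

lemma le_of_eps {x C A B : ℝ} (h : ∀ ε > 0, x ≤ C * (A + ε) * (B + ε)) : x ≤ C * A * B := by
  have h1 : Filter.Tendsto (fun ε : ℝ => C * (A + ε) * (B + ε)) (nhdsWithin 0 (Set.Ioi 0))
      (nhds (C * (A + 0) * (B + 0))) := by
    apply Filter.Tendsto.mono_left _ nhdsWithin_le_nhds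
    apply Continuous.tendsto
    fun_prop
  have := ge_of_tendsto h1 (by filter_upwards [self_mem_nhdsWithin] with ε hε using h ε hε)
  simpa using this

/-- `cz_functional` with sharp norms. -/
lemma cz_functional2 (hd : 0 < d) : ∃ C : ℝ → ℝ, (∀ r, 0 < C r) ∧
    ∀ (i j : Fin d) (q : ℝ), 1 < q → ∀ f : ℝ × Euc d → ℝ, MemLp f (ENNReal.ofReal q) volume →
    ∃ T : AllSub (volume : Measure (ℝ × Euc d)) →ₗ[ℝ] ℝ,
      (∀ r r' : ℝ, r.HolderConjugate r' → ∀ g, MemLp f (ENNReal.ofReal r) volume →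
        |T g| ≤ C r * (eLpNorm f (ENNReal.ofReal r) volume).toReal *
          (eLpNorm (g : ℝ × Euc d → ℝ) (ENNReal.ofReal r') volume).toReal) ∧
      (∀ (t : ℝ) (ζ : Euc d → ℝ), Tst Set.univ ζ → ∀ h : tens t (lap ζ) ∈ AllSub volume,
        T ⟨tens t (lap ζ), h⟩ =
        ∫ p, f p * tens t (dd (coordDir i) (dd (coordDir j) ζ)) p) := by
  obtain ⟨C, hC, H⟩ := cz_functional (d := d) hd
  refine ⟨C, hC, fun i j q hq f hf => ?_⟩
  obtain ⟨T, h1, h2, h3, h4⟩ := H i j q hq f hf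
  refine ⟨⟨⟨fun g => T g, ?_⟩, ?_⟩, ?_, ?_⟩
  · intro g g'
    exact h1 _ _ g.2 g'.2
  · intro c g
    exact h2 c _ g.2
  · intro r r' hr g hfr
    apply le_of_eps
    intro ε hε
    refine h3 r r' hr _ _ (add_pos_of_nonneg_of_pos ENNReal.toReal_nonneg hε)
      (add_pos_of_nonneg_of_pos ENNReal.toReal_nonneg hε) _ hfr g.2 ?_ ?_
    · refine (ENNReal.ofReal_toReal hfr.2.ne).symm.le.trans ?_
      exact ENNReal.ofReal_le_ofReal (by linarith)
    · refine (ENNReal.ofReal_toReal (g.2 _).2.ne).symm.le.trans ?_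
      exact ENNReal.ofReal_le_ofReal (by linarith)
  · intro t ζ hζ h
    exact h4 t ζ hζ


/-- duality characterisation of the norm on a finite measure space -/
lemma norm_le_of_dual {X : Type*} [MeasurableSpace X] {μ : Measure X} [IsFiniteMeasure μ]
    {p q : ℝ} (hpq : p.HolderConjugate q) {w : X → ℝ} (hw : MemLp w (ENNReal.ofReal p) μ) {C : ℝ}
    (hC : 0 ≤ C) (h : ∀ f : X → ℝ, AllLp μ f →
      |∫ x, w x * f x ∂μ| ≤ C * (eLpNorm f (ENNReal.ofReal q) μ).toReal) :
    eLpNorm w (ENNReal.ofReal p) μ ≤ ENNReal.ofReal C := by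
  have hi : ∀ f : X → ℝ, AllLp μ f → Integrable (fun x => w x * f x) μ :=
    fun f hf => integrable_mul_conj hpq hw (hf _)
  let L : AllSub μ →ₗ[ℝ] ℝ :=
    { toFun := fun f => ∫ x, w x * (f : X → ℝ) x ∂μ
      map_add' := fun f g => by
        rw [← integral_add (hi _ f.2) (hi _ g.2)]
        refine integral_congr_ae (Filter.Eventually.of_forall fun x => ?_)
        simp [mul_add]
      map_smul' := fun c f => by
        rw [RingHom.id_apply, smul_eq_mul, ← integral_const_mul]
        refine integral_congr_ae (Filter.Eventually.of_forall fun x => ?_)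
        simp; ring }
  obtain ⟨π, hπm, hπ1, hπ2, hπ3⟩ := lp_dual hpq (AllSub μ) (fun v hv => hv _) L hC
    (fun v => h v v.2)
  have hone : (1:ENNReal) ≤ ENNReal.ofReal p := by simpa using hpq.lt.le
  have : π =ᵐ[μ] w := by
    apply ae_eq_of_test (hπ1.integrable hone) (hw.integrable hone)
    intro v hv hvm hvb
    exact (hπ3 ⟨v, hv⟩ hvm hvb).symm
  rwa [eLpNorm_congr_ae this] at hπ2

instance : IsProbabilityMeasure ((volume : Measure ℝ).restrict (Set.Ioc 0 1)) :=
  ⟨by simp⟩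

lemma tens_one_eq (g : Euc d → ℝ) :
    tens 1 g = (Set.Ioc (0:ℝ) 1 ×ˢ (Set.univ : Set (Euc d))).indicator (fun p => g p.2) := by
  funext p
  by_cases h : p.1 ∈ Set.Ioc (0:ℝ) 1
  · rw [Set.indicator_of_mem (by simpa using h)]
    simp [tens, Set.indicator_of_mem h]
  · rw [Set.indicator_of_notMem (by simpa using h)]
    simp [tens, Set.indicator_of_notMem h]

lemma tens_one_mp : MeasurePreserving (Prod.snd : ℝ × Euc d → Euc d)
    ((volume : Measure (ℝ × Euc d)).restrict (Set.Ioc (0:ℝ) 1 ×ˢ (Set.univ : Set (Euc d)))) volume := by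
  have : (volume : Measure (ℝ × Euc d)).restrict (Set.Ioc (0:ℝ) 1 ×ˢ (Set.univ : Set (Euc d)))
      = ((volume : Measure ℝ).restrict (Set.Ioc 0 1)).prod volume := by
    rw [Measure.volume_eq_prod, ← Measure.prod_restrict, Measure.restrict_univ]
  rw [this]
  exact measurePreserving_snd

lemma tens_box_meas : MeasurableSet (Set.Ioc (0:ℝ) 1 ×ˢ (Set.univ : Set (Euc d))) :=
  measurableSet_Ioc.prod MeasurableSet.univ

lemma tens_one_norm {g : Euc d → ℝ} (hg : AEStronglyMeasurable g volume) (p : ENNReal) :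
    eLpNorm (tens 1 g) p volume = eLpNorm g p volume := by
  rw [tens_one_eq, eLpNorm_indicator_eq_eLpNorm_restrict tens_box_meas]
  exact eLpNorm_comp_measurePreserving hg tens_one_mp

lemma tens_one_memLp {g : Euc d → ℝ} {p : ENNReal} (hg : MemLp g p volume) :
    MemLp (tens 1 g) p volume := by
  rw [tens_one_eq, memLp_indicator_iff_restrict tens_box_meas]
  exact hg.comp_measurePreserving tens_one_mp

lemma tens_one_integral {g : Euc d → ℝ} (hg : AEStronglyMeasurable g volume) :
    ∫ p, tens 1 g p = ∫ x, g x := by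
  rw [tens_one_eq, integral_indicator tens_box_meas]
  rw [← integral_map (μ := ((volume : Measure (ℝ × Euc d)).restrict
    (Set.Ioc (0:ℝ) 1 ×ˢ (Set.univ : Set (Euc d))))) (φ := Prod.snd) (f := g)
    measurable_snd.aemeasurable (by rwa [tens_one_mp.map_eq]), tens_one_mp.map_eq]

/-- a priori estimate for the Laplacian on `C_c^∞(ℝ^d)` -/
lemma cz_apriori (hd : 0 < d) (p : ℝ) (hp : 1 < p) : ∃ C : ℝ, 0 < C ∧ ∀ Z : Euc d → ℝ,
    Tst Set.univ Z → ∀ i j : Fin d,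
    eLpNorm (dd (coordDir i) (dd (coordDir j) Z)) (ENNReal.ofReal p) volume
      ≤ ENNReal.ofReal C * eLpNorm (lap Z) (ENNReal.ofReal p) volume := by
  obtain ⟨C, hC, H⟩ := cz_functional2 (d := d) hd
  have hpq := Real.HolderConjugate.conjExponent hp
  set q := Real.conjExponent p
  refine ⟨C q, hC q, fun Z hZ i j => ?_⟩
  set w := dd (coordDir i) (dd (coordDir j) Z) with hwdef
  have hw : Tst Set.univ w := (hZ.dd _).dd _
  obtain ⟨R, hR, hR0⟩ := hw.exists_radius
  set B := Metric.closedBall (0 : Euc d) R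
  have hBm : MeasurableSet B := Metric.isClosed_closedBall.measurableSet
  haveI : IsFiniteMeasure ((volume : Measure (Euc d)).restrict B) :=
    ⟨by rw [Measure.restrict_apply_univ]; exact measure_closedBall_lt_top⟩
  have hwB : B.indicator w = w := by
    funext x
    by_cases hx : x ∈ B
    · rw [Set.indicator_of_mem hx]
    · rw [Set.indicator_of_notMem hx, hR0 x (by simpa [B] using hx)]
  have hlapL : MemLp (lap Z) (ENNReal.ofReal p) volume := (lap_tst hZ).memLp _ _
  have key : eLpNorm w (ENNReal.ofReal p) (volume.restrict B) ≤
      ENNReal.ofReal (C q * (eLpNorm (lap Z) (ENNReal.ofReal p) volume).toReal) := by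
    apply norm_le_of_dual hpq (hw.memLp _ _) (mul_nonneg (hC q).le ENNReal.toReal_nonneg)
    intro f hf
    have hF : ∀ p, MemLp (B.indicator f) p volume := fun p => (memLp_indicator_iff_restrict hBm).2 (hf p)
    obtain ⟨T, hT1, hT2⟩ := H i j q hpq.symm.lt (tens 1 (B.indicator f)) (tens_one_memLp (hF _))
    have hm : tens 1 (lap Z) ∈ AllSub volume := fun p => tens_one_memLp ((lap_tst hZ).memLp _ _)
    have h1 := hT2 1 Z hZ hm
    have h2 := hT1 q p hpq.symm ⟨_, hm⟩ (tens_one_memLp (hF _))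
    rw [h1] at h2
    have e1 : ∀ z, tens 1 (B.indicator f) z * tens 1 w z = tens 1 (B.indicator (fun x => w x * f x)) z := by
      intro z
      by_cases h : z.1 ∈ Set.Ioc (0:ℝ) 1
      · by_cases h' : z.2 ∈ B
        · simp [tens, Set.indicator_of_mem h, Set.indicator_of_mem h']; ring
        · simp [tens, Set.indicator_of_mem h, Set.indicator_of_notMem h']
      · simp [tens, Set.indicator_of_notMem h]
    simp_rw [← hwdef, e1] at h2
    have hwf : AEStronglyMeasurable (B.indicator (fun x => w x * f x)) volume := by
      have := (hw.cont.aestronglyMeasurable (μ := volume)).mul (hF 1).1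
      refine this.congr (Filter.Eventually.of_forall fun x => ?_)
      by_cases h' : x ∈ B
      · simp [Set.indicator_of_mem h']
      · simp [Set.indicator_of_notMem h']
    rw [tens_one_integral hwf, integral_indicator hBm, tens_one_norm (hF q.toNNReal).1,
      tens_one_norm hlapL.1, eLpNorm_indicator_eq_eLpNorm_restrict hBm] at h2
    linarith
  rw [← eLpNorm_indicator_eq_eLpNorm_restrict hBm, hwB, ENNReal.ofReal_mul (hC q).le,
    ENNReal.ofReal_toReal hlapL.2.ne] at key
  exact key

end
end

section
open MeasureTheory
noncomputable section
variable {d : ℕ}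

lemma measureQ_eq (T : ℝ) (Ω : Set (Euc d)) :
    measureQ T Ω = (volume : Measure (ℝ × Euc d)).restrict (Set.Ioc 0 T ×ˢ Ω) := by
  rw [measureQ, Measure.prod_restrict, Measure.volume_eq_prod]

lemma measureQ_finite (T : ℝ) {Ω : Set (Euc d)} (hb : Bornology.IsBounded Ω) :
    IsFiniteMeasure (measureQ T Ω) := by
  haveI : IsFiniteMeasure ((volume : Measure (Euc d)).restrict Ω) :=
    ⟨by rw [Measure.restrict_apply_univ]; exact hb.measure_lt_top⟩
  unfold measureQ; infer_instance

/-- The local pressure. -/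
lemma exists_pi0 (hd : 0 < d) : ∃ C : ℝ → ℝ, (∀ r, 0 < C r) ∧
    ∀ (T : ℝ) (Ω : Set (Euc d)), MeasurableSet Ω → Bornology.IsBounded Ω → ∀ q : ℝ, 1 < q →
    ∀ H : ℝ × Euc d → Fin d → Fin d → ℝ, MemLp H (ENNReal.ofReal q) (measureQ T Ω) →
    ∃ π : ℝ × Euc d → ℝ, Measurable π ∧ MemLp π (ENNReal.ofReal q) (measureQ T Ω) ∧
      (∀ r : ℝ, 1 < r → eLpNorm π (ENNReal.ofReal r) (measureQ T Ω)
        ≤ ENNReal.ofReal (C r) * eLpNorm H (ENNReal.ofReal r) (measureQ T Ω)) ∧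
      ∀ (t : ℝ) (ζ : Euc d → ℝ), Tst Ω ζ →
        ∫ p, π p * tens t (lap ζ) p ∂(measureQ T Ω) =
          - ∑ i : Fin d, ∑ j : Fin d,
            ∫ p, H p i j * tens t (dd (coordDir i) (dd (coordDir j) ζ)) p ∂(measureQ T Ω) := by
  obtain ⟨C, hC, HC⟩ := cz_functional2 (d := d) hd
  have hd' : (0:ℝ) < d := by exact_mod_cast hd
  refine ⟨fun r => d * (d * C r), fun r => by have := hC r; positivity, ?_⟩
  intro T Ω hΩm hΩb q hq H hH
  haveI := measureQ_finite T hΩb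
  have hQm : MeasurableSet (Set.Ioc 0 T ×ˢ Ω) := measurableSet_Ioc.prod hΩm
  set Q := Set.Ioc 0 T ×ˢ Ω
  set μ := measureQ T Ω with hμ
  have hμQ : μ = volume.restrict Q := measureQ_eq T Ω
  have hcomp : ∀ i j, AEStronglyMeasurable (fun p => H p i j) μ := fun i j =>
    (show Continuous (fun M : Fin d → Fin d → ℝ => M i j) by fun_prop).comp_aestronglyMeasurable hH.1
  have hle : ∀ i j p, ‖H p i j‖ ≤ ‖H p‖ := fun i j p =>
    (norm_le_pi_norm (H p i) j).trans (norm_le_pi_norm (H p) i)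
  have hHr : ∀ r i j, eLpNorm (fun p => H p i j) r μ ≤ eLpNorm H r μ := fun r i j =>
    eLpNorm_mono (hle i j)
  have hHm : ∀ r i j, MemLp H r μ → MemLp (fun p => H p i j) r μ := fun r i j h =>
    ⟨hcomp i j, (hHr r i j).trans_lt h.2⟩
  have hext : ∀ r (g : ℝ × Euc d → ℝ), MemLp g r μ → MemLp (Q.indicator g) r volume := fun r g hg => by
    rw [memLp_indicator_iff_restrict hQm, ← hμQ]; exact hg
  have hextn : ∀ r (g : ℝ × Euc d → ℝ), eLpNorm (Q.indicator g) r volume = eLpNorm g r μ := fun r g => by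
    rw [eLpNorm_indicator_eq_eLpNorm_restrict hQm, ← hμQ]
  have hT := fun i j => HC i j q hq (Q.indicator (fun p => H p i j)) (hext _ _ (hHm _ i j hH))
  choose S hS1 hS2 using hT
  let E : AllSub μ →ₗ[ℝ] AllSub (volume : Measure (ℝ × Euc d)) :=
    { toFun := fun g => ⟨Q.indicator g, fun p => hext p _ (g.2 p)⟩
      map_add' := fun f g => by
        apply Subtype.ext
        exact Set.indicator_add Q _ _
      map_smul' := fun c f => by
        apply Subtype.ext
        exact Set.indicator_const_smul Q c _ }
  let L : AllSub μ →ₗ[ℝ] ℝ := - ∑ i, ∑ j, (S i j).comp E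
  have hLb : ∀ r r' : ℝ, r.HolderConjugate r' → MemLp H (ENNReal.ofReal r) μ → ∀ g : AllSub μ,
      |L g| ≤ (d * (d * C r) * (eLpNorm H (ENNReal.ofReal r) μ).toReal) *
        (eLpNorm (g : ℝ × Euc d → ℝ) (ENNReal.ofReal r') μ).toReal := by
    intro r r' hr hHL g
    have h1 : L g = - ∑ i, ∑ j, S i j (E g) := by simp [L]
    rw [h1, abs_neg]
    have h2 : ∀ i j, |S i j (E g)| ≤ C r * (eLpNorm H (ENNReal.ofReal r) μ).toReal *
        (eLpNorm (g : ℝ × Euc d → ℝ) (ENNReal.ofReal r') μ).toReal := by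
      intro i j
      refine (hS1 i j r r' hr (E g) (hext _ _ (hHm _ i j hHL))).trans ?_
      have e2 : eLpNorm ((E g : AllSub (volume : Measure (ℝ × Euc d))) : ℝ × Euc d → ℝ) (ENNReal.ofReal r') volume
        = eLpNorm (g : ℝ × Euc d → ℝ) (ENNReal.ofReal r') μ := hextn _ _
      rw [hextn, e2]
      have := (hC r).le
      gcongr
      · exact hHL.2.ne
      · exact hHr _ i j
    refine (Finset.abs_sum_le_sum_abs _ _).trans ?_
    refine (Finset.sum_le_sum fun i _ => (Finset.abs_sum_le_sum_abs _ _).trans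
      (Finset.sum_le_sum fun j _ => h2 i j)).trans ?_
    simp only [Finset.sum_const, Finset.card_univ, Fintype.card_fin, nsmul_eq_mul]
    apply le_of_eq; ring
  have hrep : ∀ r r' : ℝ, r.HolderConjugate r' → MemLp H (ENNReal.ofReal r) μ →
      ∃ π : ℝ × Euc d → ℝ, Measurable π ∧ MemLp π (ENNReal.ofReal r) μ ∧
        eLpNorm π (ENNReal.ofReal r) μ ≤ ENNReal.ofReal (d * (d * C r)) * eLpNorm H (ENNReal.ofReal r) μ ∧
        ∀ v : AllSub μ, Measurable (v : ℝ × Euc d → ℝ) → (∃ M, ∀ x, |(v : ℝ × Euc d → ℝ) x| ≤ M) →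
          L v = ∫ x, π x * (v : ℝ × Euc d → ℝ) x ∂μ := by
    intro r r' hr hHL
    have h0 := (hC r).le
    obtain ⟨π, h1, h2, h3, h4⟩ := lp_dual hr (AllSub μ) (fun v hv => hv _) L (by positivity)
      (hLb r r' hr hHL)
    refine ⟨π, h1, h2, ?_, h4⟩
    rwa [ENNReal.ofReal_mul (by positivity), ENNReal.ofReal_toReal hHL.2.ne] at h3
  have hqq := Real.HolderConjugate.conjExponent hq
  obtain ⟨π, hπm, hπL, hπb, hπ⟩ := hrep q _ hqq hH
  refine ⟨π, hπm, hπL, ?_, ?_⟩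
  · intro r hr
    by_cases hfin : MemLp H (ENNReal.ofReal r) μ
    · obtain ⟨π', hπm', hπL', hπb', hπ'⟩ := hrep r _ (Real.HolderConjugate.conjExponent hr) hfin
      have : π =ᵐ[μ] π' := by
        apply ae_eq_of_test (hπL.integrable (by simpa using hq.le)) (hπL'.integrable (by simpa using hr.le))
        intro v hv hvm hvb
        rw [← hπ ⟨v, hv⟩ hvm hvb, ← hπ' ⟨v, hv⟩ hvm hvb]
      rw [eLpNorm_congr_ae this]
      exact hπb'
    · have : eLpNorm H (ENNReal.ofReal r) μ = ⊤ := by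
        by_contra hne
        exact hfin ⟨hH.1, lt_top_iff_ne_top.2 hne⟩
      rw [this, ENNReal.mul_top]
      · exact le_top
      · have := hC r
        simp only [ne_eq, ENNReal.ofReal_eq_zero, not_le]; positivity
  · intro t ζ hζ
    have hζu : Tst Set.univ ζ := hζ.mono (Set.subset_univ _)
    obtain ⟨M, hM, hM'⟩ := (lap_tst hζ).bounded
    obtain ⟨R, hR, hR'⟩ := (lap_tst hζ).exists_radius
    have hall : AllLp volume (tens t (lap ζ)) := tens_allLp t (lap_tst hζ).cont hM' hR'
    have hallμ : AllLp μ (tens t (lap ζ)) := fun p => by rw [hμQ]; exact (hall p).restrict Q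
    have hb : ∀ p, |tens t (lap ζ) p| ≤ M := by
      intro p
      unfold tens
      by_cases h : p.1 ∈ Set.Ioc (0:ℝ) t
      · rw [Set.indicator_of_mem h, one_mul]; exact hM' _
      · rw [Set.indicator_of_notMem h, zero_mul, abs_zero]; exact hM.le
    have h1 := hπ ⟨_, hallμ⟩ (tens_meas t (lap_tst hζ).cont) ⟨M, hb⟩
    rw [← h1]
    have h2 : L ⟨_, hallμ⟩ = - ∑ i, ∑ j, S i j (E ⟨_, hallμ⟩) := by simp [L]
    rw [h2]
    congr 1
    refine Finset.sum_congr rfl fun i _ => Finset.sum_congr rfl fun j _ => ?_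
    -- split time: tens t restricted to Q equals tens (min t T)
    have e : ∀ (g : Euc d → ℝ), (∀ x, x ∉ Ω → g x = 0) → Q.indicator (tens t g) = tens (min t T) g := by
      intro g hg
      funext p
      by_cases hp2 : p.2 ∈ Ω
      · by_cases hp1 : p.1 ∈ Set.Ioc 0 T
        · rw [Set.indicator_of_mem (show p ∈ Q from ⟨hp1, hp2⟩)]
          unfold tens
          congr 1
          by_cases h : p.1 ≤ t
          · rw [Set.indicator_of_mem (show p.1 ∈ Set.Ioc 0 t from ⟨hp1.1, h⟩),
              Set.indicator_of_mem (show p.1 ∈ Set.Ioc 0 (min t T) from ⟨hp1.1, le_min h hp1.2⟩)]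
          · rw [Set.indicator_of_notMem (fun h' => h h'.2),
              Set.indicator_of_notMem (fun h' => h (h'.2.trans (min_le_left _ _)))]
        · rw [Set.indicator_of_notMem (show p ∉ Q from fun h => hp1 h.1)]
          unfold tens
          rw [Set.indicator_of_notMem (fun h' => hp1 ⟨h'.1, h'.2.trans (min_le_right _ _)⟩), zero_mul]
      · rw [Set.indicator_of_notMem (show p ∉ Q from fun h => hp2 h.2)]
        simp [tens, hg _ hp2]
    have hz : ∀ {g : Euc d → ℝ}, Tst Ω g → ∀ x, x ∉ Ω → g x = 0 := fun hg x hx =>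
      image_eq_zero_of_notMem_tsupport fun h => hx (hg.ts h)
    have e1 : Q.indicator (tens t (lap ζ)) = tens (min t T) (lap ζ) := e _ (hz (lap_tst hζ))
    have hmem : tens (min t T) (lap ζ) ∈ AllSub (volume : Measure (ℝ × Euc d)) := by
      rw [← e1]; exact fun p => hext p _ (hallμ p)
    have e2 : E ⟨_, hallμ⟩ = ⟨tens (min t T) (lap ζ), hmem⟩ := Subtype.ext e1
    rw [e2, hS2 i j _ ζ hζu hmem, hμQ, ← integral_indicator hQm]
    refine integral_congr_ae (Filter.Eventually.of_forall fun p => ?_)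
    have := congrFun (e _ (hz ((hζ.dd (coordDir j)).dd (coordDir i)))) p
    simp only
    rw [← this]
    by_cases hp : p ∈ Q
    · simp [Set.indicator_of_mem hp]
    · simp [Set.indicator_of_notMem hp]

end
end

section
open MeasureTheory
noncomputable section
variable {d : ℕ}

/-! ### Averages of translates and the segment lemma -/
section av
variable {S : Type*} [MeasurableSpace S]

lemma av_aux (μ : Measure S) {a : S → ℝ} (ha : Integrable a μ) {ξ : S → Euc d} (hξ : Measurable ξ)
    {E : Type} [NormedAddCommGroup E] [NormedSpace ℝ E] {φ : Euc d → E} (hc : Continuous φ)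
    (hs : HasCompactSupport φ) (x : Euc d) :
    Integrable (fun ω => a ω • φ (x - ξ ω)) μ := by
  obtain ⟨C, hC⟩ := hs.exists_bound_of_continuous hc
  refine Integrable.mono' (ha.norm.mul_const C) ?_ (Filter.Eventually.of_forall fun ω => ?_)
  · refine ha.1.smul ?_
    exact (hc.comp_stronglyMeasurable
      ((stronglyMeasurable_const).sub hξ.stronglyMeasurable)).aestronglyMeasurable
  · rw [norm_smul]
    gcongr
    exact hC _

lemma av_hasFDerivAt (μ : Measure S) {a : S → ℝ} (ha : Integrable a μ) {ξ : S → Euc d} (hξ : Measurable ξ)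
    {E : Type} [NormedAddCommGroup E] [NormedSpace ℝ E] {φ : Euc d → E}
    (hφ : ContDiff ℝ (⊤ : ℕ∞) φ)
    (hs : HasCompactSupport φ) (x : Euc d) :
    HasFDerivAt (fun x => ∫ ω, a ω • φ (x - ξ ω) ∂μ) (∫ ω, a ω • fderiv ℝ φ (x - ξ ω) ∂μ) x := by
  have hs' : HasCompactSupport (fderiv ℝ φ) := hs.fderiv ℝ
  have hc' : Continuous (fderiv ℝ φ) := hφ.continuous_fderiv (by simp)
  obtain ⟨C, hC⟩ := hs'.exists_bound_of_continuous hc'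
  refine hasFDerivAt_integral_of_dominated_of_fderiv_le (F := fun x ω => a ω • φ (x - ξ ω))
    (F' := fun x ω => a ω • fderiv ℝ φ (x - ξ ω)) (s := Set.univ) (bound := fun ω => ‖a ω‖ * C)
    Filter.univ_mem ?_ (av_aux μ ha hξ hφ.continuous hs x) (av_aux μ ha hξ hc' hs' x).1 ?_
    (ha.norm.mul_const C) ?_
  · exact Filter.Eventually.of_forall fun y => (av_aux μ ha hξ hφ.continuous hs y).1
  · refine Filter.Eventually.of_forall fun ω y _ => ?_
    rw [norm_smul]
    gcongr
    exact hC _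
  · refine Filter.Eventually.of_forall fun ω y _ => ?_
    have h1 : HasFDerivAt (fun y => φ (y - ξ ω)) (fderiv ℝ φ (y - ξ ω)) y := by
      have := (hφ.differentiable (by simp) (y - ξ ω)).hasFDerivAt.comp y ((hasFDerivAt_id y).sub_const (ξ ω))
      exact this
    exact h1.const_smul (a ω)

lemma av_contDiff_nat (μ : Measure S) {a : S → ℝ} (ha : Integrable a μ) {ξ : S → Euc d}
    (hξ : Measurable ξ) (n : ℕ) :
    ∀ (E : Type) [NormedAddCommGroup E] [NormedSpace ℝ E] (φ : Euc d → E),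
    ContDiff ℝ (⊤ : ℕ∞) φ → HasCompactSupport φ →
    ContDiff ℝ n (fun x => ∫ ω, a ω • φ (x - ξ ω) ∂μ) := by
  induction n with
  | zero =>
    intro E _ _ φ hφ hs
    rw [Nat.cast_zero, contDiff_zero]
    exact continuous_iff_continuousAt.2 fun x => (av_hasFDerivAt μ ha hξ hφ hs x).continuousAt
  | succ n ih =>
    intro E _ _ φ hφ hs
    rw [Nat.cast_add, Nat.cast_one, contDiff_succ_iff_fderiv]
    refine ⟨fun x => (av_hasFDerivAt μ ha hξ hφ hs x).differentiableAt, ?_, ?_⟩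
    · intro h
      exact absurd h (by exact_mod_cast WithTop.coe_ne_top (a := ((n:ℕ∞))))
    · have : fderiv ℝ (fun x => ∫ ω, a ω • φ (x - ξ ω) ∂μ) =
          fun x => ∫ ω, a ω • fderiv ℝ φ (x - ξ ω) ∂μ := by
        funext x; exact (av_hasFDerivAt μ ha hξ hφ hs x).fderiv
      rw [this]
      exact ih _ _ (hφ.fderiv_right (by norm_cast)) (hs.fderiv ℝ)

/-- average of translates of `φ` -/
def av (μ : Measure S) (a : S → ℝ) (ξ : S → Euc d) (φ : Euc d → ℝ) : Euc d → ℝ :=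
  fun x => ∫ ω, a ω * φ (x - ξ ω) ∂μ

variable {μ : Measure S} {a : S → ℝ} {ξ : S → Euc d} {φ : Euc d → ℝ}

lemma av_integrable (ha : Integrable a μ) (hξ : Measurable ξ)
    (hφ : Tst Set.univ φ) (x : Euc d) : Integrable (fun ω => a ω * φ (x - ξ ω)) μ :=
  av_aux μ ha hξ hφ.cont hφ.cs x

lemma av_contDiff (ha : Integrable a μ) (hξ : Measurable ξ) (hφ : Tst Set.univ φ) :
    ContDiff ℝ (⊤ : ℕ∞) (av μ a ξ φ) := by
  rw [contDiff_infty]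
  intro n
  exact av_contDiff_nat μ ha hξ n ℝ φ hφ.cd hφ.cs

lemma dd_av (ha : Integrable a μ) (hξ : Measurable ξ) (hφ : Tst Set.univ φ) (v : Euc d) :
    dd v (av μ a ξ φ) = av μ a ξ (dd v φ) := by
  funext x
  have h1 := (av_hasFDerivAt μ ha hξ hφ.cd hφ.cs x).fderiv
  simp only [dd, av]
  have h2 : Integrable (fun ω => a ω • fderiv ℝ φ (x - ξ ω)) μ :=
    av_aux μ ha hξ (hφ.cd.continuous_fderiv (by simp)) (hφ.cs.fderiv ℝ) x
  have h3 := ContinuousLinearMap.integral_apply h2 v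
  change fderiv ℝ (fun x => ∫ ω, a ω • φ (x - ξ ω) ∂μ) x v = _
  rw [h1, h3]
  rfl

lemma av_tst {Ω K : Set (Euc d)} (ha : Integrable a μ) (hξ : Measurable ξ) (hφ : Tst Set.univ φ)
    (hK : IsCompact K) (hKΩ : K ⊆ Ω)
    (h : ∀ᵐ ω ∂μ, a ω ≠ 0 → ∀ k ∈ tsupport φ, k + ξ ω ∈ K) : Tst Ω (av μ a ξ φ) := by
  refine Tst.of_support (av_contDiff ha hξ hφ) hK hKΩ ?_
  intro x hx
  refine integral_eq_zero_of_ae ?_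
  filter_upwards [h] with ω hω
  by_cases h0 : a ω = 0
  · simp [h0]
  · have : φ (x - ξ ω) = 0 := by
      by_contra hne
      have := hω h0 (x - ξ ω) (subset_tsupport _ hne)
      rw [sub_add_cancel] at this
      exact hx this
    simp [this]

/-- the measure on `S × (0,1]` -/
abbrev seg (μ : Measure S) : Measure (S × ℝ) := μ.prod (volume.restrict (Set.Ioc 0 1))

/-- segment field -/
def segV (μ : Measure S) (a : S → ℝ) (ξ b : S → Euc d) (φ : Euc d → ℝ) (i : Fin d) : Euc d → ℝ :=
  av (seg μ) (fun z => a z.1 * b z.1 i) (fun z => ξ z.1 + z.2 • b z.1) φ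

lemma coord_meas {b : S → Euc d} (hb : Measurable b) (i : Fin d) : Measurable fun ω => b ω i :=
  (EuclideanSpace.proj (𝕜 := ℝ) i : Euc d →L[ℝ] ℝ).continuous.measurable.comp hb

lemma seg_a_integrable [SFinite μ] (ha : Integrable a μ) {b : S → Euc d} (hb : Measurable b) {B : ℝ}
    (hB : ∀ ω, a ω ≠ 0 → ‖b ω‖ ≤ B) (i : Fin d) :
    Integrable (fun z : S × ℝ => a z.1 * b z.1 i) (seg μ) := by
  have h1 : Integrable (fun ω => a ω * b ω i) μ := by
    refine Integrable.mono' (ha.norm.mul_const B) (ha.1.mul (coord_meas hb i).aestronglyMeasurable) ?_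
    refine Filter.Eventually.of_forall fun ω => ?_
    rw [norm_mul]
    by_cases h0 : a ω = 0
    · simp [h0]
    · gcongr
      exact (PiLp.norm_apply_le (b ω) i).trans (hB ω h0)
  exact h1.comp_fst _

lemma seg_xi_meas (hξ : Measurable ξ) {b : S → Euc d} (hb : Measurable b) :
    Measurable (fun z : S × ℝ => ξ z.1 + z.2 • b z.1) :=
  (hξ.comp measurable_fst).add (measurable_snd.smul (hb.comp measurable_fst))

lemma seg_tst [SFinite μ] {Ω K : Set (Euc d)} (ha : Integrable a μ) (hξ : Measurable ξ) {b : S → Euc d}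
    (hb : Measurable b) {B : ℝ} (hB : ∀ ω, a ω ≠ 0 → ‖b ω‖ ≤ B) (hφ : Tst Set.univ φ)
    (hK : IsCompact K) (hKΩ : K ⊆ Ω)
    (h : ∀ ω, a ω ≠ 0 → ∀ τ ∈ Set.Icc (0:ℝ) 1, ∀ k ∈ tsupport φ, k + (ξ ω + τ • b ω) ∈ K) (i : Fin d) :
    Tst Ω (segV μ a ξ b φ i) := by
  refine av_tst (seg_a_integrable ha hb hB i) (seg_xi_meas hξ hb) hφ hK hKΩ ?_
  have : ∀ᵐ z ∂(seg μ), z.2 ∈ Set.Ioc (0:ℝ) 1 := by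
    have h1 : ∀ᵐ τ ∂((volume : Measure ℝ).restrict (Set.Ioc 0 1)), τ ∈ Set.Ioc (0:ℝ) 1 :=
      ae_restrict_mem measurableSet_Ioc
    exact Measure.quasiMeasurePreserving_snd.ae h1
  filter_upwards [this] with z hz hne k hk
  exact h z.1 (left_ne_zero_of_mul hne) z.2 ⟨hz.1.le, hz.2⟩ k hk

lemma sum_coord (f : Euc d → ℝ) (w x : Euc d) : ∑ i, w i * dd (coordDir i) f x = dd w f x := by
  have : w = ∑ i, w i • coordDir i := by
    ext j
    simp [coordDir, Finset.sum_apply, Pi.single_apply]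
  conv_rhs => rw [this]
  simp only [dd, map_sum, map_smul, smul_eq_mul]

lemma seg_div [SFinite μ] (ha : Integrable a μ) (hξ : Measurable ξ) {b : S → Euc d}
    (hb : Measurable b) {B : ℝ} (hB : ∀ ω, a ω ≠ 0 → ‖b ω‖ ≤ B) (hφ : Tst Set.univ φ) (x : Euc d) :
    ∑ i, dd (coordDir i) (segV μ a ξ b φ i) x =
      av μ a ξ φ x - av μ a (fun ω => ξ ω + b ω) φ x := by
  have h1 : ∀ i, dd (coordDir i) (segV μ a ξ b φ i) x =
      ∫ z, a z.1 * b z.1 i * dd (coordDir i) φ (x - (ξ z.1 + z.2 • b z.1)) ∂(seg μ) := by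
    intro i
    unfold segV
    rw [dd_av (seg_a_integrable ha hb hB i) (seg_xi_meas hξ hb) hφ]
    rfl
  have hintg : ∀ i, Integrable (fun z : S × ℝ => a z.1 * b z.1 i *
      dd (coordDir i) φ (x - (ξ z.1 + z.2 • b z.1))) (seg μ) := fun i =>
    av_integrable (seg_a_integrable ha hb hB i) (seg_xi_meas hξ hb) (hφ.dd _) x
  simp_rw [h1]
  rw [← integral_finsetSum _ fun i _ => by exact hintg i]
  have h2 : ∀ z : S × ℝ, ∑ i, a z.1 * b z.1 i * dd (coordDir i) φ (x - (ξ z.1 + z.2 • b z.1))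
      = a z.1 * dd (b z.1) φ (x - (ξ z.1 + z.2 • b z.1)) := by
    intro z
    rw [← sum_coord, Finset.mul_sum]
    exact Finset.sum_congr rfl fun i _ => by ring
  have hint2 : Integrable (fun z : S × ℝ => a z.1 * dd (b z.1) φ (x - (ξ z.1 + z.2 • b z.1))) (seg μ) := by
    simp_rw [← h2]
    exact integrable_finsetSum _ fun i _ => hintg i
  simp_rw [h2]
  rw [integral_prod _ hint2]
  unfold av
  have hI2 : Integrable (fun ω => a ω * φ (x - (ξ ω + b ω))) μ :=
    av_integrable ha (ξ := fun ω => ξ ω + b ω) (hξ.add hb) hφ x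
  rw [← integral_sub (av_integrable ha hξ hφ x) hI2]
  refine integral_congr_ae (Filter.Eventually.of_forall fun ω => ?_)
  simp only
  rw [integral_const_mul, ← mul_sub]
  congr 1
  rw [← intervalIntegral.integral_of_le zero_le_one]
  have hder : ∀ τ ∈ Set.uIcc (0:ℝ) 1, HasDerivAt (fun τ => - φ (x - (ξ ω + τ • b ω)))
      (dd (b ω) φ (x - (ξ ω + τ • b ω))) τ := by
    intro τ _
    have hl := hasDerivAt_line hφ.diff (x - ξ ω) (-(b ω)) τ
    have e1 : ∀ τ : ℝ, x - ξ ω + τ • -(b ω) = x - (ξ ω + τ • b ω) := by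
      intro τ; rw [smul_neg]; abel
    simp_rw [e1] at hl
    have := hl.neg
    refine this.congr_deriv ?_
    simp [dd]
  have hcont : Continuous fun τ : ℝ => dd (b ω) φ (x - (ξ ω + τ • b ω)) :=
    (hφ.dd (b ω)).cont.comp (by fun_prop)
  rw [intervalIntegral.integral_eq_sub_of_hasDerivAt hder (hcont.intervalIntegrable _ _)]
  simp; ring

/-- integration by parts in the averaging variable -/
lemma av_by_parts {ψ f : Euc d → ℝ} (hψ : Tst Set.univ ψ) (hf : Tst Set.univ f) {s : ℝ} (hs : s ≠ 0)
    (v x : Euc d) : ∫ y, ψ y * dd v f (x - s • y) = s⁻¹ * ∫ y, dd v ψ y * f (x - s • y) := by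
  have hg : ContDiff ℝ (⊤ : ℕ∞) (fun y => f (x - s • y)) := hf.cd.comp (by fun_prop)
  have h1 : ∀ y, dd v (fun y => f (x - s • y)) y = - s * dd v f (x - s • y) := by
    intro y
    have h2 : HasFDerivAt (fun y => x - s • y) (-(s • ContinuousLinearMap.id ℝ (Euc d))) y :=
      ((hasFDerivAt_id y).const_smul s).const_sub x
    have h3 := (hf.diff (x - s • y)).hasFDerivAt.comp y h2
    have h4 : fderiv ℝ (fun y => f (x - s • y)) y = _ := h3.fderiv
    simp only [dd]
    rw [h4]
    simp
  have h2 := integral_mul_dd hg hψ v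
  simp_rw [h1] at h2
  have e1 : ∫ y, ψ y * dd v f (x - s • y) = - s⁻¹ * ∫ y, -s * dd v f (x - s • y) * ψ y := by
    rw [← integral_const_mul]
    refine integral_congr_ae (Filter.Eventually.of_forall fun y => ?_)
    simp only
    field_simp
  have e2 : ∫ y, dd v ψ y * f (x - s • y) = ∫ y, f (x - s • y) * dd v ψ y :=
    integral_congr_ae (Filter.Eventually.of_forall fun y => mul_comm _ _)
  rw [e1, e2, h2]; ring

end av
end
end

section
open MeasureTheory
noncomputable section
variable {d : ℕ}

/-! ### Schur test for averages of translates -/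
open scoped ENNReal

lemma schur {S : Type*} [MeasurableSpace S] (μ : Measure S) [SFinite μ] {p q : ℝ}
    (hpq : p.HolderConjugate q) (k : Euc d → S → ℝ≥0∞) (hk : Measurable (Function.uncurry k))
    {ξ : S → Euc d} (hξ : Measurable ξ) {G : Euc d → ℝ≥0∞} (hG : Measurable G)
    {h : Euc d → ℝ≥0∞} (hh : Measurable h) (A B : ℝ≥0∞)
    (h0 : ∀ x ω, k x ω ≠ 0 → h (x - ξ ω) ≠ 0 ∧ h (x - ξ ω) ≠ ⊤)
    (h1 : ∀ x, ∫⁻ ω, k x ω * h (x - ξ ω) ^ q ∂μ ≤ A * h x ^ q)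
    (h2 : ∀ z, ∫⁻ ω, k (z + ξ ω) ω * h (z + ξ ω) ^ p ∂μ ≤ B * h z ^ p) :
    ∫⁻ x, (∫⁻ ω, k x ω * G (x - ξ ω) ∂μ) ^ p ≤ A ^ (p / q) * B * ∫⁻ x, G x ^ p := by
  have hp := hpq.pos
  have hq := hpq.symm.pos
  have hkx : ∀ x, Measurable (k x) := fun x => hk.of_uncurry_left
  have hsub : Measurable fun z : Euc d × S => z.1 - ξ z.2 :=
    measurable_fst.sub (hξ.comp measurable_snd)
  have hadd : Measurable fun z : Euc d × S => z.1 + ξ z.2 :=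
    measurable_fst.add (hξ.comp measurable_snd)
  have hk' : Measurable fun z : Euc d × S => k z.1 z.2 := hk
  have step : ∀ x, (∫⁻ ω, k x ω * G (x - ξ ω) ∂μ) ^ p ≤
      A ^ (p / q) * ∫⁻ ω, h x ^ p * (k x ω * (h (x - ξ ω))⁻¹ ^ p * G (x - ξ ω) ^ p) ∂μ := by
    intro x
    have hx : Measurable fun ω => x - ξ ω := measurable_const.sub hξ
    have e1 : ∀ ω, k x ω * G (x - ξ ω) = (fun ω => k x ω ^ (1 / q) * h (x - ξ ω)) ω *
        (fun ω => k x ω ^ (1 / p) * ((h (x - ξ ω))⁻¹ * G (x - ξ ω))) ω := by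
      intro ω
      simp only
      by_cases hz : k x ω = 0
      · simp [hz, hq, hp]
      · obtain ⟨ha, hb⟩ := h0 x ω hz
        have hpp : k x ω ^ (1 / q) * k x ω ^ (1 / p) = k x ω := by
          rw [← ENNReal.rpow_add_of_nonneg _ _ (by positivity) (by positivity)]
          have : 1 / q + 1 / p = 1 := by
            have := hpq.inv_add_inv_eq_one
            rw [one_div, one_div, add_comm]; exact this
          rw [this, ENNReal.rpow_one]
        calc k x ω * G (x - ξ ω)
            = (k x ω ^ (1 / q) * k x ω ^ (1 / p)) * (h (x - ξ ω) * (h (x - ξ ω))⁻¹) * G (x - ξ ω) := by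
              rw [hpp, ENNReal.mul_inv_cancel ha hb, mul_one]
          _ = _ := by ring
    have e2 := ENNReal.lintegral_mul_le_Lp_mul_Lq μ hpq.symm
      (f := fun ω => k x ω ^ (1 / q) * h (x - ξ ω))
      (g := fun ω => k x ω ^ (1 / p) * ((h (x - ξ ω))⁻¹ * G (x - ξ ω)))
      (((hkx x).pow_const _).mul (hh.comp hx)).aemeasurable
      (((hkx x).pow_const _).mul ((hh.comp hx).inv.mul (hG.comp hx))).aemeasurable
    have e3 : ∀ ω, (k x ω ^ (1 / q) * h (x - ξ ω)) ^ q = k x ω * h (x - ξ ω) ^ q := by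
      intro ω
      rw [ENNReal.mul_rpow_of_nonneg _ _ hq.le, ← ENNReal.rpow_mul, one_div_mul_cancel hq.ne',
        ENNReal.rpow_one]
    have e4 : ∀ ω, (k x ω ^ (1 / p) * ((h (x - ξ ω))⁻¹ * G (x - ξ ω))) ^ p =
        k x ω * (h (x - ξ ω))⁻¹ ^ p * G (x - ξ ω) ^ p := by
      intro ω
      rw [ENNReal.mul_rpow_of_nonneg _ _ hp.le, ENNReal.mul_rpow_of_nonneg _ _ hp.le,
        ← ENNReal.rpow_mul, one_div_mul_cancel hp.ne', ENNReal.rpow_one, mul_assoc]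
    have e5 : ∫⁻ ω, k x ω * G (x - ξ ω) ∂μ ≤
        (A * h x ^ q) ^ (1 / q) *
        (∫⁻ ω, k x ω * (h (x - ξ ω))⁻¹ ^ p * G (x - ξ ω) ^ p ∂μ) ^ (1 / p) := by
      rw [lintegral_congr e1]
      refine e2.trans ?_
      simp_rw [e3, e4]
      gcongr
      exact h1 x
    have hmx : Measurable fun ω => k x ω * (h (x - ξ ω))⁻¹ ^ p * G (x - ξ ω) ^ p :=
      ((hkx x).mul ((hh.comp hx).inv.pow_const _)).mul ((hG.comp hx).pow_const _)
    rw [lintegral_const_mul _ hmx]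
    calc _ ≤ ((A * h x ^ q) ^ (1 / q) *
        (∫⁻ ω, k x ω * (h (x - ξ ω))⁻¹ ^ p * G (x - ξ ω) ^ p ∂μ) ^ (1 / p)) ^ p := by gcongr
      _ = _ := by
        rw [ENNReal.mul_rpow_of_nonneg _ _ hp.le, ← ENNReal.rpow_mul, ← ENNReal.rpow_mul,
          one_div_mul_cancel hp.ne', ENNReal.rpow_one,
          ENNReal.mul_rpow_of_nonneg _ _ (by positivity), ← ENNReal.rpow_mul, mul_assoc]
        congr 2
        · ring_nf
        · congr 1; field_simp
  have hmeas : Measurable (Function.uncurry fun (x : Euc d) (ω : S) =>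
      h x ^ p * (k x ω * (h (x - ξ ω))⁻¹ ^ p * G (x - ξ ω) ^ p)) := by
    refine ((hh.comp measurable_fst).pow_const _).mul ((hk'.mul ?_).mul ?_)
    · exact (hh.comp hsub).inv.pow_const _
    · exact (hG.comp hsub).pow_const _
  have hmeas2 : Measurable (Function.uncurry fun (x : Euc d) (ω : S) =>
      h (x + ξ ω) ^ p * (k (x + ξ ω) ω * (h x)⁻¹ ^ p * G x ^ p)) := by
    refine ((hh.comp hadd).pow_const _).mul ((?_ : Measurable _).mul ?_)
    · exact (hk.comp (hadd.prodMk measurable_snd)).mul ((hh.comp measurable_fst).inv.pow_const _)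
    · exact (hG.comp measurable_fst).pow_const _
  calc ∫⁻ x, (∫⁻ ω, k x ω * G (x - ξ ω) ∂μ) ^ p
      ≤ ∫⁻ x, A ^ (p / q) * ∫⁻ ω, h x ^ p * (k x ω * (h (x - ξ ω))⁻¹ ^ p * G (x - ξ ω) ^ p) ∂μ :=
        lintegral_mono step
    _ = A ^ (p / q) * ∫⁻ x, ∫⁻ ω, h x ^ p * (k x ω * (h (x - ξ ω))⁻¹ ^ p * G (x - ξ ω) ^ p) ∂μ := by
        exact lintegral_const_mul _ hmeas.lintegral_prod_right'
    _ = A ^ (p / q) * ∫⁻ ω, (∫⁻ x, h x ^ p * (k x ω * (h (x - ξ ω))⁻¹ ^ p * G (x - ξ ω) ^ p)) ∂μ := by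
        rw [lintegral_lintegral_swap hmeas.aemeasurable]
    _ = A ^ (p / q) * ∫⁻ ω, (∫⁻ x, h (x + ξ ω) ^ p * (k (x + ξ ω) ω * (h x)⁻¹ ^ p * G x ^ p)) ∂μ := by
        congr 1
        refine lintegral_congr fun ω => ?_
        rw [← lintegral_add_right_eq_self _ (ξ ω)]
        simp only [add_sub_cancel_right]
    _ = A ^ (p / q) * ∫⁻ x, ∫⁻ ω, h (x + ξ ω) ^ p * (k (x + ξ ω) ω * (h x)⁻¹ ^ p * G x ^ p) ∂μ := by
        rw [lintegral_lintegral_swap hmeas2.aemeasurable]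
    _ ≤ A ^ (p / q) * ∫⁻ x, B * G x ^ p := by
        gcongr with x
        have hx : Measurable fun ω => x + ξ ω := measurable_const.add hξ
        have hm : Measurable fun ω => k (x + ξ ω) ω * h (x + ξ ω) ^ p :=
          (hk.comp (hx.prodMk measurable_id)).mul ((hh.comp hx).pow_const _)
        calc _ = ∫⁻ ω, (k (x + ξ ω) ω * h (x + ξ ω) ^ p) * ((h x)⁻¹ ^ p * G x ^ p) ∂μ :=
              lintegral_congr fun ω => by ring
          _ = (∫⁻ ω, k (x + ξ ω) ω * h (x + ξ ω) ^ p ∂μ) * ((h x)⁻¹ ^ p * G x ^ p) := by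
              rw [lintegral_mul_const _ hm]
          _ ≤ B * h x ^ p * ((h x)⁻¹ ^ p * G x ^ p) := by gcongr; exact h2 x
          _ = B * ((h x ^ p * (h x)⁻¹ ^ p) * G x ^ p) := by ring
          _ ≤ B * (1 * G x ^ p) := by
              gcongr
              rw [← ENNReal.mul_rpow_of_nonneg _ _ hp.le]
              calc _ ≤ (1:ℝ≥0∞) ^ p := by gcongr; exact ENNReal.mul_inv_le_one _
                _ = 1 := ENNReal.one_rpow _
          _ = B * G x ^ p := by rw [one_mul]
    _ = _ := by rw [lintegral_const_mul _ (hG.pow_const _), mul_assoc]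

/-- from `lintegral` to `eLpNorm` -/
lemma eLpNorm_le_of_lintegral {p : ℝ} (hp : 0 < p) {f : Euc d → ℝ} {F G : Euc d → ℝ≥0∞} {C : ℝ≥0∞}
    (hf : ∀ x, ENNReal.ofReal |f x| ≤ F x) (h : ∫⁻ x, F x ^ p ≤ C ^ p * ∫⁻ x, G x ^ p) :
    eLpNorm f (ENNReal.ofReal p) volume ≤ C * (∫⁻ x, G x ^ p) ^ (1 / p) := by
  rw [eLpNorm_eq_lintegral_rpow_enorm_toReal (by simpa using hp) (by simp), ENNReal.toReal_ofReal hp.le]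
  calc _ ≤ (C ^ p * ∫⁻ x, G x ^ p) ^ (1 / p) := by
        gcongr
        refine le_trans (lintegral_mono fun x => ?_) h
        gcongr
        rw [Real.enorm_eq_ofReal_abs]; exact hf x
    _ = _ := by
        rw [ENNReal.mul_rpow_of_nonneg _ _ (by positivity), ← ENNReal.rpow_mul,
          mul_one_div_cancel hp.ne', ENNReal.rpow_one]

lemma eLpNorm_real {p : ℝ} (hp : 0 < p) (f : Euc d → ℝ) :
    eLpNorm f (ENNReal.ofReal p) volume = (∫⁻ x, (ENNReal.ofReal |f x|) ^ p) ^ (1 / p) := by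
  rw [eLpNorm_eq_lintegral_rpow_enorm_toReal (by simpa using hp) (by simp), ENNReal.toReal_ofReal hp.le]
  simp_rw [Real.enorm_eq_ofReal_abs]

/-- Minkowski's inequality for averages of translates -/
lemma av_norm {S : Type*} [MeasurableSpace S] {μ : Measure S} [SFinite μ] {p : ℝ} (hp : 1 < p)
    {a : S → ℝ} (ha : Measurable a) {ξ : S → Euc d} (hξ : Measurable ξ) {φ : Euc d → ℝ}
    (hφ : Measurable φ) {A : ℝ≥0∞} (hA : ∫⁻ ω, ENNReal.ofReal |a ω| ∂μ ≤ A) :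
    eLpNorm (av μ a ξ φ) (ENNReal.ofReal p) volume ≤ A * eLpNorm φ (ENNReal.ofReal p) volume := by
  have hpq := Real.HolderConjugate.conjExponent hp
  set q := p.conjExponent
  have hp0 : 0 < p := by linarith
  rw [eLpNorm_real hp0 φ]
  refine eLpNorm_le_of_lintegral hp0 (F := fun x => ∫⁻ ω, ENNReal.ofReal |a ω| *
    ENNReal.ofReal |φ (x - ξ ω)| ∂μ) ?_ ?_
  · intro x
    have := enorm_integral_le_lintegral_enorm (μ := μ) (fun ω => a ω * φ (x - ξ ω))
    rw [Real.enorm_eq_ofReal_abs] at this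
    refine this.trans (le_of_eq (lintegral_congr fun ω => ?_))
    rw [Real.enorm_eq_ofReal_abs, abs_mul, ENNReal.ofReal_mul (abs_nonneg _)]
  · have hk : Measurable (Function.uncurry fun (_ : Euc d) (ω : S) => ENNReal.ofReal |a ω|) :=
      (continuous_abs.measurable.comp (ha.comp measurable_snd)).ennreal_ofReal
    have := schur μ hpq (fun _ ω => ENNReal.ofReal |a ω|) hk hξ
      (G := fun x => ENNReal.ofReal |φ x|) (continuous_abs.measurable.comp hφ).ennreal_ofReal
      (h := fun _ => 1) measurable_const A A (by simp) (by simpa using hA) (by simpa using hA)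
    refine this.trans (le_of_eq ?_)
    congr 1
    have e : p / q + 1 = p := by
      have h1 := hpq.symm.pos
      have := hpq.mul_eq_add
      field_simp; linarith
    conv_rhs => rw [← e]
    rw [ENNReal.rpow_add_of_nonneg _ _ (div_nonneg hp0.le hpq.symm.nonneg) zero_le_one, ENNReal.rpow_one]
end
end

section
open MeasureTheory
noncomputable section
variable {d : ℕ}

/-! ### Functions that differ by a compactly supported divergence -/

/-- `θ` and `θ'` differ by the divergence of a test field -/
def Cnn (Ω : Set (Euc d)) (θ θ' : Euc d → ℝ) : Prop :=
  ∃ W : Fin d → Euc d → ℝ, (∀ i, Tst Ω (W i)) ∧ ∀ x, ∑ i, dd (coordDir i) (W i) x = θ x - θ' x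

lemma Cnn.symm {Ω : Set (Euc d)} {θ θ' : Euc d → ℝ} (h : Cnn Ω θ θ') : Cnn Ω θ' θ := by
  obtain ⟨W, hW, hd⟩ := h
  refine ⟨fun i x => (-1) * W i x, fun i => (hW i).const_mul _, fun x => ?_⟩
  have : ∀ i, dd (coordDir i) (fun x => (-1) * W i x) x = (-1) * dd (coordDir i) (W i) x := by
    intro i
    simp [dd, fderiv_const_mul ((hW i).diff x)]
  simp_rw [this, ← Finset.mul_sum, hd]; ring

lemma Cnn.trans {Ω : Set (Euc d)} {θ θ' θ'' : Euc d → ℝ} (h : Cnn Ω θ θ') (h' : Cnn Ω θ' θ'') :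
    Cnn Ω θ θ'' := by
  obtain ⟨W, hW, hd⟩ := h
  obtain ⟨W', hW', hd'⟩ := h'
  refine ⟨fun i x => W i x + W' i x, fun i => (hW i).add (hW' i), fun x => ?_⟩
  have : ∀ i, dd (coordDir i) (fun x => W i x + W' i x) x =
      dd (coordDir i) (W i) x + dd (coordDir i) (W' i) x := by
    intro i
    simp only [dd]
    rw [fderiv_fun_add ((hW i).diff x) ((hW' i).diff x)]; rfl
  simp_rw [this, Finset.sum_add_distrib, hd, hd']; ring

lemma cnn_aux {Ω : Set (Euc d)} {c : Euc d} {r : ℝ} (hΩ : Metric.ball c (2 * r) ⊆ Ω)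
    {θ θ' : Euc d → ℝ} (h : Tst (Metric.ball c r) θ) (h' : Tst (Metric.ball c r) θ') (h1 : ∫ x, θ' x = 1) :
    Cnn Ω θ (fun x => ∫ y, θ' y * θ (x - (y - c))) := by
  have hm : Measurable fun y : Euc d => y - c := measurable_id.sub_const c
  have hi : Integrable θ' := (h'.mono (Set.subset_univ _)).integrable
  have hB : ∀ y, θ' y ≠ 0 → ‖y - c‖ ≤ r := by
    intro y hy
    have := h'.ts (subset_tsupport _ hy)
    rw [Metric.mem_ball, dist_eq_norm] at this
    exact this.le
  have hφ := h.mono (Set.subset_univ _)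
  obtain ⟨s, hs, hsr⟩ : ∃ s < r, tsupport θ ⊆ Metric.closedBall c s := by
    have hc : IsCompact (tsupport θ) := h.cs
    rcases (tsupport θ).eq_empty_or_nonempty with he | hne
    · exact ⟨r - 1, by linarith, by simp [he]⟩
    · obtain ⟨x, hx, hmax⟩ := hc.exists_isMaxOn hne (f := fun x => dist x c)
        (continuous_id.dist continuous_const).continuousOn
      exact ⟨dist x c, h.ts hx, fun y hy => hmax hy⟩
  have hK : ∀ ω, θ' ω ≠ 0 → ∀ τ ∈ Set.Icc (0:ℝ) 1, ∀ k ∈ tsupport θ,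
      k + ((fun _ => (0 : Euc d)) ω + τ • (ω - c)) ∈ Metric.closedBall c (s + r) := by
    intro ω hω τ hτ k hk
    rw [Metric.mem_closedBall, dist_eq_norm]
    have e : k + ((fun _ => (0 : Euc d)) ω + τ • (ω - c)) - c = (k - c) + τ • (ω - c) := by
      simp only [zero_add]; abel
    rw [e]
    refine (norm_add_le _ _).trans (add_le_add ?_ ?_)
    · have := hsr hk
      rwa [Metric.mem_closedBall, dist_eq_norm] at this
    · rw [norm_smul, Real.norm_of_nonneg hτ.1]
      have := hB ω hω
      nlinarith [hτ.1, hτ.2, norm_nonneg (ω - c)]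
  refine ⟨segV volume θ' (fun _ => 0) (fun y => y - c) θ, fun i => ?_, fun x => ?_⟩
  · refine seg_tst hi measurable_const hm hB hφ (isCompact_closedBall c (s + r)) ?_ hK i
    exact (Metric.closedBall_subset_ball (by linarith)).trans hΩ
  · rw [seg_div hi measurable_const hm hB hφ x]
    congr 1
    · simp only [av, sub_zero]
      rw [integral_mul_const, h1, one_mul]
    · simp [av]

lemma cnn_ball {Ω : Set (Euc d)} {c : Euc d} {r : ℝ} (hΩ : Metric.ball c (2 * r) ⊆ Ω)
    {θ θ' : Euc d → ℝ} (h : Tst (Metric.ball c r) θ) (h' : Tst (Metric.ball c r) θ') (h1 : ∫ x, θ x = 1)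
    (h1' : ∫ x, θ' x = 1) : Cnn Ω θ θ' := by
  have a := cnn_aux hΩ h h' h1'
  have b := (cnn_aux hΩ h' h h1).symm
  have : (fun x => ∫ y, θ' y * θ (x - (y - c))) = fun x => ∫ y, θ y * θ' (x - (y - c)) := by
    funext x
    rw [← integral_sub_left_eq_self _ volume (x + c)]
    refine integral_congr_ae (Filter.Eventually.of_forall fun y => ?_)
    simp only
    rw [mul_comm]
    congr 2 <;> abel
  rw [this] at a
  exact a.trans b

lemma exists_bump (c : Euc d) {r : ℝ} (hr : 0 < r) :
    ∃ θ : Euc d → ℝ, Tst (Metric.ball c r) θ ∧ (∫ x, θ x = 1) ∧ ∀ x, 0 ≤ θ x := by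
  let b : ContDiffBump c := ⟨r / 4, r / 2, by positivity, by linarith⟩
  refine ⟨b.normed volume, ⟨b.contDiff_normed, b.hasCompactSupport_normed, ?_⟩, b.integral_normed,
    b.nonneg_normed⟩
  rw [b.tsupport_normed_eq]
  exact Metric.closedBall_subset_ball (by change r / 2 < r; linarith)

/-- unit bump near a point -/
def Nr (Ω : Set (Euc d)) (x : Euc d) (θ : Euc d → ℝ) : Prop :=
  ∃ r, 0 < r ∧ Metric.ball x (2 * r) ⊆ Ω ∧ Tst (Metric.ball x r) θ ∧ ∫ y, θ y = 1

lemma Nr.exists {Ω : Set (Euc d)} (hΩ : IsOpen Ω) {x : Euc d} (hx : x ∈ Ω) : ∃ θ, Nr Ω x θ := by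
  obtain ⟨e, he, hb⟩ := Metric.isOpen_iff.1 hΩ x hx
  obtain ⟨θ, h1, h2, -⟩ := exists_bump x (half_pos he)
  exact ⟨θ, e / 2, half_pos he, by rwa [mul_div_cancel₀ _ two_ne_zero], h1, h2⟩

/-- in a connected open set, unit bumps all differ by divergences -/
lemma cnn_all {Ω : Set (Euc d)} (hΩ : IsOpen Ω) (hc : IsPreconnected Ω) {x y : Euc d} (hx : x ∈ Ω)
    (hy : y ∈ Ω) {θ θ' : Euc d → ℝ} (h : Nr Ω x θ) (h' : Nr Ω y θ') : Cnn Ω θ θ' := by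
  have key := hc.induction₂ (fun x y => y ∈ Ω → ∀ θ θ', Nr Ω x θ → Nr Ω y θ' → Cnn Ω θ θ')
    ?_ ?_ ?_ hx hy
  · exact key hy θ θ' h h'
  · intro x hx
    obtain ⟨e, he, hb⟩ := Metric.isOpen_iff.1 hΩ x hx
    have : Metric.ball x (e / 4) ∈ nhdsWithin x Ω :=
      mem_nhdsWithin_of_mem_nhds (Metric.ball_mem_nhds x (by positivity))
    filter_upwards [this] with y hy hyΩ θ θ' hθ hθ'
    obtain ⟨r, hr, hrb, ht, hi⟩ := hθ
    obtain ⟨r', hr', hrb', ht', hi'⟩ := hθ'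
    obtain ⟨b, hb1, hb2, -⟩ := exists_bump x (lt_min hr (show 0 < e / 4 by positivity))
    obtain ⟨b', hb1', hb2', -⟩ := exists_bump y (lt_min hr' (show 0 < e / 4 by positivity))
    have c1 : Cnn Ω θ b := cnn_ball hrb ht (hb1.mono (Metric.ball_subset_ball (min_le_left _ _))) hi hb2
    have c2 : Cnn Ω b' θ' :=
      cnn_ball hrb' (hb1'.mono (Metric.ball_subset_ball (min_le_left _ _))) ht' hb2' hi'
    have c3 : Cnn Ω b b' := by
      refine cnn_ball (c := x) (r := e / 2) (by rwa [mul_div_cancel₀ _ two_ne_zero]) ?_ ?_ hb2 hb2'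
      · exact hb1.mono (Metric.ball_subset_ball ((min_le_right _ _).trans (by linarith)))
      · refine hb1'.mono ((Metric.ball_subset_ball (min_le_right _ _)).trans ?_)
        refine Metric.ball_subset_ball' ?_
        rw [Metric.mem_ball] at hy; linarith
    exact c1.trans (c3.trans c2)
  · intro x y z hx hy hz h1 h2 _ θ θ' a b
    obtain ⟨m, hm⟩ := Nr.exists hΩ hy
    exact (h1 hy θ m a hm).trans (h2 hz m θ' hm b)
  · intro x y hx hy h1 _ θ θ' a b
    exact (h1 hy θ' θ b a).symm
end
end

section
open MeasureTheory
noncomputable section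
variable {d : ℕ}

/-! ### Mollification as a divergence -/

lemma exists_moll (hd : 0 < d) : ∃ ψ κ : Euc d → ℝ, Tst Set.univ ψ ∧ Tst Set.univ κ ∧
    (∀ y, ψ y ≠ 0 → ‖y‖ ≤ 1) ∧ (∀ y, κ y ≠ 0 → ‖y‖ ≤ 1) ∧
    (∀ y, 0 ≤ ψ y) ∧ (∫ y, ψ y = 1) ∧
    ∀ i y, y i * ψ y = - dd (coordDir i) κ y := by
  let b : ℝ → ℝ := fun s => Real.smoothTransition (1 - s)
  have hb : ContDiff ℝ (⊤ : ℕ∞) b :=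
    Real.smoothTransition.contDiff.comp (contDiff_const.sub contDiff_id)
  have hb' : ContDiff ℝ (⊤ : ℕ∞) (deriv b) := by
    have h2 := (contDiff_infty_iff_deriv (f := b)).1 hb
    exact h2.2
  have hbd : Differentiable ℝ b := hb.differentiable (by simp)
  have hb1 : ∀ s, 1 ≤ s → b s = 0 := fun s hs => Real.smoothTransition.zero_of_nonpos (by linarith)
  have hb0 : b 0 = 1 := by simp [b]
  have hanti : Antitone b := by
    intro x y hxy
    exact Real.smoothTransition.monotone (by linarith)
  have hd1 : ∀ s, 1 < s → deriv b s = 0 := by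
    intro s hs
    have : b =ᶠ[nhds s] fun _ => (0:ℝ) := by
      filter_upwards [lt_mem_nhds hs] with x hx using hb1 x hx.le
    rw [this.deriv_eq]; simp
  have hnq : ContDiff ℝ (⊤ : ℕ∞) (fun y : Euc d => ‖y‖ ^ 2) := contDiff_norm_sq ℝ
  have hsq : ∀ y : Euc d, 1 < ‖y‖ → 1 < ‖y‖ ^ 2 := fun y hy => by nlinarith
  let κ0 : Euc d → ℝ := fun y => b (‖y‖ ^ 2)
  let ψ0 : Euc d → ℝ := fun y => -2 * deriv b (‖y‖ ^ 2)
  have hκs : ∀ y, κ0 y ≠ 0 → ‖y‖ ≤ 1 := by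
    intro y hy; by_contra h; push Not at h
    exact hy (hb1 _ (hsq y h).le)
  have hψs : ∀ y, ψ0 y ≠ 0 → ‖y‖ ≤ 1 := by
    intro y hy; by_contra h; push Not at h
    exact hy (by simp [ψ0, hd1 _ (hsq y h)])
  have hκ : Tst Set.univ κ0 := by
    refine Tst.of_support (hb.comp hnq) (isCompact_closedBall (0:Euc d) 1) (Set.subset_univ _) ?_
    intro x hx; by_contra h; exact hx (by simpa using hκs x h)
  have hψ : Tst Set.univ ψ0 := by
    refine Tst.of_support (contDiff_const.mul (hb'.comp hnq)) (isCompact_closedBall (0:Euc d) 1)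
      (Set.subset_univ _) ?_
    intro x hx; by_contra h; exact hx (by simpa using hψs x h)
  have hψ0 : ∀ y, 0 ≤ ψ0 y := by
    intro y
    have := hanti.deriv_nonpos (x := ‖y‖ ^ 2)
    simp only [ψ0]; linarith
  have hrel : ∀ i y, y i * ψ0 y = - dd (coordDir i) κ0 y := by
    intro i y
    have h1 : HasFDerivAt κ0 (deriv b (‖y‖ ^ 2) • (2 • (innerSL ℝ y))) y := by
      have := (hbd (‖y‖ ^ 2)).hasDerivAt.comp_hasFDerivAt y (hasStrictFDerivAt_norm_sq y).hasFDerivAt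
      exact this
    simp only [dd, h1.fderiv, ψ0]
    simp [coordDir, EuclideanSpace.inner_single_right]
    ring
  obtain ⟨c, hc, hcd⟩ := exists_deriv_eq_slope b (show (0:ℝ) < 1 by norm_num) hbd.continuous.continuousOn
    hbd.differentiableOn
  have hne : ψ0 (Real.sqrt c • coordDir ⟨0, hd⟩) ≠ 0 := by
    have : ‖Real.sqrt c • (coordDir ⟨0, hd⟩ : Euc d)‖ ^ 2 = c := by
      rw [norm_smul, mul_pow, Real.norm_eq_abs, sq_abs, Real.sq_sqrt hc.1.le]
      simp [coordDir]
    simp only [ψ0, this, hcd, hb0, hb1 1 le_rfl]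
    norm_num
  have hpos : 0 < ∫ y, ψ0 y :=
    hψ.cont.integral_pos_of_hasCompactSupport_nonneg_nonzero hψ.cs (fun y => hψ0 y) hne
  set m := ∫ y, ψ0 y
  refine ⟨fun y => m⁻¹ * ψ0 y, fun y => m⁻¹ * κ0 y, hψ.const_mul _, hκ.const_mul _, ?_, ?_, ?_, ?_, ?_⟩
  · exact fun y hy => hψs y (right_ne_zero_of_mul hy)
  · exact fun y hy => hκs y (right_ne_zero_of_mul hy)
  · exact fun y => mul_nonneg (inv_nonneg.2 hpos.le) (hψ0 y)
  · rw [integral_const_mul]; exact inv_mul_cancel₀ hpos.ne'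
  · intro i y
    rw [dd_const_mul hκ.diff, mul_left_comm, hrel]
    ring

lemma lint_abs {f : Euc d → ℝ} (hf : Integrable f) :
    ∫⁻ x, ENNReal.ofReal |f x| = ENNReal.ofReal (∫ x, |f x|) := by
  rw [ofReal_integral_eq_lintegral_ofReal hf.abs (Filter.Eventually.of_forall fun x => abs_nonneg _)]

lemma moll_main (hd : 0 < d) {p : ℝ} (hp : 1 < p) : ∃ C : ℝ, 0 < C ∧ ∀ ε : ℝ, 0 < ε →
    ∀ f : Euc d → ℝ, Tst Set.univ f → ∃ (w : Fin d → Euc d → ℝ) (g : Euc d → ℝ),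
      (∀ i, Tst (Metric.cthickening ε (tsupport f)) (w i)) ∧
      Tst (Metric.cthickening ε (tsupport f)) g ∧
      (∀ x, ∑ i, dd (coordDir i) (w i) x = f x - g x) ∧
      (∀ i j, eLpNorm (dd (coordDir j) (w i)) (ENNReal.ofReal p) volume ≤
        ENNReal.ofReal C * eLpNorm f (ENNReal.ofReal p) volume) ∧
      eLpNorm g (ENNReal.ofReal p) volume ≤ ENNReal.ofReal C * eLpNorm f (ENNReal.ofReal p) volume ∧
      (∀ j, eLpNorm (dd (coordDir j) g) (ENNReal.ofReal p) volume ≤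
        ENNReal.ofReal (C / ε) * eLpNorm f (ENNReal.ofReal p) volume) := by
  obtain ⟨ψ, κ, hψ, hκ, hψs, hκs, hψ0, hψ1, hrel⟩ := exists_moll hd
  obtain ⟨C0, hC0, hcz⟩ := cz_apriori hd p hp
  have hψi : Integrable ψ := hψ.integrable
  set M : ℝ := ∑ j, ∫ y, |dd (coordDir j) ψ y| with hM
  have hMj : ∀ j, ∫ y, |dd (coordDir j) ψ y| ≤ M := fun j =>
    Finset.single_le_sum (f := fun j => ∫ y, |dd (coordDir j) ψ y|)
      (fun i _ => integral_nonneg fun y => abs_nonneg _) (Finset.mem_univ j)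
  have hM0 : 0 ≤ M := Finset.sum_nonneg fun i _ => integral_nonneg fun y => abs_nonneg _
  refine ⟨2 * C0 + M + 1, by positivity, fun ε hε f hf => ?_⟩
  set K := Metric.cthickening ε (tsupport f) with hKdef
  have hK : IsCompact K := hf.cs.cthickening
  have hmε : Measurable fun y : Euc d => ε • y := measurable_id.const_smul ε
  have hin : ∀ y : Euc d, ‖y‖ ≤ 1 → ∀ τ ∈ Set.Icc (0:ℝ) 1, ∀ k ∈ tsupport f, k + τ • ε • y ∈ K := by
    intro y hy τ hτ k hk
    refine Metric.mem_cthickening_of_dist_le _ k _ _ hk ?_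
    rw [dist_eq_norm, add_sub_cancel_left, norm_smul, norm_smul, Real.norm_of_nonneg hτ.1,
      Real.norm_of_nonneg hε.le]
    have : ε * ‖y‖ ≤ ε := by nlinarith
    nlinarith [hτ.1, hτ.2, mul_nonneg hε.le (norm_nonneg y)]
  have hB : ∀ y : Euc d, ψ y ≠ 0 → ‖ε • y‖ ≤ ε := by
    intro y hy
    rw [norm_smul, Real.norm_of_nonneg hε.le]
    nlinarith [hψs y hy]
  have hw : ∀ i, Tst K (segV volume ψ (fun _ => 0) (fun y => ε • y) f i) := by
    intro i
    refine seg_tst hψi measurable_const hmε hB hf hK le_rfl ?_ i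
    intro y hy τ hτ k hk
    simpa using hin y (hψs y hy) τ hτ k hk
  have hg : Tst K (av volume ψ (fun y => ε • y) f) := by
    refine av_tst hψi hmε hf hK le_rfl (Filter.Eventually.of_forall fun y hy k hk => ?_)
    simpa using hin y (hψs y hy) 1 (by simp) k hk
  have hdiv : ∀ x, ∑ i, dd (coordDir i) (segV volume ψ (fun _ => 0) (fun y => ε • y) f i) x =
      f x - av volume ψ (fun y => ε • y) f x := by
    intro x
    rw [seg_div hψi measurable_const hmε hB hf x]
    congr 1
    · simp only [av, sub_zero]; rw [integral_mul_const, hψ1, one_mul]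
    · simp [av]
  -- the potential
  set aZ : Euc d × ℝ → ℝ := fun z => κ z.1 * (-ε ^ 2 * z.2) with haZ
  have hξZ : Measurable fun z : Euc d × ℝ => z.2 • ε • z.1 :=
    measurable_snd.smul (measurable_fst.const_smul ε)
  have haZi : Integrable aZ (seg volume) := by
    refine hκ.integrable.mul_prod (g := fun τ : ℝ => -ε ^ 2 * τ) ?_
    have : IntegrableOn (fun τ : ℝ => -ε ^ 2 * τ) (Set.Icc 0 1) :=
      (by fun_prop : Continuous fun τ : ℝ => -ε ^ 2 * τ).continuousOn.integrableOn_Icc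
    exact this.mono_set Set.Ioc_subset_Icc_self
  have hmem : ∀ᵐ z ∂(seg (volume : Measure (Euc d))), z.2 ∈ Set.Ioc (0:ℝ) 1 := by
    have h1 : ∀ᵐ τ ∂((volume : Measure ℝ).restrict (Set.Ioc 0 1)), τ ∈ Set.Ioc (0:ℝ) 1 :=
      ae_restrict_mem measurableSet_Ioc
    exact Measure.quasiMeasurePreserving_snd.ae h1
  have hZ : Tst Set.univ (av (seg volume) aZ (fun z => z.2 • ε • z.1) f) := by
    refine av_tst haZi hξZ hf hK (Set.subset_univ _) ?_
    filter_upwards [hmem] with z hz hne k hk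
    exact hin z.1 (hκs z.1 (left_ne_zero_of_mul hne)) z.2 ⟨hz.1.le, hz.2⟩ k hk
  set Z := av (seg volume) aZ (fun z : Euc d × ℝ => z.2 • ε • z.1) f with hZdef
  have hVZ : ∀ i, segV volume ψ (fun _ => 0) (fun y => ε • y) f i = dd (coordDir i) Z := by
    intro i
    rw [hZdef, dd_av haZi hξZ hf]
    funext x
    have i1 : Integrable (fun z : Euc d × ℝ => ψ z.1 * (ε • z.1) i * f (x - (0 + z.2 • ε • z.1)))
        (seg volume) :=
      av_integrable (seg_a_integrable hψi hmε hB i) (seg_xi_meas (ξ := fun _ => 0) measurable_const hmε) hf x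
    have i2 : Integrable (fun z : Euc d × ℝ => aZ z * dd (coordDir i) f (x - z.2 • ε • z.1)) (seg volume) :=
      av_integrable haZi hξZ (hf.dd _) x
    simp only [segV, av]
    rw [integral_prod_symm _ i1, integral_prod_symm _ i2]
    refine setIntegral_congr_fun measurableSet_Ioc fun τ hτ => ?_
    simp only [haZ]
    have hs : τ * ε ≠ 0 := (mul_pos hτ.1 hε).ne'
    have e0 := av_by_parts hκ hf hs (coordDir i) x
    have e1 : ∀ y, ψ y * (ε • y) i * f (x - (0 + τ • ε • y)) =
        -ε * (dd (coordDir i) κ y * f (x - (τ * ε) • y)) := by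
      intro y
      have := hrel i y
      rw [zero_add, smul_smul, show (ε • y) i = ε * y i from rfl]
      linear_combination ε * f (x - (τ * ε) • y) * this
    have e2 : ∀ y, κ y * (-ε ^ 2 * τ) * dd (coordDir i) f (x - τ • ε • y) =
        (-ε ^ 2 * τ) * (κ y * dd (coordDir i) f (x - (τ * ε) • y)) := by
      intro y; rw [smul_smul]; ring
    simp_rw [e1, e2]
    rw [integral_const_mul, integral_const_mul, e0]
    have hτ0 : τ ≠ 0 := hτ.1.ne'
    have hε0 : ε ≠ 0 := hε.ne'
    generalize (∫ y, dd (coordDir i) κ y * f (x - (τ * ε) • y)) = I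
    field_simp
  have hfm : Measurable f := hf.cont.measurable
  have hgn : eLpNorm (av volume ψ (fun y => ε • y) f) (ENNReal.ofReal p) volume ≤
      1 * eLpNorm f (ENNReal.ofReal p) volume := by
    refine av_norm hp hψ.cont.measurable hmε hfm ?_
    rw [lint_abs hψi]
    simp_rw [abs_of_nonneg (hψ0 _)]
    rw [hψ1]; simp
  have hp1 : 1 ≤ ENNReal.ofReal p := by simpa using hp.le
  refine ⟨_, _, hw, hg, hdiv, ?_, ?_, ?_⟩
  · intro i j
    rw [hVZ]
    refine (hcz Z hZ j i).trans ?_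
    have hl : lap Z = fun x => f x - av volume ψ (fun y => ε • y) f x := by
      funext x
      rw [← hdiv x]
      simp_rw [hVZ]
      rfl
    have h2 : eLpNorm (lap Z) (ENNReal.ofReal p) volume ≤ 2 * eLpNorm f (ENNReal.ofReal p) volume := by
      rw [hl]
      refine (eLpNorm_sub_le hf.cont.aestronglyMeasurable hg.cont.aestronglyMeasurable hp1).trans ?_
      rw [one_mul] at hgn
      rw [two_mul]; gcongr
    calc _ ≤ ENNReal.ofReal C0 * (2 * eLpNorm f (ENNReal.ofReal p) volume) := by gcongr
      _ = ENNReal.ofReal (2 * C0) * eLpNorm f (ENNReal.ofReal p) volume := by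
        rw [ENNReal.ofReal_mul (by norm_num)]
        simp; ring
      _ ≤ _ := by gcongr; linarith
  · refine hgn.trans ?_
    gcongr
    rw [← ENNReal.ofReal_one]; exact ENNReal.ofReal_le_ofReal (by linarith)
  · intro j
    have e : dd (coordDir j) (av volume ψ (fun y => ε • y) f) =
        av volume (fun y => ε⁻¹ * dd (coordDir j) ψ y) (fun y => ε • y) f := by
      rw [dd_av hψi hmε hf]
      funext x
      simp only [av]
      rw [av_by_parts hψ hf hε.ne', ← integral_const_mul]
      simp_rw [mul_assoc]
    rw [e]
    have h3 := (hψ.dd (coordDir j)).const_mul ε⁻¹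
    refine av_norm hp h3.cont.measurable hmε hfm ?_
    rw [lint_abs h3.integrable]
    refine ENNReal.ofReal_le_ofReal ?_
    simp_rw [abs_mul]
    rw [integral_const_mul, abs_of_pos (inv_pos.2 hε), div_eq_inv_mul]
    have := hMj j
    gcongr
    linarith
end
end

section
open MeasureTheory
noncomputable section
variable {d : ℕ}
open scoped ENNReal

/-! ### Layered mollification -/

lemma smooth_urysohn {s t : Set (Euc d)} (hs : IsClosed s) (ht : IsClosed t) (hd : Disjoint s t) :
    ∃ f : Euc d → ℝ, ContDiff ℝ (⊤ : ℕ∞) f ∧ (∀ x ∈ s, f x = 0) ∧ (∀ x ∈ t, f x = 1) ∧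
      ∀ x, f x ∈ Set.Icc (0:ℝ) 1 := by
  obtain ⟨f, h0, h1, h2⟩ := exists_contMDiffMap_zero_one_of_isClosed (n := (⊤ : ℕ∞))
    (modelWithCornersSelf ℝ (Euc d)) hs ht hd
  exact ⟨f, f.contMDiff.contDiff, fun x hx => h0 hx, fun x hx => h1 hx, h2⟩

lemma overlap_norm {p : ℝ} (hp : 1 ≤ p) (N : ℕ) (g F : ℕ → Euc d → ℝ) (f : Euc d → ℝ)
    (hg : ∀ k, Measurable (g k)) (hF : ∀ k, Measurable (F k))
    (hov : ∀ x k l, g k x ≠ 0 → g l x ≠ 0 → l ≤ k + 4)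
    {C : ℝ≥0∞} (hn : ∀ k, eLpNorm (g k) (ENNReal.ofReal p) volume ≤
      C * eLpNorm (F k) (ENNReal.ofReal p) volume)
    (hsum : ∀ x, ∑ k ∈ Finset.range N, ENNReal.ofReal |F k x| ^ p ≤ ENNReal.ofReal |f x| ^ p) :
    eLpNorm (fun x => ∑ k ∈ Finset.range N, g k x) (ENNReal.ofReal p) volume ≤
      5 * C * eLpNorm f (ENNReal.ofReal p) volume := by
  have hp0 : 0 < p := by linarith
  rw [eLpNorm_real hp0 f]
  refine eLpNorm_le_of_lintegral hp0 (F := fun x => ∑ k ∈ Finset.range N, ENNReal.ofReal |g k x|) ?_ ?_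
  · intro x
    rw [← ENNReal.ofReal_sum_of_nonneg fun i _ => abs_nonneg _]
    exact ENNReal.ofReal_le_ofReal (Finset.abs_sum_le_sum_abs _ _)
  · have hpt : ∀ x, (∑ k ∈ Finset.range N, ENNReal.ofReal |g k x|) ^ p ≤
        5 ^ p * ∑ k ∈ Finset.range N, ENNReal.ofReal |g k x| ^ p := by
      intro x
      classical
      set s := (Finset.range N).filter fun k => g k x ≠ 0 with hs
      have e1 : ∑ k ∈ Finset.range N, ENNReal.ofReal |g k x| = ∑ k ∈ s, ENNReal.ofReal |g k x| := by
        rw [hs, Finset.sum_filter_of_ne]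
        intro k _ hk h; simp [h] at hk
      have hcard : s.card ≤ 5 := by
        rcases s.eq_empty_or_nonempty with he | hne
        · simp [he]
        · have hm := s.min'_mem hne
          have : s ⊆ Finset.Icc (s.min' hne) (s.min' hne + 4) := by
            intro l hl
            rw [Finset.mem_Icc]
            refine ⟨s.min'_le l hl, ?_⟩
            rw [hs, Finset.mem_filter] at hl
            exact hov x _ _ (Finset.mem_filter.1 hm).2 hl.2
          refine (Finset.card_le_card this).trans ?_
          simp; omega
      rw [e1]
      refine (ENNReal.rpow_sum_le_const_mul_sum_rpow s _ hp).trans ?_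
      refine mul_le_mul' ?_ (Finset.sum_le_sum_of_subset (Finset.filter_subset _ _))
      calc (s.card : ℝ≥0∞) ^ (p - 1) ≤ 5 ^ (p - 1) :=
            ENNReal.rpow_le_rpow (by exact_mod_cast hcard) (by linarith)
        _ ≤ 5 ^ p := ENNReal.rpow_le_rpow_of_exponent_le (by norm_num) (by linarith)
    have hmg : ∀ k, Measurable fun x => ENNReal.ofReal |g k x| ^ p := fun k =>
      (continuous_abs.measurable.comp (hg k)).ennreal_ofReal.pow_const _
    have hmF : ∀ k, Measurable fun x => ENNReal.ofReal |F k x| ^ p := fun k =>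
      (continuous_abs.measurable.comp (hF k)).ennreal_ofReal.pow_const _
    have hk : ∀ k, ∫⁻ x, ENNReal.ofReal |g k x| ^ p ≤ C ^ p * ∫⁻ x, ENNReal.ofReal |F k x| ^ p := by
      intro k
      have := ENNReal.rpow_le_rpow (hn k) hp0.le
      rw [eLpNorm_real hp0, eLpNorm_real hp0, ENNReal.mul_rpow_of_nonneg _ _ hp0.le,
        ← ENNReal.rpow_mul, ← ENNReal.rpow_mul, one_div_mul_cancel hp0.ne', ENNReal.rpow_one,
        ENNReal.rpow_one] at this
      exact this
    calc _ ≤ ∫⁻ x, 5 ^ p * ∑ k ∈ Finset.range N, ENNReal.ofReal |g k x| ^ p := lintegral_mono hpt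
      _ = 5 ^ p * ∑ k ∈ Finset.range N, ∫⁻ x, ENNReal.ofReal |g k x| ^ p := by
          rw [lintegral_const_mul _ (Finset.measurable_fun_sum _ fun k _ => hmg k),
            lintegral_finsetSum _ fun k _ => by exact hmg k]
      _ ≤ 5 ^ p * ∑ k ∈ Finset.range N, C ^ p * ∫⁻ x, ENNReal.ofReal |F k x| ^ p := by
          gcongr with k _; exact hk k
      _ = (5 * C) ^ p * ∫⁻ x, ∑ k ∈ Finset.range N, ENNReal.ofReal |F k x| ^ p := by
          rw [← Finset.mul_sum, lintegral_finsetSum _ fun k _ => by exact hmF k,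
            ENNReal.mul_rpow_of_nonneg _ _ hp0.le, mul_assoc]
      _ ≤ _ := by gcongr with x; exact hsum x

lemma layer (hd : 0 < d) {p : ℝ} (hp : 1 < p) : ∃ C : ℝ, 0 < C ∧ ∀ (ρ : Euc d → ℝ) (σ : ℝ), 0 < σ →
    (∀ x y, ρ x ≤ ρ y + ‖x - y‖) → (∀ x, ρ x ≤ σ) →
    ∀ f : Euc d → ℝ, Tst {x | 0 < ρ x} f → ∃ (w : Fin d → Euc d → ℝ) (h : Euc d → ℝ),
      (∀ i, Tst ({x | 0 < ρ x} ∩ Metric.cthickening σ (tsupport f)) (w i)) ∧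
      Tst ({x | 0 < ρ x} ∩ Metric.cthickening σ (tsupport f)) h ∧
      (∀ x, ∑ i, dd (coordDir i) (w i) x = f x - h x) ∧
      (∀ i j, eLpNorm (dd (coordDir j) (w i)) (ENNReal.ofReal p) volume ≤
        ENNReal.ofReal C * eLpNorm f (ENNReal.ofReal p) volume) ∧
      eLpNorm h (ENNReal.ofReal p) volume ≤ ENNReal.ofReal C * eLpNorm f (ENNReal.ofReal p) volume ∧
      (∀ j, eLpNorm (fun x => ρ x * dd (coordDir j) h x) (ENNReal.ofReal p) volume ≤
        ENNReal.ofReal C * eLpNorm f (ENNReal.ofReal p) volume) := by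
  obtain ⟨C, hC, hmoll⟩ := moll_main hd hp
  refine ⟨80 * C, by positivity, ?_⟩
  intro ρ σ hσ hlip hρσ f hf
  have hp0 : 0 < p := by linarith
  have hρc : Continuous ρ := by
    refine (LipschitzWith.of_le_add (f := ρ) fun x y => ?_).continuous
    rw [dist_eq_norm]; exact hlip x y
  have hU : ∀ k : ℕ, ∃ Θ : Euc d → ℝ, ContDiff ℝ (⊤ : ℕ∞) Θ ∧ (∀ x, ρ x ≤ σ / 2 ^ k → Θ x = 0) ∧
      (∀ x, 2 * (σ / 2 ^ k) ≤ ρ x → Θ x = 1) ∧ ∀ x, Θ x ∈ Set.Icc (0:ℝ) 1 := by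
    intro k
    refine smooth_urysohn (s := {x | ρ x ≤ σ / 2 ^ k}) (t := {x | 2 * (σ / 2 ^ k) ≤ ρ x})
      (isClosed_le hρc continuous_const) (isClosed_le continuous_const hρc) ?_
    rw [Set.disjoint_left]
    intro x hx hx'
    have : 0 < σ / 2 ^ k := by positivity
    change ρ x ≤ σ / 2 ^ k at hx
    change 2 * (σ / 2 ^ k) ≤ ρ x at hx'
    linarith
  choose Θ hΘs hΘ0 hΘ1 hΘI using hU
  have hΘ00 : ∀ x, Θ 0 x = 0 := fun x => hΘ0 0 x (by simpa using hρσ x)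
  have hhalf : ∀ k : ℕ, 2 * (σ / 2 ^ (k + 1)) = σ / 2 ^ k := by
    intro k; rw [pow_succ]; field_simp
  set χ : ℕ → Euc d → ℝ := fun k x => Θ (k + 1) x - Θ k x with hχ
  have hχs : ∀ k, ContDiff ℝ (⊤ : ℕ∞) (χ k) := fun k => (hΘs _).sub (hΘs _)
  have hχ0 : ∀ k x, 0 ≤ χ k x := by
    intro k x
    rcases le_or_gt (ρ x) (σ / 2 ^ k) with h | h
    · simp only [hχ]; rw [hΘ0 k x h]; linarith [(hΘI (k+1) x).1]
    · simp only [hχ]; rw [hΘ1 (k + 1) x (by rw [hhalf]; exact h.le)]; linarith [(hΘI k x).2]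
  have hχ1 : ∀ k x, χ k x ≤ 1 := fun k x => by
    simp only [hχ]; linarith [(hΘI (k+1) x).2, (hΘI k x).1]
  have hχsum : ∀ N x, ∑ k ∈ Finset.range N, χ k x = Θ N x := by
    intro N x
    simp only [hχ]
    rw [Finset.sum_range_sub (fun k => Θ k x), hΘ00, sub_zero]
  set F : ℕ → Euc d → ℝ := fun k x => χ k x * f x with hFdef
  have hF : ∀ k, Tst {x | 0 < ρ x} (F k) := fun k => Tst.mul_left (hχs k) hf
  have hFts : ∀ k, tsupport (F k) ⊆ {x | σ / 2 ^ (k + 1) ≤ ρ x ∧ ρ x ≤ 2 * (σ / 2 ^ k)} := by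
    intro k
    refine closure_minimal ?_ ((isClosed_le continuous_const hρc).inter (isClosed_le hρc continuous_const))
    intro x hx
    have hx' : χ k x ≠ 0 := left_ne_zero_of_mul hx
    constructor
    · change σ / 2 ^ (k + 1) ≤ ρ x
      by_contra h; push Not at h
      apply hx'
      simp only [hχ]
      rw [hΘ0 (k + 1) x h.le, hΘ0 k x (h.le.trans (by rw [← hhalf k]; have : 0 < σ / 2 ^ (k+1) := by positivity
                                                      linarith))]
      simp
    · change ρ x ≤ 2 * (σ / 2 ^ k)
      by_contra h; push Not at h
      apply hx'
      simp only [hχ]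
      rw [hΘ1 k x h.le, hΘ1 (k + 1) x (by rw [hhalf]; have : 0 < σ / 2 ^ k := by positivity
                                          linarith)]
      simp
  have hFts2 : ∀ k, tsupport (F k) ⊆ tsupport f := fun k => tsupport_mul_subset_right
  have hεpos : ∀ k : ℕ, 0 < σ / 2 ^ (k + 2) := fun k => by positivity
  have hall := fun k => hmoll (σ / 2 ^ (k + 2)) (hεpos k) (F k) ((hF k).mono (Set.subset_univ _))
  choose w g hw hg hdiv hwn hgn hgdn using hall
  have hthick : ∀ k, ∀ x ∈ Metric.cthickening (σ / 2 ^ (k + 2)) (tsupport (F k)),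
      σ / 2 ^ (k + 2) ≤ ρ x ∧ ρ x ≤ 16 * (σ / 2 ^ (k + 2)) := by
    intro k x hx
    have hc : IsCompact (tsupport (F k)) := (hF k).cs
    rw [hc.cthickening_eq_biUnion_closedBall (hεpos k).le] at hx
    simp only [Set.mem_iUnion, Metric.mem_closedBall, dist_eq_norm] at hx
    obtain ⟨y, hy, hxy⟩ := hx
    obtain ⟨h1, h2⟩ := hFts k hy
    have l1 := hlip x y
    have l2 := hlip y x
    rw [norm_sub_rev] at l2
    have e1 := hhalf (k + 1)
    have e2 := hhalf k
    have := hεpos k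
    constructor <;> linarith
  have hsub : ∀ k, Metric.cthickening (σ / 2 ^ (k + 2)) (tsupport (F k)) ⊆
      {x | 0 < ρ x} ∩ Metric.cthickening σ (tsupport f) := by
    intro k x hx
    refine ⟨(hεpos k).trans_le (hthick k x hx).1, ?_⟩
    refine Metric.cthickening_mono ?_ _ (Metric.cthickening_subset_of_subset _ (hFts2 k) hx)
    exact div_le_self hσ.le (one_le_pow₀ (by norm_num))
  -- overlap
  have hov : ∀ x k l, x ∈ Metric.cthickening (σ / 2 ^ (k + 2)) (tsupport (F k)) →
      x ∈ Metric.cthickening (σ / 2 ^ (l + 2)) (tsupport (F l)) → l ≤ k + 4 := by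
    intro x k l hk hl
    have h1 := (hthick k x hk).1
    have h2 := (hthick l x hl).2
    by_contra hlt; push Not at hlt
    have h3 : (2:ℝ) ^ (k + 4 + 1 + 2) ≤ 2 ^ (l + 2) := pow_le_pow_right₀ (by norm_num) (by omega)
    have h4 : σ / 2 ^ (l + 2) ≤ σ / 2 ^ (k + 4 + 1 + 2) := by gcongr
    have h5 : σ / 2 ^ (k + 4 + 1 + 2) = σ / 2 ^ (k + 2) / 32 := by
      rw [show k + 4 + 1 + 2 = (k + 2) + 5 by ring, pow_add _ (k+2), div_div]; norm_num
    have := hεpos k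
    linarith
  obtain ⟨N, hN⟩ : ∃ N, ∀ x, Θ N x * f x = f x := by
    obtain ⟨m, hm, hmρ⟩ : ∃ m > 0, ∀ x ∈ tsupport f, m ≤ ρ x := by
      have hc : IsCompact (tsupport f) := hf.cs
      rcases (tsupport f).eq_empty_or_nonempty with he | hne
      · exact ⟨1, one_pos, by simp [he]⟩
      · obtain ⟨x, hx, hmin⟩ := hc.exists_isMinOn hne hρc.continuousOn
        exact ⟨ρ x, hf.ts hx, fun y hy => hmin hy⟩
    obtain ⟨N, hN⟩ := exists_pow_lt_of_lt_one (show 0 < m / (2 * σ) by positivity)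
      (show (1/2 : ℝ) < 1 by norm_num)
    refine ⟨N, fun x => ?_⟩
    by_cases hx : x ∈ tsupport f
    · rw [hΘ1 N x, one_mul]
      refine le_trans ?_ (hmρ x hx)
      rw [lt_div_iff₀ (by positivity), one_div, inv_pow] at hN
      rw [div_eq_mul_inv]; linarith
    · rw [image_eq_zero_of_notMem_tsupport hx, mul_zero]
  have hFsum : ∀ x, ∑ k ∈ Finset.range N, F k x = f x := by
    intro x
    simp only [hFdef]
    rw [← Finset.sum_mul, hχsum, hN]
  have hpsum : ∀ x, ∑ k ∈ Finset.range N, ENNReal.ofReal |F k x| ^ p ≤ ENNReal.ofReal |f x| ^ p := by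
    intro x
    calc ∑ k ∈ Finset.range N, ENNReal.ofReal |F k x| ^ p
        ≤ ∑ k ∈ Finset.range N, ENNReal.ofReal (χ k x) * ENNReal.ofReal |f x| ^ p := by
          refine Finset.sum_le_sum fun k _ => ?_
          simp only [hFdef]
          rw [abs_mul, abs_of_nonneg (hχ0 k x), ENNReal.ofReal_mul (hχ0 k x),
            ENNReal.mul_rpow_of_nonneg _ _ hp0.le]
          gcongr
          refine ENNReal.rpow_le_self_of_le_one ?_ hp.le
          rw [← ENNReal.ofReal_one]; exact ENNReal.ofReal_le_ofReal (hχ1 k x)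
      _ = ENNReal.ofReal (Θ N x) * ENNReal.ofReal |f x| ^ p := by
          rw [← Finset.sum_mul, ← ENNReal.ofReal_sum_of_nonneg fun k _ => hχ0 k x, hχsum]
      _ ≤ 1 * ENNReal.ofReal |f x| ^ p := by
          gcongr
          rw [← ENNReal.ofReal_one]; exact ENNReal.ofReal_le_ofReal (hΘI N x).2
      _ = _ := one_mul _
  have hmF : ∀ k, Measurable (F k) := fun k => (hF k).cont.measurable
  have hTs : ∀ {S : Set (Euc d)} {φ : Euc d → ℝ}, Tst S φ → ∀ x, φ x ≠ 0 → x ∈ S := by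
    intro S φ hφ x hx
    exact hφ.ts (subset_tsupport _ hx)
  have hCle : ∀ c : ℝ, c ≤ 16 * C → 5 * ENNReal.ofReal c * eLpNorm f (ENNReal.ofReal p) volume ≤
      ENNReal.ofReal (80 * C) * eLpNorm f (ENNReal.ofReal p) volume := by
    intro c hc
    gcongr
    rw [show (5:ℝ≥0∞) = ENNReal.ofReal 5 by simp, ← ENNReal.ofReal_mul (by norm_num)]
    exact ENNReal.ofReal_le_ofReal (by linarith)
  refine ⟨fun i x => ∑ k ∈ Finset.range N, w k i x, fun x => ∑ k ∈ Finset.range N, g k x,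
    fun i => Tst.sum _ fun k _ => (hw k i).mono (hsub k), Tst.sum _ fun k _ => (hg k).mono (hsub k),
    ?_, ?_, ?_, ?_⟩
  · intro x
    have : ∀ i, dd (coordDir i) (fun x => ∑ k ∈ Finset.range N, w k i x) x =
        ∑ k ∈ Finset.range N, dd (coordDir i) (w k i) x := fun i =>
      dd_sum _ (fun k _ => (hw k i).diff) _ _
    simp_rw [this]
    rw [Finset.sum_comm]
    simp_rw [hdiv]
    rw [Finset.sum_sub_distrib, hFsum]
  · intro i j
    have : dd (coordDir j) (fun x => ∑ k ∈ Finset.range N, w k i x) =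
        fun x => ∑ k ∈ Finset.range N, dd (coordDir j) (w k i) x :=
      funext fun x => dd_sum _ (fun k _ => (hw k i).diff) _ _
    rw [this]
    refine (overlap_norm hp.le N (fun k => dd (coordDir j) (w k i)) F f
      (fun k => ((hw k i).dd _).cont.measurable) hmF ?_ (fun k => hwn k i j) hpsum).trans
      (hCle C (by linarith))
    exact fun x k l hk hl => hov x k l (hTs ((hw k i).dd _) x hk) (hTs ((hw l i).dd _) x hl)
  · refine (overlap_norm hp.le N g F f (fun k => (hg k).cont.measurable) hmF ?_ hgn hpsum).trans
      (hCle C (by linarith))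
    exact fun x k l hk hl => hov x k l (hTs (hg k) x hk) (hTs (hg l) x hl)
  · intro j
    have : (fun x => ρ x * dd (coordDir j) (fun x => ∑ k ∈ Finset.range N, g k x) x) =
        fun x => ∑ k ∈ Finset.range N, ρ x * dd (coordDir j) (g k) x := by
      funext x
      rw [dd_sum _ (fun k _ => (hg k).diff), Finset.mul_sum]
    rw [this]
    refine (overlap_norm hp.le N (fun k x => ρ x * dd (coordDir j) (g k) x) F f
      (fun k => hρc.measurable.mul ((hg k).dd _).cont.measurable) hmF ?_
      (C := ENNReal.ofReal (16 * C)) ?_ hpsum).trans (hCle (16 * C) le_rfl)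
    · exact fun x k l hk hl => hov x k l (hTs ((hg k).dd _) x (right_ne_zero_of_mul hk))
        (hTs ((hg l).dd _) x (right_ne_zero_of_mul hl))
    · intro k
      have h1 : eLpNorm (fun x => ρ x * dd (coordDir j) (g k) x) (ENNReal.ofReal p) volume ≤
          ENNReal.ofReal (16 * (σ / 2 ^ (k + 2))) *
            eLpNorm (dd (coordDir j) (g k)) (ENNReal.ofReal p) volume := by
        refine eLpNorm_le_mul_eLpNorm_of_ae_le_mul (Filter.Eventually.of_forall fun x => ?_) _
        rw [norm_mul]
        by_cases hx : dd (coordDir j) (g k) x = 0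
        · simp [hx]
        · obtain ⟨a1, a2⟩ := hthick k x (hTs ((hg k).dd _) x hx)
          rw [Real.norm_of_nonneg ((hεpos k).le.trans a1)]
          gcongr
      refine h1.trans ?_
      calc _ ≤ ENNReal.ofReal (16 * (σ / 2 ^ (k + 2))) * (ENNReal.ofReal (C / (σ / 2 ^ (k + 2))) *
            eLpNorm (F k) (ENNReal.ofReal p) volume) := by gcongr; exact hgdn k j
        _ = _ := by
          have := hεpos k
          rw [← mul_assoc, ← ENNReal.ofReal_mul (by positivity)]
          congr 2
          field_simp
end
end

section
open MeasureTheory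
noncomputable section
variable {d : ℕ}
open scoped ENNReal

/-! ### One-dimensional kernel estimates -/

lemma lint_rpow_Ioo {m : ℝ} (hm : 0 < m) :
    ∫⁻ s in Set.Ioo 0 m, ENNReal.ofReal (s ^ (-(1/2) : ℝ)) = ENNReal.ofReal (2 * m ^ (1/2 : ℝ)) := by
  have hi : IntervalIntegrable (fun s : ℝ => s ^ (-(1/2) : ℝ)) volume 0 m :=
    intervalIntegral.intervalIntegrable_rpow' (by norm_num)
  rw [intervalIntegrable_iff_integrableOn_Ioc_of_le hm.le] at hi
  rw [restrict_Ioo_eq_restrict_Ioc]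
  rw [← ofReal_integral_eq_lintegral_ofReal hi, ← intervalIntegral.integral_of_le hm.le,
    integral_rpow (Or.inl (by norm_num))]
  · congr 1
    norm_num
    ring
  · filter_upwards [ae_restrict_mem measurableSet_Ioc] with s hs
    exact Real.rpow_nonneg hs.1.le _

lemma lint_rpow_Ioi {a b : ℝ} (ha : 0 < a) (hb : 0 < b) :
    ∫⁻ s in Set.Ioi a, ENNReal.ofReal (s ^ (-1 - b)) = ENNReal.ofReal (a ^ (-b) / b) := by
  have hi := integrableOn_Ioi_rpow_of_lt (show -1 - b < -1 by linarith) ha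
  rw [← ofReal_integral_eq_lintegral_ofReal hi, integral_Ioi_rpow_of_lt (by linarith) ha]
  · congr 1
    rw [show -1 - b + 1 = -b by ring]
    field_simp
  · filter_upwards [ae_restrict_mem measurableSet_Ioi] with s hs
    exact Real.rpow_nonneg (ha.trans hs).le _

open Classical in
lemma cone1 {ρ : Euc d → ℝ} {c γ : ℝ} (hc : 0 < c) (hγ : 0 < γ) {S : Set (Euc d)} {y : Euc d}
    (hcone : ∀ z ∈ S, ∀ s ∈ Set.Icc (0:ℝ) 1, γ * s ≤ ρ (z + s • y)) (x : Euc d) :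
    ∫⁻ s in Set.Ioc (0:ℝ) 1, (if c * ρ x ≤ s ∧ x - s • y ∈ S then
      ENNReal.ofReal (s⁻¹ * ρ (x - s • y) ^ (-(1/2) : ℝ)) else 0) ≤
      ENNReal.ofReal (2 / (c * γ) * ρ x ^ (-(1/2) : ℝ)) := by
  set E : Set ℝ := {s | s ∈ Set.Ioc (0:ℝ) 1 ∧ x - s • y ∈ S} with hE
  rcases E.eq_empty_or_nonempty with he | hne
  · rw [setLIntegral_congr_fun (g := fun _ => 0) measurableSet_Ioc]
    · simp
    · intro s hs
      simp only
      rw [if_neg]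
      rintro ⟨-, h⟩
      have : s ∈ E := ⟨hs, h⟩
      simp [he] at this
  have hbd : BddAbove E := ⟨1, fun s hs => hs.1.2⟩
  set m := sSup E with hm
  obtain ⟨s0, hs0⟩ := hne
  have hm0 : 0 < m := hs0.1.1.trans_le (le_csSup hbd hs0)
  have hρm : γ * m ≤ ρ x := by
    have : m ≤ ρ x / γ := by
      refine csSup_le ⟨s0, hs0⟩ fun s hs => ?_
      rw [le_div_iff₀ hγ, mul_comm]
      have := hcone _ hs.2 s ⟨hs.1.1.le, hs.1.2⟩
      simpa using this
    rwa [le_div_iff₀ hγ, mul_comm] at this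
  have hρ0 : 0 < ρ x := (mul_pos hγ hm0).trans_le hρm
  have hlow : ∀ s ∈ E, γ * (m - s) ≤ ρ (x - s • y) := by
    intro s hs
    have : m ≤ s + ρ (x - s • y) / γ := by
      refine csSup_le ⟨s0, hs0⟩ fun s' hs' => ?_
      rcases le_total s s' with h | h
      · have := hcone _ hs'.2 (s' - s) ⟨by linarith, by linarith [hs'.1.2, hs.1.1]⟩
        have e : x - s' • y + (s' - s) • y = x - s • y := by rw [sub_smul]; abel
        rw [e] at this
        have h2 : s' - s ≤ ρ (x - s • y) / γ := by rw [le_div_iff₀ hγ]; linarith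
        linarith
      · have := hcone _ hs.2 0 ⟨le_rfl, zero_le_one⟩
        rw [mul_zero, zero_smul, add_zero] at this
        have : 0 ≤ ρ (x - s • y) / γ := by positivity
        linarith
    have h2 : m - s ≤ ρ (x - s • y) / γ := by linarith
    rw [le_div_iff₀ hγ] at h2; linarith
  set K : ℝ := (c * ρ x)⁻¹ * γ ^ (-(1/2) : ℝ) with hK
  have hK0 : 0 ≤ K := by positivity
  have hpt : ∀ s, s ∈ Set.Ioc (0:ℝ) 1 → s ≠ m → (if c * ρ x ≤ s ∧ x - s • y ∈ S then
      ENNReal.ofReal (s⁻¹ * ρ (x - s • y) ^ (-(1/2) : ℝ)) else 0) ≤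
      (Set.Ioo 0 m).indicator (fun s => ENNReal.ofReal K * ENNReal.ofReal ((s) ^ (-(1/2) : ℝ))) (m - s) := by
    intro s hs hsm
    split_ifs with h
    · have hsE : s ∈ E := ⟨hs, h.2⟩
      have hsm' : s < m := lt_of_le_of_ne (le_csSup hbd hsE) hsm
      rw [Set.indicator_of_mem (show m - s ∈ Set.Ioo 0 m from ⟨by linarith, by linarith [hs.1]⟩),
        ← ENNReal.ofReal_mul hK0]
      refine ENNReal.ofReal_le_ofReal ?_
      have h1 : ρ (x - s • y) ^ (-(1/2) : ℝ) ≤ (γ * (m - s)) ^ (-(1/2) : ℝ) :=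
        Real.rpow_le_rpow_of_nonpos (mul_pos hγ (by linarith)) (hlow s hsE) (by norm_num)
      rw [Real.mul_rpow hγ.le (by linarith)] at h1
      have h2 : s⁻¹ ≤ (c * ρ x)⁻¹ := inv_anti₀ (by positivity) h.1
      rw [hK, mul_assoc]
      have : 0 ≤ (m - s) ^ (-(1/2) : ℝ) := Real.rpow_nonneg (by linarith) _
      refine mul_le_mul h2 h1 (Real.rpow_nonneg ?_ _) (by positivity)
      exact (mul_nonneg hγ.le (by linarith)).trans (hlow s hsE)
    · exact zero_le
  calc _ ≤ ∫⁻ s in Set.Ioc (0:ℝ) 1, (Set.Ioo 0 m).indicator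
        (fun s => ENNReal.ofReal K * ENNReal.ofReal ((s) ^ (-(1/2) : ℝ))) (m - s) := by
        refine lintegral_mono_ae ?_
        have h1 : ∀ᵐ s ∂(volume.restrict (Set.Ioc (0:ℝ) 1)), s ≠ m :=
          ae_restrict_of_ae (compl_mem_ae_iff.2 (measure_singleton m))
        filter_upwards [ae_restrict_mem measurableSet_Ioc, h1] with s hs hsm using hpt s hs hsm
    _ ≤ ∫⁻ s, (Set.Ioo 0 m).indicator
        (fun s => ENNReal.ofReal K * ENNReal.ofReal ((s) ^ (-(1/2) : ℝ))) (m - s) :=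
        setLIntegral_le_lintegral _ _
    _ = ∫⁻ s, (Set.Ioo 0 m).indicator
        (fun s => ENNReal.ofReal K * ENNReal.ofReal ((s) ^ (-(1/2) : ℝ))) s :=
        lintegral_sub_left_eq_self _ m
    _ = ENNReal.ofReal K * ENNReal.ofReal (2 * m ^ (1/2 : ℝ)) := by
        rw [lintegral_indicator measurableSet_Ioo, lintegral_const_mul' _ _ ENNReal.ofReal_ne_top,
          lint_rpow_Ioo hm0]
    _ ≤ _ := by
        rw [← ENNReal.ofReal_mul hK0]
        refine ENNReal.ofReal_le_ofReal ?_
        have h1 : m ^ (1/2 : ℝ) ≤ (ρ x / γ) ^ (1/2 : ℝ) := by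
          refine Real.rpow_le_rpow hm0.le ?_ (by norm_num)
          rw [le_div_iff₀ hγ]; linarith
        have h2 : (ρ x / γ) ^ (1/2 : ℝ) = ρ x * ρ x ^ (-(1/2) : ℝ) * γ ^ (-(1/2) : ℝ) := by
          rw [Real.div_rpow hρ0.le hγ.le, Real.rpow_neg hγ.le, div_eq_mul_inv]
          congr 1
          nth_rewrite 2 [← Real.rpow_one (ρ x)]
          rw [← Real.rpow_add hρ0]; norm_num
        have h3 : γ ^ (-(1/2) : ℝ) * γ ^ (-(1/2) : ℝ) = γ⁻¹ := by
          rw [← Real.rpow_add hγ, ← Real.rpow_neg_one]; norm_num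
        calc K * (2 * m ^ (1/2 : ℝ)) ≤ K * (2 * (ρ x * ρ x ^ (-(1/2) : ℝ) * γ ^ (-(1/2) : ℝ))) := by
              rw [← h2]; gcongr
          _ = (c * ρ x)⁻¹ * ρ x * 2 * ρ x ^ (-(1/2) : ℝ) * (γ ^ (-(1/2) : ℝ) * γ ^ (-(1/2) : ℝ)) := by
              rw [hK]; ring
          _ = _ := by rw [h3]; field_simp
          _ ≤ _ := le_rfl

open Classical in
lemma cone2 {ρ : Euc d → ℝ} {c γ Y b : ℝ} (hc : 0 < c) (hγ : 0 < γ) (hY : 0 ≤ Y) (hb : 0 < b)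
    (hlip : ∀ x y, ρ x ≤ ρ y + ‖x - y‖) {z y : Euc d} (hy : ‖y‖ ≤ Y) (hz : 0 < ρ z)
    (hcone : ∀ s ∈ Set.Icc (0:ℝ) 1, γ * s ≤ ρ (z + s • y)) :
    ∫⁻ s in Set.Ioc (0:ℝ) 1, (if c * ρ (z + s • y) ≤ s then
      ENNReal.ofReal (s⁻¹ * ρ (z + s • y) ^ (-b)) else 0) ≤
      ENNReal.ofReal (γ ^ (-b) * ((2 * (c⁻¹ + Y)) ^ b / b) * ρ z ^ (-b)) := by
  set a : ℝ := ρ z / (2 * (c⁻¹ + Y)) with ha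
  have hden : 0 < c⁻¹ + Y := by positivity
  have ha0 : 0 < a := by positivity
  have hpt : ∀ s ∈ Set.Ioc (0:ℝ) 1, (if c * ρ (z + s • y) ≤ s then
      ENNReal.ofReal (s⁻¹ * ρ (z + s • y) ^ (-b)) else 0) ≤
      (Set.Ioi a).indicator (fun s => ENNReal.ofReal (γ ^ (-b)) * ENNReal.ofReal (s ^ (-1 - b))) s := by
    intro s hs
    split_ifs with h
    · have h1 : ρ z ≤ (c⁻¹ + Y) * s := by
        have l := hlip z (z + s • y)
        rw [show z - (z + s • y) = -(s • y) by abel, norm_neg, norm_smul, Real.norm_of_nonneg hs.1.le] at l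
        have : ρ (z + s • y) ≤ c⁻¹ * s := by
          rw [inv_mul_eq_div, le_div_iff₀ hc, mul_comm]; exact h
        nlinarith [hs.1]
      have h2 : a < s := by
        rw [ha, div_lt_iff₀ (by positivity)]
        nlinarith [hs.1, mul_pos hden hs.1]
      rw [Set.indicator_of_mem (show s ∈ Set.Ioi a from h2), ← ENNReal.ofReal_mul (by positivity)]
      refine ENNReal.ofReal_le_ofReal ?_
      have h3 : ρ (z + s • y) ^ (-b) ≤ (γ * s) ^ (-b) :=
        Real.rpow_le_rpow_of_nonpos (mul_pos hγ hs.1) (hcone s ⟨hs.1.le, hs.2⟩) (by linarith)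
      rw [Real.mul_rpow hγ.le hs.1.le] at h3
      have h4 : s ^ (-1 - b) = s⁻¹ * s ^ (-b) := by
        rw [← Real.rpow_neg_one, ← Real.rpow_add hs.1]; ring_nf
      rw [h4]
      have : 0 ≤ s⁻¹ := by have := hs.1; positivity
      nlinarith [mul_le_mul_of_nonneg_left h3 this]
    · exact zero_le
  calc _ ≤ ∫⁻ s in Set.Ioc (0:ℝ) 1,
        (Set.Ioi a).indicator (fun s => ENNReal.ofReal (γ ^ (-b)) * ENNReal.ofReal (s ^ (-1 - b))) s :=
        setLIntegral_mono' measurableSet_Ioc hpt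
    _ ≤ ∫⁻ s, (Set.Ioi a).indicator (fun s => ENNReal.ofReal (γ ^ (-b)) * ENNReal.ofReal (s ^ (-1 - b))) s :=
        setLIntegral_le_lintegral _ _
    _ = ENNReal.ofReal (γ ^ (-b)) * ENNReal.ofReal (a ^ (-b) / b) := by
        rw [lintegral_indicator measurableSet_Ioi, lintegral_const_mul' _ _ ENNReal.ofReal_ne_top,
          lint_rpow_Ioi ha0 hb]
    _ = _ := by
        rw [← ENNReal.ofReal_mul (by positivity)]
        congr 1
        rw [ha, Real.div_rpow hz.le (by positivity), Real.rpow_neg (by positivity) b,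
          Real.rpow_neg (by positivity) b, Real.rpow_neg (x := 2 * (c⁻¹ + Y)) (by positivity) b]
        field_simp

/-- integrals over `seg` of products -/
lemma seg_bound (a : Euc d → ℝ≥0∞) (b : Euc d → ℝ → ℝ≥0∞) (β : ℝ≥0∞) (hβ : β ≠ ⊤) (ha : ∀ y, a y ≠ ⊤)
    (hb : ∀ y, a y ≠ 0 → ∫⁻ s in Set.Ioc (0:ℝ) 1, b y s ≤ β) :
    ∫⁻ z, a z.1 * b z.1 z.2 ∂(seg volume) ≤ (∫⁻ y, a y) * β := by
  refine (lintegral_prod_le _).trans ?_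
  calc _ ≤ ∫⁻ y, a y * β := by
        refine lintegral_mono fun y => ?_
        simp only
        rw [lintegral_const_mul' _ _ (ha y)]
        by_cases h : a y = 0
        · simp [h]
        · gcongr; exact hb y h
    _ ≤ _ := by
        rw [lintegral_mul_const' _ _ hβ]
end
end

section
open MeasureTheory
open scoped ENNReal
noncomputable section
variable {d : ℕ}

open Classical in
lemma cone_F1 {p q : ℝ} (hpq : p.HolderConjugate q) {κ : Euc d → ℝ} (hκ : Continuous κ) {c Y : ℝ} (hc : 0 < c)
    (hcY : c * Y ≤ 1 / 2) (hκY : ∀ y, κ y ≠ 0 → ‖y‖ ≤ Y) {ρ : Euc d → ℝ} (hρ0 : ∀ x, 0 ≤ ρ x) (hρm : Measurable ρ)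
    (hlip : ∀ x y, ρ x ≤ ρ y + ‖x - y‖) {G : Euc d → ℝ≥0∞} (hG : Measurable G) :
    ∫⁻ x, (∫⁻ z, (ENNReal.ofReal |κ z.1| * (if z.2 < c * ρ x then ENNReal.ofReal (2 / ρ x) else 0)) *
      G (x - z.2 • z.1) ∂(seg volume)) ^ p ≤
      ((∫⁻ y, ENNReal.ofReal |κ y|) * ENNReal.ofReal (2 * c)) ^ (p / q) *
        ((∫⁻ y, ENNReal.ofReal |κ y|) * ENNReal.ofReal (6 * c)) * ∫⁻ x, G x ^ p := by
  have hmk : Measurable (Function.uncurry fun (x : Euc d) (z : Euc d × ℝ) =>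
      ENNReal.ofReal |κ z.1| * (if z.2 < c * ρ x then ENNReal.ofReal (2 / ρ x) else 0)) := by
    have h1 : Measurable fun w : Euc d × (Euc d × ℝ) => ENNReal.ofReal |κ w.2.1| :=
      (hκ.abs.measurable.comp (measurable_fst.comp measurable_snd)).ennreal_ofReal
    have h2 : Measurable fun w : Euc d × (Euc d × ℝ) => ENNReal.ofReal (2 / ρ w.1) :=
      ((measurable_const.div (hρm.comp measurable_fst))).ennreal_ofReal
    refine h1.mul (Measurable.ite ?_ h2 measurable_const)
    exact measurableSet_lt (measurable_snd.comp measurable_snd) ((hρm.comp measurable_fst).const_mul c)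
  have hξ : Measurable fun z : Euc d × ℝ => z.2 • z.1 := measurable_snd.smul measurable_fst
  have key : ∀ r : ℝ, 0 ≤ r → ∀ m : ℝ, ∀ f : ℝ → ℝ≥0∞, (∀ s, 0 < s → f s ≠ 0 → s < m) →
      (∀ s, 0 < s → f s ≤ ENNReal.ofReal r) → ∫⁻ s in Set.Ioc (0:ℝ) 1, f s ≤ ENNReal.ofReal (r * m) := by
    intro r hr m f h1 h2
    calc ∫⁻ s in Set.Ioc (0:ℝ) 1, f s ≤ ∫⁻ s in Set.Ioc (0:ℝ) 1, (Set.Ioo 0 m).indicator (fun _ => ENNReal.ofReal r) s := by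
          refine setLIntegral_mono' measurableSet_Ioc fun s hs => ?_
          by_cases hf : f s = 0
          · simp [hf]
          · rw [Set.indicator_of_mem (show s ∈ Set.Ioo 0 m from ⟨hs.1, h1 s hs.1 hf⟩)]
            exact h2 s hs.1
      _ ≤ ∫⁻ s, (Set.Ioo 0 m).indicator (fun _ => ENNReal.ofReal r) s := setLIntegral_le_lintegral _ _
      _ = _ := by
          rw [lintegral_indicator measurableSet_Ioo, lintegral_const, Measure.restrict_apply_univ, Real.volume_Ioo,
            ENNReal.ofReal_mul hr, sub_zero]
  have hs := schur (seg volume) hpq (fun (x : Euc d) (z : Euc d × ℝ) =>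
      ENNReal.ofReal |κ z.1| * (if z.2 < c * ρ x then ENNReal.ofReal (2 / ρ x) else 0)) hmk hξ hG
      (h := fun _ => 1) measurable_const ((∫⁻ y, ENNReal.ofReal |κ y|) * ENNReal.ofReal (2 * c))
      ((∫⁻ y, ENNReal.ofReal |κ y|) * ENNReal.ofReal (6 * c)) (fun _ _ _ => by simp) ?_ ?_
  · exact hs
  · intro x
    simp only [ENNReal.one_rpow, mul_one]
    refine seg_bound (fun y => ENNReal.ofReal |κ y|) (fun y s => if s < c * ρ x then ENNReal.ofReal (2 / ρ x) else 0)
      _ ENNReal.ofReal_ne_top (fun _ => ENNReal.ofReal_ne_top) fun y _ => ?_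
    refine (key (2 / ρ x) (div_nonneg zero_le_two (hρ0 x)) (c * ρ x) _ ?_ ?_).trans (ENNReal.ofReal_le_ofReal ?_)
    · intro s _ h; by_contra h'; simp [h'] at h
    · intro s _; split_ifs <;> simp
    · rcases (hρ0 x).eq_or_lt with h | h
      · rw [← h]; simp; positivity
      · apply le_of_eq; field_simp
  · intro z
    simp only [ENNReal.one_rpow, mul_one]
    refine seg_bound (fun y => ENNReal.ofReal |κ y|)
      (fun y s => if s < c * ρ (z + s • y) then ENNReal.ofReal (2 / ρ (z + s • y)) else 0)
      _ ENNReal.ofReal_ne_top (fun _ => ENNReal.ofReal_ne_top) fun y hy => ?_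
    have hyY : ‖y‖ ≤ Y := hκY y fun h => hy (by simp [h])
    have hh : ∀ s, 0 < s → s < c * ρ (z + s • y) → ρ (z + s • y) ≤ 2 * ρ z ∧ ρ z ≤ 3 / 2 * ρ (z + s • y) ∧ 0 < ρ (z + s • y) := by
      intro s hs hlt
      have e1 := hlip (z + s • y) z
      have e2 := hlip z (z + s • y)
      have e3 : ‖z + s • y - z‖ = s * ‖y‖ := by rw [add_sub_cancel_left, norm_smul, Real.norm_of_nonneg hs.le]
      have e4 : ‖z - (z + s • y)‖ = s * ‖y‖ := by rw [norm_sub_rev, e3]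
      rw [e3] at e1; rw [e4] at e2
      have e5 : s * ‖y‖ ≤ 1 / 2 * ρ (z + s • y) := by
        calc s * ‖y‖ ≤ c * ρ (z + s • y) * Y := by
              refine mul_le_mul hlt.le hyY (norm_nonneg _) (by have := hρ0 (z + s • y); positivity)
          _ = c * Y * ρ (z + s • y) := by ring
          _ ≤ _ := mul_le_mul_of_nonneg_right hcY (hρ0 _)
      refine ⟨by linarith, by linarith, ?_⟩
      by_contra h
      have : ρ (z + s • y) = 0 := le_antisymm (not_lt.1 h) (hρ0 _)
      rw [this] at hlt; linarith
    refine (key (3 / ρ z) (div_nonneg (by norm_num) (hρ0 z)) (2 * c * ρ z) _ ?_ ?_).trans (ENNReal.ofReal_le_ofReal ?_)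
    · intro s hs h
      have hlt : s < c * ρ (z + s • y) := by by_contra h'; simp [h'] at h
      obtain ⟨g1, g2, g3⟩ := hh s hs hlt
      nlinarith
    · intro s hs
      split_ifs with hlt
      · obtain ⟨g1, g2, g3⟩ := hh s hs hlt
        refine ENNReal.ofReal_le_ofReal ?_
        have : 0 < ρ z := by linarith
        rw [div_le_div_iff₀ g3 this]; linarith
      · simp
    · rcases (hρ0 z).eq_or_lt with h | h
      · rw [← h]; simp; positivity
      · apply le_of_eq; field_simp; norm_num

open Classical in
lemma cone_F2 {p q : ℝ} (hpq : p.HolderConjugate q) {κ : Euc d → ℝ} (hκ : Continuous κ) {c Y γ : ℝ} (hc : 0 < c)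
    (hγ : 0 < γ) (hY : 0 ≤ Y)
    (hκY : ∀ y, κ y ≠ 0 → ‖y‖ ≤ Y) {ρ : Euc d → ℝ} (hρ0 : ∀ x, 0 ≤ ρ x) (hρm : Measurable ρ)
    (hlip : ∀ x y, ρ x ≤ ρ y + ‖x - y‖) {S : Set (Euc d)} (hS : MeasurableSet S) (hSρ : ∀ z ∈ S, 0 < ρ z)
    (hcone : ∀ z ∈ S, ∀ y, κ y ≠ 0 → ∀ s ∈ Set.Icc (0:ℝ) 1, γ * s ≤ ρ (z + s • y))
    {G : Euc d → ℝ≥0∞} (hG : Measurable G) :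
    ∫⁻ x, (∫⁻ z, (ENNReal.ofReal |κ z.1| * (if c * ρ x ≤ z.2 ∧ x - z.2 • z.1 ∈ S then ENNReal.ofReal (z.2⁻¹) else 0)) *
      G (x - z.2 • z.1) ∂(seg volume)) ^ p ≤
      ((∫⁻ y, ENNReal.ofReal |κ y|) * ENNReal.ofReal (2 / (c * γ))) ^ (p / q) *
        ((∫⁻ y, ENNReal.ofReal |κ y|) * ENNReal.ofReal (γ ^ (-(p / (2 * q))) * ((2 * (c⁻¹ + Y)) ^ (p / (2 * q)) / (p / (2 * q)))))
        * ∫⁻ x, G x ^ p := by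
  have hp := hpq.pos
  have hq := hpq.symm.pos
  have hξ : Measurable fun z : Euc d × ℝ => z.2 • z.1 := measurable_snd.smul measurable_fst
  have hmk : Measurable (Function.uncurry fun (x : Euc d) (z : Euc d × ℝ) =>
      ENNReal.ofReal |κ z.1| * (if c * ρ x ≤ z.2 ∧ x - z.2 • z.1 ∈ S then ENNReal.ofReal (z.2⁻¹) else 0)) := by
    have h1 : Measurable fun w : Euc d × (Euc d × ℝ) => ENNReal.ofReal |κ w.2.1| :=
      (hκ.abs.measurable.comp (measurable_fst.comp measurable_snd)).ennreal_ofReal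
    have h2 : Measurable fun w : Euc d × (Euc d × ℝ) => ENNReal.ofReal (w.2.2⁻¹) :=
      ((measurable_snd.comp measurable_snd).inv).ennreal_ofReal
    refine h1.mul (Measurable.ite (MeasurableSet.inter ?_ ?_) h2 measurable_const)
    · exact measurableSet_le ((hρm.comp measurable_fst).const_mul c) (measurable_snd.comp measurable_snd)
    · exact hS.preimage (measurable_fst.sub (hξ.comp measurable_snd))
  have hw : ∀ x (r : ℝ), 0 ≤ r → (ENNReal.ofReal (ρ x ^ (-(1 / (2 * q))))) ^ r = ENNReal.ofReal (ρ x ^ (-(r / (2 * q)))) := by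
    intro x r hr
    rw [ENNReal.ofReal_rpow_of_nonneg (Real.rpow_nonneg (hρ0 x) _) hr, ← Real.rpow_mul (hρ0 x)]
    congr 2; ring
  have hwq : ∀ x, (ENNReal.ofReal (ρ x ^ (-(1 / (2 * q))))) ^ q = ENNReal.ofReal (ρ x ^ (-(1/2) : ℝ)) := by
    intro x; rw [hw x q hq.le]; congr 2; field_simp
  refine schur (seg volume) hpq (fun (x : Euc d) (z : Euc d × ℝ) =>
      ENNReal.ofReal |κ z.1| * (if c * ρ x ≤ z.2 ∧ x - z.2 • z.1 ∈ S then ENNReal.ofReal (z.2⁻¹) else 0)) hmk hξ hG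
      (h := fun x => ENNReal.ofReal (ρ x ^ (-(1 / (2 * q))))) (hρm.pow_const _).ennreal_ofReal _ _ ?_ ?_ ?_
  · intro x z h
    have hz : x - z.2 • z.1 ∈ S := by
      by_contra h'; simp [h'] at h
    refine ⟨?_, ENNReal.ofReal_ne_top⟩
    simp only [ne_eq, ENNReal.ofReal_eq_zero, not_le]
    exact Real.rpow_pos_of_pos (hSρ _ hz) _
  · intro x
    simp only [hwq]
    rw [mul_assoc, ← ENNReal.ofReal_mul (by positivity)]
    refine le_trans (le_of_eq ?_) (seg_bound (fun y => ENNReal.ofReal |κ y|) (fun y s => if c * ρ x ≤ s ∧ x - s • y ∈ S then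
      ENNReal.ofReal (s⁻¹ * ρ (x - s • y) ^ (-(1/2) : ℝ)) else 0)
      _ ENNReal.ofReal_ne_top (fun _ => ENNReal.ofReal_ne_top) fun y hy => ?_)
    · refine lintegral_congr fun z => ?_
      rw [mul_assoc]
      split_ifs with h
      · rw [mul_comm (z.2⁻¹), ENNReal.ofReal_mul (Real.rpow_nonneg (hρ0 _) _), mul_comm (ENNReal.ofReal (z.2⁻¹))]
      · simp
    · exact cone1 hc hγ (fun z hz s hs => hcone z hz y (fun h => hy (by simp [h])) s hs) x
  · intro z
    simp only [hw _ p hp.le, add_sub_cancel_right]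
    rw [mul_assoc, ← ENNReal.ofReal_mul (by positivity)]
    refine le_trans (le_of_eq ?_) (seg_bound (fun y => ENNReal.ofReal |κ y|) (fun y s => if c * ρ (z + s • y) ≤ s ∧ z ∈ S then
      ENNReal.ofReal (s⁻¹ * ρ (z + s • y) ^ (-(p / (2 * q)))) else 0)
      _ ENNReal.ofReal_ne_top (fun _ => ENNReal.ofReal_ne_top) fun y hy => ?_)
    · refine lintegral_congr fun z => ?_
      rw [mul_assoc]
      split_ifs with h
      · rw [mul_comm (z.2⁻¹), ENNReal.ofReal_mul (Real.rpow_nonneg (hρ0 _) _), mul_comm (ENNReal.ofReal (z.2⁻¹))]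
      · simp
    · by_cases hz : z ∈ S
      · simp only [hz, and_true]
        have hy0 : κ y ≠ 0 := fun h => hy (by simp [h])
        exact cone2 hc hγ hY (by positivity) hlip (hκY y hy0) (hSρ z hz) (hcone z hz y hy0)
      · simp [hz]
end
end

section
open MeasureTheory
open scoped ENNReal
noncomputable section
variable {d : ℕ}

open Classical in
lemma cone_pt {κ : Euc d → ℝ} (hκ : Tst Set.univ κ) {c : ℝ} {ρ : Euc d → ℝ}
    (hρm : Measurable ρ) (hρ0 : ∀ x, 0 ≤ ρ x) (hc : 0 < c) {Y : ℝ} (hcY : c * Y ≤ 1 / 2)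
    (hκY : ∀ y, κ y ≠ 0 → ‖y‖ ≤ Y) (hlip : ∀ x y, ρ x ≤ ρ y + ‖x - y‖)
    {h : Euc d → ℝ} (hh : Tst Set.univ h) (v x : Euc d) :
    ENNReal.ofReal |av (seg volume) (fun z => κ z.1) (fun z => z.2 • z.1) (dd v h) x| ≤
      (∫⁻ z, (ENNReal.ofReal |κ z.1| * (if z.2 < c * ρ x then ENNReal.ofReal (2 / ρ x) else 0)) *
      ENNReal.ofReal |ρ (x - z.2 • z.1) * dd v h (x - z.2 • z.1)| ∂(seg volume)) +
      ∫⁻ z, (ENNReal.ofReal |dd v κ z.1| * (if c * ρ x ≤ z.2 ∧ x - z.2 • z.1 ∈ tsupport h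
        then ENNReal.ofReal (z.2⁻¹) else 0)) * ENNReal.ofReal |h (x - z.2 • z.1)| ∂(seg volume) := by
  have hξ : Measurable fun z : Euc d × ℝ => z.2 • z.1 := measurable_snd.smul measurable_fst
  have hxξ : Measurable fun z : Euc d × ℝ => x - z.2 • z.1 := measurable_const.sub hξ
  have hκi : Integrable (fun z : Euc d × ℝ => κ z.1) (seg volume) := hκ.integrable.comp_fst _
  have hintg := av_integrable hκi hξ (hh.dd v) x
  set f1 : Euc d × ℝ → ℝ≥0∞ := fun z => (ENNReal.ofReal |κ z.1| * (if z.2 < c * ρ x then ENNReal.ofReal (2 / ρ x) else 0)) *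
      ENNReal.ofReal |ρ (x - z.2 • z.1) * dd v h (x - z.2 • z.1)| with hf1
  set f2 : Euc d × ℝ → ℝ≥0∞ := fun z => (ENNReal.ofReal |dd v κ z.1| * (if c * ρ x ≤ z.2 ∧ x - z.2 • z.1 ∈ tsupport h
        then ENNReal.ofReal (z.2⁻¹) else 0)) * ENNReal.ofReal |h (x - z.2 • z.1)| with hf2
  have m1 : Measurable f1 := by
    refine Measurable.mul (Measurable.mul ?_ ?_) ?_
    · exact (hκ.cont.abs.measurable.comp measurable_fst).ennreal_ofReal
    · exact Measurable.ite (measurableSet_lt measurable_snd measurable_const) measurable_const measurable_const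
    · exact (((hρm.comp hxξ).mul ((hh.dd v).cont.measurable.comp hxξ)).abs).ennreal_ofReal
  have m2 : Measurable f2 := by
    refine Measurable.mul (Measurable.mul ?_ ?_) ?_
    · exact ((hκ.dd v).cont.abs.measurable.comp measurable_fst).ennreal_ofReal
    · refine Measurable.ite (MeasurableSet.inter (measurableSet_le measurable_const measurable_snd) ?_)
        (measurable_snd.inv).ennreal_ofReal measurable_const
      exact (isClosed_tsupport h).measurableSet.preimage hxξ
    · exact (hh.cont.abs.measurable.comp hxξ).ennreal_ofReal
  rw [← lintegral_add_left m1]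
  unfold av seg
  rw [integral_prod_symm _ hintg, lintegral_prod_symm' (fun z => f1 z + f2 z) (m1.add m2)]
  have := enorm_integral_le_lintegral_enorm (μ := volume.restrict (Set.Ioc (0:ℝ) 1))
    (fun s => ∫ y, κ y * dd v h (x - s • y))
  rw [Real.enorm_eq_ofReal_abs] at this
  refine this.trans (setLIntegral_mono' measurableSet_Ioc fun s hs => ?_)
  by_cases hsc : s < c * ρ x
  · refine (enorm_integral_le_lintegral_enorm _).trans (lintegral_mono fun y => ?_)
    refine le_trans ?_ le_self_add
    simp only [hf1, if_pos hsc]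
    rw [Real.enorm_eq_ofReal_abs, abs_mul, ENNReal.ofReal_mul (abs_nonneg _), mul_assoc]
    by_cases hy : κ y = 0
    · simp [hy]
    gcongr
    rw [← ENNReal.ofReal_mul (div_nonneg zero_le_two (hρ0 x)), abs_mul, abs_of_nonneg (hρ0 _)]
    refine ENNReal.ofReal_le_ofReal ?_
    have hρx : 0 < ρ x := by
      by_contra h'
      have : ρ x = 0 := le_antisymm (not_lt.1 h') (hρ0 x)
      rw [this] at hsc; linarith [hs.1]
    have e1 := hlip x (x - s • y)
    rw [sub_sub_cancel, norm_smul, Real.norm_of_nonneg hs.1.le] at e1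
    have e5 : s * ‖y‖ ≤ 1 / 2 * ρ x := by
      calc s * ‖y‖ ≤ c * ρ x * Y := by
            exact mul_le_mul hsc.le (hκY y hy) (norm_nonneg _) (by positivity)
        _ = c * Y * ρ x := by ring
        _ ≤ _ := mul_le_mul_of_nonneg_right hcY (hρ0 _)
    have e6 : 1 ≤ 2 / ρ x * ρ (x - s • y) := by
      rw [div_mul_eq_mul_div, le_div_iff₀ hρx]; linarith
    calc |dd v h (x - s • y)| = 1 * |dd v h (x - s • y)| := (one_mul _).symm
      _ ≤ (2 / ρ x * ρ (x - s • y)) * |dd v h (x - s • y)| := by gcongr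
      _ = _ := by ring
  · rw [av_by_parts hκ hh hs.1.ne', ← integral_const_mul]
    refine (enorm_integral_le_lintegral_enorm _).trans (lintegral_mono fun y => ?_)
    refine le_trans ?_ le_add_self
    simp only [hf2]
    by_cases hy : h (x - s • y) = 0
    · simp [hy]
    rw [if_pos ⟨not_lt.1 hsc, subset_tsupport _ hy⟩, Real.enorm_eq_ofReal_abs, abs_mul, abs_mul,
      ENNReal.ofReal_mul (abs_nonneg _), ENNReal.ofReal_mul (abs_nonneg _), abs_of_pos (inv_pos.2 hs.1)]
    apply le_of_eq; ring

open Classical in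
lemma cone_core {p : ℝ} (hp : 1 < p) {κ : Euc d → ℝ} (hκ : Tst Set.univ κ) {Y γ : ℝ} (hY : 0 ≤ Y) (hγ : 0 < γ)
    (hκY : ∀ y ∈ tsupport κ, ‖y‖ ≤ Y) (v : Euc d) :
    ∃ C > 0, ∀ ρ : Euc d → ℝ, Measurable ρ → (∀ x, 0 ≤ ρ x) → (∀ x y, ρ x ≤ ρ y + ‖x - y‖) → ∀ h, Tst Set.univ h →
      (∀ z ∈ tsupport h, 0 < ρ z) →
      (∀ z ∈ tsupport h, ∀ y ∈ tsupport κ, ∀ s ∈ Set.Icc (0:ℝ) 1, γ * s ≤ ρ (z + s • y)) →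
      eLpNorm (av (seg volume) (fun z => κ z.1) (fun z => z.2 • z.1) (dd v h)) (ENNReal.ofReal p) volume ≤
        ENNReal.ofReal C * (eLpNorm h (ENNReal.ofReal p) volume +
          eLpNorm (fun x => ρ x * dd v h x) (ENNReal.ofReal p) volume) := by
  have hpq := Real.HolderConjugate.conjExponent hp
  set q := p.conjExponent
  have hp0 := hpq.pos
  have hq0 := hpq.symm.pos
  set c : ℝ := 1 / (2 * (Y + 1)) with hcdef
  have hc : 0 < c := by positivity
  have hcY : c * Y ≤ 1 / 2 := by
    rw [hcdef, div_mul_eq_mul_div, div_le_div_iff₀ (by positivity) (by norm_num)]; linarith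
  have fin : ∀ κ : Euc d → ℝ, Tst Set.univ κ → (∫⁻ y, ENNReal.ofReal |κ y|) ≠ ⊤ := by
    intro κ hκ
    rw [lint_abs hκ.integrable]; exact ENNReal.ofReal_ne_top
  obtain ⟨K1, hK1, hK1'⟩ : ∃ K : ℝ≥0∞, K ≠ ⊤ ∧ K = ((∫⁻ y, ENNReal.ofReal |κ y|) * ENNReal.ofReal (2 * c)) ^ (p / q) *
        ((∫⁻ y, ENNReal.ofReal |κ y|) * ENNReal.ofReal (6 * c)) := by
    refine ⟨_, ENNReal.mul_ne_top (ENNReal.rpow_ne_top_of_nonneg (by positivity) ?_) ?_, rfl⟩ <;>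
    exact ENNReal.mul_ne_top (fin κ hκ) ENNReal.ofReal_ne_top
  obtain ⟨K2, hK2, hK2'⟩ : ∃ K : ℝ≥0∞, K ≠ ⊤ ∧ K = ((∫⁻ y, ENNReal.ofReal |dd v κ y|) * ENNReal.ofReal (2 / (c * γ))) ^ (p / q) *
        ((∫⁻ y, ENNReal.ofReal |dd v κ y|) * ENNReal.ofReal (γ ^ (-(p / (2 * q))) * ((2 * (c⁻¹ + Y)) ^ (p / (2 * q)) / (p / (2 * q))))) := by
    refine ⟨_, ENNReal.mul_ne_top (ENNReal.rpow_ne_top_of_nonneg (by positivity) ?_) ?_, rfl⟩ <;>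
    exact ENNReal.mul_ne_top (fin _ (hκ.dd v)) ENNReal.ofReal_ne_top
  have hD1 : K1 ^ (1 / p) ≠ ⊤ := ENNReal.rpow_ne_top_of_nonneg (by positivity) hK1
  have hD2 : K2 ^ (1 / p) ≠ ⊤ := ENNReal.rpow_ne_top_of_nonneg (by positivity) hK2
  refine ⟨(K1 ^ (1 / p)).toReal + (K2 ^ (1 / p)).toReal + 1, by positivity, ?_⟩
  intro ρ hρm hρ0 hlip h hh hpos hcone
  have hκ1 : ∀ y, κ y ≠ 0 → ‖y‖ ≤ Y := fun y hy => hκY y (subset_tsupport _ hy)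
  have hdκ : ∀ y, dd v κ y ≠ 0 → y ∈ tsupport κ := fun y hy => dd_ts v (subset_tsupport _ hy)
  set F1 : Euc d → ℝ≥0∞ := fun x => ∫⁻ z, (ENNReal.ofReal |κ z.1| * (if z.2 < c * ρ x then ENNReal.ofReal (2 / ρ x) else 0)) *
      ENNReal.ofReal |ρ (x - z.2 • z.1) * dd v h (x - z.2 • z.1)| ∂(seg volume) with hF1
  set F2 : Euc d → ℝ≥0∞ := fun x => ∫⁻ z, (ENNReal.ofReal |dd v κ z.1| * (if c * ρ x ≤ z.2 ∧ x - z.2 • z.1 ∈ tsupport h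
        then ENNReal.ofReal (z.2⁻¹) else 0)) * ENNReal.ofReal |h (x - z.2 • z.1)| ∂(seg volume) with hF2
  have mρ : Measurable fun x => ENNReal.ofReal |ρ x * dd v h x| :=
    ((hρm.mul (hh.dd v).cont.measurable).abs).ennreal_ofReal
  have mh : Measurable fun x => ENNReal.ofReal |h x| := hh.cont.abs.measurable.ennreal_ofReal
  have b1 : ∫⁻ x, F1 x ^ p ≤ K1 * ∫⁻ x, (ENNReal.ofReal |ρ x * dd v h x|) ^ p := by
    rw [hK1']
    exact cone_F1 hpq hκ.cont hc hcY hκ1 hρ0 hρm hlip mρ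
  have b2 : ∫⁻ x, F2 x ^ p ≤ K2 * ∫⁻ x, (ENNReal.ofReal |h x|) ^ p := by
    rw [hK2']
    exact cone_F2 hpq (hκ.dd v).cont hc hγ hY (fun y hy => hκY y (hdκ y hy)) hρ0 hρm hlip
      (isClosed_tsupport h).measurableSet hpos (fun z hz y hy => hcone z hz y (hdκ y hy)) mh
  have hξ : Measurable fun w : Euc d × (Euc d × ℝ) => w.1 - w.2.2 • w.2.1 := by fun_prop
  have mF1 : Measurable F1 := by
    refine Measurable.lintegral_prod_right' (f := fun w : Euc d × (Euc d × ℝ) => (ENNReal.ofReal |κ w.2.1| * (if w.2.2 < c * ρ w.1 then ENNReal.ofReal (2 / ρ w.1) else 0)) *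
      ENNReal.ofReal |ρ (w.1 - w.2.2 • w.2.1) * dd v h (w.1 - w.2.2 • w.2.1)|) ?_
    refine Measurable.mul (Measurable.mul ?_ (Measurable.ite ?_ ?_ measurable_const)) (mρ.comp hξ)
    · exact (hκ.cont.abs.measurable.comp (measurable_fst.comp measurable_snd)).ennreal_ofReal
    · exact measurableSet_lt (measurable_snd.comp measurable_snd) ((hρm.comp measurable_fst).const_mul c)
    · exact (measurable_const.div (hρm.comp measurable_fst)).ennreal_ofReal
  have mF2 : Measurable F2 := by
    refine Measurable.lintegral_prod_right' (f := fun w : Euc d × (Euc d × ℝ) => (ENNReal.ofReal |dd v κ w.2.1| * (if c * ρ w.1 ≤ w.2.2 ∧ w.1 - w.2.2 • w.2.1 ∈ tsupport h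
        then ENNReal.ofReal (w.2.2⁻¹) else 0)) * ENNReal.ofReal |h (w.1 - w.2.2 • w.2.1)|) ?_
    refine Measurable.mul (Measurable.mul ?_ (Measurable.ite (MeasurableSet.inter ?_ ?_) ?_ measurable_const)) (mh.comp hξ)
    · exact ((hκ.dd v).cont.abs.measurable.comp (measurable_fst.comp measurable_snd)).ennreal_ofReal
    · exact measurableSet_le ((hρm.comp measurable_fst).const_mul c) (measurable_snd.comp measurable_snd)
    · exact (isClosed_tsupport h).measurableSet.preimage hξ
    · exact (measurable_snd.comp measurable_snd).inv.ennreal_ofReal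
  rw [eLpNorm_real hp0, eLpNorm_real hp0 h, eLpNorm_real hp0 (fun x => ρ x * dd v h x)]
  set N1 := ∫⁻ x, (ENNReal.ofReal |ρ x * dd v h x|) ^ p
  set N2 := ∫⁻ x, (ENNReal.ofReal |h x|) ^ p
  calc _ ≤ (∫⁻ x, (F1 + F2) x ^ p) ^ (1 / p) := by
        gcongr with x
        exact cone_pt hκ hρm hρ0 hc hcY hκ1 hlip hh v x
    _ ≤ (∫⁻ x, F1 x ^ p) ^ (1 / p) + (∫⁻ x, F2 x ^ p) ^ (1 / p) :=
        ENNReal.lintegral_Lp_add_le mF1.aemeasurable mF2.aemeasurable hp.le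
    _ ≤ (K1 * N1) ^ (1 / p) + (K2 * N2) ^ (1 / p) := by gcongr
    _ = K1 ^ (1 / p) * N1 ^ (1 / p) + K2 ^ (1 / p) * N2 ^ (1 / p) := by
        rw [ENNReal.mul_rpow_of_nonneg _ _ (by positivity), ENNReal.mul_rpow_of_nonneg _ _ (by positivity)]
    _ ≤ _ := by
        rw [mul_add, add_comm]
        have g1 : K1 ^ (1 / p) ≤ ENNReal.ofReal ((K1 ^ (1 / p)).toReal + (K2 ^ (1 / p)).toReal + 1) := by
          rw [← ENNReal.ofReal_toReal hD1]
          refine ENNReal.ofReal_le_ofReal ?_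
          rw [ENNReal.ofReal_toReal hD1]
          have : 0 ≤ (K2 ^ (1 / p)).toReal := ENNReal.toReal_nonneg
          linarith
        have g2 : K2 ^ (1 / p) ≤ ENNReal.ofReal ((K1 ^ (1 / p)).toReal + (K2 ^ (1 / p)).toReal + 1) := by
          rw [← ENNReal.ofReal_toReal hD2]
          refine ENNReal.ofReal_le_ofReal ?_
          rw [ENNReal.ofReal_toReal hD2]
          have : 0 ≤ (K1 ^ (1 / p)).toReal := ENNReal.toReal_nonneg
          linarith
        gcongr

/-- the segment field pushing along `ψ` has gradient controlled by the weighted norm -/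
lemma cone_est {p : ℝ} (hp : 1 < p) {ψ : Euc d → ℝ} (hψ : Tst Set.univ ψ) {Y γ : ℝ} (hY : 0 ≤ Y) (hγ : 0 < γ)
    (hψY : ∀ y ∈ tsupport ψ, ‖y‖ ≤ Y) :
    ∃ C > 0, ∀ ρ : Euc d → ℝ, Measurable ρ → (∀ x, 0 ≤ ρ x) → (∀ x y, ρ x ≤ ρ y + ‖x - y‖) → ∀ h, Tst Set.univ h →
      (∀ z ∈ tsupport h, 0 < ρ z) →
      (∀ z ∈ tsupport h, ∀ y ∈ tsupport ψ, ∀ s ∈ Set.Icc (0:ℝ) 1, γ * s ≤ ρ (z + s • y)) →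
      ∀ i j, eLpNorm (dd (coordDir j) (segV volume ψ (fun _ => 0) id h i)) (ENNReal.ofReal p) volume ≤
        ENNReal.ofReal C * (eLpNorm h (ENNReal.ofReal p) volume +
          eLpNorm (fun x => ρ x * dd (coordDir j) h x) (ENNReal.ofReal p) volume) := by
  have hcd : ∀ i : Fin d, ContDiff ℝ (⊤ : ℕ∞) fun y : Euc d => y i := fun i =>
    (EuclideanSpace.proj (𝕜 := ℝ) i : Euc d →L[ℝ] ℝ).contDiff
  have hκ : ∀ i : Fin d, Tst Set.univ (fun y : Euc d => y i * ψ y) := fun i => hψ.mul_left (hcd i)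
  have hsub : ∀ i : Fin d, tsupport (fun y : Euc d => y i * ψ y) ⊆ tsupport ψ := fun i =>
    closure_mono (Function.support_subset_iff'.2 fun y hy => by
      rw [Function.notMem_support.1 hy, mul_zero])
  choose C hC0 hC using fun (i : Fin d) (j : Fin d) => cone_core hp (hκ i) hY hγ (fun y hy => hψY y (hsub i hy)) (coordDir j)
  refine ⟨1 + ∑ i, ∑ j, C i j, ?_, ?_⟩
  · have : 0 ≤ ∑ i, ∑ j, C i j := Finset.sum_nonneg fun i _ => Finset.sum_nonneg fun j _ => (hC0 i j).le
    linarith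
  intro ρ hρm hρ0 hlip h hh hpos hcone i j
  have e : dd (coordDir j) (segV volume ψ (fun _ => 0) id h i) =
      av (seg volume) (fun z : Euc d × ℝ => z.1 i * ψ z.1) (fun z => z.2 • z.1) (dd (coordDir j) h) := by
    unfold segV
    rw [dd_av (seg_a_integrable hψ.integrable measurable_id (B := Y) (fun ω h => hψY ω (subset_tsupport _ h)) i)
      (seg_xi_meas measurable_const measurable_id) hh]
    congr 1
    · ext z; simp only [id]; ring
    · ext1 z; simp
  rw [e]
  refine (hC i j ρ hρm hρ0 hlip h hh hpos (fun z hz y hy => hcone z hz y (hsub i hy))).trans ?_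
  gcongr
  have h1 : C i j ≤ ∑ j, C i j := Finset.single_le_sum (f := fun j => C i j) (fun j _ => (hC0 i j).le) (Finset.mem_univ j)
  have h2 : ∑ j, C i j ≤ ∑ i, ∑ j, C i j := Finset.single_le_sum (f := fun i => ∑ j, C i j)
    (fun i _ => Finset.sum_nonneg fun j _ => (hC0 i j).le) (Finset.mem_univ i)
  linarith
end
end

section
open MeasureTheory
open scoped ENNReal
noncomputable section
variable {d : ℕ}

/-! ### The right inverse of the divergence near a point -/

lemma l1_le {p : ℝ} (hp : 1 < p) {S : Set (Euc d)} (hS : Bornology.IsBounded S) :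
    ∃ C : ℝ, 0 < C ∧ ∀ f, Tst S f → ∫⁻ x, ENNReal.ofReal |f x| ≤ ENNReal.ofReal C * eLpNorm f (ENNReal.ofReal p) volume := by
  obtain ⟨R, hR⟩ := hS.subset_closedBall 0
  set B : Set (Euc d) := Metric.closedBall 0 R
  have hB : volume B ≠ ⊤ := (isCompact_closedBall _ _).measure_lt_top.ne
  have hpos : 0 < 1 - 1 / p := by
    rw [sub_pos, div_lt_one (by linarith)]; exact hp
  have hfin : volume B ^ (1 - 1 / p) ≠ ⊤ := ENNReal.rpow_ne_top_of_nonneg hpos.le hB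
  refine ⟨(volume B ^ (1 - 1 / p)).toReal + 1, by positivity, fun f hf => ?_⟩
  have h0 : ∀ x, x ∉ B → f x = 0 := fun x hx => hf.eq_zero fun h => hx (hR h)
  have e : B.indicator f = f := by
    ext x
    by_cases hx : x ∈ B
    · simp [hx]
    · simp [hx, h0 x hx]
  have h1 := eLpNorm_le_eLpNorm_mul_rpow_measure_univ (μ := volume.restrict B) (p := 1) (q := ENNReal.ofReal p)
    (f := f) (by rw [← ENNReal.ofReal_one]; exact ENNReal.ofReal_le_ofReal hp.le) hf.cont.aestronglyMeasurable
  rw [← eLpNorm_indicator_eq_eLpNorm_restrict measurableSet_closedBall,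
    ← eLpNorm_indicator_eq_eLpNorm_restrict measurableSet_closedBall, e, Measure.restrict_apply_univ,
    ENNReal.toReal_one, ENNReal.toReal_ofReal (by linarith), eLpNorm_one_eq_lintegral_enorm] at h1
  simp_rw [Real.enorm_eq_ofReal_abs] at h1
  refine h1.trans ?_
  rw [mul_comm, div_one]
  gcongr
  rw [← ENNReal.ofReal_toReal hfin]
  refine ENNReal.ofReal_le_ofReal ?_
  rw [ENNReal.ofReal_toReal hfin]; linarith

lemma abs_int_le {f : Euc d → ℝ} {K : ℝ≥0∞} (h : ∫⁻ x, ENNReal.ofReal |f x| ≤ K) :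
    ENNReal.ofReal |∫ x, f x| ≤ K := by
  have := enorm_integral_le_lintegral_enorm (μ := (volume : Measure (Euc d))) f
  simp_rw [Real.enorm_eq_ofReal_abs] at this
  exact this.trans h

lemma eLp_const_mul (c : ℝ) (f : Euc d → ℝ) (p : ℝ≥0∞) :
    eLpNorm (fun x => c * f x) p volume = ENNReal.ofReal |c| * eLpNorm f p volume := by
  have := eLpNorm_const_smul c f p volume
  rw [Real.enorm_eq_ofReal_abs] at this
  exact this

/-- pushing the mass of `h * ψ` to a single translate of `ψ` -/
lemma push_to_point {p : ℝ} (hp : 1 < p) {ψ : Euc d → ℝ} (hψ : Tst Set.univ ψ) {Ω A : Set (Euc d)}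
    (hA : Bornology.IsBounded A) {y0 : Euc d} {B : ℝ} (hB0 : 0 ≤ B) (hB : ∀ z ∈ A, ‖y0 - z‖ ≤ B)
    (hΩ : ∀ z ∈ A, ∀ k ∈ tsupport ψ, ∀ τ ∈ Set.Icc (0:ℝ) 1, k + (z + τ • (y0 - z)) ∈ Ω) :
    ∃ C : ℝ, 0 < C ∧ ∀ h, Tst A h → ∃ v : Fin d → Euc d → ℝ, (∀ i, Tst Ω (v i)) ∧
      (∀ x, ∑ i, dd (coordDir i) (v i) x = (∫ z, h z * ψ (x - z)) - (∫ z, h z) * ψ (x - y0)) ∧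
      ∀ i j, eLpNorm (dd (coordDir j) (v i)) (ENNReal.ofReal p) volume ≤
        ENNReal.ofReal C * eLpNorm h (ENNReal.ofReal p) volume := by
  obtain ⟨C1, hC1, hl⟩ := l1_le hp hA
  have hmem : ∀ j : Fin d, eLpNorm (dd (coordDir j) ψ) (ENNReal.ofReal p) volume ≠ ⊤ := fun j =>
    ((hψ.dd _).memLp _ _).eLpNorm_ne_top
  set K : ℝ := ∑ j : Fin d, (eLpNorm (dd (coordDir j) ψ) (ENNReal.ofReal p) volume).toReal with hK
  have hK0 : 0 ≤ K := Finset.sum_nonneg fun j _ => ENNReal.toReal_nonneg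
  have hKj : ∀ j : Fin d, eLpNorm (dd (coordDir j) ψ) (ENNReal.ofReal p) volume ≤ ENNReal.ofReal K := by
    intro j
    rw [← ENNReal.ofReal_toReal (hmem j)]
    exact ENNReal.ofReal_le_ofReal (Finset.single_le_sum (f := fun j : Fin d => (eLpNorm (dd (coordDir j) ψ) (ENNReal.ofReal p) volume).toReal)
      (fun j _ => ENNReal.toReal_nonneg) (Finset.mem_univ j))
  refine ⟨B * C1 * K + 1, by positivity, fun h hh => ?_⟩
  have hb : Measurable fun z : Euc d => y0 - z := measurable_const.sub measurable_id
  have hBh : ∀ z, h z ≠ 0 → ‖y0 - z‖ ≤ B := fun z hz => hB z (hh.ts (subset_tsupport _ hz))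
  refine ⟨segV volume h id (fun z => y0 - z) ψ, ?_, ?_, ?_⟩
  · set m : Euc d × Euc d × ℝ → Euc d := fun w => w.1 + (w.2.1 + w.2.2 • (y0 - w.2.1))
    have hmc : Continuous m := by fun_prop
    refine seg_tst hh.integrable measurable_id hb hBh hψ
      ((hψ.cs.prod (hh.cs.prod (isCompact_Icc (a := (0:ℝ)) (b := 1)))).image hmc) ?_ ?_
    · rintro _ ⟨⟨k, z, τ⟩, ⟨hk, hz, hτ⟩, rfl⟩
      exact hΩ z (hh.ts hz) k hk τ hτ
    · intro z hz τ hτ k hk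
      exact ⟨(k, z, τ), ⟨hk, subset_tsupport _ hz, hτ⟩, rfl⟩
  · intro x
    rw [seg_div hh.integrable measurable_id hb hBh hψ x]
    simp only [av, id, add_sub_cancel]
    rw [integral_mul_const]
  · intro i j
    have e : dd (coordDir j) (segV volume h id (fun z => y0 - z) ψ i) = _ :=
      dd_av (seg_a_integrable hh.integrable hb hBh i) (seg_xi_meas measurable_id hb) hψ (coordDir j)
    rw [e]
    have hm : Measurable fun z : Euc d × ℝ => h z.1 * (y0 - z.1) i :=
      (hh.cont.measurable.comp measurable_fst).mul ((coord_meas hb i).comp measurable_fst)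
    have hA1 : ∫⁻ z : Euc d × ℝ, ENNReal.ofReal |h z.1 * (y0 - z.1) i| ∂(seg volume) ≤
        ENNReal.ofReal (B * C1) * eLpNorm h (ENNReal.ofReal p) volume := by
      have hb1 := seg_bound (d := d) (fun z => ENNReal.ofReal |h z * (y0 - z) i|) (fun _ _ => 1) 1 ENNReal.one_ne_top
        (fun _ => ENNReal.ofReal_ne_top) (fun y _ => by simp)
      simp only [mul_one] at hb1
      refine hb1.trans ?_
      calc _ ≤ ∫⁻ z, ENNReal.ofReal B * ENNReal.ofReal |h z| := by
            refine lintegral_mono fun z => ?_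
            simp only
            rw [← ENNReal.ofReal_mul hB0]
            refine ENNReal.ofReal_le_ofReal ?_
            rw [abs_mul, mul_comm]
            by_cases hz : h z = 0
            · simp [hz]
            · gcongr
              exact (PiLp.norm_apply_le (y0 - z) i).trans (hBh z hz)
        _ = ENNReal.ofReal B * ∫⁻ z, ENNReal.ofReal |h z| := lintegral_const_mul' _ _ ENNReal.ofReal_ne_top
        _ ≤ ENNReal.ofReal B * (ENNReal.ofReal C1 * eLpNorm h (ENNReal.ofReal p) volume) := by
            gcongr; exact hl h hh
        _ = _ := by rw [ENNReal.ofReal_mul hB0, mul_assoc]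
    refine (av_norm hp hm (seg_xi_meas measurable_id hb) (hψ.dd _).cont.measurable hA1).trans ?_
    calc _ ≤ ENNReal.ofReal (B * C1) * eLpNorm h (ENNReal.ofReal p) volume * ENNReal.ofReal K := by
          gcongr; exact hKj j
      _ = ENNReal.ofReal (B * C1 * K) * eLpNorm h (ENNReal.ofReal p) volume := by
          rw [ENNReal.ofReal_mul (by positivity : 0 ≤ B * C1)]; ring
      _ ≤ _ := by gcongr; linarith

def BogOn (Ω A : Set (Euc d)) (θ0 : Euc d → ℝ) (p : ℝ) : Prop :=
  ∃ C : ℝ, 0 < C ∧ ∀ f, Tst A f → ∃ v : Fin d → Euc d → ℝ, (∀ i, Tst Ω (v i)) ∧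
    (∀ x, ∑ i, dd (coordDir i) (v i) x = f x - (∫ y, f y) * θ0 x) ∧
    ∀ i j, eLpNorm (dd (coordDir j) (v i)) (ENNReal.ofReal p) volume ≤
        ENNReal.ofReal C * eLpNorm f (ENNReal.ofReal p) volume

lemma div_integral {f h : Euc d → ℝ} {w : Fin d → Euc d → ℝ} (hw : ∀ i, Tst Set.univ (w i))
    (hf : Tst Set.univ f) (hh : Tst Set.univ h)
    (hdiv : ∀ x, ∑ i, dd (coordDir i) (w i) x = f x - h x) : ∫ x, f x = ∫ x, h x := by
  have h1 : ∫ x, ∑ i, dd (coordDir i) (w i) x = 0 := by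
    rw [integral_finsetSum _ fun i _ => by exact ((hw i).dd _).integrable]
    exact Finset.sum_eq_zero fun i _ => integral_dd (hw i) _
  simp_rw [hdiv] at h1
  rw [integral_sub hf.integrable hh.integrable] at h1
  linarith

lemma conv_comm (ψ h : Euc d → ℝ) (x : Euc d) : ∫ y, ψ y * h (x - y) = ∫ z, h z * ψ (x - z) := by
  rw [← integral_sub_left_eq_self (fun z => h z * ψ (x - z)) volume x]
  refine integral_congr_ae (Filter.Eventually.of_forall fun y => ?_)
  simp [mul_comm]

lemma bog_chart (hd : 0 < d) {Ω : Set (Euc d)} (hΩ : IsOpen Ω) (hc : IsPreconnected Ω) (hbd : Bornology.IsBounded Ω)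
    {xs : Euc d} (hxs : xs ∈ Ω) {θ0 : Euc d → ℝ} (hθ0 : Nr Ω xs θ0) {p : ℝ} (hp : 1 < p)
    {x0 n : Euc d} {β R : ℝ} (hx0 : x0 ∈ closure Ω) (hβ : 0 < β) (hR : 0 < R)
    (hcone : ∀ y ∈ Ω ∩ Metric.ball x0 R, ∀ s ∈ Set.Ioc (0:ℝ) 1, ∀ w ∈ Metric.ball n β, y + s • w ∈ Ω) :
    ∃ r > 0, BogOn Ω (Ω ∩ Metric.ball x0 r) θ0 p := by
  have : Nonempty (Fin d) := ⟨⟨0, hd⟩⟩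
  have hne : Ωᶜ.Nonempty := by
    rw [Set.nonempty_compl]
    rintro rfl
    exact NormedSpace.unbounded_univ ℝ (Euc d) hbd
  set σ : ℝ := min R (β / 4) / 2 with hσd
  have hm0 : 0 < min R (β / 4) := lt_min hR (by positivity)
  have hσ : 0 < σ := by positivity
  set ρ : Euc d → ℝ := fun x => min (Metric.infDist x Ωᶜ) σ with hρd
  have hρ0 : ∀ x, 0 ≤ ρ x := fun x => le_min Metric.infDist_nonneg hσ.le
  have hρm : Measurable ρ := ((Metric.continuous_infDist_pt _).min continuous_const).measurable
  have hρσ : ∀ x, ρ x ≤ σ := fun x => min_le_right _ _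
  have hlip : ∀ x y, ρ x ≤ ρ y + ‖x - y‖ := by
    intro x y
    have h1 : Metric.infDist x Ωᶜ ≤ Metric.infDist y Ωᶜ + ‖x - y‖ := by
      rw [← dist_eq_norm]; exact Metric.infDist_le_infDist_add_dist
    have h2 := norm_nonneg (x - y)
    simp only [hρd]
    rcases min_cases (Metric.infDist y Ωᶜ) σ with ⟨h, -⟩ | ⟨h, -⟩ <;> rw [h]
    · exact (min_le_left _ _).trans h1
    · exact (min_le_right _ _).trans (by linarith)
  have hρΩ : {x | 0 < ρ x} = Ω := by
    ext x
    change 0 < ρ x ↔ _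
    rw [hρd, lt_min_iff, and_iff_left hσ, ← hΩ.isClosed_compl.notMem_iff_infDist_pos hne]
    simp
  obtain ⟨y0, hy0b, hy0⟩ := mem_closure_iff.1 hx0 _ Metric.isOpen_ball (Metric.mem_ball_self (x := x0) hσ)
  have hσR : σ + σ ≤ R := by
    have := min_le_left R (β / 4); linarith
  have hσβ : σ + σ ≤ β / 4 := by
    have := min_le_right R (β / 4); linarith
  have hy0R : y0 ∈ Ω ∩ Metric.ball x0 R := ⟨hy0, Metric.ball_subset_ball (by linarith) hy0b⟩
  obtain ⟨ψ, hψ, hψ1, hψ0⟩ := exists_bump n (half_pos hβ)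
  have hψu : Tst Set.univ ψ := hψ.mono (Set.subset_univ _)
  have hψY : ∀ y ∈ tsupport ψ, ‖y‖ ≤ ‖n‖ + β := by
    intro y hy
    have := hψ.ts hy
    rw [Metric.mem_ball, dist_eq_norm] at this
    have h2 := norm_add_le n (y - n)
    rw [add_sub_cancel] at h2; linarith
  -- the set containing the smoothed function
  set A : Set (Euc d) := Ω ∩ Metric.ball x0 (σ + σ) with hA
  have hAR : A ⊆ Ω ∩ Metric.ball x0 R := Set.inter_subset_inter_right _ (Metric.ball_subset_ball hσR)
  have hAb : Bornology.IsBounded A := hbd.subset Set.inter_subset_left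
  obtain ⟨CL, hCL, hlayer⟩ := layer hd hp
  have hγ : 0 < min (β / 2) σ := lt_min (by positivity) hσ
  obtain ⟨CC, hCC, hcest⟩ := cone_est hp hψu (Y := ‖n‖ + β) (by positivity) hγ hψY
  have hyA : ∀ z ∈ A, ‖y0 - z‖ ≤ β / 2 := by
    intro z hz
    have h1 := hz.2
    rw [Metric.mem_ball] at h1 hy0b
    rw [← dist_eq_norm]
    have := dist_triangle_right y0 z x0
    linarith
  obtain ⟨CP, hCP, hpush⟩ := push_to_point hp hψu (Ω := Ω) hAb (y0 := y0) (B := β / 2) (by positivity) hyA (by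
    intro z hz k hk τ hτ
    have h1 := hcone z (hAR hz) 1 ⟨one_pos, le_rfl⟩ (k + τ • (y0 - z)) (by
      rw [Metric.mem_ball, dist_eq_norm]
      have h2 := hψ.ts hk
      rw [Metric.mem_ball, dist_eq_norm] at h2
      have h3 : ‖τ • (y0 - z)‖ ≤ β / 2 := by
        rw [norm_smul, Real.norm_of_nonneg hτ.1]
        calc τ * ‖y0 - z‖ ≤ 1 * ‖y0 - z‖ := by gcongr; exact hτ.2
          _ ≤ _ := by rw [one_mul]; exact hyA z hz
      calc ‖k + τ • (y0 - z) - n‖ = ‖(k - n) + τ • (y0 - z)‖ := by congr 1; abel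
        _ ≤ ‖k - n‖ + ‖τ • (y0 - z)‖ := norm_add_le _ _
        _ < β := by linarith)
    convert h1 using 1
    rw [one_smul]; abel)
  -- the fixed field
  have hNr : Nr Ω (y0 + n) (fun x => ψ (x - y0)) := by
    refine ⟨β / 2, half_pos hβ, ?_, ?_, ?_⟩
    · intro x hx
      have := hcone y0 hy0R 1 ⟨one_pos, le_rfl⟩ (x - y0) (by
        rw [Metric.mem_ball, dist_eq_norm] at hx ⊢
        calc ‖x - y0 - n‖ = ‖x - (y0 + n)‖ := by congr 1; abel
          _ < β := by linarith)
      simpa using this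
    · refine Tst.of_support (hψ.cd.comp (by fun_prop)) (hψ.cs.image (continuous_add_const y0)) ?_ ?_
      · rintro _ ⟨k, hk, rfl⟩
        have h2 := hψ.ts hk
        rw [Metric.mem_ball, dist_eq_norm] at h2 ⊢
        convert h2 using 2
        change k + y0 - (y0 + n) = k - n
        abel
      · intro x hx
        by_contra h
        exact hx ⟨x - y0, subset_tsupport _ h, by simp⟩
    · rw [integral_sub_right_eq_self]; exact hψ1
  have hny : y0 + n ∈ Ω := by
    have := hcone y0 hy0R 1 ⟨one_pos, le_rfl⟩ n (Metric.mem_ball_self hβ)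
    simpa using this
  obtain ⟨W, hW, hWd⟩ := cnn_all hΩ hc hny hxs hNr hθ0
  have hmemW : ∀ i j : Fin d, eLpNorm (dd (coordDir j) (W i)) (ENNReal.ofReal p) volume ≠ ⊤ := fun i j =>
    (((hW i).dd _).memLp _ _).eLpNorm_ne_top
  set K : ℝ := ∑ i : Fin d, ∑ j : Fin d, (eLpNorm (dd (coordDir j) (W i)) (ENNReal.ofReal p) volume).toReal with hK
  have hK0 : 0 ≤ K := Finset.sum_nonneg fun i _ => Finset.sum_nonneg fun j _ => ENNReal.toReal_nonneg
  have hKj : ∀ i j : Fin d, eLpNorm (dd (coordDir j) (W i)) (ENNReal.ofReal p) volume ≤ ENNReal.ofReal K := by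
    intro i j
    rw [← ENNReal.ofReal_toReal (hmemW i j)]
    refine ENNReal.ofReal_le_ofReal ?_
    refine (Finset.single_le_sum (f := fun j : Fin d => (eLpNorm (dd (coordDir j) (W i)) (ENNReal.ofReal p) volume).toReal)
      (fun j _ => ENNReal.toReal_nonneg) (Finset.mem_univ j)).trans ?_
    exact Finset.single_le_sum (f := fun i : Fin d => ∑ j : Fin d, (eLpNorm (dd (coordDir j) (W i)) (ENNReal.ofReal p) volume).toReal)
      (fun i _ => Finset.sum_nonneg fun j _ => ENNReal.toReal_nonneg) (Finset.mem_univ i)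
  obtain ⟨C1, hC1, hl⟩ := l1_le hp hAb
  refine ⟨σ, hσ, CL + CC * (CL + CL) + CP * CL + C1 * CL * K, by positivity, fun f hf => ?_⟩
  obtain ⟨w, h, hw, hh, hwd, hwn, hhn, hρn⟩ := hlayer ρ σ hσ hlip hρσ f (by
    rw [hρΩ]; exact hf.mono Set.inter_subset_left)
  rw [hρΩ] at hw hh
  have hsub : Ω ∩ Metric.cthickening σ (tsupport f) ⊆ A := by
    rintro x ⟨hx, hx'⟩
    refine ⟨hx, ?_⟩
    rw [hf.cs.cthickening_eq_biUnion_closedBall hσ.le] at hx'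
    obtain ⟨z, hz, hxz⟩ := Set.mem_iUnion₂.1 hx'
    have h1 := (hf.ts hz).2
    rw [Metric.mem_ball] at h1 ⊢
    rw [Metric.mem_closedBall] at hxz
    have := dist_triangle x z x0
    linarith
  have hhA : Tst A h := hh.mono hsub
  have hhu : Tst Set.univ h := hh.mono (Set.subset_univ _)
  have hwΩ : ∀ i, Tst Ω (w i) := fun i => (hw i).mono Set.inter_subset_left
  have hintg : ∫ x, f x = ∫ x, h x := div_integral (fun i => (hw i).mono (Set.subset_univ _))
    (hf.mono (Set.subset_univ _)) hhu hwd
  have hconeΩ : ∀ z ∈ tsupport h, ∀ y ∈ tsupport ψ, ∀ s ∈ Set.Icc (0:ℝ) 1, ∀ w' : Euc d, ‖w'‖ < β / 2 → z + s • (y + w') ∈ Ω := by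
    intro z hz y hy s hs w' hw'
    rcases hs.1.eq_or_lt with h0 | h0
    · rw [← h0, zero_smul, add_zero]; exact (hhA.ts hz).1
    · refine hcone z (hAR (hhA.ts hz)) s ⟨h0, hs.2⟩ _ ?_
      have h2 := hψ.ts hy
      rw [Metric.mem_ball, dist_eq_norm] at h2 ⊢
      calc ‖y + w' - n‖ = ‖(y - n) + w'‖ := by congr 1; abel
        _ ≤ ‖y - n‖ + ‖w'‖ := norm_add_le _ _
        _ < β := by linarith
  have hv2n := hcest ρ hρm hρ0 hlip h hhu (fun z hz => by
    have : z ∈ {x | 0 < ρ x} := by rw [hρΩ]; exact (hhA.ts hz).1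
    exact this) (by
    intro z hz y hy s hs
    rcases hs.1.eq_or_lt with h0 | h0
    · rw [← h0, mul_zero]; exact hρ0 _
    refine le_min ?_ ?_
    · calc min (β / 2) σ * s ≤ β / 2 * s := by gcongr; exact min_le_left _ _
        _ ≤ _ := by
          rw [Metric.le_infDist hne]
          intro u hu
          by_contra hlt
          push Not at hlt
          apply hu
          have := hconeΩ z hz y hy s hs (s⁻¹ • (u - (z + s • y))) (by
            rw [norm_smul, norm_inv, Real.norm_of_nonneg h0.le, inv_mul_lt_iff₀ h0, ← dist_eq_norm, dist_comm]
            linarith)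
          rw [smul_add, smul_inv_smul₀ h0.ne'] at this
          convert this using 1
          abel
    · calc min (β / 2) σ * s ≤ σ * 1 := mul_le_mul (min_le_right _ _) hs.2 hs.1 hσ.le
        _ = σ := mul_one _)
  have hψB : ∀ y, ψ y ≠ 0 → ‖id y‖ ≤ ‖n‖ + β := fun y hy => hψY y (subset_tsupport _ hy)
  have hv2 : ∀ i, Tst Ω (segV volume ψ (fun _ => 0) id h i) := by
    set m : Euc d × Euc d × ℝ → Euc d := fun w => w.1 + ((0 : Euc d) + w.2.2 • id w.2.1)
    have hmc : Continuous m := by fun_prop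
    refine seg_tst hψ.integrable measurable_const measurable_id hψB hhu
      ((hhu.cs.prod (hψ.cs.prod (isCompact_Icc (a := (0:ℝ)) (b := 1)))).image hmc) ?_ ?_
    · rintro _ ⟨⟨k, z, τ⟩, ⟨hk, hz, hτ⟩, rfl⟩
      have := hconeΩ k hk z hz τ hτ 0 (by simpa using half_pos hβ)
      simpa [m] using this
    · intro z hz τ hτ k hk
      exact ⟨(k, z, τ), ⟨hk, subset_tsupport _ hz, hτ⟩, rfl⟩
  have hv2d := seg_div (μ := volume) hψ.integrable (ξ := fun _ => (0 : Euc d)) measurable_const measurable_id hψB hhu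
  obtain ⟨v3, hv3, hv3d, hv3n⟩ := hpush h hhA
  have hv4n : ∀ i j, eLpNorm (dd (coordDir j) (fun x => (∫ y, h y) * W i x)) (ENNReal.ofReal p) volume ≤
      ENNReal.ofReal (C1 * CL * K) * eLpNorm f (ENNReal.ofReal p) volume := by
    intro i j
    have e : dd (coordDir j) (fun x => (∫ y, h y) * W i x) = fun x => (∫ y, h y) * dd (coordDir j) (W i) x := by
      ext x; exact dd_const_mul (hW i).diff _ _ _
    rw [e, eLp_const_mul]
    calc _ ≤ (ENNReal.ofReal C1 * (ENNReal.ofReal CL * eLpNorm f (ENNReal.ofReal p) volume)) * ENNReal.ofReal K := by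
          refine mul_le_mul' ?_ (hKj i j)
          refine (abs_int_le (hl h hhA)).trans ?_
          gcongr
      _ = _ := by
          rw [ENNReal.ofReal_mul (by positivity : 0 ≤ C1 * CL), ENNReal.ofReal_mul hC1.le]; ring
  refine ⟨fun i x => w i x + segV volume ψ (fun _ => 0) id h i x + v3 i x + (∫ y, h y) * W i x, ?_, ?_, ?_⟩
  · intro i
    exact (((hwΩ i).add (hv2 i)).add (hv3 i)).add ((hW i).const_mul _)
  · intro x
    have e : ∀ i, dd (coordDir i) (fun x => w i x + segV volume ψ (fun _ => 0) id h i x + v3 i x + (∫ y, h y) * W i x) x =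
        dd (coordDir i) (w i) x + dd (coordDir i) (segV volume ψ (fun _ => 0) id h i) x + dd (coordDir i) (v3 i) x +
          (∫ y, h y) * dd (coordDir i) (W i) x := by
      intro i
      rw [dd_add (((hwΩ i).add (hv2 i)).add (hv3 i)).diff ((hW i).const_mul _).diff,
        dd_add ((hwΩ i).add (hv2 i)).diff (hv3 i).diff, dd_add (hwΩ i).diff (hv2 i).diff, dd_const_mul (hW i).diff]
    simp_rw [e]
    rw [Finset.sum_add_distrib, Finset.sum_add_distrib, Finset.sum_add_distrib, ← Finset.mul_sum, hwd, hv2d, hv3d, hWd, hintg]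
    simp only [av, id, zero_add, sub_zero]
    rw [conv_comm, integral_mul_const, hψ1]
    ring
  · intro i j
    have e : dd (coordDir j) (fun x => w i x + segV volume ψ (fun _ => 0) id h i x + v3 i x + (∫ y, h y) * W i x) =
        ((dd (coordDir j) (w i) + dd (coordDir j) (segV volume ψ (fun _ => 0) id h i)) + dd (coordDir j) (v3 i)) +
          dd (coordDir j) (fun x => (∫ y, h y) * W i x) := by
      ext x
      rw [dd_add (((hwΩ i).add (hv2 i)).add (hv3 i)).diff ((hW i).const_mul _).diff,
        dd_add ((hwΩ i).add (hv2 i)).diff (hv3 i).diff, dd_add (hwΩ i).diff (hv2 i).diff]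
      rfl
    have m1 := ((hwΩ i).dd (coordDir j)).cont.aestronglyMeasurable (μ := (volume : Measure (Euc d)))
    have m2 := ((hv2 i).dd (coordDir j)).cont.aestronglyMeasurable (μ := (volume : Measure (Euc d)))
    have m3 := ((hv3 i).dd (coordDir j)).cont.aestronglyMeasurable (μ := (volume : Measure (Euc d)))
    have m4 := (((hW i).const_mul (∫ y, h y)).dd (coordDir j)).cont.aestronglyMeasurable (μ := (volume : Measure (Euc d)))
    have hp1 : 1 ≤ ENNReal.ofReal p := by rw [← ENNReal.ofReal_one]; exact ENNReal.ofReal_le_ofReal hp.le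
    rw [e]
    refine (eLpNorm_add_le ((m1.add m2).add m3) m4 hp1).trans ?_
    refine (add_le_add_left (eLpNorm_add_le (m1.add m2) m3 hp1) _).trans ?_
    refine (add_le_add_left (add_le_add_left (eLpNorm_add_le m1 m2 hp1) _) _).trans ?_
    have g2 : eLpNorm (dd (coordDir j) (segV volume ψ (fun _ => 0) id h i)) (ENNReal.ofReal p) volume ≤
        ENNReal.ofReal (CC * (CL + CL)) * eLpNorm f (ENNReal.ofReal p) volume := by
      refine (hv2n i j).trans ?_
      rw [ENNReal.ofReal_mul hCC.le, ENNReal.ofReal_add hCL.le hCL.le, mul_assoc, add_mul]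
      gcongr
      exact hρn j
    have g3 : eLpNorm (dd (coordDir j) (v3 i)) (ENNReal.ofReal p) volume ≤
        ENNReal.ofReal (CP * CL) * eLpNorm f (ENNReal.ofReal p) volume := by
      refine (hv3n i j).trans ?_
      rw [ENNReal.ofReal_mul hCP.le, mul_assoc]
      gcongr
    rw [ENNReal.ofReal_add (by positivity) (by positivity), ENNReal.ofReal_add (by positivity) (by positivity),
      ENNReal.ofReal_add (by positivity) (by positivity), add_mul, add_mul, add_mul]
    exact add_le_add (add_le_add (add_le_add (hwn i j) g2) g3) (hv4n i j)
end
end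

section
open MeasureTheory
open scoped ENNReal
noncomputable section
variable {d : ℕ}

lemma cone_prop {Ω : Set (Euc d)} (hΩ : IsOpen Ω) (hC : HasC4Boundary Ω) {x0 : Euc d} (hx0 : x0 ∈ closure Ω) :
    ∃ (n : Euc d) (β R : ℝ), 0 < β ∧ 0 < R ∧
      ∀ y ∈ Ω ∩ Metric.ball x0 R, ∀ s ∈ Set.Ioc (0:ℝ) 1, ∀ w ∈ Metric.ball n β, y + s • w ∈ Ω := by
  by_cases hin : x0 ∈ Ω
  · obtain ⟨e, he, hb⟩ := Metric.isOpen_iff.1 hΩ x0 hin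
    refine ⟨0, e / 2, e / 2, half_pos he, half_pos he, ?_⟩
    intro y hy s hs w hw
    apply hb
    have h1 := hy.2
    rw [Metric.mem_ball, dist_eq_norm] at h1 ⊢
    rw [Metric.mem_ball, dist_zero_right] at hw
    have h2 : ‖s • w‖ ≤ ‖w‖ := by
      rw [norm_smul, Real.norm_of_nonneg hs.1.le]
      calc s * ‖w‖ ≤ 1 * ‖w‖ := by gcongr; exact hs.2
        _ = _ := one_mul _
    calc ‖y + s • w - x0‖ = ‖(y - x0) + s • w‖ := by congr 1; abel
      _ ≤ _ := norm_add_le _ _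
      _ < e := by linarith
  · have hfr : x0 ∈ frontier Ω := ⟨hx0, by rwa [hΩ.interior_eq]⟩
    obtain ⟨U, g, hxU, hU, hg, hg', hΩU⟩ := hC x0 hfr
    obtain ⟨v, hv⟩ : ∃ v, fderiv ℝ g x0 v ≠ 0 := by
      by_contra h
      push Not at h
      exact hg' x0 hxU (ContinuousLinearMap.ext h)
    obtain ⟨e0, he0⟩ : ∃ e0, fderiv ℝ g x0 e0 < 0 := by
      rcases lt_or_gt_of_ne hv with h | h
      · exact ⟨v, h⟩
      · exact ⟨-v, by simpa using h⟩
    have hcont : Continuous fun z : Euc d × Euc d => fderiv ℝ g z.1 z.2 :=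
      ((hg.continuous_fderiv (by norm_num)).comp continuous_fst).clm_apply continuous_snd
    have hop : IsOpen ({z : Euc d × Euc d | fderiv ℝ g z.1 z.2 < 0} ∩ (U ×ˢ Set.univ)) :=
      (isOpen_lt hcont continuous_const).inter (hU.prod isOpen_univ)
    obtain ⟨δ, hδ, hb⟩ := Metric.isOpen_iff.1 hop (x0, e0) ⟨he0, hxU, trivial⟩
    have hbb : ∀ x ∈ Metric.ball x0 δ, ∀ w ∈ Metric.ball e0 δ, fderiv ℝ g x w < 0 ∧ x ∈ U := by
      intro x hx w hw
      have : (x, w) ∈ Metric.ball (x0, e0) δ := by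
        rw [← ball_prod_same]; exact ⟨hx, hw⟩
      have := hb this
      exact ⟨this.1, this.2.1⟩
    set l : ℝ := δ / 2 / (‖e0‖ + δ) with hl
    have hden : 0 < ‖e0‖ + δ := by positivity
    have hl0 : 0 < l := by positivity
    have hlm : l * (‖e0‖ + δ) = δ / 2 := by rw [hl]; field_simp
    refine ⟨l • e0, l * δ, δ / 2, by positivity, by positivity, ?_⟩
    intro y hy s hs w hw
    obtain ⟨w', hw', rfl⟩ : ∃ w' ∈ Metric.ball e0 δ, l • w' = w := by
      refine ⟨l⁻¹ • w, ?_, smul_inv_smul₀ hl0.ne' w⟩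
      rw [Metric.mem_ball, dist_eq_norm] at hw ⊢
      have : l⁻¹ • w - e0 = l⁻¹ • (w - l • e0) := by rw [smul_sub, inv_smul_smul₀ hl0.ne']
      rw [this, norm_smul, norm_inv, Real.norm_of_nonneg hl0.le, inv_mul_lt_iff₀ hl0]
      exact hw
    have hwn : ‖l • w'‖ ≤ δ / 2 := by
      rw [← hlm, norm_smul, Real.norm_of_nonneg hl0.le]
      gcongr
      rw [Metric.mem_ball, dist_eq_norm] at hw'
      have := norm_add_le e0 (w' - e0)
      rw [add_sub_cancel] at this; linarith
    have hball : ∀ τ ∈ Set.Icc (0:ℝ) 1, y + τ • (l • w') ∈ Metric.ball x0 δ := by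
      intro τ hτ
      have h1 := hy.2
      rw [Metric.mem_ball, dist_eq_norm] at h1 ⊢
      have h2 : ‖τ • (l • w')‖ ≤ δ / 2 := by
        rw [norm_smul, Real.norm_of_nonneg hτ.1]
        calc τ * ‖l • w'‖ ≤ 1 * ‖l • w'‖ := by gcongr; exact hτ.2
          _ ≤ _ := by rw [one_mul]; exact hwn
      calc ‖y + τ • (l • w') - x0‖ = ‖(y - x0) + τ • (l • w')‖ := by congr 1; abel
        _ ≤ _ := norm_add_le _ _
        _ < δ := by linarith
    have hder : ∀ τ : ℝ, HasDerivAt (fun τ : ℝ => g (y + τ • (l • w'))) (fderiv ℝ g (y + τ • (l • w')) (l • w')) τ := by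
      intro τ
      have := hasDerivAt_line (hg.differentiable (by norm_num)) y (l • w') τ
      exact this
    have hanti : StrictAntiOn (fun τ : ℝ => g (y + τ • (l • w'))) (Set.Icc 0 1) := by
      refine strictAntiOn_of_deriv_neg (convex_Icc 0 1) (fun τ _ => (hder τ).continuousAt.continuousWithinAt) ?_
      intro τ hτ
      rw [interior_Icc] at hτ
      rw [(hder τ).deriv, map_smul, smul_eq_mul]
      exact mul_neg_of_pos_of_neg hl0 (hbb _ (hball τ ⟨hτ.1.le, hτ.2.le⟩) w' hw').1
    have hg0 : g y < 0 := by
      have hyU : y ∈ Ω ∩ U := by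
        refine ⟨hy.1, ?_⟩
        have := hball 0 ⟨le_rfl, zero_le_one⟩
        rw [zero_smul, add_zero] at this
        exact (hbb y this w' hw').2
      rw [hΩU] at hyU
      exact hyU.2
    have h1 := hanti ⟨le_rfl, zero_le_one⟩ ⟨hs.1.le, hs.2⟩ hs.1
    simp only [zero_smul, add_zero] at h1
    have hmem : y + s • (l • w') ∈ Ω ∩ U := by
      rw [hΩU]
      exact ⟨(hbb _ (hball s ⟨hs.1.le, hs.2⟩) w' hw').2, h1.trans hg0⟩
    exact hmem.1

lemma bog_union {Ω V1 V2 : Set (Euc d)} (h1 : IsOpen V1) (h2 : IsOpen V2) {θ0 : Euc d → ℝ} {p : ℝ} (hp : 1 < p)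
    (hb1 : BogOn Ω (Ω ∩ V1) θ0 p) (hb2 : BogOn Ω (Ω ∩ V2) θ0 p) : BogOn Ω (Ω ∩ (V1 ∪ V2)) θ0 p := by
  obtain ⟨C1, hC1, hb1⟩ := hb1
  obtain ⟨C2, hC2, hb2⟩ := hb2
  refine ⟨C1 + C2, by positivity, fun f hf => ?_⟩
  have hp1 : 1 ≤ ENNReal.ofReal p := by rw [← ENNReal.ofReal_one]; exact ENNReal.ofReal_le_ofReal hp.le
  set K := tsupport f
  have hKc : IsCompact K := hf.cs
  obtain ⟨K1, K2, hK1, hK2, hK1V, hK2V, hK⟩ := hKc.binary_compact_cover h1 h2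
    (hf.ts.trans Set.inter_subset_right)
  obtain ⟨L1, hL1, hKL1, hLV1⟩ := exists_compact_between hK1 h1 hK1V
  obtain ⟨L2, hL2, hKL2, hLV2⟩ := exists_compact_between hK2 h2 hK2V
  obtain ⟨χ, hχ, hχ0, hχ1, hχI⟩ := smooth_urysohn (s := (interior L1)ᶜ) (t := K \ interior L2)
    isOpen_interior.isClosed_compl (hKc.diff isOpen_interior).isClosed (by
      rw [Set.disjoint_left]
      rintro x hx ⟨hx1, hx2⟩
      rw [hK] at hx1
      rcases hx1 with h | h
      · exact hx (hKL1 h)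
      · exact hx2 (hKL2 h))
  have t1 : Tst (Ω ∩ V1) (fun x => χ x * f x) := by
    refine Tst.of_support (hχ.mul hf.cd) (hKc.inter hL1) (fun x hx => ⟨(hf.ts hx.1).1, hLV1 hx.2⟩) ?_
    intro x hx
    by_cases hxK : x ∈ K
    · rw [hχ0 x fun h => hx ⟨hxK, interior_subset h⟩, zero_mul]
    · rw [image_eq_zero_of_notMem_tsupport hxK, mul_zero]
  have t2 : Tst (Ω ∩ V2) (fun x => (1 - χ x) * f x) := by
    refine Tst.of_support ((contDiff_const.sub hχ).mul hf.cd) (hKc.inter hL2) (fun x hx => ⟨(hf.ts hx.1).1, hLV2 hx.2⟩) ?_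
    intro x hx
    by_cases hxK : x ∈ K
    · rw [hχ1 x ⟨hxK, fun h => hx ⟨hxK, interior_subset h⟩⟩, sub_self, zero_mul]
    · rw [image_eq_zero_of_notMem_tsupport hxK, mul_zero]
  obtain ⟨v1, hv1, hv1d, hv1n⟩ := hb1 _ t1
  obtain ⟨v2, hv2, hv2d, hv2n⟩ := hb2 _ t2
  have n1 : eLpNorm (fun x => χ x * f x) (ENNReal.ofReal p) volume ≤ eLpNorm f (ENNReal.ofReal p) volume :=
    eLpNorm_mono fun x => by
      rw [norm_mul, Real.norm_of_nonneg (hχI x).1]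
      exact mul_le_of_le_one_left (norm_nonneg _) (hχI x).2
  have n2 : eLpNorm (fun x => (1 - χ x) * f x) (ENNReal.ofReal p) volume ≤ eLpNorm f (ENNReal.ofReal p) volume :=
    eLpNorm_mono fun x => by
      rw [norm_mul, Real.norm_of_nonneg (sub_nonneg.2 (hχI x).2)]
      exact mul_le_of_le_one_left (norm_nonneg _) (by linarith [(hχI x).1])
  have hintg : ∫ x, f x = (∫ x, χ x * f x) + ∫ x, (1 - χ x) * f x := by
    rw [← integral_add t1.integrable t2.integrable]
    refine integral_congr_ae (Filter.Eventually.of_forall fun x => ?_)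
    simp only; ring
  refine ⟨fun i x => v1 i x + v2 i x, fun i => (hv1 i).add (hv2 i), ?_, ?_⟩
  · intro x
    simp_rw [fun i => dd_add (hv1 i).diff (hv2 i).diff (coordDir i) x]
    rw [Finset.sum_add_distrib, hv1d, hv2d, hintg]
    ring
  · intro i j
    have e : dd (coordDir j) (fun x => v1 i x + v2 i x) = dd (coordDir j) (v1 i) + dd (coordDir j) (v2 i) := by
      ext x; exact dd_add (hv1 i).diff (hv2 i).diff _ _
    rw [e]
    refine (eLpNorm_add_le ((hv1 i).dd _).cont.aestronglyMeasurable ((hv2 i).dd _).cont.aestronglyMeasurable hp1).trans ?_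
    rw [ENNReal.ofReal_add hC1.le hC2.le, add_mul]
    refine add_le_add ((hv1n i j).trans ?_) ((hv2n i j).trans ?_) <;> gcongr

/-- The Bogovskii operator. -/
lemma bogovskii (hd : 0 < d) {Ω : Set (Euc d)} (hΩ : IsOpen Ω) (hc : IsConnected Ω) (hbd : Bornology.IsBounded Ω)
    (hC4 : HasC4Boundary Ω) : ∃ θ0, Tst Ω θ0 ∧ (∫ x, θ0 x = 1) ∧ ∀ p : ℝ, 1 < p → BogOn Ω Ω θ0 p := by
  obtain ⟨xs, hxs⟩ := hc.nonempty
  obtain ⟨θ0, hθ0⟩ := Nr.exists hΩ hxs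
  obtain ⟨r, hr, hb, ht, hi⟩ := id hθ0
  refine ⟨θ0, ht.mono ((Metric.ball_subset_ball (by linarith)).trans hb), hi, fun p hp => ?_⟩
  have hcl : IsCompact (closure Ω) := hbd.isCompact_closure
  have key : ∃ V, IsOpen V ∧ closure Ω ⊆ V ∧ BogOn Ω (Ω ∩ V) θ0 p := by
    refine hcl.induction_on (p := fun s => ∃ V, IsOpen V ∧ s ⊆ V ∧ BogOn Ω (Ω ∩ V) θ0 p) ?_ ?_ ?_ ?_
    · refine ⟨∅, isOpen_empty, le_rfl, 1, one_pos, fun f hf => ⟨fun _ _ => 0, fun i => Tst.zero, ?_, ?_⟩⟩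
      · have h0 : ∀ x, f x = 0 := fun x => hf.eq_zero (by simp)
        intro x
        simp [h0, dd]
      · intro i j
        have : dd (coordDir j) (fun _ : Euc d => (0:ℝ)) = fun _ => 0 := by ext x; simp [dd]
        rw [this]; simp
    · rintro s t hst ⟨V, hV, htV, hb⟩
      exact ⟨V, hV, hst.trans htV, hb⟩
    · rintro s t ⟨V, hV, hsV, hb⟩ ⟨V', hV', htV, hb'⟩
      exact ⟨V ∪ V', hV.union hV', Set.union_subset_union hsV htV, bog_union hV hV' hp hb hb'⟩
    · intro x hx
      obtain ⟨n, β, R, hβ, hR, hcone⟩ := cone_prop hΩ hC4 hx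
      obtain ⟨r, hr, hbog⟩ := bog_chart hd hΩ hc.isPreconnected hbd hxs hθ0 hp hx hβ hR hcone
      exact ⟨Metric.ball x r, mem_nhdsWithin_of_mem_nhds (Metric.ball_mem_nhds x hr), Metric.ball x r,
        Metric.isOpen_ball, le_rfl, hbog⟩
  obtain ⟨V, -, hV, hb⟩ := key
  rwa [Set.inter_eq_left.2 (subset_closure.trans hV)] at hb
end
end

section
open MeasureTheory
open scoped ENNReal
noncomputable section
variable {d : ℕ}

/-! ### Space-time helpers -/

/-- the standing assumptions -/
structure Dat (T : ℝ) (Ω : Set (Euc d)) (q : ℝ) (u : ℝ → Euc d → Euc d)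
    (G : Fin d → Fin d → ℝ × Euc d → ℝ) : Prop where
  op : IsOpen Ω
  bd : Bornology.IsBounded Ω
  T0 : 0 < T
  q1 : 1 < q
  u2 : ∀ t ∈ Set.Icc 0 T, MemLp (u t) 2 (volume.restrict Ω)
  um : AEStronglyMeasurable (fun p : ℝ × Euc d => u p.1 p.2) (measureQ T Ω)
  uc : ∀ g : Euc d → Euc d, MemLp g 2 (volume.restrict Ω) →
    ContinuousOn (fun t => ∫ x in Ω, ∑ i, u t x i * g x i) (Set.Icc 0 T)
  G2 : ∀ i j, MemLp (G i j) (ENNReal.ofReal q) (measureQ T Ω)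

lemma finite_restrict {Ω : Set (Euc d)} (hb : Bornology.IsBounded Ω) :
    IsFiniteMeasure (volume.restrict Ω) :=
  ⟨by rw [Measure.restrict_apply_univ]; exact hb.measure_lt_top⟩

lemma integrable_of_slices {T : ℝ} {Ω : Set (Euc d)} (hb : Bornology.IsBounded Ω)
    {h : ℝ → Euc d → ℝ} (hm : AEStronglyMeasurable (fun p : ℝ × Euc d => h p.1 p.2) (measureQ T Ω))
    {p : ℝ≥0∞} (hp : 1 ≤ p) {K : ℝ≥0∞} (hK : K ≠ ⊤)
    (hsm : ∀ t ∈ Set.Icc 0 T, AEStronglyMeasurable (h t) (volume.restrict Ω))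
    (hs : ∀ t ∈ Set.Icc 0 T, eLpNorm (h t) p (volume.restrict Ω) ≤ K) :
    Integrable (fun p : ℝ × Euc d => h p.1 p.2) (measureQ T Ω) := by
  haveI := finite_restrict hb
  refine ⟨hm, ?_⟩
  unfold HasFiniteIntegral
  unfold measureQ
  refine (lintegral_prod_le _).trans_lt ?_
  set A : ℝ≥0∞ := K * (volume.restrict Ω) Set.univ ^ (1 / (1:ℝ≥0∞).toReal - 1 / p.toReal) with hA
  have hAt : A ≠ ⊤ := by
    refine ENNReal.mul_ne_top hK (ENNReal.rpow_ne_top_of_nonneg ?_ (measure_ne_top _ _))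
    rw [ENNReal.toReal_one, div_one, sub_nonneg]
    rcases eq_or_ne p ⊤ with rfl | hpt
    · simp
    · rw [div_le_one]
      · rw [← ENNReal.toReal_one]; exact (ENNReal.toReal_le_toReal (by simp) hpt).2 hp
      · exact ENNReal.toReal_pos (by intro h; simp [h] at hp) hpt
  refine lt_of_le_of_lt (lintegral_mono_ae (g := fun _ => A) ?_) ?_
  · filter_upwards [ae_restrict_mem measurableSet_Ioc] with t ht
    have ht' : t ∈ Set.Icc 0 T := ⟨ht.1.le, ht.2⟩
    have := eLpNorm_le_eLpNorm_mul_rpow_measure_univ hp (hsm t ht')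
    rw [eLpNorm_one_eq_lintegral_enorm] at this
    refine this.trans ?_
    rw [hA]
    gcongr
    exact hs t ht'
  · rw [lintegral_const]
    exact ENNReal.mul_lt_top hAt.lt_top (measure_lt_top _ _)

lemma coord_norm_le (x : Euc d) (i : Fin d) : ‖x i‖ ≤ ‖x‖ := PiLp.norm_apply_le x i

lemma Dat.sup {T q : ℝ} {Ω : Set (Euc d)} {u : ℝ → Euc d → Euc d} {G : Fin d → Fin d → ℝ × Euc d → ℝ}
    (D : Dat T Ω q u G) : (⨆ s ∈ Set.Icc 0 T, eLpNorm (u s) 2 (volume.restrict Ω)) ≠ ⊤ := by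
  set g : Set.Icc 0 T → (Lp (Euc d) 2 (volume.restrict Ω) →L[ℝ] ℝ) :=
    fun s => innerSL ℝ ((D.u2 s s.2).toLp) with hg
  have h1 : ∀ x, ∃ C, ∀ s, ‖g s x‖ ≤ C := by
    intro x
    obtain ⟨C, hC⟩ := isCompact_Icc.exists_bound_of_continuousOn (D.uc x (Lp.memLp x))
    refine ⟨C, fun s => ?_⟩
    have e : g s x = ∫ y in Ω, ∑ i, u s y i * x y i := by
      rw [hg]
      simp only [innerSL_apply_apply]
      rw [L2.inner_def]
      refine integral_congr_ae ?_
      filter_upwards [(D.u2 s s.2).coeFn_toLp] with y hy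
      rw [hy]
      simp [PiLp.inner_apply, mul_comm]
    rw [e]; exact hC s s.2
  obtain ⟨C, hC⟩ := banach_steinhaus h1
  refine ne_top_of_le_ne_top (ENNReal.ofReal_ne_top (r := C)) ?_
  refine iSup₂_le fun s hs => ?_
  have := hC ⟨s, hs⟩
  rw [hg] at this
  simp only [innerSL_apply_norm] at this
  rw [Lp.norm_toLp] at this
  rw [← ENNReal.ofReal_toReal (D.u2 s hs).eLpNorm_ne_top]
  exact ENNReal.ofReal_le_ofReal this

section
variable {T q : ℝ} {Ω : Set (Euc d)} {u : ℝ → Euc d → Euc d} {G : Fin d → Fin d → ℝ × Euc d → ℝ}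

lemma coord_memLp {X : Type*} [MeasurableSpace X] {μ : Measure X} {f : X → Euc d} {p : ℝ≥0∞}
    (hf : MemLp f p μ) (i : Fin d) : MemLp (fun x => f x i) p μ := by
  refine hf.of_le ?_ (Filter.Eventually.of_forall fun x => coord_norm_le _ _)
  exact (EuclideanSpace.proj (𝕜 := ℝ) i).continuous.comp_aestronglyMeasurable hf.1

lemma Dat.u_int (D : Dat T Ω q u G) (i : Fin d) :
    Integrable (fun p : ℝ × Euc d => u p.1 p.2 i) (measureQ T Ω) := by
  refine integrable_of_slices (h := fun t x => u t x i) D.bd ?_ (p := 2) (by norm_num) D.sup ?_ ?_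
  · exact (EuclideanSpace.proj (𝕜 := ℝ) i).continuous.comp_aestronglyMeasurable D.um
  · exact fun t ht => (coord_memLp (D.u2 t ht) i).1
  · intro t ht
    refine (eLpNorm_mono (g := u t) fun x => coord_norm_le _ _).trans ?_
    exact le_iSup₂ (f := fun s (_ : s ∈ Set.Icc 0 T) => eLpNorm (u s) 2 (volume.restrict Ω)) t ht

lemma Dat.G_int (D : Dat T Ω q u G) (i j : Fin d) : Integrable (G i j) (measureQ T Ω) := by
  haveI := measureQ_finite T D.bd
  refine (D.G2 i j).integrable ?_
  rw [← ENNReal.ofReal_one]; exact ENNReal.ofReal_le_ofReal D.q1.le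
end

lemma tens_bdd (t : ℝ) {ζ : Euc d → ℝ} {C : ℝ} (h : ∀ x, |ζ x| ≤ C) (p : ℝ × Euc d) :
    |tens t ζ p| ≤ C := by
  have hC : 0 ≤ C := (abs_nonneg _).trans (h 0)
  unfold tens
  by_cases h1 : p.1 ∈ Set.Ioc 0 t
  · rw [Set.indicator_of_mem h1, one_mul]; exact h _
  · rw [Set.indicator_of_notMem h1, zero_mul, abs_zero]; exact hC

lemma int_tens {μ : Measure (ℝ × Euc d)} {f : ℝ × Euc d → ℝ} (hf : Integrable f μ) (t : ℝ)
    {Ω : Set (Euc d)} {ζ : Euc d → ℝ} (hζ : Tst Ω ζ) : Integrable (fun p => f p * tens t ζ p) μ := by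
  obtain ⟨C, hC, h⟩ := hζ.bounded
  exact hf.mul_bdd (c := C) (tens_meas t hζ.cont).aestronglyMeasurable
    (Filter.Eventually.of_forall fun p => by rw [Real.norm_eq_abs]; exact tens_bdd t h p)

lemma tens_cont {T : ℝ} {Ω : Set (Euc d)} {f : ℝ × Euc d → ℝ} (hf : Integrable f (measureQ T Ω))
    {ζ : Euc d → ℝ} (hζ : Tst Ω ζ) :
    Continuous fun t => ∫ p, f p * tens t ζ p ∂(measureQ T Ω) := by
  obtain ⟨C, hC, h⟩ := hζ.bounded
  rw [continuous_iff_continuousAt]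
  intro t0
  refine continuousAt_of_dominated (bound := fun p => |f p| * C) ?_ ?_ ?_ ?_
  · exact Filter.Eventually.of_forall fun t => (int_tens hf t hζ).1
  · refine Filter.Eventually.of_forall fun t => Filter.Eventually.of_forall fun p => ?_
    rw [Real.norm_eq_abs, abs_mul]
    exact mul_le_mul_of_nonneg_left (tens_bdd t h p) (abs_nonneg _)
  · exact hf.abs.mul_const C
  · have h0 : ∀ᵐ s ∂(volume.restrict (Set.Ioc 0 T)), s ≠ t0 := by
      refine ae_restrict_of_ae ?_
      rw [ae_iff]; simp
    have := (Measure.quasiMeasurePreserving_fst (μ := volume.restrict (Set.Ioc 0 T)) (ν := volume.restrict Ω)).ae h0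
    unfold measureQ
    filter_upwards [this] with p hp
    refine ContinuousAt.mul continuousAt_const ?_
    unfold tens
    refine ContinuousAt.mul ?_ continuousAt_const
    rcases lt_or_gt_of_ne hp with hlt | hgt
    · refine ContinuousAt.congr (f := fun _ => (Set.Ioi (0:ℝ)).indicator (fun _ => (1:ℝ)) p.1) continuousAt_const ?_
      filter_upwards [lt_mem_nhds hlt] with t ht
      by_cases h' : 0 < p.1
      · simp [Set.indicator, h', ht.le]
      · simp [Set.indicator, h']
    · refine ContinuousAt.congr (f := fun _ => (0:ℝ)) continuousAt_const ?_
      filter_upwards [gt_mem_nhds hgt] with t ht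
      simp [Set.indicator, ht]

/-- slices of space-time test functions -/
lemma slice_tst {T : ℝ} {Ω : Set (Euc d)} {ζ : ℝ × Euc d → ℝ} (hζ : Tst (Set.Ioo 0 T ×ˢ Ω) ζ) (t : ℝ) :
    Tst Ω (fun x => ζ (t, x)) := by
  refine Tst.of_support (K := Prod.snd '' tsupport ζ) ?_ (hζ.cs.image continuous_snd) ?_ ?_
  · exact hζ.cd.comp (contDiff_const.prodMk contDiff_id)
  · rintro _ ⟨p, hp, rfl⟩
    exact (hζ.ts hp).2
  · intro x hx
    by_contra h
    exact hx ⟨(t, x), subset_tsupport _ h, rfl⟩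

lemma dd_slice {ζ : ℝ × Euc d → ℝ} (hζ : Differentiable ℝ ζ) (t : ℝ) (v x : Euc d) :
    dd v (fun x => ζ (t, x)) x = dd ((0:ℝ), v) ζ (t, x) := by
  unfold dd
  have h1 : HasFDerivAt (fun x : Euc d => (t, x)) (ContinuousLinearMap.inr ℝ ℝ (Euc d)) x :=
    hasFDerivAt_prodMk_right t x
  have := (hζ (t, x)).hasFDerivAt.comp x h1
  have e : (fun x => ζ (t, x)) = ζ ∘ (fun x => (t, x)) := rfl
  rw [e, this.fderiv]; rfl

lemma hasDerivAt_time {ζ : ℝ × Euc d → ℝ} (hζ : Differentiable ℝ ζ) (t : ℝ) (x : Euc d) :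
    HasDerivAt (fun t => ζ (t, x)) (dd ((1:ℝ), (0 : Euc d)) ζ (t, x)) t := by
  unfold dd
  have h1 : HasDerivAt (fun t : ℝ => (t, x)) ((1:ℝ), (0 : Euc d)) t :=
    (hasDerivAt_id t).prodMk (hasDerivAt_const t x)
  exact (hζ (t, x)).hasFDerivAt.comp_hasDerivAt t h1

lemma time_int {T : ℝ} {Ω : Set (Euc d)} {ζ : ℝ × Euc d → ℝ} (hζ : Tst (Set.Ioo 0 T ×ˢ Ω) ζ)
    {a : ℝ} (ha : a ≤ T) (x : Euc d) :
    ∫ t in Set.Ioc a T, dd ((1:ℝ), (0 : Euc d)) ζ (t, x) = - ζ (a, x) := by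
  rw [← intervalIntegral.integral_of_le ha]
  rw [intervalIntegral.integral_eq_sub_of_hasDerivAt (f := fun t => ζ (t, x))
    (fun t _ => hasDerivAt_time hζ.diff t x)]
  · rw [hζ.eq_zero (x := (T, x)) (by simp)]; simp
  · refine Continuous.intervalIntegrable ?_ _ _
    exact (hζ.dd _).cont.comp (by fun_prop)

lemma time_ibp {T : ℝ} {Ω : Set (Euc d)} (hb : Bornology.IsBounded Ω) {f : ℝ × Euc d → ℝ}
    (hf : Integrable f (measureQ T Ω))
    {ζ : ℝ × Euc d → ℝ} (hζ : Tst (Set.Ioo 0 T ×ˢ Ω) ζ) :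
    Integrable (fun t => ∫ p, f p * tens t (fun x => dd ((1:ℝ), (0 : Euc d)) ζ (t, x)) p ∂(measureQ T Ω))
      (volume.restrict (Set.Ioc 0 T)) ∧
    ∫ t in Set.Ioc 0 T, (∫ p, f p * tens t (fun x => dd ((1:ℝ), (0 : Euc d)) ζ (t, x)) p ∂(measureQ T Ω))
      = - ∫ p, f p * ζ p ∂(measureQ T Ω) := by
  haveI := measureQ_finite T hb
  haveI := finite_restrict hb
  obtain ⟨C, hC, h⟩ := (hζ.dd ((1:ℝ), (0 : Euc d))).bounded
  have hI : Integrable (fun z : ℝ × (ℝ × Euc d) => f z.2 * tens z.1 (fun x => dd ((1:ℝ), (0 : Euc d)) ζ (z.1, x)) z.2)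
      ((volume.restrict (Set.Ioc 0 T)).prod (measureQ T Ω)) := by
    refine (hf.comp_snd (volume.restrict (Set.Ioc 0 T))).mul_bdd (c := C) ?_
      (Filter.Eventually.of_forall fun p => by rw [Real.norm_eq_abs]; exact tens_bdd _ (fun x => h _) _)
    refine Measurable.aestronglyMeasurable ?_
    unfold tens
    refine Measurable.mul ?_ ?_
    · have : (fun z : ℝ × (ℝ × Euc d) => (Set.Ioc 0 z.1).indicator (fun _ => (1:ℝ)) z.2.1)
        = ({z : ℝ × (ℝ × Euc d) | 0 < z.2.1} ∩ {z | z.2.1 ≤ z.1}).indicator (fun _ => 1) := by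
        ext z; simp [Set.indicator]
      rw [this]
      refine measurable_const.indicator (MeasurableSet.inter ?_ ?_)
      · exact measurableSet_lt measurable_const (by fun_prop)
      · exact measurableSet_le (by fun_prop) (by fun_prop)
    · exact (hζ.dd _).cont.measurable.comp (by fun_prop)
  refine ⟨hI.integral_prod_left, ?_⟩
  rw [integral_integral_swap hI, ← integral_neg]
  refine integral_congr_ae ?_
  have h0 : ∀ᵐ s ∂(volume.restrict (Set.Ioc 0 T)), s ∈ Set.Ioc 0 T := ae_restrict_mem measurableSet_Ioc
  have := (Measure.quasiMeasurePreserving_fst (μ := volume.restrict (Set.Ioc 0 T)) (ν := volume.restrict Ω)).ae h0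
  filter_upwards [this] with p hp
  rw [integral_const_mul, ← mul_neg]
  congr 1
  rw [show ζ p = ζ (p.1, p.2) from rfl, ← time_int hζ hp.2]
  rw [← integral_indicator measurableSet_Ioc, ← integral_indicator measurableSet_Ioc]
  -- `{p.1}` is null
  refine integral_congr_ae ?_
  have h1 : ∀ᵐ s : ℝ, s ≠ p.1 := by rw [ae_iff]; simp
  filter_upwards [h1] with t ht
  unfold tens
  by_cases h2 : t ∈ Set.Ioc p.1 T
  · rw [Set.indicator_of_mem h2, Set.indicator_of_mem (show t ∈ Set.Ioc 0 T from ⟨hp.1.trans h2.1, h2.2⟩),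
      Set.indicator_of_mem (show p.1 ∈ Set.Ioc 0 t from ⟨hp.1, h2.1.le⟩), one_mul]
  · rw [Set.indicator_of_notMem h2]
    by_cases h3 : t ∈ Set.Ioc 0 T
    · rw [Set.indicator_of_mem h3, Set.indicator_of_notMem, zero_mul]
      intro h4
      exact h2 ⟨lt_of_le_of_ne h4.2 ht.symm, h3.2⟩
    · rw [Set.indicator_of_notMem h3]

lemma time_ibp0 {T : ℝ} (hT : 0 ≤ T) {Ω : Set (Euc d)} (hb : Bornology.IsBounded Ω) {f : Euc d → ℝ}
    (hf : Integrable f (volume.restrict Ω))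
    {ζ : ℝ × Euc d → ℝ} (hζ : Tst (Set.Ioo 0 T ×ˢ Ω) ζ) :
    Integrable (fun p : ℝ × Euc d => f p.2 * dd ((1:ℝ), (0 : Euc d)) ζ p) (measureQ T Ω) ∧
    ∫ p, f p.2 * dd ((1:ℝ), (0 : Euc d)) ζ p ∂(measureQ T Ω) = 0 := by
  haveI := finite_restrict hb
  obtain ⟨C, hC, h⟩ := (hζ.dd ((1:ℝ), (0 : Euc d))).bounded
  have hI : Integrable (fun p : ℝ × Euc d => f p.2 * dd ((1:ℝ), (0 : Euc d)) ζ p) (measureQ T Ω) := by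
    unfold measureQ
    exact (hf.comp_snd (volume.restrict (Set.Ioc 0 T))).mul_bdd (c := C) (hζ.dd _).cont.aestronglyMeasurable
      (Filter.Eventually.of_forall fun p => by rw [Real.norm_eq_abs]; exact h _)
  refine ⟨hI, ?_⟩
  unfold measureQ at hI ⊢
  rw [integral_prod_symm _ hI]
  refine integral_eq_zero_of_ae (Filter.Eventually.of_forall fun x => ?_)
  simp only [Pi.zero_apply]
  rw [integral_const_mul, time_int hζ hT, hζ.eq_zero (x := (0, x)) (by simp)]
  simp

end
end

section
open MeasureTheory
open scoped ENNReal
noncomputable section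
variable {d : ℕ}

/-! ### The du Bois-Reymond lemma -/

lemma primitive_tst {T : ℝ} (hT : 0 < T) {ψ : ℝ → ℝ} (hψ : Tst (Set.Ioo 0 T) ψ) (h0 : ∫ t, ψ t = 0) :
    ∃ θ, Tst (Set.Ioo 0 T) θ ∧ ∀ t, dd 1 θ t = ψ t := by
  have hK : IsCompact (insert (T/2) (tsupport ψ)) := hψ.cs.insert _
  have hKs : insert (T/2) (tsupport ψ) ⊆ Set.Ioo 0 T := by
    intro x hx
    rcases hx with rfl | hx
    · exact ⟨by linarith, by linarith⟩
    · exact hψ.ts hx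
  obtain ⟨a, ha, hla⟩ := hK.exists_isLeast (Set.insert_nonempty _ _)
  obtain ⟨b, hb, hlb⟩ := hK.exists_isGreatest (Set.insert_nonempty _ _)
  have hz : ∀ x, x ∉ Set.Icc a b → ψ x = 0 := by
    intro x hx
    by_contra h
    have : x ∈ insert (T/2) (tsupport ψ) := Set.mem_insert_of_mem _ (subset_tsupport _ h)
    exact hx ⟨hla this, hlb this⟩
  have hder : ∀ t, HasDerivAt (fun t => ∫ s in (0:ℝ)..t, ψ s) (ψ t) t := fun t =>
    intervalIntegral.integral_hasDerivAt_right (hψ.cont.intervalIntegrable _ _)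
      (hψ.cont.stronglyMeasurableAtFilter _ _) hψ.cont.continuousAt
  have hcd : ContDiff ℝ (⊤ : ℕ∞) (fun t => ∫ s in (0:ℝ)..t, ψ s) := by
    rw [contDiff_infty_iff_deriv]
    refine ⟨fun t => (hder t).differentiableAt, ?_⟩
    rw [show deriv (fun t => ∫ s in (0:ℝ)..t, ψ s) = ψ from funext fun t => (hder t).deriv]
    exact hψ.cd
  refine ⟨fun t => ∫ s in (0:ℝ)..t, ψ s, ?_, ?_⟩
  · refine Tst.of_support (K := Set.Icc a b) hcd isCompact_Icc ?_ ?_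
    · intro x hx
      exact ⟨(hKs ha).1.trans_le hx.1, hx.2.trans_lt (hKs hb).2⟩
    · intro t ht
      rcases lt_or_ge t a with h | h
      · refine intervalIntegral.integral_zero_ae (Filter.Eventually.of_forall fun s hs => hz s ?_)
        intro h2
        rcases le_total 0 t with h3 | h3
        · rw [Set.uIoc_of_le h3] at hs; linarith [hs.2, h2.1]
        · rw [Set.uIoc_of_ge h3] at hs; linarith [hs.2, h2.1, (hKs ha).1]
      · have hbt : b < t := by
          by_contra h'
          exact ht ⟨h, not_lt.1 h'⟩
        rw [intervalIntegral.integral_of_le ((hKs hb).1.le.trans hbt.le)]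
        refine Eq.trans ?_ h0
        refine setIntegral_eq_integral_of_forall_compl_eq_zero fun x hx => hz x ?_
        intro h2
        exact hx ⟨(hKs ha).1.trans_le h2.1, h2.2.trans hbt.le⟩
  · intro t
    unfold dd
    rw [fderiv_apply_one_eq_deriv]
    exact (hder t).deriv

lemma du_bois {T : ℝ} (hT : 0 < T) {w : ℝ → ℝ} (hw : ContinuousOn w (Set.Icc 0 T))
    (h : ∀ θ, Tst (Set.Ioo 0 T) θ → ∫ t in Set.Ioc 0 T, dd 1 θ t * w t = 0) :
    ∃ c, ∀ t ∈ Set.Icc 0 T, w t = c := by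
  have hwi : IntegrableOn w (Set.Ioc 0 T) :=
    (hw.integrableOn_Icc).mono_set Set.Ioc_subset_Icc_self
  obtain ⟨ω, hω, hω1⟩ : ∃ ω : ℝ → ℝ, Tst (Set.Ioo 0 T) ω ∧ ∫ t, ω t = 1 := by
    let b : ContDiffBump (T/2) := ⟨T/8, T/4, by linarith, by linarith⟩
    refine ⟨b.normed volume, Tst.of_support (K := Metric.closedBall (T/2) (T/4)) b.contDiff_normed
      (isCompact_closedBall _ _) ?_ ?_, b.integral_normed⟩
    · intro x hx
      rw [Metric.mem_closedBall, Real.dist_eq, abs_le] at hx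
      exact ⟨by linarith, by linarith⟩
    · intro x hx
      by_contra h'
      have : x ∈ tsupport (b.normed volume) := subset_tsupport _ h'
      rw [b.tsupport_normed_eq] at this
      exact hx this
  set c : ℝ := ∫ t in Set.Ioc 0 T, ω t * w t with hc
  refine ⟨c, ?_⟩
  have hbi : ∀ g, Tst (Set.Ioo 0 T) g → IntegrableOn (fun t => g t * w t) (Set.Ioc 0 T) := by
    intro g hg
    obtain ⟨C, hC, hb⟩ := hg.bounded
    exact hwi.bdd_mul (c := C) hg.cont.aestronglyMeasurable (Filter.Eventually.of_forall fun x => hb x)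
  have hintg : ∀ g, Tst (Set.Ioo 0 T) g → ∫ t, g t = ∫ t in Set.Ioc 0 T, g t := by
    intro g hg
    refine (setIntegral_eq_integral_of_forall_compl_eq_zero fun x hx => hg.eq_zero fun h' => hx ?_).symm
    exact Set.Ioo_subset_Ioc_self h'
  have key : ∀ g, Tst (Set.Ioo 0 T) g → ∫ t in Set.Ioc 0 T, g t * (w t - c) = 0 := by
    intro g hg
    have hgi : Integrable g := hg.cont.integrable_of_hasCompactSupport hg.cs
    have hωi : Integrable ω := hω.cont.integrable_of_hasCompactSupport hω.cs
    obtain ⟨θ, hθ, hθd⟩ := primitive_tst hT (hg.sub (hω.const_mul (∫ t, g t))) (by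
      rw [integral_sub hgi (hωi.const_mul _), integral_const_mul, hω1]; ring)
    have h1 := h θ hθ
    simp_rw [hθd] at h1
    have e1 : ∀ t, (g t - (∫ t, g t) * ω t) * w t = g t * w t - (∫ t, g t) * (ω t * w t) := fun t => by ring
    simp_rw [e1] at h1
    rw [integral_sub (hbi g hg) ((hbi ω hω).const_mul _), integral_const_mul, ← hc] at h1
    simp_rw [mul_sub]
    rw [integral_sub (hbi g hg) ((hgi.integrableOn).mul_const _), integral_mul_const, ← hintg g hg]
    exact h1
  have hae : ∀ᵐ t, t ∈ Set.Ioo 0 T → w t - c = 0 := by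
    refine isOpen_Ioo.ae_eq_zero_of_integral_contDiff_smul_eq_zero ?_ ?_
    · refine IntegrableOn.locallyIntegrableOn ?_
      exact (hwi.sub (integrableOn_const (by simp))).mono_set Set.Ioo_subset_Ioc_self
    · intro g hg hgc hgt
      have hg' : Tst (Set.Ioo 0 T) g := ⟨hg, hgc, hgt⟩
      rw [← key g hg']
      refine (setIntegral_eq_integral_of_forall_compl_eq_zero fun x hx => ?_).symm
      rw [hg'.eq_zero fun h' => hx (Set.Ioo_subset_Ioc_self h'), zero_smul]
  have := Measure.eqOn_Icc_of_ae_eq (μ := volume) (f := w) (g := fun _ => c) hT.ne ?_ hw continuousOn_const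
  · exact this
  · rw [Filter.EventuallyEq, ae_restrict_congr_set Ioo_ae_eq_Icc.symm, ae_restrict_iff' measurableSet_Ioo]
    filter_upwards [hae] with t ht h1
    linarith [ht h1]

/-! ### The functional `F_t` -/

/-- the functional whose representation gives the harmonic pressure -/
def Fn (T : ℝ) (Ω : Set (Euc d)) (u : ℝ → Euc d → Euc d) (G : Fin d → Fin d → ℝ × Euc d → ℝ)
    (t : ℝ) (φ : Fin d → Euc d → ℝ) : ℝ :=
  (∫ x in Ω, ∑ i, (u t x i - u 0 x i) * φ i x) +
    ∑ i, ∑ j, ∫ p, G i j p * tens t (dd (coordDir j) (φ i)) p ∂(measureQ T Ω)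

section
variable {T q : ℝ} {Ω : Set (Euc d)} {u : ℝ → Euc d → Euc d} {G : Fin d → Fin d → ℝ × Euc d → ℝ}

lemma Dat.u1 (D : Dat T Ω q u G) {t : ℝ} (ht : t ∈ Set.Icc 0 T) (i : Fin d) :
    Integrable (fun x => u t x i) (volume.restrict Ω) := by
  haveI := finite_restrict D.bd
  exact (coord_memLp (D.u2 t ht) i).integrable (by norm_num)

lemma Dat.zero_mem (D : Dat T Ω q u G) : (0:ℝ) ∈ Set.Icc 0 T := ⟨le_rfl, D.T0.le⟩

lemma mul_tst_int {μ : Measure (Euc d)} {f φ : Euc d → ℝ} (hf : Integrable f μ) {A : Set (Euc d)}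
    (hφ : Tst A φ) : Integrable (fun x => f x * φ x) μ := by
  obtain ⟨C, hC, hb⟩ := hφ.bounded
  exact hf.mul_bdd (c := C) hφ.cont.aestronglyMeasurable (Filter.Eventually.of_forall fun x => hb x)

lemma Dat.w_int (D : Dat T Ω q u G) {t : ℝ} (ht : t ∈ Set.Icc 0 T) {φ : Euc d → ℝ}
    (hφ : Tst Ω φ) (i : Fin d) : Integrable (fun x => (u t x i - u 0 x i) * φ x) (volume.restrict Ω) :=
  mul_tst_int ((D.u1 ht i).sub (D.u1 D.zero_mem i)) hφ

lemma Fn_lin (D : Dat T Ω q u G) {t : ℝ} (ht : t ∈ Set.Icc 0 T) {φ ψ : Fin d → Euc d → ℝ}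
    (hφ : ∀ i, Tst Ω (φ i)) (hψ : ∀ i, Tst Ω (ψ i)) (c : ℝ) :
    Fn T Ω u G t (fun i x => φ i x + c * ψ i x) = Fn T Ω u G t φ + c * Fn T Ω u G t ψ := by
  unfold Fn
  have h1 : ∀ x, ∑ i, (u t x i - u 0 x i) * (φ i x + c * ψ i x)
      = ∑ i, (u t x i - u 0 x i) * φ i x + c * ∑ i, (u t x i - u 0 x i) * ψ i x := by
    intro x
    rw [Finset.mul_sum, ← Finset.sum_add_distrib]
    exact Finset.sum_congr rfl fun i _ => by ring
  simp_rw [h1]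
  rw [integral_add (integrable_finsetSum _ fun i _ => D.w_int ht (hφ i) i)
    ((integrable_finsetSum _ fun i _ => D.w_int ht (hψ i) i).const_mul c), integral_const_mul]
  have h2 : ∀ i j, ∫ p, G i j p * tens t (dd (coordDir j) (fun x => φ i x + c * ψ i x)) p ∂(measureQ T Ω)
      = (∫ p, G i j p * tens t (dd (coordDir j) (φ i)) p ∂(measureQ T Ω)) +
        c * ∫ p, G i j p * tens t (dd (coordDir j) (ψ i)) p ∂(measureQ T Ω) := by
    intro i j
    rw [← integral_const_mul, ← integral_add (int_tens (D.G_int i j) t ((hφ i).dd _))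
      ((int_tens (D.G_int i j) t ((hψ i).dd _)).const_mul c)]
    congr 1
    ext p
    unfold tens
    rw [dd_add (hφ i).diff ((hψ i).const_mul c).diff, dd_const_mul (hψ i).diff]
    ring
  simp_rw [h2, Finset.sum_add_distrib, ← Finset.mul_sum]
  ring

lemma Fn_smul (D : Dat T Ω q u G) {t : ℝ} (ht : t ∈ Set.Icc 0 T) {ψ : Fin d → Euc d → ℝ}
    (hψ : ∀ i, Tst Ω (ψ i)) (c : ℝ) :
    Fn T Ω u G t (fun i x => c * ψ i x) = c * Fn T Ω u G t ψ := by
  have h0 : Fn T Ω u G t (fun _ _ => 0) = 0 := by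
    unfold Fn
    have : ∀ j : Fin d, dd (coordDir j) (fun _ : Euc d => (0:ℝ)) = fun _ => 0 := by
      intro j; ext x; simp [dd]
    simp [this, tens]
  have := Fn_lin D ht (φ := fun _ _ => 0) (fun i => Tst.zero) hψ c
  simp only [zero_add, h0] at this
  exact this

lemma Fn_zero (φ : Fin d → Euc d → ℝ) : Fn T Ω u G 0 φ = 0 := by
  unfold Fn tens
  simp

lemma vec_memLp {μ : Measure (Euc d)} {φ : Fin d → Euc d → ℝ} {p : ℝ≥0∞} (hφ : ∀ i, MemLp (φ i) p μ) :
    MemLp (fun x => (WithLp.toLp 2 fun i => φ i x : Euc d)) p μ := by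
  exact MemLp.of_eval_piLp hφ

lemma Fn_cont (D : Dat T Ω q u G) {φ : Fin d → Euc d → ℝ} (hφ : ∀ i, Tst Ω (φ i)) :
    ContinuousOn (fun t => Fn T Ω u G t φ) (Set.Icc 0 T) := by
  unfold Fn
  refine ContinuousOn.add ?_ ?_
  · have h1 := D.uc (fun x => WithLp.toLp 2 fun i => φ i x) (vec_memLp fun i => (hφ i).memLp _ _)
    have h2 : ContinuousOn (fun t => (∫ x in Ω, ∑ i, u t x i * φ i x) - ∫ x in Ω, ∑ i, u 0 x i * φ i x)
        (Set.Icc 0 T) := h1.sub continuousOn_const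
    refine h2.congr fun t ht => ?_
    simp only
    rw [← integral_sub (integrable_finsetSum _ fun i _ => mul_tst_int (D.u1 ht i) (hφ i))
      (integrable_finsetSum _ fun i _ => mul_tst_int (D.u1 D.zero_mem i) (hφ i))]
    congr 1
    ext x
    rw [← Finset.sum_sub_distrib]
    exact Finset.sum_congr rfl fun i _ => by ring
  · refine Continuous.continuousOn ?_
    exact continuous_finsetSum _ fun i _ => continuous_finsetSum _ fun j _ =>
      tens_cont (D.G_int i j) ((hφ i).dd _)

lemma int_Fn (D : Dat T Ω q u G) {η : Fin d → ℝ × Euc d → ℝ} (hη : ∀ i, Tst (Set.Ioo 0 T ×ˢ Ω) (η i)) :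
    ∫ t in Set.Ioc 0 T, Fn T Ω u G t (fun i x => dd ((1:ℝ), (0 : Euc d)) (η i) (t, x)) =
      (∫ p, (∑ i, u p.1 p.2 i * dd ((1:ℝ), (0 : Euc d)) (η i) p) ∂(measureQ T Ω)) -
      ∫ p, (∑ i, ∑ j, G i j p * dd ((0:ℝ), coordDir j) (η i) p) ∂(measureQ T Ω) := by
  haveI := finite_restrict D.bd
  have hbm : ∀ {f : ℝ × Euc d → ℝ} {ζ : ℝ × Euc d → ℝ}, Integrable f (measureQ T Ω) →
      Tst (Set.Ioo 0 T ×ˢ Ω) ζ → Integrable (fun p => f p * ζ p) (measureQ T Ω) := by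
    intro f ζ hf hζ
    obtain ⟨C, hC, hb⟩ := hζ.bounded
    exact hf.mul_bdd (c := C) hζ.cont.aestronglyMeasurable (Filter.Eventually.of_forall fun x => hb x)
  -- the velocity part
  have hu : ∀ i, Integrable (fun p : ℝ × Euc d => (u p.1 p.2 i - u 0 p.2 i) * dd ((1:ℝ), (0 : Euc d)) (η i) p)
      (measureQ T Ω) := by
    intro i
    have := (hbm (D.u_int i) ((hη i).dd ((1:ℝ), (0 : Euc d)))).sub
      (time_ibp0 D.T0.le D.bd (D.u1 D.zero_mem i) (hη i)).1
    refine this.congr (Filter.Eventually.of_forall fun p => ?_)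
    simp only [Pi.sub_apply]; ring
  have hus : Integrable (fun p : ℝ × Euc d => ∑ i, (u p.1 p.2 i - u 0 p.2 i) * dd ((1:ℝ), (0 : Euc d)) (η i) p)
      (measureQ T Ω) := integrable_finsetSum _ fun i _ => hu i
  have e1 : ∫ t in Set.Ioc 0 T, ∫ x in Ω, ∑ i, (u t x i - u 0 x i) * dd ((1:ℝ), (0 : Euc d)) (η i) (t, x)
      = ∫ p, (∑ i, u p.1 p.2 i * dd ((1:ℝ), (0 : Euc d)) (η i) p) ∂(measureQ T Ω) := by
    have := integral_prod (μ := volume.restrict (Set.Ioc 0 T)) (ν := volume.restrict Ω) _ hus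
    refine this.symm.trans ?_
    change ∫ p, _ ∂(measureQ T Ω) = _
    rw [integral_finsetSum _ fun i _ => by exact hu i,
      integral_finsetSum _ fun i _ => by exact hbm (D.u_int i) ((hη i).dd _)]
    refine Finset.sum_congr rfl fun i _ => ?_
    simp_rw [sub_mul]
    rw [integral_sub (hbm (D.u_int i) ((hη i).dd _)) (time_ibp0 D.T0.le D.bd (D.u1 D.zero_mem i) (hη i)).1,
      (time_ibp0 D.T0.le D.bd (D.u1 D.zero_mem i) (hη i)).2, sub_zero]
  have hsl : ∀ (t : ℝ) (i j : Fin d), dd (coordDir j) (fun x => dd ((1:ℝ), (0 : Euc d)) (η i) (t, x))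
      = fun x => dd ((1:ℝ), (0 : Euc d)) (dd ((0:ℝ), coordDir j) (η i)) (t, x) := by
    intro t i j
    ext x
    rw [dd_slice ((hη i).dd _).diff, dd_comm (hη i).cd]
  unfold Fn
  simp_rw [hsl]
  rw [integral_add hus.integral_prod_left (integrable_finsetSum _ fun i _ => integrable_finsetSum _ fun j _ =>
    (time_ibp D.bd (D.G_int i j) ((hη i).dd ((0:ℝ), coordDir j))).1), e1, sub_eq_add_neg]
  congr 1
  rw [integral_finsetSum _ fun i _ => integrable_finsetSum _ fun j _ =>
    (time_ibp D.bd (D.G_int i j) ((hη i).dd ((0:ℝ), coordDir j))).1,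
    integral_finsetSum _ fun i _ => integrable_finsetSum _ fun j _ => by
      exact hbm (D.G_int i j) ((hη i).dd ((0:ℝ), coordDir j)), ← Finset.sum_neg_distrib]
  refine Finset.sum_congr rfl fun i _ => ?_
  rw [integral_finsetSum _ fun j _ => (time_ibp D.bd (D.G_int i j) ((hη i).dd ((0:ℝ), coordDir j))).1,
    integral_finsetSum _ fun j _ => by
      exact hbm (D.G_int i j) ((hη i).dd ((0:ℝ), coordDir j)), ← Finset.sum_neg_distrib]
  refine Finset.sum_congr rfl fun j _ => ?_
  exact (time_ibp D.bd (D.G_int i j) ((hη i).dd ((0:ℝ), coordDir j))).2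

/-- the weak formulation for divergence free fields -/
def Wk (T : ℝ) (Ω : Set (Euc d)) (u : ℝ → Euc d → Euc d) (G : Fin d → Fin d → ℝ × Euc d → ℝ) : Prop :=
  ∀ η : Fin d → ℝ × Euc d → ℝ, (∀ i, Tst (Set.Ioo 0 T ×ˢ Ω) (η i)) →
    (∀ p, ∑ j, dd ((0:ℝ), coordDir j) (η j) p = 0) →
    ∫ p, (∑ i, u p.1 p.2 i * dd ((1:ℝ), (0 : Euc d)) (η i) p) ∂(measureQ T Ω) =
      ∫ p, (∑ i, ∑ j, G i j p * dd ((0:ℝ), coordDir j) (η i) p) ∂(measureQ T Ω)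

lemma Fn_vanish (D : Dat T Ω q u G) (W : Wk T Ω u G) {φ : Fin d → Euc d → ℝ} (hφ : ∀ i, Tst Ω (φ i))
    (hdiv : ∀ x, ∑ i, dd (coordDir i) (φ i) x = 0) {t : ℝ} (ht : t ∈ Set.Icc 0 T) :
    Fn T Ω u G t φ = 0 := by
  obtain ⟨c, hc⟩ := du_bois D.T0 (Fn_cont D hφ) (by
    intro θ hθ
    have hη : ∀ i, Tst (Set.Ioo 0 T ×ˢ Ω) (fun p : ℝ × Euc d => θ p.1 * φ i p.2) := by
      intro i
      refine Tst.of_support (K := tsupport θ ×ˢ tsupport (φ i)) ?_ (hθ.cs.prod (hφ i).cs) ?_ ?_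
      · exact (hθ.cd.comp contDiff_fst).mul ((hφ i).cd.comp contDiff_snd)
      · exact Set.prod_mono hθ.ts (hφ i).ts
      · intro p hp
        by_contra h
        exact hp ⟨subset_tsupport _ (left_ne_zero_of_mul h), subset_tsupport _ (right_ne_zero_of_mul h)⟩
    have hdt : ∀ i t x, dd ((1:ℝ), (0 : Euc d)) (fun p : ℝ × Euc d => θ p.1 * φ i p.2) (t, x)
        = dd 1 θ t * φ i x := by
      intro i t x
      have h1 := hasDerivAt_time (hη i).diff t x
      have h2 : HasDerivAt θ (dd 1 θ t) t := by
        unfold dd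
        rw [fderiv_apply_one_eq_deriv]
        exact (hθ.diff t).hasDerivAt
      exact h1.unique (h2.mul_const (φ i x))
    have hdx : ∀ i j t x, dd ((0:ℝ), coordDir j) (fun p : ℝ × Euc d => θ p.1 * φ i p.2) (t, x)
        = θ t * dd (coordDir j) (φ i) x := by
      intro i j t x
      rw [← dd_slice (hη i).diff]
      exact dd_const_mul (hφ i).diff (θ t) _ x
    have h1 := int_Fn D hη
    rw [W _ hη (by
      rintro ⟨t, x⟩
      simp_rw [hdx, ← Finset.mul_sum, hdiv, mul_zero]), sub_self] at h1
    simp_rw [hdt] at h1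
    refine Eq.trans ?_ h1
    refine setIntegral_congr_fun measurableSet_Ioc fun s hs => ?_
    exact (Fn_smul D ⟨hs.1.le, hs.2⟩ hφ _).symm)
  rw [hc t ht, ← hc 0 D.zero_mem, Fn_zero]

end
end
end

section
open MeasureTheory
open scoped ENNReal
noncomputable section
variable {d : ℕ}

/-! ### Poincaré inequality and bounds for `F_t` -/

lemma poincare {Ω : Set (Euc d)} (hb : Bornology.IsBounded Ω) {p : ℝ} (hp : 1 < p) (i0 : Fin d) :
    ∃ C : ℝ, 0 < C ∧ ∀ v, Tst Ω v → eLpNorm v (ENNReal.ofReal p) volume ≤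
      ENNReal.ofReal C * eLpNorm (dd (coordDir i0) v) (ENNReal.ofReal p) volume := by
  obtain ⟨R, hR0, hR⟩ := hb.subset_closedBall_lt 0 0
  set L : ℝ := 2 * R + 1 with hL
  refine ⟨L, by positivity, fun v hv => ?_⟩
  set e : Euc d := coordDir i0 with he
  have hen : ‖e‖ = 1 := by simp [he, coordDir]
  set μ : Measure ℝ := volume.restrict (Set.Ioc 0 L)
  have h1 := av_norm (d := d) (μ := μ) hp (a := fun _ => (1:ℝ)) measurable_const
    (ξ := fun t : ℝ => -(t • e)) (by fun_prop) (hv.dd e).cont.measurable (A := ENNReal.ofReal L) (by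
      simp [μ])
  refine le_trans (eLpNorm_mono fun x => ?_) h1
  by_cases hx : x ∈ Ω
  · have h2 : av μ (fun _ => (1:ℝ)) (fun t : ℝ => -(t • e)) (dd e v) x = - v x := by
      unfold av
      simp only [one_mul, sub_neg_eq_add, μ]
      rw [← intervalIntegral.integral_of_le (by positivity)]
      rw [intervalIntegral.integral_eq_sub_of_hasDerivAt (f := fun t : ℝ => v (x + t • e))]
      · have : v (x + L • e) = 0 := by
          refine hv.eq_zero fun h => ?_
          have h3 := hR h
          have h4 := hR hx
          rw [mem_closedBall_zero_iff] at h3 h4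
          have h5 : ‖L • e‖ = L := by rw [norm_smul, hen, mul_one, Real.norm_of_nonneg (by positivity)]
          have h6 : ‖L • e‖ ≤ ‖x + L • e‖ + ‖x‖ := by
            calc ‖L • e‖ = ‖(x + L • e) - x‖ := by simp
              _ ≤ _ := norm_sub_le _ _
          linarith
        rw [this]; simp
      · intro t _
        exact hasDerivAt_line hv.diff x e t
      · refine Continuous.intervalIntegrable ?_ _ _
        exact (hv.dd e).cont.comp (by fun_prop)
    rw [h2, norm_neg]
  · rw [hv.eq_zero hx, norm_zero]; exact norm_nonneg _

lemma holder_abs {X : Type*} [MeasurableSpace X] {μ : Measure X} {r p : ℝ} (h : r.HolderConjugate p)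
    {f g : X → ℝ} (hf : AEStronglyMeasurable f μ) (hg : AEStronglyMeasurable g μ) :
    ENNReal.ofReal |∫ x, f x * g x ∂μ| ≤
      eLpNorm f (ENNReal.ofReal r) μ * eLpNorm g (ENNReal.ofReal p) μ := by
  haveI : ENNReal.HolderConjugate (ENNReal.ofReal r) (ENNReal.ofReal p) := h.ennrealOfReal
  have h1 := eLpNorm_smul_le_mul_eLpNorm (p := ENNReal.ofReal r) (q := ENNReal.ofReal p) (r := 1) hg hf
  refine le_trans ?_ h1
  rw [eLpNorm_one_eq_lintegral_enorm, ← Real.enorm_eq_ofReal_abs]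
  exact enorm_integral_le_lintegral_enorm _

lemma tens_norm (T t : ℝ) (Ω : Set (Euc d)) {ψ : Euc d → ℝ} (hψ : Continuous ψ) {p : ℝ≥0∞} (hp : p ≠ ⊤) :
    eLpNorm (tens t ψ) p (measureQ T Ω) ≤ ENNReal.ofReal T ^ (1 / p).toReal * eLpNorm ψ p volume := by
  have h1 : eLpNorm (tens t ψ) p (measureQ T Ω) ≤ eLpNorm (ψ ∘ Prod.snd) p (measureQ T Ω) := by
    refine eLpNorm_mono fun z => ?_
    unfold tens
    by_cases h1 : z.1 ∈ Set.Ioc 0 t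
    · rw [Set.indicator_of_mem h1, one_mul]; exact le_rfl
    · rw [Set.indicator_of_notMem h1, zero_mul, norm_zero]; exact norm_nonneg _
  refine h1.trans ?_
  unfold measureQ
  rw [← eLpNorm_map_measure hψ.aestronglyMeasurable measurable_snd.aemeasurable, Measure.map_snd_prod,
    eLpNorm_smul_measure_of_ne_top hp, Measure.restrict_apply_univ, Real.volume_Ioc, sub_zero, smul_eq_mul]
  gcongr
  exact Measure.restrict_le_self

lemma Fn_bound {T : ℝ} {Ω : Set (Euc d)} (hb : Bornology.IsBounded Ω) {r p : ℝ}
    (hpr : r.HolderConjugate p) (hp2 : 2 ≤ p) : ∃ K : ℝ, 0 < K ∧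
    ∀ q u G, Dat T Ω q u G → ∀ t ∈ Set.Icc 0 T, ∀ φ : Fin d → Euc d → ℝ, (∀ i, Tst Ω (φ i)) →
      ENNReal.ofReal |Fn T Ω u G t φ| ≤ ENNReal.ofReal K *
        ((∑ i, ∑ j, eLpNorm (G i j) (ENNReal.ofReal r) (measureQ T Ω)) +
          ⨆ s ∈ Set.Icc 0 T, eLpNorm (u s) 2 (volume.restrict Ω)) *
        ∑ i, ∑ j, eLpNorm (dd (coordDir j) (φ i)) (ENNReal.ofReal p) volume := by
  haveI := finite_restrict hb
  choose C hC0 hC using fun i0 : Fin d => poincare hb (p := p) (by linarith) i0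
  set C' : ℝ := ∑ i, C i
  have hC' : 0 ≤ C' := Finset.sum_nonneg fun i _ => (hC0 i).le
  set E : ℝ≥0∞ := (volume.restrict Ω) Set.univ ^ (1 / (2:ℝ≥0∞).toReal - 1 / (ENNReal.ofReal p).toReal) with hE
  have hEt : E ≠ ⊤ := by
    refine ENNReal.rpow_ne_top_of_nonneg ?_ (measure_ne_top _ _)
    rw [ENNReal.toReal_ofReal (by linarith), ENNReal.toReal_ofNat, sub_nonneg]
    exact one_div_le_one_div_of_le (by norm_num) hp2
  set T' : ℝ≥0∞ := ENNReal.ofReal T ^ (1 / ENNReal.ofReal p).toReal with hT'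
  have hTt : T' ≠ ⊤ := ENNReal.rpow_ne_top_of_nonneg ENNReal.toReal_nonneg ENNReal.ofReal_ne_top
  set KK : ℝ≥0∞ := ∑ _i : Fin d, 2 * (ENNReal.ofReal C' * E) + T' with hKK
  have hKt : KK ≠ ⊤ := by
    refine ENNReal.add_ne_top.2 ⟨(ENNReal.sum_ne_top).2 fun i _ => ?_, hTt⟩
    exact ENNReal.mul_ne_top (by norm_num) (ENNReal.mul_ne_top ENNReal.ofReal_ne_top hEt)
  refine ⟨KK.toReal + 1, by positivity, fun q u G D t ht φ hφ => ?_⟩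
  have hKle : KK ≤ ENNReal.ofReal (KK.toReal + 1) := by
    rw [ENNReal.le_ofReal_iff_toReal_le hKt (by positivity)]; linarith
  set S : ℝ≥0∞ := ∑ i, ∑ j, eLpNorm (dd (coordDir j) (φ i)) (ENNReal.ofReal p) volume with hS
  set M : ℝ≥0∞ := ⨆ s ∈ Set.Icc 0 T, eLpNorm (u s) 2 (volume.restrict Ω) with hM
  set N : ℝ≥0∞ := ∑ i, ∑ j, eLpNorm (G i j) (ENNReal.ofReal r) (measureQ T Ω) with hN
  have hSle : ∀ i j, eLpNorm (dd (coordDir j) (φ i)) (ENNReal.ofReal p) volume ≤ S := by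
    intro i j
    refine le_trans ?_ (Finset.single_le_sum (f := fun i => ∑ j, eLpNorm (dd (coordDir j) (φ i)) (ENNReal.ofReal p) volume)
      (fun i _ => zero_le) (Finset.mem_univ i))
    exact Finset.single_le_sum (f := fun j => eLpNorm (dd (coordDir j) (φ i)) (ENNReal.ofReal p) volume)
      (fun i _ => zero_le) (Finset.mem_univ j)
  have hMs : ∀ s ∈ Set.Icc 0 T, eLpNorm (u s) 2 (volume.restrict Ω) ≤ M := fun s hs =>
    le_iSup₂ (f := fun s (_ : s ∈ Set.Icc 0 T) => eLpNorm (u s) 2 (volume.restrict Ω)) s hs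
  have tri : ∀ {α : Type} (s : Finset α) (f : α → ℝ), ENNReal.ofReal |∑ a ∈ s, f a| ≤ ∑ a ∈ s, ENNReal.ofReal |f a| := by
    intro α s f
    rw [← ENNReal.ofReal_sum_of_nonneg fun _ _ => abs_nonneg _]
    exact ENNReal.ofReal_le_ofReal (Finset.abs_sum_le_sum_abs _ _)
  have two : ENNReal.ofReal 2 = 2 := by simp
  -- velocity part
  have hA : ENNReal.ofReal |∫ x in Ω, ∑ i, (u t x i - u 0 x i) * φ i x| ≤
      (∑ _i : Fin d, 2 * (ENNReal.ofReal C' * E)) * M * S := by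
    rw [integral_finsetSum _ fun i _ => D.w_int ht (hφ i) i]
    refine (tri _ _).trans ?_
    rw [mul_assoc, Finset.sum_mul]
    refine Finset.sum_le_sum fun i _ => ?_
    have h1 := holder_abs (μ := volume.restrict Ω) (r := 2) (p := 2) Real.HolderConjugate.two_two
      (f := fun x => u t x i - u 0 x i) (g := φ i)
      ((coord_memLp (D.u2 t ht) i).1.sub (coord_memLp (D.u2 0 D.zero_mem) i).1) (hφ i).cont.aestronglyMeasurable
    refine h1.trans ?_
    rw [two]
    have h2 : eLpNorm (fun x => u t x i - u 0 x i) 2 (volume.restrict Ω) ≤ 2 * M := by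
      refine (eLpNorm_sub_le (f := fun x => u t x i) (g := fun x => u 0 x i) (coord_memLp (D.u2 t ht) i).1
        (coord_memLp (D.u2 0 D.zero_mem) i).1 (by norm_num)).trans ?_
      rw [two_mul]
      refine add_le_add ?_ ?_
      · exact (eLpNorm_mono fun x => coord_norm_le _ _).trans (hMs t ht)
      · exact (eLpNorm_mono fun x => coord_norm_le _ _).trans (hMs 0 D.zero_mem)
    have h3 : eLpNorm (φ i) 2 (volume.restrict Ω) ≤ ENNReal.ofReal C' * S * E := by
      refine (eLpNorm_le_eLpNorm_mul_rpow_measure_univ (q := ENNReal.ofReal p) ?_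
        (hφ i).cont.aestronglyMeasurable).trans ?_
      · rw [← two]; exact ENNReal.ofReal_le_ofReal hp2
      · refine mul_le_mul_left ?_ _
        refine (eLpNorm_mono_measure _ Measure.restrict_le_self).trans ?_
        refine (hC i _ (hφ i)).trans ?_
        gcongr
        · exact Finset.single_le_sum (f := C) (fun i _ => (hC0 i).le) (Finset.mem_univ i)
        · exact hSle i i
    calc _ ≤ (2 * M) * (ENNReal.ofReal C' * S * E) := by gcongr
      _ = _ := by ring
  have hB : ENNReal.ofReal |∑ i, ∑ j, ∫ z, G i j z * tens t (dd (coordDir j) (φ i)) z ∂(measureQ T Ω)| ≤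
      T' * N * S := by
    refine (tri _ _).trans ?_
    clear_value S
    rw [hN, Finset.mul_sum, Finset.sum_mul]
    refine Finset.sum_le_sum fun i _ => (tri _ _).trans ?_
    rw [Finset.mul_sum, Finset.sum_mul]
    refine Finset.sum_le_sum fun j _ => ?_
    refine (holder_abs hpr (D.G2 i j).1 (tens_meas t ((hφ i).dd _).cont).aestronglyMeasurable).trans ?_
    calc _ ≤ eLpNorm (G i j) (ENNReal.ofReal r) (measureQ T Ω) * (T' * S) := by
          gcongr
          refine (tens_norm T t Ω ((hφ i).dd _).cont ENNReal.ofReal_ne_top).trans ?_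
          gcongr
          exact hSle i j
      _ = _ := by ring
  unfold Fn
  calc _ ≤ ENNReal.ofReal (|∫ x in Ω, ∑ i, (u t x i - u 0 x i) * φ i x| +
          |∑ i, ∑ j, ∫ z, G i j z * tens t (dd (coordDir j) (φ i)) z ∂(measureQ T Ω)|) :=
        ENNReal.ofReal_le_ofReal (abs_add_le _ _)
    _ ≤ _ := ENNReal.ofReal_add_le
    _ ≤ (∑ _i : Fin d, 2 * (ENNReal.ofReal C' * E)) * M * S + T' * N * S := add_le_add hA hB
    _ ≤ KK * M * S + KK * N * S := by
        gcongr
        · rw [hKK]; exact le_self_add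
        · rw [hKK]; exact le_add_self
    _ = KK * (N + M) * S := by ring
    _ ≤ _ := by gcongr

end
end

section
open MeasureTheory
open scoped ENNReal
noncomputable section
variable {d : ℕ}

/-! ### Existence of the harmonic pressure at a fixed time -/

lemma Fn_unique {T q : ℝ} {Ω : Set (Euc d)} {u : ℝ → Euc d → Euc d} {G : Fin d → Fin d → ℝ × Euc d → ℝ}
    (D : Dat T Ω q u G) (W : Wk T Ω u G) {φ ψ : Fin d → Euc d → ℝ} (hφ : ∀ i, Tst Ω (φ i))
    (hψ : ∀ i, Tst Ω (ψ i))
    (hdiv : ∀ x, ∑ i, dd (coordDir i) (φ i) x = ∑ i, dd (coordDir i) (ψ i) x) {t : ℝ} (ht : t ∈ Set.Icc 0 T) :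
    Fn T Ω u G t φ = Fn T Ω u G t ψ := by
  have h1 := Fn_lin D ht hφ hψ (-1)
  rw [Fn_vanish D W (fun i => (hφ i).add ((hψ i).const_mul (-1))) (fun x => ?_) ht] at h1
  · linarith
  · have : ∀ i, dd (coordDir i) (fun x => φ i x + -1 * ψ i x) x
        = dd (coordDir i) (φ i) x - dd (coordDir i) (ψ i) x := by
      intro i
      rw [dd_add (hφ i).diff ((hψ i).const_mul _).diff, dd_const_mul (hψ i).diff]; ring
    simp_rw [this, Finset.sum_sub_distrib, hdiv, sub_self]

/-- test functions as a submodule -/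
def tstSub (Ω : Set (Euc d)) : Submodule ℝ (Euc d → ℝ) where
  carrier := {g | Tst Ω g}
  add_mem' := fun ha hb => Tst.add ha hb
  zero_mem' := Tst.zero
  smul_mem' := fun c _ hx => Tst.const_mul c hx

lemma tst_norm_restrict {Ω : Set (Euc d)} (hm : MeasurableSet Ω) {g : Euc d → ℝ} (hg : Tst Ω g) (p : ℝ≥0∞) :
    eLpNorm g p (volume.restrict Ω) = eLpNorm g p volume := by
  rw [← eLpNorm_indicator_eq_eLpNorm_restrict hm]
  congr 1
  ext x
  by_cases hx : x ∈ Ω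
  · simp [hx]
  · simp [hx, hg.eq_zero hx]

lemma ae_unique {Ω : Set (Euc d)} (ho : IsOpen Ω) {f g : Euc d → ℝ}
    (hf : Integrable f (volume.restrict Ω)) (hg : Integrable g (volume.restrict Ω))
    (h : ∀ ζ, Tst Ω ζ → ∫ x in Ω, f x * ζ x = ∫ x in Ω, g x * ζ x) : f =ᵐ[volume.restrict Ω] g := by
  have hae : ∀ᵐ x, x ∈ Ω → f x - g x = 0 := by
    refine ho.ae_eq_zero_of_integral_contDiff_smul_eq_zero ?_ ?_
    · exact IntegrableOn.locallyIntegrableOn (hf.sub hg)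
    · intro ζ h1 h2 h3
      have hζ : Tst Ω ζ := ⟨h1, h2, h3⟩
      have e : ∫ x, ζ x • (f x - g x) = ∫ x in Ω, ζ x • (f x - g x) := by
        refine (setIntegral_eq_integral_of_forall_compl_eq_zero fun x hx => ?_).symm
        rw [hζ.eq_zero hx, zero_smul]
      have e2 : ∀ x, ζ x • (f x - g x) = f x * ζ x - g x * ζ x := fun x => by rw [smul_eq_mul]; ring
      rw [e]
      simp_rw [e2]
      rw [integral_sub (mul_tst_int hf hζ) (mul_tst_int hg hζ), h ζ hζ, sub_self]
  rw [Filter.EventuallyEq, ae_restrict_iff' ho.measurableSet]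
  filter_upwards [hae] with x hx h1
  linarith [hx h1]

lemma exists_pit (hd : 0 < d) {T : ℝ} {Ω : Set (Euc d)} (hΩ : IsOpen Ω) (hc : IsConnected Ω)
    (hb : Bornology.IsBounded Ω) (hC4 : HasC4Boundary Ω) :
    ∃ (K : ℝ → ℝ) (V : (Euc d → ℝ) → Fin d → Euc d → ℝ), (∀ r, 0 < K r) ∧
      (∀ g, Tst Ω g → ∀ i, Tst Ω (V g i)) ∧
      ∀ q u G, Dat T Ω q u G → Wk T Ω u G → ∀ t ∈ Set.Icc 0 T, ∃ π : Euc d → ℝ, Measurable π ∧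
        MemLp π (ENNReal.ofReal (min 2 q)) (volume.restrict Ω) ∧
        (∀ φ : Fin d → Euc d → ℝ, (∀ i, Tst Ω (φ i)) →
          Fn T Ω u G t φ = ∫ x in Ω, π x * ∑ i, dd (coordDir i) (φ i) x) ∧
        (∀ g, Tst Ω g → ∫ x in Ω, π x * g x = Fn T Ω u G t (V g)) ∧
        ∀ r, 1 < r → r ≤ 2 → eLpNorm π (ENNReal.ofReal r) (volume.restrict Ω) ≤ ENNReal.ofReal (K r) *
          ((∑ i, ∑ j, eLpNorm (G i j) (ENNReal.ofReal r) (measureQ T Ω)) +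
          ⨆ s ∈ Set.Icc 0 T, eLpNorm (u s) 2 (volume.restrict Ω)) := by
  haveI := finite_restrict hb
  obtain ⟨θ0, hθ, hθ1, hBog⟩ := bogovskii hd hΩ hc hb hC4
  -- a fixed choice of `v_g`
  have hV : ∀ g, ∃ v : Fin d → Euc d → ℝ, Tst Ω g → (∀ i, Tst Ω (v i)) ∧
      (∀ x, ∑ i, dd (coordDir i) (v i) x = g x - (∫ y, g y) * θ0 x) := by
    intro g
    obtain ⟨C, hC, h⟩ := hBog 2 (by norm_num)
    by_cases hg : Tst Ω g
    · obtain ⟨v, h1, h2, h3⟩ := h g hg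
      exact ⟨v, fun _ => ⟨h1, h2⟩⟩
    · exact ⟨0, fun h => absurd h hg⟩
  choose V hV using hV
  -- constants
  have hK : ∀ r : ℝ, ∃ K : ℝ, 0 < K ∧ (1 < r → r ≤ 2 → ∀ q u G, Dat T Ω q u G → Wk T Ω u G → ∀ t ∈ Set.Icc 0 T,
      ∀ g, Tst Ω g → ENNReal.ofReal |Fn T Ω u G t (V g)| ≤ ENNReal.ofReal K *
        ((∑ i, ∑ j, eLpNorm (G i j) (ENNReal.ofReal r) (measureQ T Ω)) +
          ⨆ s ∈ Set.Icc 0 T, eLpNorm (u s) 2 (volume.restrict Ω)) *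
        eLpNorm g (ENNReal.ofReal (Real.conjExponent r)) (volume.restrict Ω)) := by
    intro r
    by_cases hr : 1 < r ∧ r ≤ 2
    swap
    · exact ⟨1, one_pos, fun h1 h2 => absurd ⟨h1, h2⟩ hr⟩
    have hpq := Real.HolderConjugate.conjExponent hr.1
    set p := Real.conjExponent r with hp
    have hp2 : 2 ≤ p := by
      rw [hp]
      unfold Real.conjExponent
      rw [le_div_iff₀ (by linarith [hr.1])]
      linarith [hr.2]
    obtain ⟨K1, hK1, hF⟩ := Fn_bound (T := T) hb hpq hp2
    obtain ⟨B, hB, hBg⟩ := hBog p (by linarith)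
    refine ⟨K1 * (∑ _i : Fin d, ∑ _j : Fin d, B) + 1, ?_, ?_⟩
    · have : 0 ≤ ∑ _i : Fin d, ∑ _j : Fin d, B := Finset.sum_nonneg fun _ _ => Finset.sum_nonneg fun _ _ => hB.le
      positivity
    intro _ _ q u G D W t ht g hg
    obtain ⟨v, h1, h2, h3⟩ := hBg g hg
    rw [Fn_unique D W (hV g hg).1 h1 (fun x => by rw [(hV g hg).2 x, h2 x]) ht]
    refine (hF q u G D t ht v h1).trans ?_
    rw [tst_norm_restrict hΩ.measurableSet hg]
    set NM := (∑ i, ∑ j, eLpNorm (G i j) (ENNReal.ofReal r) (measureQ T Ω)) +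
          ⨆ s ∈ Set.Icc 0 T, eLpNorm (u s) 2 (volume.restrict Ω)
    clear_value NM
    have h4 : ∑ i, ∑ j, eLpNorm (dd (coordDir j) (v i)) (ENNReal.ofReal p) volume ≤
        ENNReal.ofReal (∑ _i : Fin d, ∑ _j : Fin d, B) * eLpNorm g (ENNReal.ofReal p) volume := by
      rw [ENNReal.ofReal_sum_of_nonneg fun _ _ => Finset.sum_nonneg fun _ _ => hB.le, Finset.sum_mul]
      refine Finset.sum_le_sum fun i _ => ?_
      rw [ENNReal.ofReal_sum_of_nonneg fun _ _ => hB.le, Finset.sum_mul]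
      exact Finset.sum_le_sum fun j _ => h3 i j
    calc _ ≤ ENNReal.ofReal K1 * NM * (ENNReal.ofReal (∑ _i : Fin d, ∑ _j : Fin d, B) * eLpNorm g (ENNReal.ofReal p) volume) := by
          gcongr
      _ = ENNReal.ofReal (K1 * (∑ _i : Fin d, ∑ _j : Fin d, B)) * NM * eLpNorm g (ENNReal.ofReal p) volume := by
          rw [ENNReal.ofReal_mul hK1.le]; ring
      _ ≤ _ := by
          gcongr
          linarith
  choose K hK0 hKb using hK
  refine ⟨K, V, hK0, fun g hg => (hV g hg).1, fun q u G D W t ht => ?_⟩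
  -- the linear functional
  let L : tstSub Ω →ₗ[ℝ] ℝ :=
    { toFun := fun g => Fn T Ω u G t (V g)
      map_add' := by
        rintro ⟨f, hf⟩ ⟨g, hg⟩
        change Tst Ω f at hf
        change Tst Ω g at hg
        have h1 := Fn_lin D ht (hV f hf).1 (hV g hg).1 1
        rw [one_mul] at h1
        change Fn T Ω u G t (V (f + g)) = Fn T Ω u G t (V f) + Fn T Ω u G t (V g)
        rw [← h1]
        have hfg : Tst Ω (f + g) := hf.add hg
        refine Fn_unique D W (hV _ hfg).1 (fun i => ((hV f hf).1 i).add (((hV g hg).1 i).const_mul 1)) (fun x => ?_) ht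
        rw [(hV _ hfg).2 x]
        simp_rw [dd_add ((hV f hf).1 _).diff (((hV g hg).1 _).const_mul 1).diff, dd_const_mul ((hV g hg).1 _).diff, one_mul,
          Finset.sum_add_distrib]
        rw [(hV f hf).2 x, (hV g hg).2 x]
        simp only [Pi.add_apply]
        rw [integral_add hf.integrable hg.integrable]
        ring
      map_smul' := by
        rintro c ⟨g, hg⟩
        change Tst Ω g at hg
        change Fn T Ω u G t (V (c • g)) = c * Fn T Ω u G t (V g)
        rw [← Fn_smul D ht (hV g hg).1 c]
        have hfg : Tst Ω (c • g) := hg.const_mul c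
        refine Fn_unique D W (hV _ hfg).1 (fun i => ((hV g hg).1 i).const_mul c) (fun x => ?_) ht
        rw [(hV _ hfg).2 x]
        simp_rw [dd_const_mul ((hV g hg).1 _).diff, ← Finset.mul_sum]
        rw [(hV g hg).2 x]
        simp only [Pi.smul_apply, smul_eq_mul]
        rw [integral_const_mul]
        ring }
  have hL : ∀ g : tstSub Ω, L g = Fn T Ω u G t (V g) := fun g => rfl
  -- representation for every admissible exponent
  have rep : ∀ r, 1 < r → r ≤ 2 → (∀ i j, MemLp (G i j) (ENNReal.ofReal r) (measureQ T Ω)) →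
      ∃ π : Euc d → ℝ, Measurable π ∧ MemLp π (ENNReal.ofReal r) (volume.restrict Ω) ∧
        eLpNorm π (ENNReal.ofReal r) (volume.restrict Ω) ≤ ENNReal.ofReal (K r) *
          ((∑ i, ∑ j, eLpNorm (G i j) (ENNReal.ofReal r) (measureQ T Ω)) +
          ⨆ s ∈ Set.Icc 0 T, eLpNorm (u s) 2 (volume.restrict Ω)) ∧
        ∀ g, Tst Ω g → ∫ x in Ω, π x * g x = Fn T Ω u G t (V g) := by
    intro r hr1 hr2 hGr
    have hpq := Real.HolderConjugate.conjExponent hr1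
    set NM := (∑ i, ∑ j, eLpNorm (G i j) (ENNReal.ofReal r) (measureQ T Ω)) +
          ⨆ s ∈ Set.Icc 0 T, eLpNorm (u s) 2 (volume.restrict Ω) with hNM
    have hNMt : NM ≠ ⊤ := ENNReal.add_ne_top.2 ⟨ENNReal.sum_ne_top.2 fun i _ => ENNReal.sum_ne_top.2 fun j _ =>
      (hGr i j).eLpNorm_ne_top, D.sup⟩
    have hCt : ENNReal.ofReal (K r) * NM ≠ ⊤ := ENNReal.mul_ne_top ENNReal.ofReal_ne_top hNMt
    obtain ⟨π, h1, h2, h3, h4⟩ := lp_dual (μ := volume.restrict Ω) hpq (tstSub Ω) (fun v hv => Tst.memLp hv _ _) L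
      (C := (ENNReal.ofReal (K r) * NM).toReal) ENNReal.toReal_nonneg (by
        rintro ⟨g, hg⟩
        rw [hL]
        have h5 := hKb r hr1 hr2 q u G D W t ht g hg
        rw [← hNM] at h5
        have h6 := ENNReal.toReal_mono (ENNReal.mul_ne_top hCt (Tst.memLp hg _ _).eLpNorm_ne_top) h5
        rw [ENNReal.toReal_ofReal (abs_nonneg _), ENNReal.toReal_mul] at h6
        exact h6)
    rw [ENNReal.ofReal_toReal hCt] at h3
    refine ⟨π, h1, h2, h3, fun g hg => ?_⟩
    obtain ⟨M, hM, hMb⟩ := hg.bounded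
    rw [← h4 ⟨g, hg⟩ hg.cont.measurable ⟨M, hMb⟩]
    exact hL _
  have hs1 : 1 < min 2 q := lt_min (by norm_num) D.q1
  haveI := measureQ_finite T hb
  obtain ⟨π, h1, h2, h3, h4⟩ := rep (min 2 q) hs1 (min_le_left _ _) (fun i j =>
    (D.G2 i j).mono_exponent (ENNReal.ofReal_le_ofReal (min_le_right _ _)))
  have one_le : ∀ r : ℝ, 1 < r → (1:ℝ≥0∞) ≤ ENNReal.ofReal r := fun r hr => by
    rw [← ENNReal.ofReal_one]; exact ENNReal.ofReal_le_ofReal hr.le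
  refine ⟨π, h1, h2, ?_, h4, ?_⟩
  · intro φ hφ
    have hg : Tst Ω (fun x => ∑ i, dd (coordDir i) (φ i) x) := Tst.sum _ fun i _ => (hφ i).dd _
    rw [h4 _ hg]
    refine Fn_unique D W hφ (hV _ hg).1 (fun x => ?_) ht
    rw [(hV _ hg).2 x]
    have : ∫ y, ∑ i, dd (coordDir i) (φ i) y = 0 := by
      rw [integral_finsetSum _ fun i _ => by exact ((hφ i).dd _).integrable]
      exact Finset.sum_eq_zero fun i _ => integral_dd ((hφ i).mono (Set.subset_univ _)) _
    rw [this, zero_mul, sub_zero]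
  · intro r hr1 hr2
    by_cases hGr : ∀ i j, MemLp (G i j) (ENNReal.ofReal r) (measureQ T Ω)
    · obtain ⟨π', h1', h2', h3', h4'⟩ := rep r hr1 hr2 hGr
      have : π =ᵐ[volume.restrict Ω] π' := ae_unique hΩ (h2.integrable (one_le _ hs1))
        (h2'.integrable (one_le _ hr1)) fun ζ hζ => by rw [h4 ζ hζ, h4' ζ hζ]
      rw [eLpNorm_congr_ae this]
      exact h3'
    · push Not at hGr
      obtain ⟨i, j, hij⟩ := hGr
      have : eLpNorm (G i j) (ENNReal.ofReal r) (measureQ T Ω) = ⊤ := by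
        by_contra h
        exact hij ⟨(D.G2 i j).1, lt_top_iff_ne_top.2 h⟩
      have e : ∑ i, ∑ j, eLpNorm (G i j) (ENNReal.ofReal r) (measureQ T Ω) = ⊤ :=
        ENNReal.sum_eq_top.2 ⟨i, Finset.mem_univ _, ENNReal.sum_eq_top.2 ⟨j, Finset.mem_univ _, this⟩⟩
      rw [e, top_add, ENNReal.mul_top]
      · exact le_top
      · exact (ENNReal.ofReal_pos.2 (hK0 r)).ne'

end
end

section
open MeasureTheory
open scoped ENNReal
noncomputable section
variable {d : ℕ}

/-! ### Weak continuity and joint measurability -/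

lemma tst_dense {Ω : Set (Euc d)} (hΩ : IsOpen Ω) (hb : Bornology.IsBounded Ω) {p : ℝ≥0∞} (hp1 : 1 ≤ p)
    (hp : p ≠ ⊤) {g : Euc d → ℝ} (hg : MemLp g p (volume.restrict Ω)) {ε : ℝ} (hε : 0 < ε) :
    ∃ ζ, Tst Ω ζ ∧ eLpNorm (fun x => g x - ζ x) p (volume.restrict Ω) ≤ ENNReal.ofReal ε := by
  haveI := finite_restrict hb
  obtain ⟨h, hc, hcd, hle⟩ := hg.exist_eLpNorm_sub_le hp hp1 (half_pos hε)
  have hmem : MemLp h p (volume.restrict Ω) := hcd.continuous.memLp_of_hasCompactSupport hc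
  obtain ⟨δ, hδ, hδb⟩ := hmem.eLpNorm_indicator_le hp1 hp (half_pos hε)
  obtain ⟨K, hKΩ, hK, hKd⟩ := hΩ.measurableSet.exists_isCompact_diff_lt (μ := volume) hb.measure_lt_top.ne
    (ε := ENNReal.ofReal δ) (ENNReal.ofReal_pos.2 hδ).ne'
  obtain ⟨K', hK', hKK', hK'Ω⟩ := exists_compact_between hK hΩ hKΩ
  obtain ⟨χ, hχ, hχ0, hχ1, hχI⟩ := smooth_urysohn (s := (interior K')ᶜ) (t := K) isOpen_interior.isClosed_compl
    hK.isClosed (Set.disjoint_left.2 fun x hx hx' => hx (hKK' hx'))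
  have hχT : Tst Ω χ := Tst.of_support hχ hK' hK'Ω fun x hx => hχ0 x fun h => hx (interior_subset h)
  refine ⟨fun x => h x * χ x, hχT.mul_left hcd, ?_⟩
  have e : (fun x => g x - h x * χ x) = (g - h) + fun x => h x * (1 - χ x) := by
    ext x; simp only [Pi.add_apply, Pi.sub_apply]; ring
  rw [e]
  have hmm : AEStronglyMeasurable (fun x => h x * (1 - χ x)) (volume.restrict Ω) :=
    (hcd.continuous.mul (continuous_const.sub hχT.cont)).aestronglyMeasurable
  refine (eLpNorm_add_le (hg.1.sub hmem.1) hmm hp1).trans ?_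
  rw [show ε = ε/2 + ε/2 by ring, ENNReal.ofReal_add (by positivity) (by positivity)]
  refine add_le_add hle ?_
  refine le_trans (eLpNorm_mono fun x => ?_) (hδb Kᶜ hK.measurableSet.compl ?_)
  · by_cases hx : x ∈ K
    · rw [hχ1 x hx]; simp [hx]
    · rw [Set.indicator_of_mem (show x ∈ Kᶜ from hx), norm_mul]
      refine mul_le_of_le_one_right (norm_nonneg _) ?_
      have := hχI x
      rw [Real.norm_eq_abs, abs_le]
      constructor <;> linarith [this.1, this.2]
  · rw [Measure.restrict_apply hK.measurableSet.compl]
    refine le_trans (measure_mono ?_) hKd.le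
    rintro x ⟨h1, h2⟩
    exact ⟨h2, h1⟩

lemma wk_cont {T : ℝ} {Ω : Set (Euc d)} (hΩ : IsOpen Ω) (hb : Bornology.IsBounded Ω) {s : ℝ} (hs : 1 < s)
    {P : ℝ → Euc d → ℝ} {A : ℝ≥0∞} (hA : A ≠ ⊤)
    (hP : ∀ t ∈ Set.Icc 0 T, MemLp (P t) (ENNReal.ofReal s) (volume.restrict Ω))
    (hPA : ∀ t ∈ Set.Icc 0 T, eLpNorm (P t) (ENNReal.ofReal s) (volume.restrict Ω) ≤ A)
    (hPc : ∀ g, Tst Ω g → ContinuousOn (fun t => ∫ x in Ω, P t x * g x) (Set.Icc 0 T))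
    {g : Euc d → ℝ} (hg : MemLp g (ENNReal.ofReal (s / (s - 1))) (volume.restrict Ω)) :
    ContinuousOn (fun t => ∫ x in Ω, P t x * g x) (Set.Icc 0 T) := by
  have hpq : s.HolderConjugate (s / (s - 1)) := Real.HolderConjugate.conjExponent hs
  refine continuousOn_of_uniform_approx_of_continuousOn fun U hU => ?_
  obtain ⟨ε, hε, hεU⟩ := Metric.mem_uniformity_dist.1 hU
  set a : ℝ := A.toReal with ha
  have ha0 : 0 ≤ a := ENNReal.toReal_nonneg
  set δ : ℝ := ε / (2 * (a + 1)) with hδ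
  have hδ0 : 0 < δ := by positivity
  obtain ⟨ζ, hζ, hle⟩ := tst_dense hΩ hb (p := ENNReal.ofReal (s / (s - 1))) (by
    rw [← ENNReal.ofReal_one]; exact ENNReal.ofReal_le_ofReal hpq.symm.lt.le) ENNReal.ofReal_ne_top hg hδ0
  refine ⟨_, hPc ζ hζ, fun t ht => hεU ?_⟩
  rw [Real.dist_eq, ← integral_sub (integrable_mul_conj hpq (hP t ht) hg)
    (integrable_mul_conj hpq (hP t ht) (hζ.memLp _ _))]
  simp_rw [← mul_sub]
  have h1 := holder_abs hpq (hP t ht).1 (hg.1.sub hζ.cont.aestronglyMeasurable)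
  have h2 : ENNReal.ofReal |∫ x in Ω, P t x * (g x - ζ x)| ≤ ENNReal.ofReal (a * δ) := by
    refine h1.trans ?_
    rw [ENNReal.ofReal_mul ha0, ha, ENNReal.ofReal_toReal hA]
    exact mul_le_mul' (hPA t ht) hle
  rw [ENNReal.ofReal_le_ofReal_iff (by positivity)] at h2
  refine h2.trans_lt ?_
  rw [hδ, mul_div_assoc', div_lt_iff₀ (by positivity)]
  nlinarith

lemma joint_meas {T : ℝ} (hT : 0 < T) {Ω : Set (Euc d)} (hΩ : IsOpen Ω) (hb : Bornology.IsBounded Ω)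
    {P : ℝ → Euc d → ℝ} (hPm : ∀ t ∈ Set.Icc 0 T, Measurable (P t))
    (hPi : ∀ t ∈ Set.Icc 0 T, Integrable (P t) (volume.restrict Ω))
    (hPc : ∀ g, Continuous g → HasCompactSupport g → ContinuousOn (fun t => ∫ x in Ω, P t x * g x) (Set.Icc 0 T)) :
    ∃ Q : ℝ → Euc d → ℝ, Measurable (fun p : ℝ × Euc d => Q p.1 p.2) ∧
      ∀ t ∈ Set.Icc 0 T, Q t =ᵐ[volume.restrict Ω] P t := by
  let φ : ℕ → ContDiffBump (0 : Euc d) := fun n =>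
    ⟨1 / ((n:ℝ) + 1), 2 * (1 / ((n:ℝ) + 1)), by positivity, by
      have : (0:ℝ) < 1 / ((n:ℝ) + 1) := by positivity
      linarith⟩
  have hφ0 : Filter.Tendsto (fun n => (φ n).rOut) Filter.atTop (nhds 0) := by
    have := (tendsto_one_div_add_atTop_nhds_zero_nat (𝕜 := ℝ)).const_mul 2
    rwa [mul_zero] at this
  have hφK : ∀ᶠ n in Filter.atTop, (φ n).rOut ≤ 2 * (φ n).rIn := Filter.Eventually.of_forall fun n => le_rfl
  let cl : ℝ → ℝ := fun t => (Set.projIcc 0 T hT.le t : ℝ)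
  have hcl : ∀ t, cl t ∈ Set.Icc 0 T := fun t => (Set.projIcc 0 T hT.le t).2
  have hclc : Continuous cl := continuous_subtype_val.comp continuous_projIcc
  let B : ℕ → ℝ → Euc d → ℝ := fun n t x => ∫ y in Ω, P (cl t) y * (φ n).normed volume (x - y)
  have hB : ∀ n, Measurable (Function.uncurry (B n)) := by
    intro n
    refine measurable_uncurry_of_continuous_of_measurable ?_ ?_
    · intro x
      have h1 := hPc (fun y => (φ n).normed volume (x - y))
        ((φ n).continuous_normed.comp (by fun_prop))
        ((φ n).hasCompactSupport_normed.comp_homeomorph (Homeomorph.subLeft x))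
      exact h1.comp_continuous hclc hcl
    · intro t
      have h2 : StronglyMeasurable (fun z : Euc d × Euc d => P (cl t) z.2 * (φ n).normed volume (z.1 - z.2)) := by
        refine Measurable.stronglyMeasurable ?_
        refine ((hPm _ (hcl t)).comp measurable_snd).mul ?_
        exact (φ n).continuous_normed.measurable.comp (by fun_prop)
      exact (h2.integral_prod_right (ν := volume.restrict Ω)).measurable
  refine ⟨fun t x => Filter.limsup (fun n => B n t x) Filter.atTop, ?_, ?_⟩
  · exact Measurable.limsup (f := fun n (p : ℝ × Euc d) => B n p.1 p.2) fun n => hB n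
  · intro t ht
    have hct : cl t = t := by
      simp only [cl]
      rw [Set.projIcc_of_mem hT.le ht]
    have hli : LocallyIntegrable (Ω.indicator (P t)) volume :=
      ((integrable_indicator_iff hΩ.measurableSet).2 (hPi t ht)).locallyIntegrable
    have h3 := ContDiffBump.ae_convolution_tendsto_right_of_locallyIntegrable (μ := volume) hφ0 hφK hli
    rw [Filter.EventuallyEq, ae_restrict_iff' hΩ.measurableSet]
    filter_upwards [h3] with x hx hxΩ
    rw [Set.indicator_of_mem hxΩ] at hx
    refine Filter.Tendsto.limsup_eq (hx.congr fun n => ?_)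
    rw [convolution_lsmul_swap]
    simp only [B]
    rw [hct, ← integral_indicator hΩ.measurableSet]
    congr 1
    ext y
    by_cases hy : y ∈ Ω
    · simp [hy, mul_comm]
    · simp [hy]

lemma core (hd : 0 < d) {T : ℝ} {Ω : Set (Euc d)} (hΩ : IsOpen Ω) (hc : IsConnected Ω)
    (hb : Bornology.IsBounded Ω) (hC4 : HasC4Boundary Ω) :
    ∃ (K : ℝ → ℝ), (∀ r, 0 < K r) ∧
      ∀ q u G, Dat T Ω q u G → Wk T Ω u G → ∃ π : ℝ → Euc d → ℝ,
        Integrable (fun p : ℝ × Euc d => π p.1 p.2) (measureQ T Ω) ∧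
        (∀ t ∈ Set.Icc 0 T, Integrable (π t) (volume.restrict Ω)) ∧
        (∀ t ∈ Set.Icc 0 T, ∀ φ : Fin d → Euc d → ℝ, (∀ i, Tst Ω (φ i)) →
          Fn T Ω u G t φ = ∫ x in Ω, π t x * ∑ i, dd (coordDir i) (φ i) x) ∧
        (∀ g, MemLp g (ENNReal.ofReal (min 2 q / (min 2 q - 1))) (volume.restrict Ω) →
          ContinuousOn (fun t => ∫ x in Ω, π t x * g x) (Set.Icc 0 T)) ∧
        (∀ᵐ x ∂(volume.restrict Ω), π 0 x = 0) ∧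
        ∀ r, 1 < r → r ≤ 2 → ∀ t ∈ Set.Icc 0 T,
          eLpNorm (π t) (ENNReal.ofReal r) (volume.restrict Ω) ≤ ENNReal.ofReal (K r) *
          ((∑ i, ∑ j, eLpNorm (G i j) (ENNReal.ofReal r) (measureQ T Ω)) +
          ⨆ s ∈ Set.Icc 0 T, eLpNorm (u s) 2 (volume.restrict Ω)) := by
  haveI := finite_restrict hb
  obtain ⟨K, V, hK, hV, h⟩ := exists_pit hd (T := T) hΩ hc hb hC4
  refine ⟨K, hK, fun q u G D W => ?_⟩
  have hex : ∀ t, ∃ π : Euc d → ℝ, t ∈ Set.Icc 0 T → Measurable π ∧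
        MemLp π (ENNReal.ofReal (min 2 q)) (volume.restrict Ω) ∧
        (∀ φ : Fin d → Euc d → ℝ, (∀ i, Tst Ω (φ i)) →
          Fn T Ω u G t φ = ∫ x in Ω, π x * ∑ i, dd (coordDir i) (φ i) x) ∧
        (∀ g, Tst Ω g → ∫ x in Ω, π x * g x = Fn T Ω u G t (V g)) ∧
        ∀ r, 1 < r → r ≤ 2 → eLpNorm π (ENNReal.ofReal r) (volume.restrict Ω) ≤ ENNReal.ofReal (K r) *
          ((∑ i, ∑ j, eLpNorm (G i j) (ENNReal.ofReal r) (measureQ T Ω)) +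
          ⨆ s ∈ Set.Icc 0 T, eLpNorm (u s) 2 (volume.restrict Ω)) := by
    intro t
    by_cases ht : t ∈ Set.Icc 0 T
    · obtain ⟨π, hπ⟩ := h q u G D W t ht
      exact ⟨π, fun _ => hπ⟩
    · exact ⟨0, fun h => absurd h ht⟩
  choose P hP using hex
  have hs1 : 1 < min 2 q := lt_min (by norm_num) D.q1
  have hs1' : (1:ℝ≥0∞) ≤ ENNReal.ofReal (min 2 q) := by
    rw [← ENNReal.ofReal_one]; exact ENNReal.ofReal_le_ofReal hs1.le
  haveI := measureQ_finite T hb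
  set A : ℝ≥0∞ := ENNReal.ofReal (K (min 2 q)) *
          ((∑ i, ∑ j, eLpNorm (G i j) (ENNReal.ofReal (min 2 q)) (measureQ T Ω)) +
          ⨆ s ∈ Set.Icc 0 T, eLpNorm (u s) 2 (volume.restrict Ω)) with hA
  have hAt : A ≠ ⊤ := ENNReal.mul_ne_top ENNReal.ofReal_ne_top (ENNReal.add_ne_top.2
    ⟨ENNReal.sum_ne_top.2 fun i _ => ENNReal.sum_ne_top.2 fun j _ =>
      ((D.G2 i j).mono_exponent (ENNReal.ofReal_le_ofReal (min_le_right _ _))).eLpNorm_ne_top, D.sup⟩)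
  have hPA : ∀ t ∈ Set.Icc 0 T, eLpNorm (P t) (ENNReal.ofReal (min 2 q)) (volume.restrict Ω) ≤ A :=
    fun t ht => (hP t ht).2.2.2.2 _ hs1 (min_le_left _ _)
  have hPint : ∀ t ∈ Set.Icc 0 T, Integrable (P t) (volume.restrict Ω) :=
    fun t ht => (hP t ht).2.1.integrable hs1'
  have hPt : ∀ g, Tst Ω g → ContinuousOn (fun t => ∫ x in Ω, P t x * g x) (Set.Icc 0 T) := fun g hg =>
    (Fn_cont D (hV g hg)).congr fun t ht => (hP t ht).2.2.2.1 g hg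
  have hPw : ∀ g, MemLp g (ENNReal.ofReal (min 2 q / (min 2 q - 1))) (volume.restrict Ω) →
      ContinuousOn (fun t => ∫ x in Ω, P t x * g x) (Set.Icc 0 T) := fun g hg =>
    wk_cont hΩ hb hs1 hAt (fun t ht => (hP t ht).2.1) hPA hPt hg
  obtain ⟨Q, hQm, hQ⟩ := joint_meas D.T0 hΩ hb (fun t ht => (hP t ht).1) hPint
    (fun g hg hgc => hPw g (hg.memLp_of_hasCompactSupport hgc))
  have hQi : ∀ t ∈ Set.Icc 0 T, ∀ g : Euc d → ℝ, ∫ x in Ω, Q t x * g x = ∫ x in Ω, P t x * g x := by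
    intro t ht g
    refine integral_congr_ae ?_
    filter_upwards [hQ t ht] with x hx
    rw [hx]
  have hQint : ∀ t ∈ Set.Icc 0 T, Integrable (Q t) (volume.restrict Ω) :=
    fun t ht => (hPint t ht).congr (hQ t ht).symm
  refine ⟨Q, ?_, hQint, ?_, ?_, ?_, ?_⟩
  · refine integrable_of_slices hb hQm.aestronglyMeasurable hs1' hAt (fun t ht => (hQint t ht).1) ?_
    intro t ht
    rw [eLpNorm_congr_ae (hQ t ht)]
    exact hPA t ht
  · intro t ht φ hφ
    rw [hQi t ht, (hP t ht).2.2.1 φ hφ]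
  · exact fun g hg => (hPw g hg).congr fun t ht => hQi t ht g
  · have h0 := D.zero_mem
    have := ae_unique hΩ (hQint 0 h0) (g := fun _ => 0) (integrable_zero _ _ _) fun ζ hζ => by
      rw [hQi 0 h0, (hP 0 h0).2.2.2.1 ζ hζ, Fn_zero]; simp
    exact this
  · intro r h1 h2 t ht
    rw [eLpNorm_congr_ae (hQ t ht)]
    exact (hP t ht).2.2.2.2 r h1 h2

end
end

section
open MeasureTheory
open scoped ENNReal
noncomputable section
variable {d : ℕ}

/-! ### Bridging to the vector field formulation -/

lemma comp_fderiv {η : ℝ × Euc d → Euc d} (hη : Differentiable ℝ η) (p v : ℝ × Euc d) (i : Fin d) :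
    fderiv ℝ η p v i = dd v (fun q => η q i) p := by
  unfold dd
  have := ((EuclideanSpace.proj (𝕜 := ℝ) i).hasFDerivAt (x := η p)).comp p (hη p).hasFDerivAt
  have e : (fun q => η q i) = (EuclideanSpace.proj (𝕜 := ℝ) i) ∘ η := rfl
  rw [e, this.fderiv]; rfl

lemma IsTestVF.comp {T : ℝ} {Ω : Set (Euc d)} {η : ℝ × Euc d → Euc d} (hη : IsTestVF T Ω η) (i : Fin d) :
    Tst (Set.Ioo 0 T ×ˢ Ω) (fun q => η q i) := by
  refine Tst.of_support (K := tsupport η) ?_ hη.2.1 hη.2.2 ?_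
  · exact (contDiff_euclidean.1 hη.1) i
  · intro x hx
    rw [image_eq_zero_of_notMem_tsupport hx]; rfl

lemma isTestVF_mk {T : ℝ} {Ω : Set (Euc d)} {η : Fin d → ℝ × Euc d → ℝ}
    (hη : ∀ i, Tst (Set.Ioo 0 T ×ˢ Ω) (η i)) :
    IsTestVF T Ω (fun p => (WithLp.toLp 2 (fun i => η i p) : Euc d)) := by
  have hK : IsCompact (⋃ i, tsupport (η i)) := isCompact_iUnion fun i => (hη i).cs
  have ht : tsupport (fun p => (WithLp.toLp 2 (fun i => η i p) : Euc d)) ⊆ ⋃ i, tsupport (η i) := by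
    refine closure_minimal ?_ hK.isClosed
    intro p hp
    by_contra hn
    refine hp ?_
    ext i
    simp only [Set.mem_iUnion, not_exists] at hn
    exact image_eq_zero_of_notMem_tsupport (f := η i) (hn i)
  refine ⟨contDiff_euclidean.2 fun i => (hη i).cd, hK.of_isClosed_subset (isClosed_tsupport _) ht,
    ht.trans (Set.iUnion_subset fun i => (hη i).ts)⟩

lemma mul_tst_intQ {μ : Measure (ℝ × Euc d)} {f φ : ℝ × Euc d → ℝ} (hf : Integrable f μ)
    {A : Set (ℝ × Euc d)} (hφ : Tst A φ) : Integrable (fun x => f x * φ x) μ := by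
  obtain ⟨C, hC, hb⟩ := hφ.bounded
  exact hf.mul_bdd (c := C) hφ.cont.aestronglyMeasurable (Filter.Eventually.of_forall fun x => hb x)

lemma entry_memLp {μ : Measure (ℝ × Euc d)} {H : ℝ × Euc d → Fin d → Fin d → ℝ} {p : ℝ≥0∞}
    (hH : MemLp H p μ) (i j : Fin d) : MemLp (fun x => H x i j) p μ := by
  refine hH.of_le ?_ (Filter.Eventually.of_forall fun x =>
    (norm_le_pi_norm (H x i) j).trans (norm_le_pi_norm (H x) i))
  exact (show Continuous fun A : Fin d → Fin d → ℝ => A i j by fun_prop).comp_aestronglyMeasurable hH.1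

/-- the corrected matrix field -/
def Gf (H : ℝ × Euc d → Fin d → Fin d → ℝ) (π : ℝ × Euc d → ℝ) (i j : Fin d) (p : ℝ × Euc d) : ℝ :=
  H p i j + if i = j then π p else 0

lemma Gf_eq (H : ℝ × Euc d → Fin d → Fin d → ℝ) (π : ℝ × Euc d → ℝ) {i j : Fin d} (h : i = j) :
    Gf H π i j = (fun x => H x i j) + π := by funext x; simp [Gf, h]

lemma Gf_ne (H : ℝ × Euc d → Fin d → Fin d → ℝ) (π : ℝ × Euc d → ℝ) {i j : Fin d} (h : ¬ i = j) :
    Gf H π i j = fun x => H x i j := by funext x; simp [Gf, h]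

lemma Gf_sum (H : ℝ × Euc d → Fin d → Fin d → ℝ) (π : ℝ × Euc d → ℝ) (p : ℝ × Euc d)
    (b : Fin d → Fin d → ℝ) :
    ∑ i, ∑ j, Gf H π i j p * b i j = (∑ i, ∑ j, H p i j * b i j) + π p * ∑ j, b j j := by
  unfold Gf
  simp [add_mul, Finset.sum_add_distrib, ite_mul, Finset.mul_sum]

lemma Gf_memLp {μ : Measure (ℝ × Euc d)} {H : ℝ × Euc d → Fin d → Fin d → ℝ} {π : ℝ × Euc d → ℝ}
    {p : ℝ≥0∞} (hH : MemLp H p μ) (hπ : MemLp π p μ) (i j : Fin d) : MemLp (Gf H π i j) p μ := by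
  by_cases h : i = j
  · rw [Gf_eq H π h]; exact (entry_memLp hH i j).add hπ
  · rw [Gf_ne H π h]; exact entry_memLp hH i j

lemma Gf_norm {μ : Measure (ℝ × Euc d)} {H : ℝ × Euc d → Fin d → Fin d → ℝ} {π : ℝ × Euc d → ℝ}
    {p : ℝ≥0∞} (hp : 1 ≤ p) (hH : AEStronglyMeasurable H μ) (hπ : AEStronglyMeasurable π μ) (i j : Fin d) :
    eLpNorm (Gf H π i j) p μ ≤ eLpNorm H p μ + eLpNorm π p μ := by
  have h1 : eLpNorm (fun x => H x i j) p μ ≤ eLpNorm H p μ := eLpNorm_mono fun x =>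
    (norm_le_pi_norm (H x i) j).trans (norm_le_pi_norm (H x) i)
  have hm : AEStronglyMeasurable (fun x => H x i j) μ :=
    (show Continuous fun A : Fin d → Fin d → ℝ => A i j by fun_prop).comp_aestronglyMeasurable hH
  by_cases h : i = j
  · rw [Gf_eq H π h]
    exact (eLpNorm_add_le hm hπ hp).trans (by gcongr)
  · rw [Gf_ne H π h]
    exact h1.trans le_self_add

/-- swapping the time derivative and the divergence on slices -/
lemma slice_div {T : ℝ} {Ω : Set (Euc d)} {η : Fin d → ℝ × Euc d → ℝ}
    (hη : ∀ i, Tst (Set.Ioo 0 T ×ˢ Ω) (η i)) (t : ℝ) (x : Euc d) :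
    ∑ i, dd (coordDir i) (fun x => dd ((1:ℝ), (0 : Euc d)) (η i) (t, x)) x =
      dd ((1:ℝ), (0 : Euc d)) (fun p => ∑ j, dd ((0:ℝ), coordDir j) (η j) p) (t, x) := by
  rw [dd_sum _ fun i _ => ((hη i).dd _).diff]
  refine Finset.sum_congr rfl fun i _ => ?_
  rw [dd_slice ((hη i).dd _).diff, dd_comm (hη i).cd]

lemma Gf_int {T : ℝ} {Ω : Set (Euc d)} {H : ℝ × Euc d → Fin d → Fin d → ℝ} {π : ℝ × Euc d → ℝ}
    (hH : ∀ i j, Integrable (fun p => H p i j) (measureQ T Ω)) (hπ : Integrable π (measureQ T Ω))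
    {η : Fin d → ℝ × Euc d → ℝ} (hη : ∀ i, Tst (Set.Ioo 0 T ×ˢ Ω) (η i)) :
    ∫ p, (∑ i, ∑ j, Gf H π i j p * dd ((0:ℝ), coordDir j) (η i) p) ∂(measureQ T Ω) =
      (∫ p, (∑ i, ∑ j, H p i j * dd ((0:ℝ), coordDir j) (η i) p) ∂(measureQ T Ω)) +
        ∫ p, π p * (∑ j, dd ((0:ℝ), coordDir j) (η j) p) ∂(measureQ T Ω) := by
  rw [← integral_add]
  · exact integral_congr_ae (Filter.Eventually.of_forall fun p =>
      Gf_sum H π p fun i j => dd ((0:ℝ), coordDir j) (η i) p)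
  · exact integrable_finsetSum _ fun i _ => integrable_finsetSum _ fun j _ =>
      mul_tst_intQ (hH i j) ((hη i).dd _)
  · exact mul_tst_intQ hπ (Tst.sum _ fun j _ => (hη j).dd _)

lemma Gf_tens {T : ℝ} {Ω : Set (Euc d)} {H : ℝ × Euc d → Fin d → Fin d → ℝ} {π : ℝ × Euc d → ℝ}
    (hH : ∀ i j, Integrable (fun p => H p i j) (measureQ T Ω)) (hπ : Integrable π (measureQ T Ω))
    {t : ℝ} {ζ : Euc d → ℝ} (hζ : Tst Ω ζ)
    (h : ∫ p, π p * tens t (lap ζ) p ∂(measureQ T Ω) =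
          - ∑ i : Fin d, ∑ j : Fin d,
            ∫ p, H p i j * tens t (dd (coordDir i) (dd (coordDir j) ζ)) p ∂(measureQ T Ω)) :
    ∑ i, ∑ j, ∫ p, Gf H π i j p * tens t (dd (coordDir j) (dd (coordDir i) ζ)) p ∂(measureQ T Ω) = 0 := by
  have hc : ∀ i j : Fin d, dd (coordDir j) (dd (coordDir i) ζ) = dd (coordDir i) (dd (coordDir j) ζ) :=
    fun i j => funext fun x => dd_comm hζ.cd _ _ _
  have hT : ∀ i j : Fin d, Tst Ω (dd (coordDir j) (dd (coordDir i) ζ)) := fun i j => (hζ.dd _).dd _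
  have hG : ∀ i j, Integrable (Gf H π i j) (measureQ T Ω) := fun i j => by
    by_cases h : i = j
    · rw [Gf_eq H π h]; exact (hH i j).add hπ
    · rw [Gf_ne H π h]; exact hH i j
  have e1 : ∑ i, ∑ j, ∫ p, Gf H π i j p * tens t (dd (coordDir j) (dd (coordDir i) ζ)) p ∂(measureQ T Ω)
      = ∫ p, (∑ i, ∑ j, Gf H π i j p * tens t (dd (coordDir j) (dd (coordDir i) ζ)) p) ∂(measureQ T Ω) := by
    rw [integral_finsetSum _ fun i _ => integrable_finsetSum _ fun j _ => by
      exact int_tens (hG i j) t (hT i j)]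
    refine Finset.sum_congr rfl fun i _ => ?_
    rw [integral_finsetSum _ fun j _ => by exact int_tens (hG i j) t (hT i j)]
  have e2 : ∑ i, ∑ j, ∫ p, H p i j * tens t (dd (coordDir j) (dd (coordDir i) ζ)) p ∂(measureQ T Ω)
      = ∫ p, (∑ i, ∑ j, H p i j * tens t (dd (coordDir j) (dd (coordDir i) ζ)) p) ∂(measureQ T Ω) := by
    rw [integral_finsetSum _ fun i _ => integrable_finsetSum _ fun j _ => by
      exact int_tens (hH i j) t (hT i j)]
    refine Finset.sum_congr rfl fun i _ => ?_
    rw [integral_finsetSum _ fun j _ => by exact int_tens (hH i j) t (hT i j)]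
  have e3 : ∑ i, ∑ j, ∫ p, H p i j * tens t (dd (coordDir i) (dd (coordDir j) ζ)) p ∂(measureQ T Ω)
      = ∑ i, ∑ j, ∫ p, H p i j * tens t (dd (coordDir j) (dd (coordDir i) ζ)) p ∂(measureQ T Ω) :=
    Finset.sum_congr rfl fun i _ => Finset.sum_congr rfl fun j _ => by rw [hc i j]
  rw [e3, e2] at h
  have hl : ∀ p, tens t (lap ζ) p = ∑ j, tens t (dd (coordDir j) (dd (coordDir j) ζ)) p := by
    intro p
    simp only [tens, lap, Finset.mul_sum]
  have hi : Integrable (fun p => π p * tens t (lap ζ) p) (measureQ T Ω) :=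
    int_tens hπ t (Ω := Ω) (Tst.sum _ fun j _ => hT j j)
  rw [e1]
  simp_rw [Gf_sum H π _ fun i j => tens t (dd (coordDir j) (dd (coordDir i) ζ)) _, ← hl]
  rw [integral_add (integrable_finsetSum _ fun i _ => integrable_finsetSum _ fun j _ => by
      exact int_tens (hH i j) t (hT i j)) hi, h]
  ring

end
end

/-- Pressure decomposition (Theorem A.1): if `u ∈ C_w([0,T];L²(Ω)^d)` and
`H ∈ L^q(Q_T)^{d×d}` satisfy `∫ u·∂_t η = ∫ H : ∇η` for all divergence-free test fields,
then there are integrable `π_h`, `π₀` with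
`∫ u·∂_t η = ∫ H : ∇η + ∫ π₀ div η + ∫ π_h ∂_t(div η)` for all test fields, such that
`π_h` is weakly continuous into `L^{min(2,q)}(Ω)`, `π_h(0) = 0`,
`Δπ_h(t) = −div(u(t) − u(0))` distributionally, and the stated norm bounds hold with
constants independent of `u`, `H`, `π_h`, `π₀`. -/
theorem pressure_decomposition
    (d : ℕ) (hd : d = 2 ∨ d = 3)
    (Ω : Set (Euc d)) (hΩopen : IsOpen Ω) (hΩconn : IsConnected Ω)
    (hΩbdd : Bornology.IsBounded Ω) (hΩC4 : HasC4Boundary Ω)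
    (T : ℝ) (hT : 0 < T)
    (q : ℝ) (hq : 1 < q) :
    ∃ (c : ℝ → ℝ) (c' : ℝ),
      (∀ r : ℝ, 1 < r → r ≤ 2 → 0 < c r) ∧ 0 < c' ∧
      ∀ (u : ℝ → Euc d → Euc d) (H : ℝ × Euc d → Fin d → Fin d → ℝ),
        (∀ t ∈ Set.Icc (0 : ℝ) T, MemLp (u t) 2 (volume.restrict Ω)) →
        AEStronglyMeasurable (fun p : ℝ × Euc d => u p.1 p.2) (measureQ T Ω) →
        -- weak continuity of `t ↦ u(t)` into `L²(Ω)^d`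
        (∀ g : Euc d → Euc d, MemLp g 2 (volume.restrict Ω) →
          ContinuousOn (fun t => ∫ x in Ω, ∑ i : Fin d, u t x i * g x i)
            (Set.Icc (0 : ℝ) T)) →
        MemLp H (ENNReal.ofReal q) (measureQ T Ω) →
        -- weak formulation on divergence-free test fields
        (∀ η : ℝ × Euc d → Euc d, IsTestVF T Ω η → (∀ p, spDiv η p = 0) →
          ∫ p, (∑ i : Fin d, u p.1 p.2 i * fderiv ℝ η p ((1 : ℝ), 0) i) ∂(measureQ T Ω)
          = ∫ p, (∑ i : Fin d, ∑ j : Fin d,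
              H p i j * fderiv ℝ (fun q' => η q' i) p ((0 : ℝ), coordDir j))
              ∂(measureQ T Ω)) →
        ∃ πh π₀ : ℝ → Euc d → ℝ,
          Integrable (fun p : ℝ × Euc d => πh p.1 p.2) (measureQ T Ω) ∧
          Integrable (fun p : ℝ × Euc d => π₀ p.1 p.2) (measureQ T Ω) ∧
          -- decomposition identity for all test fields
          (∀ η : ℝ × Euc d → Euc d, IsTestVF T Ω η →
            ∫ p, (∑ i : Fin d, u p.1 p.2 i * fderiv ℝ η p ((1 : ℝ), 0) i) ∂(measureQ T Ω)
            = (∫ p, (∑ i : Fin d, ∑ j : Fin d,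
                  H p i j * fderiv ℝ (fun q' => η q' i) p ((0 : ℝ), coordDir j))
                  ∂(measureQ T Ω))
              + (∫ p, π₀ p.1 p.2 * spDiv η p ∂(measureQ T Ω))
              + ∫ p, πh p.1 p.2 * fderiv ℝ (spDiv η) p ((1 : ℝ), 0) ∂(measureQ T Ω)) ∧
          -- (a) weak continuity of `π_h` into `L^{min(2,q)}(Ω)`
          (∀ g : Euc d → ℝ,
            MemLp g (ENNReal.ofReal (min 2 q / (min 2 q - 1))) (volume.restrict Ω) →
            ContinuousOn (fun t => ∫ x in Ω, πh t x * g x) (Set.Icc (0 : ℝ) T)) ∧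
          (∀ᵐ x ∂(volume.restrict Ω), πh 0 x = 0) ∧
          -- `Δπ_h(t) = −div(u(t) − u(0))` in the sense of distributions on `Ω`
          (∀ t ∈ Set.Icc (0 : ℝ) T, ∀ ζ : Euc d → ℝ,
            ContDiff ℝ (⊤ : ℕ∞) ζ → HasCompactSupport ζ → tsupport ζ ⊆ Ω →
            ∫ x in Ω, πh t x *
                (∑ j : Fin d, fderiv ℝ (fun y => fderiv ℝ ζ y (coordDir j)) x (coordDir j))
            = ∫ x in Ω, ∑ i : Fin d, (u t x i - u 0 x i) * fderiv ℝ ζ x (coordDir i)) ∧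
          -- (b) the norm bounds
          (∀ r : ℝ, 1 < r → r ≤ 2 → ∀ t ∈ Set.Icc (0 : ℝ) T,
            eLpNorm (πh t) (ENNReal.ofReal r) (volume.restrict Ω)
              ≤ ENNReal.ofReal (c r) *
                (eLpNorm H (ENNReal.ofReal r) (measureQ T Ω)
                  + ⨆ s ∈ Set.Icc (0 : ℝ) T, eLpNorm (u s) 2 (volume.restrict Ω))) ∧
          eLpNorm (fun p : ℝ × Euc d => π₀ p.1 p.2) (ENNReal.ofReal q) (measureQ T Ω)
            ≤ ENNReal.ofReal c' * eLpNorm H (ENNReal.ofReal q) (measureQ T Ω) := by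
  have hd0 : 0 < d := by rcases hd with h | h <;> omega
  obtain ⟨C, hC, HC⟩ := exists_pi0 (d := d) hd0
  obtain ⟨K, hK, HK⟩ := core hd0 (T := T) hΩopen hΩconn hΩbdd hΩC4
  refine ⟨fun r => K r * (d * (d * (1 + C r)) + 1), C q, fun r _ _ => ?_, hC q, ?_⟩
  · have h1 := hC r
    have h2 := hK r
    positivity
  intro u H hu hum huc hH hwk
  haveI := measureQ_finite T hΩbdd
  have hq1 : (1:ENNReal) ≤ ENNReal.ofReal q := by
    rw [← ENNReal.ofReal_one]; exact ENNReal.ofReal_le_ofReal hq.le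
  obtain ⟨π, hπm, hπ, hπn, hπl⟩ := HC T Ω hΩopen.measurableSet hΩbdd q hq H hH
  have hπi : Integrable π (measureQ T Ω) := hπ.integrable hq1
  have hHi : ∀ i j, Integrable (fun p => H p i j) (measureQ T Ω) := fun i j =>
    (entry_memLp hH i j).integrable hq1
  have D : Dat T Ω q u (Gf H π) := ⟨hΩopen, hΩbdd, hT, hq, hu, hum, huc, Gf_memLp hH hπ⟩
  have W : Wk T Ω u (Gf H π) := by
    intro η hη h0
    have hv := isTestVF_mk hη
    have := hwk _ hv h0
    rw [Gf_int hHi hπi hη]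
    simp only [h0, mul_zero, integral_zero, add_zero]
    refine Eq.trans ?_ this
    refine integral_congr_ae (Filter.Eventually.of_forall fun p => ?_)
    refine Finset.sum_congr rfl fun i _ => ?_
    rw [comp_fderiv (hv.1.differentiable (by simp))]
  obtain ⟨P, hPi, hPs, hPr, hPw, hP0, hPn⟩ := HK q u _ D W
  refine ⟨P, fun t x => π (t, x), hPi, hπi, ?_, hPw, hP0, ?_, ?_, hπn q hq⟩
  · intro η hη
    have hc := fun i => hη.comp i
    have e1 := int_Fn D hc
    have hS : Tst (Set.Ioo 0 T ×ˢ Ω) (spDiv η) := Tst.sum _ fun j _ => (hc j).dd ((0:ℝ), coordDir j)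
    have hPS : Integrable (fun p : ℝ × Euc d => P p.1 p.2 * dd ((1:ℝ), (0 : Euc d)) (spDiv η) p)
      (measureQ T Ω) := mul_tst_intQ hPi (hS.dd _)
    have e2 : ∫ t in Set.Ioc 0 T, Fn T Ω u (Gf H π) t (fun i x => dd ((1:ℝ), (0 : Euc d)) (fun q => η q i) (t, x))
        = ∫ p, P p.1 p.2 * dd ((1:ℝ), (0 : Euc d)) (spDiv η) p ∂(measureQ T Ω) := by
      refine Eq.trans ?_ (integral_prod (μ := volume.restrict (Set.Ioc 0 T)) (ν := volume.restrict Ω) _ hPS).symm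
      refine setIntegral_congr_fun measurableSet_Ioc fun t ht => ?_
      have := hPr t ⟨ht.1.le, ht.2⟩ _ fun i => slice_tst ((hc i).dd ((1:ℝ), (0 : Euc d))) t
      refine this.trans ?_
      refine integral_congr_ae (Filter.Eventually.of_forall fun x => ?_)
      exact congrArg (P t x * ·) (slice_div hc t x)
    have e3 := Gf_int hHi hπi hc
    have e4 : ∫ p, (∑ i : Fin d, u p.1 p.2 i * fderiv ℝ η p ((1 : ℝ), 0) i) ∂(measureQ T Ω)
        = ∫ p, (∑ i : Fin d, u p.1 p.2 i * dd ((1:ℝ), (0 : Euc d)) (fun q => η q i) p) ∂(measureQ T Ω) := by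
      refine integral_congr_ae (Filter.Eventually.of_forall fun p => ?_)
      refine Finset.sum_congr rfl fun i _ => ?_
      rw [comp_fderiv (hη.1.differentiable (by simp))]
    rw [e2, e3] at e1
    rw [e4]
    exact (sub_eq_iff_eq_add'.1 e1.symm)
  · intro t ht ζ h1 h2 h3
    have hζ : Tst Ω ζ := ⟨h1, h2, h3⟩
    have e1 := hPr t ht _ fun i => hζ.dd (coordDir i)
    unfold Fn at e1
    rw [Gf_tens hHi hπi hζ (hπl t ζ hζ), add_zero] at e1
    exact e1.symm
  · intro r h1 h2 t ht
    refine (hPn r h1 h2 t ht).trans ?_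
    have h1' : (1:ENNReal) ≤ ENNReal.ofReal r := by
      rw [← ENNReal.ofReal_one]; exact ENNReal.ofReal_le_ofReal h1.le
    have hCr := hC r
    have hKr := hK r
    generalize (⨆ s ∈ Set.Icc (0 : ℝ) T, eLpNorm (u s) 2 (volume.restrict Ω)) = M
    have hG : ∀ i j, eLpNorm (Gf H π i j) (ENNReal.ofReal r) (measureQ T Ω)
        ≤ ENNReal.ofReal (1 + C r) * eLpNorm H (ENNReal.ofReal r) (measureQ T Ω) := by
      intro i j
      refine (Gf_norm h1' hH.1 hπm.aestronglyMeasurable i j).trans ?_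
      rw [ENNReal.ofReal_add zero_le_one hCr.le, ENNReal.ofReal_one, add_mul, one_mul]
      gcongr
      exact hπn r h1
    generalize eLpNorm H (ENNReal.ofReal r) (measureQ T Ω) = N at hG ⊢
    have hsum : (∑ i, ∑ j, eLpNorm (Gf H π i j) (ENNReal.ofReal r) (measureQ T Ω))
        ≤ ENNReal.ofReal (d * (d * (1 + C r))) * N := by
      refine (Finset.sum_le_sum fun i _ => Finset.sum_le_sum fun j _ => hG i j).trans ?_
      simp only [Finset.sum_const, Finset.card_univ, Fintype.card_fin, nsmul_eq_mul]
      rw [ENNReal.ofReal_mul (by positivity), ENNReal.ofReal_mul (by positivity), ENNReal.ofReal_natCast]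
      simp only [mul_assoc, le_refl]
    rw [ENNReal.ofReal_mul hKr.le, mul_assoc]
    gcongr
    rw [ENNReal.ofReal_add (by positivity) zero_le_one, ENNReal.ofReal_one, add_mul, one_mul]
    refine add_le_add (hsum.trans ?_) le_add_self
    gcongr
    exact le_self_add

end
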